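/- Let T be a right triangle (one interior angle equal to π/2). Then every second Neumann eigenfunction u of T has no critical points. -/

import Mathlib

open Set

noncomputable section

abbrev E2 : Type := EuclideanSpace ℝ (Fin 2)

/-- The closed triangle: convex hull of the three vertices. -/
def Tri (v₁ v₂ v₃ : E2) : Set E2 := convexHull ℝ {v₁, v₂, v₃}

/-- The vertex set of the triangle. -/
def Vtx (v₁ v₂ v₃ : E2) : Set E2 := {v₁, v₂, v₃}

/-- The triangle minus its vertices. -/
def TriDom (v₁ v₂ v₃ : E2) : Set E2 := Tri v₁ v₂ v₃ \ Vtx v₁ v₂ v₃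

/-- Second (mixed) directional derivative of `u` at `p`: first in direction `v`, then `w`. -/
def mixedDeriv (u : E2 → ℝ) (p v w : E2) : ℝ :=
  fderiv ℝ (fun y => fderiv ℝ u y v) p w

/-- The (geometers') Laplacian `−(∂ₓ² + ∂_y²) u` at `p`. -/
def negLap (u : E2 → ℝ) (p : E2) : ℝ :=
  -(mixedDeriv u p (EuclideanSpace.single 0 1) (EuclideanSpace.single 0 1)
    + mixedDeriv u p (EuclideanSpace.single 1 1) (EuclideanSpace.single 1 1))

/-- `u` satisfies Neumann conditions along the segment `[a,b]`: at every non-endpoint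
point of the segment, the derivative of `u` (within `S`) annihilates every vector
orthogonal to the direction of the side; equivalently the normal derivative vanishes. -/
def NeumannOn (S : Set E2) (a b : E2) (u : E2 → ℝ) : Prop :=
  ∀ p ∈ segment ℝ a b, p ≠ a → p ≠ b →
    ∀ w : E2, @inner ℝ _ _ w (b - a) = 0 → fderivWithin ℝ u S p w = 0

/-- `u` is a Neumann eigenfunction of the triangle with vertices `v₁ v₂ v₃`,
with eigenvalue `μ > 0`. -/
structure IsNeumannEigenfun (v₁ v₂ v₃ : E2) (μ : ℝ) (u : E2 → ℝ) : Prop where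
  pos : 0 < μ
  nonconst : ¬ ∃ c : ℝ, ∀ z ∈ Tri v₁ v₂ v₃, u z = c
  cont : ContinuousOn u (Tri v₁ v₂ v₃)
  smooth : ContDiffOn ℝ (⊤ : ℕ∞) u (TriDom v₁ v₂ v₃)
  eqn : ∀ p ∈ interior (Tri v₁ v₂ v₃), negLap u p = μ * u p
  neumann₁₂ : NeumannOn (TriDom v₁ v₂ v₃) v₁ v₂ u
  neumann₂₃ : NeumannOn (TriDom v₁ v₂ v₃) v₂ v₃ u
  neumann₃₁ : NeumannOn (TriDom v₁ v₂ v₃) v₃ v₁ u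

/-- `u` is a second Neumann eigenfunction: a Neumann eigenfunction whose eigenvalue is
the least `μ > 0` admitting a Neumann eigenfunction. -/
def IsSecondNeumannEigenfun (v₁ v₂ v₃ : E2) (u : E2 → ℝ) : Prop :=
  ∃ μ : ℝ, IsNeumannEigenfun v₁ v₂ v₃ μ u ∧
    ∀ (μ' : ℝ) (u' : E2 → ℝ), IsNeumannEigenfun v₁ v₂ v₃ μ' u' → μ ≤ μ'

/-- `p` is a critical point of `u`: a non-vertex point of the triangle at which the
derivative (within the triangle minus vertices) vanishes. -/
def IsCritPt (v₁ v₂ v₃ : E2) (u : E2 → ℝ) (p : E2) : Prop :=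
  p ∈ TriDom v₁ v₂ v₃ ∧ fderivWithin ℝ u (TriDom v₁ v₂ v₃) p = 0

/-- `(a, b)` is (an ordering of) a side of the triangle `v₁ v₂ v₃`. -/
def IsSide (v₁ v₂ v₃ a b : E2) : Prop :=
  (a = v₁ ∧ b = v₂) ∨ (a = v₂ ∧ b = v₃) ∨ (a = v₃ ∧ b = v₁)

/-- Reflection of `z` across the line through `a` and `b`. -/
def lineReflect (a b z : E2) : E2 :=
  (2 : ℝ) • (a + ((@inner ℝ _ _ (z - a) (b - a)) / (@inner ℝ _ _ (b - a) (b - a))) • (b - a)) - z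

/-- Determinant of the Hessian of `w` at `p` (in the standard coordinates). -/
def hessDet (w : E2 → ℝ) (p : E2) : ℝ :=
  mixedDeriv w p (EuclideanSpace.single 0 1) (EuclideanSpace.single 0 1) *
      mixedDeriv w p (EuclideanSpace.single 1 1) (EuclideanSpace.single 1 1) -
    mixedDeriv w p (EuclideanSpace.single 0 1) (EuclideanSpace.single 1 1) *
      mixedDeriv w p (EuclideanSpace.single 1 1) (EuclideanSpace.single 0 1)

/-- The Hessian at `p` of the extension of `u` by reflection across the side `[a,b]`
satisfies the predicate `P`: there is a smooth local extension `w` of `u` near `p`,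
invariant under the reflection across the line through `a, b`, with `P (hessDet w p)`. -/
def ReflHessAt (v₁ v₂ v₃ a b : E2) (u : E2 → ℝ) (p : E2) (P : ℝ → Prop) : Prop :=
  ∃ (U : Set E2) (w : E2 → ℝ), IsOpen U ∧ p ∈ U ∧ ContDiffOn ℝ (⊤ : ℕ∞) w U ∧
    (∀ z ∈ U ∩ Tri v₁ v₂ v₃, w z = u z) ∧
    (∀ z ∈ U, lineReflect a b z ∈ U → w (lineReflect a b z) = w z) ∧
    P (hessDet w p)

/-- `p` is an isolated local extremum of `u` on the triangle: the connected component
of the level set `{z ∈ T : u z = u p}` containing `p` is `{p}`. -/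
def IsIsolatedExtremum (v₁ v₂ v₃ : E2) (u : E2 → ℝ) (p : E2) : Prop :=
  connectedComponentIn {z ∈ Tri v₁ v₂ v₃ | u z = u p} p = {p}

section
open Set

def dA (α : ℝ) (n i j : ℕ) : ℝ := if i + j < n then α * (if j = 0 then 1/2 else 1) else 0

def dM (n i j : ℕ) : ℝ :=
  if i + j ≤ n then (if i = 0 then 1/2 else 1) * (if j = 0 then 1/2 else 1) *
    (if i + j = n then 1/2 else 1) else 0

def dX (α : ℝ) (n : ℕ) (u : ℕ → ℕ → ℝ) (i j : ℕ) : ℝ := dA α n i j * (u (i+1) j - u i j)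

def dT (u : ℕ → ℕ → ℝ) : ℕ → ℕ → ℝ := fun i j => u j i

def dN (α β : ℝ) (n : ℕ) (u : ℕ → ℕ → ℝ) (i j : ℕ) : ℝ :=
  (dX α n u i j - if i = 0 then 0 else dX α n u (i-1) j) +
  (dX β n (dT u) j i - if j = 0 then 0 else dX β n (dT u) (j-1) i)

def dE (α β : ℝ) (n : ℕ) (u v : ℕ → ℕ → ℝ) : ℝ :=
  ∑ i ∈ Finset.range (n+1), ∑ j ∈ Finset.range (n+1),
    (dX α n u i j * (v (i+1) j - v i j) + dX β n (dT u) j i * (v i (j+1) - v i j))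

def dS (n : ℕ) (u v : ℕ → ℕ → ℝ) : ℝ :=
  ∑ i ∈ Finset.range (n+1), ∑ j ∈ Finset.range (n+1), dM n i j * u i j * v i j

lemma abel_aux (A v : ℕ → ℝ) (M : ℕ) :
    ∑ i ∈ Finset.range (M+1), A i * (v (i+1) - v i) =
    - ∑ i ∈ Finset.range (M+1), (A i - if i = 0 then 0 else A (i-1)) * v i + A M * v (M+1) := by
  induction M with
  | zero => simp; ring
  | succ k ih =>
    rw [Finset.sum_range_succ, ih, Finset.sum_range_succ _ (k+1)]
    simp; ring

lemma dX_zero (α : ℝ) (n : ℕ) (u : ℕ → ℕ → ℝ) (i j : ℕ) (h : n ≤ i + j) : dX α n u i j = 0 := by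
  simp [dX, dA, not_lt.mpr h]

lemma dN_zero (α β : ℝ) (n : ℕ) (u : ℕ → ℕ → ℝ) (i j : ℕ) (h : n < i + j) : dN α β n u i j = 0 := by
  unfold dN
  rw [dX_zero _ _ _ _ _ (by omega), dX_zero β _ _ _ _ (by omega)]
  rcases i with _ | i <;> rcases j with _ | j <;> simp <;> 
  (try rw [dX_zero _ _ _ _ _ (by omega)]) <;> (try rw [dX_zero _ _ _ _ _ (by omega)]) <;> simp

lemma dWF (α β : ℝ) (n : ℕ) (u v : ℕ → ℕ → ℝ) :
    dE α β n u v = - ∑ i ∈ Finset.range (n+1), ∑ j ∈ Finset.range (n+1), dN α β n u i j * v i j := by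
  unfold dE
  simp only [Finset.sum_add_distrib]
  rw [Finset.sum_comm]
  have h1 : ∀ j, ∑ i ∈ Finset.range (n+1), dX α n u i j * (v (i+1) j - v i j) =
    - ∑ i ∈ Finset.range (n+1), (dX α n u i j - if i = 0 then 0 else dX α n u (i-1) j) * v i j := by
    intro j
    rw [abel_aux (fun i => dX α n u i j) (fun i => v i j), dX_zero _ _ _ _ _ (by omega)]; simp
  have h2 : ∀ i, ∑ j ∈ Finset.range (n+1), dX β n (dT u) j i * (v i (j+1) - v i j) =
    - ∑ j ∈ Finset.range (n+1), (dX β n (dT u) j i - if j = 0 then 0 else dX β n (dT u) (j-1) i) * v i j := by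
    intro j
    rw [abel_aux (fun i => dX β n (dT u) i j) (fun i => v j i), dX_zero _ _ _ _ _ (by omega)]; simp
  simp only [h1, h2, dN, add_mul, Finset.sum_add_distrib, Finset.sum_neg_distrib, neg_add]
  congr 2
  rw [Finset.sum_comm]

lemma dE_symm (α β : ℝ) (n : ℕ) (u v : ℕ → ℕ → ℝ) : dE α β n u v = dE α β n v u := by
  unfold dE dX dT
  refine Finset.sum_congr rfl fun i _ => Finset.sum_congr rfl fun j _ => by ring

lemma dM_pos {n i j : ℕ} (h : i + j ≤ n) : 0 < dM n i j := by
  unfold dM; rw [if_pos h]; split_ifs <;> norm_num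

lemma dM_zero {n i j : ℕ} (h : n < i + j) : dM n i j = 0 := by
  unfold dM; rw [if_neg (by omega)]

lemma dM_nonneg (n i j : ℕ) : 0 ≤ dM n i j := by
  rcases le_or_gt (i+j) n with h | h
  · exact (dM_pos h).le
  · rw [dM_zero h]

lemma dM_le (n i j : ℕ) : dM n i j ≤ 1 := by
  unfold dM; split_ifs <;> norm_num

lemma dM_swap (n i j : ℕ) : dM n i j = dM n j i := by
  unfold dM; rw [add_comm i j]; split_ifs <;> norm_num

lemma dA_nonneg {α : ℝ} (hα : 0 ≤ α) (n i j : ℕ) : 0 ≤ dA α n i j := by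
  unfold dA; split_ifs <;> linarith

lemma dA_le {α : ℝ} (hα : 0 ≤ α) (n i j : ℕ) : dA α n i j ≤ α := by
  unfold dA; split_ifs <;> linarith

/-- The discrete cone. -/
def dCone (n : ℕ) (u : ℕ → ℕ → ℝ) : Prop :=
  ∀ i j, i + j < n → u i j ≤ u (i+1) j ∧ u i (j+1) ≤ u i j

def dL (α β : ℝ) (n : ℕ) (u : ℕ → ℕ → ℝ) (i j : ℕ) : ℝ := dN α β n u i j / dM n i j

lemma dL_lt (α β : ℝ) (n : ℕ) (u : ℕ → ℕ → ℝ) (i j : ℕ) (h : i + j < n) :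
    dL α β n u i j = α * ((u (i+1) j - u i j) - if i = 0 then -(u (i+1) j - u i j) else u i j - u (i-1) j)
     + β * ((u i (j+1) - u i j) - if j = 0 then -(u i (j+1) - u i j) else u i j - u i (j-1)) := by
  unfold dL dN dX dT dM dA
  rw [if_pos h, if_pos (by omega : j + i < n), if_pos h.le, if_neg h.ne]
  rcases i with _ | i <;> rcases j with _ | j <;> simp <;>
  (try rw [if_pos (by omega : i + (j+1) < n)]) <;> (try rw [if_pos (by omega : j + (i+1) < n)]) <;>
  (try rw [if_pos (by omega : i < n)]) <;> (try rw [if_pos (by omega : j < n)]) <;> (try ring)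

lemma dL_eq (α β : ℝ) (n : ℕ) (hn : 0 < n) (u : ℕ → ℕ → ℝ) (i j : ℕ) (h : i + j = n) :
    dL α β n u i j = 2 * (α * (if i = 0 then 0 else u (i-1) j - u i j) +
      β * (if j = 0 then 0 else u i (j-1) - u i j)) := by
  unfold dL dN dX dT dM dA
  rw [if_neg (by omega : ¬ (i + j < n)), if_neg (by omega : ¬ (j + i < n)), if_pos h.le, if_pos h]
  rcases i with _ | i <;> rcases j with _ | j <;> simp <;>
  (try rw [if_pos (by omega : i + (j+1) < n)]) <;> (try rw [if_pos (by omega : j + (i+1) < n)]) <;>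
  (try rw [if_pos (by omega : i < n)]) <;> (try rw [if_pos (by omega : j < n)]) <;> (try ring)

lemma dCone_step1 {α β τ : ℝ} (hα : 0 ≤ α) (hβ : 0 ≤ β) (hτ : 0 ≤ τ) (h1 : τ * (4*α+4*β) ≤ 1)
    (n : ℕ) (u : ℕ → ℕ → ℝ) (hu : dCone n u) (i j : ℕ) (h : i + j < n) :
    u i j + τ * dL α β n u i j ≤ u (i+1) j + τ * dL α β n u (i+1) j := by
  have hn : 0 < n := by omega
  obtain ⟨p1, q1⟩ := hu i j h
  have key : -(4*α+4*β) * (u (i+1) j - u i j) ≤ dL α β n u (i+1) j - dL α β n u i j := by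
    rcases Nat.lt_or_ge (i+1+j) n with h2 | h2
    · rw [dL_lt _ _ _ _ _ _ h2, dL_lt _ _ _ _ _ _ h]
      obtain ⟨p2, q2⟩ := hu (i+1) j h2
      obtain ⟨p3, q3⟩ := hu i (j+1) (by omega)
      rcases i with _ | i <;> rcases j with _ | j <;> simp at *
      · nlinarith
      · obtain ⟨p4, q4⟩ := hu 0 j (by omega)
        simp at *; nlinarith
      · obtain ⟨p4, q4⟩ := hu i 0 (by omega)
        nlinarith
      · obtain ⟨p4, q4⟩ := hu i (j+1) (by omega)
        obtain ⟨p5, q5⟩ := hu (i+1) j (by omega)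
        nlinarith
    · rw [dL_eq _ _ _ hn _ _ _ (by omega : i+1+j = n), dL_lt _ _ _ _ _ _ h]
      rcases i with _ | i <;> rcases j with _ | j <;> simp at *
      · nlinarith
      · obtain ⟨p4, q4⟩ := hu 0 j (by omega)
        obtain ⟨p5, q5⟩ := hu 1 j (by omega)
        simp at *; nlinarith
      · obtain ⟨p4, q4⟩ := hu i 0 (by omega)
        nlinarith
      · obtain ⟨p4, q4⟩ := hu i (j+1) (by omega)
        obtain ⟨p5, q5⟩ := hu (i+1) j (by omega)
        obtain ⟨p6, q6⟩ := hu (i+1+1) j (by omega)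
        nlinarith
  have h3 := mul_le_mul_of_nonneg_left key hτ
  have h4 := mul_le_mul_of_nonneg_right h1 (sub_nonneg.mpr p1)
  nlinarith

lemma dN_swap (α β : ℝ) (n : ℕ) (u : ℕ → ℕ → ℝ) (i j : ℕ) :
    dN β α n (fun i j => - u j i) j i = - dN α β n u i j := by
  unfold dN dX dT
  rcases i with _ | i <;> rcases j with _ | j <;> simp <;> ring

lemma dCone_step {α β τ : ℝ} (hα : 0 ≤ α) (hβ : 0 ≤ β) (hτ : 0 ≤ τ) (h1 : τ * (4*α+4*β) ≤ 1)
    (n : ℕ) (u : ℕ → ℕ → ℝ) (hu : dCone n u) :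
    dCone n (fun i j => u i j + τ * dL α β n u i j) := by
  intro i j h
  refine ⟨dCone_step1 hα hβ hτ h1 n u hu i j h, ?_⟩
  have := dCone_step1 hβ hα hτ (by linarith) n (fun i j => - u j i)
    (fun i j h => by have := hu j i (by omega); constructor <;> linarith [this.1, this.2]) j i (by omega)
  simp only [dL, dN_swap] at this
  simp only [dL]
  rw [dM_swap n i j, dM_swap n i (j+1)]
  have e1 := neg_div (dM n j i) (dN α β n u i j)
  have e2 := neg_div (dM n (j+1) i) (dN α β n u i (j+1))
  rw [e1, e2] at this
  linarith

lemma dN_eq_ML (α β : ℝ) (n : ℕ) (u : ℕ → ℕ → ℝ) (i j : ℕ) :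
    dN α β n u i j = dM n i j * dL α β n u i j := by
  unfold dL
  rcases le_or_gt (i+j) n with h | h
  · rw [mul_div_cancel₀ _ (dM_pos h).ne']
  · rw [dN_zero _ _ _ _ _ _ h, dM_zero h]; simp

lemma dWF_L (α β : ℝ) (n : ℕ) (u v : ℕ → ℕ → ℝ) :
    dE α β n u v = - dS n (dL α β n u) v := by
  rw [dWF]; unfold dS
  simp only [dN_eq_ML]

end

section
open Set

lemma dE_expand (α β : ℝ) (n : ℕ) (u w : ℕ → ℕ → ℝ) (τ : ℝ) :
    dE α β n (fun i j => u i j + τ * w i j) (fun i j => u i j + τ * w i j) =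
    dE α β n u u + 2 * τ * dE α β n u w + τ^2 * dE α β n w w := by
  unfold dE dX dT
  simp only [Finset.mul_sum, ← Finset.sum_add_distrib]
  refine Finset.sum_congr rfl fun i _ => Finset.sum_congr rfl fun j _ => by ring

lemma dS_expand (n : ℕ) (u w : ℕ → ℕ → ℝ) (τ : ℝ) :
    dS n (fun i j => u i j + τ * w i j) (fun i j => u i j + τ * w i j) =
    dS n u u + 2 * τ * dS n u w + τ^2 * dS n w w := by
  unfold dS
  simp only [Finset.mul_sum, ← Finset.sum_add_distrib]
  refine Finset.sum_congr rfl fun i _ => Finset.sum_congr rfl fun j _ => by ring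

lemma dS_symm (n : ℕ) (u w : ℕ → ℕ → ℝ) : dS n u w = dS n w u := by
  unfold dS
  refine Finset.sum_congr rfl fun i _ => Finset.sum_congr rfl fun j _ => by ring

lemma dS_add_left (n : ℕ) (u w v : ℕ → ℕ → ℝ) (τ : ℝ) :
    dS n (fun i j => u i j + τ * w i j) v = dS n u v + τ * dS n w v := by
  unfold dS
  simp only [Finset.mul_sum, ← Finset.sum_add_distrib]
  refine Finset.sum_congr rfl fun i _ => Finset.sum_congr rfl fun j _ => by ring

lemma dE_smul (α β : ℝ) (n : ℕ) (u v : ℕ → ℕ → ℝ) (c d : ℝ) :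
    dE α β n (fun i j => c * u i j) (fun i j => d * v i j) = c * d * dE α β n u v := by
  unfold dE dX dT
  simp only [Finset.mul_sum]
  refine Finset.sum_congr rfl fun i _ => Finset.sum_congr rfl fun j _ => by ring

lemma dS_smul (n : ℕ) (u v : ℕ → ℕ → ℝ) (c d : ℝ) :
    dS n (fun i j => c * u i j) (fun i j => d * v i j) = c * d * dS n u v := by
  unfold dS
  simp only [Finset.mul_sum]
  refine Finset.sum_congr rfl fun i _ => Finset.sum_congr rfl fun j _ => by ring

lemma dE_nonneg {α β : ℝ} (hα : 0 ≤ α) (hβ : 0 ≤ β) (n : ℕ) (u : ℕ → ℕ → ℝ) :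
    0 ≤ dE α β n u u := by
  unfold dE dX dT
  refine Finset.sum_nonneg fun i _ => Finset.sum_nonneg fun j _ => ?_
  have h1 := dA_nonneg hα n i j
  have h2 := dA_nonneg hβ n j i
  have := mul_nonneg h1 (sq_nonneg (u (i+1) j - u i j))
  have := mul_nonneg h2 (sq_nonneg (u i (j+1) - u i j))
  nlinarith

lemma dS_nonneg (n : ℕ) (u : ℕ → ℕ → ℝ) : 0 ≤ dS n u u := by
  unfold dS
  refine Finset.sum_nonneg fun i _ => Finset.sum_nonneg fun j _ => ?_
  have := mul_nonneg (dM_nonneg n i j) (sq_nonneg (u i j))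
  nlinarith

lemma dS_term_le (n : ℕ) (u : ℕ → ℕ → ℝ) (i j : ℕ) (h : i + j ≤ n) :
    dM n i j * u i j * u i j ≤ dS n u u := by
  unfold dS
  have hnn : ∀ i j, 0 ≤ dM n i j * u i j * u i j := fun i j => by
    have := mul_nonneg (dM_nonneg n i j) (sq_nonneg (u i j)); nlinarith
  calc dM n i j * u i j * u i j ≤ ∑ j ∈ Finset.range (n+1), dM n i j * u i j * u i j :=
        Finset.single_le_sum (f := fun j => dM n i j * u i j * u i j) (fun j _ => hnn i j)
          (Finset.mem_range.mpr (by omega))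
    _ ≤ _ := Finset.single_le_sum (f := fun i => ∑ j ∈ Finset.range (n+1), dM n i j * u i j * u i j)
      (fun i _ => Finset.sum_nonneg fun j _ => hnn i j) (Finset.mem_range.mpr (by omega))

lemma dM_ge {n i j : ℕ} (h : i + j ≤ n) : 1/8 ≤ dM n i j := by
  unfold dM; rw [if_pos h]; split_ifs <;> norm_num

def dOne : ℕ → ℕ → ℝ := fun _ _ => 1

/-- admissible set -/
def dK (n : ℕ) : Set (ℕ → ℕ → ℝ) :=
  {u | (∀ i j, n < i + j → u i j = 0) ∧ dCone n u ∧ dS n u dOne = 0 ∧ dS n u u = 1}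

lemma dK_compact (n : ℕ) : IsCompact (dK n) := by
  have hc : IsCompact (Set.pi univ (fun _ : ℕ => Set.pi univ (fun _ : ℕ => Icc (-3:ℝ) 3))) :=
    isCompact_univ_pi fun _ => isCompact_univ_pi fun _ => isCompact_Icc
  refine hc.of_isClosed_subset ?_ ?_
  · have e : ∀ i j, Continuous (fun u : ℕ → ℕ → ℝ => u i j) := fun i j => by fun_prop
    have c1 : IsClosed {u : ℕ → ℕ → ℝ | ∀ i j, n < i + j → u i j = 0} := by
      simp only [Set.ofPred_forall]
      exact isClosed_iInter fun i => isClosed_iInter fun j => isClosed_iInter fun _ =>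
        isClosed_eq (e i j) continuous_const
    have c2 : IsClosed {u : ℕ → ℕ → ℝ | dCone n u} := by
      unfold dCone
      simp only [Set.ofPred_forall, Set.ofPred_and]
      exact isClosed_iInter fun i => isClosed_iInter fun j => isClosed_iInter fun _ =>
        (isClosed_le (e i j) (e _ _)).inter (isClosed_le (e _ _) (e _ _))
    have c3 : IsClosed {u : ℕ → ℕ → ℝ | dS n u dOne = 0} := by
      refine isClosed_eq ?_ continuous_const
      unfold dS; fun_prop
    have c4 : IsClosed {u : ℕ → ℕ → ℝ | dS n u u = 1} := by
      refine isClosed_eq ?_ continuous_const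
      unfold dS; fun_prop
    exact c1.inter (c2.inter (c3.inter c4))
  · rintro u ⟨h1, h2, h3, h4⟩ i - j -
    rcases le_or_gt (i+j) n with h | h
    · have := dS_term_le n u i j h
      have h8 := dM_ge h
      rw [h4] at this
      have : (1/8) * (u i j)^2 ≤ 1 := by nlinarith [sq_nonneg (u i j)]
      constructor <;> nlinarith
    · rw [h1 i j h]; norm_num

lemma dE_one (α β : ℝ) (n : ℕ) (u : ℕ → ℕ → ℝ) : dE α β n u dOne = 0 := by
  unfold dE dOne; simp

/-- Existence of discrete monotone eigenvectors. -/
lemma d_exists {α β : ℝ} (hα : 0 < α) (hβ : 0 < β) (n : ℕ) (u0 : ℕ → ℕ → ℝ)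
    (h0 : dCone n u0) (h1 : dS n u0 dOne = 0) (h2 : 0 < dS n u0 u0) :
    ∃ (u : ℕ → ℕ → ℝ) (l : ℝ), 0 ≤ l ∧ dCone n u ∧ dS n u u = 1 ∧ dS n u dOne = 0 ∧
      (∀ i j, dN α β n u i j = - l * dM n i j * u i j) ∧
      l * dS n u0 u0 ≤ dE α β n u0 u0 := by
  -- normalisation of cone elements
  have hnorm : ∀ w : ℕ → ℕ → ℝ, dCone n w → dS n w dOne = 0 → 0 < dS n w w →
      ∃ w' ∈ dK n, dE α β n w' w' * dS n w w = dE α β n w w := by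
    intro w hw hw1 hw2
    set c := (Real.sqrt (dS n w w))⁻¹ with hc
    have hsq : Real.sqrt (dS n w w) ^ 2 = dS n w w := Real.sq_sqrt hw2.le
    have hpos : 0 < Real.sqrt (dS n w w) := Real.sqrt_pos.mpr hw2
    have hcc : c * c * dS n w w = 1 := by
      rw [hc]; nth_rewrite 3 [← hsq]; field_simp
    have hc0 : 0 < c := inv_pos.mpr hpos
    let w' : ℕ → ℕ → ℝ := fun i j => if i + j ≤ n then c * w i j else 0
    have eS : ∀ v, dS n w' v = dS n (fun i j => c * w i j) v := by
      intro v; unfold dS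
      refine Finset.sum_congr rfl fun i _ => Finset.sum_congr rfl fun j _ => ?_
      simp only [w']
      split_ifs with h
      · rfl
      · rw [dM_zero (by omega)]; simp
    have eE : ∀ v, dE α β n w' v = dE α β n (fun i j => c * w i j) v := by
      intro v; unfold dE dX dT
      refine Finset.sum_congr rfl fun i _ => Finset.sum_congr rfl fun j _ => ?_
      simp only [w', dA]
      by_cases h : i + j < n
      · have a1 : i + 1 + j ≤ n := by omega
        have a2 : i + (j + 1) ≤ n := by omega
        have a3 : i + j ≤ n := by omega
        simp only [a1, a2, a3, if_true]
      · rw [if_neg h, if_neg (by omega : ¬ j + i < n)]; simp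
    refine ⟨w', ⟨?_, ?_, ?_, ?_⟩, ?_⟩
    · intro i j h; simp only [w']; rw [if_neg (by omega)]
    · intro i j h
      simp only [w']
      rw [if_pos (by omega), if_pos (by omega), if_pos (by omega)]
      exact ⟨mul_le_mul_of_nonneg_left (hw i j h).1 hc0.le, mul_le_mul_of_nonneg_left (hw i j h).2 hc0.le⟩
    · rw [eS]
      have := dS_smul n w dOne c 1
      simp only [one_mul, mul_one, hw1, mul_zero] at this
      exact this
    · rw [eS, dS_symm, eS, dS_smul, hcc]
    · rw [eE, dE_symm, eE, dE_smul]; linear_combination dE α β n w w * hcc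
  obtain ⟨w0, hw0, -⟩ := hnorm u0 h0 h1 h2
  have hcont : ContinuousOn (fun u : ℕ → ℕ → ℝ => dE α β n u u) (dK n) := by
    apply Continuous.continuousOn
    unfold dE dX dT; fun_prop
  obtain ⟨u, hu, hmin⟩ := (dK_compact n).exists_isMinOn ⟨w0, hw0⟩ hcont
  have hmin' : ∀ w, dCone n w → dS n w dOne = 0 → dE α β n u u * dS n w w ≤ dE α β n w w := by
    intro w hw hw1
    rcases (dS_nonneg n w).eq_or_lt with h | h
    · rw [← h]; simpa using dE_nonneg hα.le hβ.le n w
    · obtain ⟨w', hw', he⟩ := hnorm w hw hw1 h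
      rw [← he]
      exact mul_le_mul_of_nonneg_right (hmin hw') h.le
  obtain ⟨hu0, huc, hu1, huu⟩ := hu
  set l := dE α β n u u with hl
  refine ⟨u, l, dE_nonneg hα.le hβ.le n u, huc, huu, hu1, ?_, hmin' u0 h0 h1⟩
  set w := dL α β n u with hw
  have hwu : dS n w u = - l := by rw [hl, dWF_L]; simp [hw]
  have hww : dE α β n u w = - dS n w w := by rw [dWF_L]
  have hw1 : dS n w dOne = 0 := by
    have := dWF_L α β n u dOne
    rw [dE_one] at this; linarith
  -- first variation
  have hvar : ∀ τ : ℝ, 0 < τ → τ * (4*α+4*β) ≤ 1 →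
      2 * (dS n w w - l^2) ≤ τ * (dE α β n w w) := by
    intro τ hτ hτ1
    have h3 := hmin' _ (dCone_step hα.le hβ.le hτ.le hτ1 n u huc)
      (by rw [dS_add_left, hu1, ← hw, hw1]; simp)
    rw [dE_expand, dS_expand, ← hw, ← hl, huu, dS_symm n u w, hwu, hww] at h3
    have h5 : 0 ≤ l * dS n w w := mul_nonneg (dE_nonneg hα.le hβ.le n u) (dS_nonneg n w)
    have h6 : τ * (2 * (dS n w w - l^2)) ≤ τ * (τ * dE α β n w w) := by
      nlinarith [mul_nonneg (sq_nonneg τ) h5]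
    exact le_of_mul_le_mul_left h6 hτ
  have hle : dS n w w ≤ l^2 := by
    by_contra hcon
    push Not at hcon
    set d := dS n w w - l^2
    have hd : 0 < d := by simp only [d]; linarith
    set Q := dE α β n w w
    have hQ : 0 ≤ Q := dE_nonneg hα.le hβ.le n w
    set τ := min (1/(4*α+4*β)) (d/(Q+1)) with hτ
    have hτ0 : 0 < τ := lt_min (by positivity) (by positivity)
    have t1 : τ ≤ 1/(4*α+4*β) := min_le_left _ _
    have t2 : τ ≤ d/(Q+1) := min_le_right _ _
    rw [le_div_iff₀ (by positivity)] at t1 t2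
    have := hvar τ hτ0 t1
    nlinarith
  have hz : dS n (fun i j => w i j + l * u i j) (fun i j => w i j + l * u i j) ≤ 0 := by
    rw [dS_expand, hwu, huu]; nlinarith
  intro i j
  rcases le_or_gt (i+j) n with h | h
  · have h3 := (dS_term_le n (fun i j => w i j + l * u i j) i j h).trans hz
    have h4 := dM_pos h
    have h5 : (w i j + l * u i j)^2 ≤ 0 := by
      by_contra hc; push Not at hc
      have := mul_pos h4 hc
      nlinarith
    have h6 : w i j + l * u i j = 0 := by
      have := sq_nonneg (w i j + l * u i j)
      exact pow_eq_zero_iff (two_ne_zero) |>.mp (le_antisymm h5 this)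
    rw [dN_eq_ML, ← hw]
    linear_combination dM n i j * h6
  · rw [dN_zero _ _ _ _ _ _ h, dM_zero h]; simp

end

section
open Set

lemma dCone_right {n : ℕ} {u : ℕ → ℕ → ℝ} (hu : dCone n u) {i i' j : ℕ} (h : i ≤ i') (h' : i' + j ≤ n) :
    u i j ≤ u i' j := by
  induction i', h using Nat.le_induction with
  | base => exact le_rfl
  | succ k hk ih => exact (ih (by omega)).trans (hu k j (by omega)).1

lemma dCone_down {n : ℕ} {u : ℕ → ℕ → ℝ} (hu : dCone n u) {i j j' : ℕ} (h : j ≤ j') (h' : i + j' ≤ n) :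
    u i j' ≤ u i j := by
  induction j', h using Nat.le_induction with
  | base => exact le_rfl
  | succ k hk ih => exact (hu i k (by omega)).2.trans (ih (by omega))

lemma dCone_mono {n : ℕ} {u : ℕ → ℕ → ℝ} (hu : dCone n u) {i i' j j' : ℕ} (h1 : i ≤ i') (h2 : j' ≤ j)
    (h : i + j ≤ n) (h' : i' + j' ≤ n) : u i j ≤ u i' j' :=
  (dCone_down hu h2 h).trans (dCone_right hu h1 h')

lemma dN_smul (α β : ℝ) (n : ℕ) (u : ℕ → ℕ → ℝ) (c : ℝ) (i j : ℕ) :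
    dN α β n (fun i j => c * u i j) i j = c * dN α β n u i j := by
  unfold dN dX dT
  split_ifs <;> ring

lemma d_u0_norm (k : ℕ) : (k:ℝ)^4/8 ≤ dS (4*k) (fun i j => (i:ℝ) - j) (fun i j => (i:ℝ) - j) := by
  have hnn : ∀ i j : ℕ, 0 ≤ dM (4*k) i j * ((i:ℝ) - j) * ((i:ℝ) - j) := fun i j => by
    have := mul_nonneg (dM_nonneg (4*k) i j) (sq_nonneg ((i:ℝ) - j)); nlinarith
  unfold dS
  calc (k:ℝ)^4/8 = ∑ i ∈ Finset.Ico (2*k) (3*k), ∑ j ∈ Finset.range k, (k:ℝ)^2/8 := by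
        simp
        rw [show 3 * k - 2 * k = k by omega]; ring
    _ ≤ ∑ i ∈ Finset.Ico (2*k) (3*k), ∑ j ∈ Finset.range k, dM (4*k) i j * ((i:ℝ) - j) * ((i:ℝ) - j) := by
        refine Finset.sum_le_sum fun i hi => Finset.sum_le_sum fun j hj => ?_
        rw [Finset.mem_Ico] at hi
        rw [Finset.mem_range] at hj
        have := @dM_ge (4*k) i j (by omega)
        have h1 : (k:ℝ) ≤ (i:ℝ) - j := by
          have : k + j ≤ i := by omega
          have : (k:ℝ) + j ≤ i := by exact_mod_cast this
          linarith
        have h2 : (0:ℝ) ≤ k := by positivity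
        have h3 : (k:ℝ)^2 ≤ ((i:ℝ)-j)^2 := by nlinarith
        nlinarith [sq_nonneg ((i:ℝ)-j)]
    _ ≤ ∑ i ∈ Finset.Ico (2*k) (3*k), ∑ j ∈ Finset.range (4*k+1), dM (4*k) i j * ((i:ℝ) - j) * ((i:ℝ) - j) := by
        refine Finset.sum_le_sum fun i hi => Finset.sum_le_sum_of_subset_of_nonneg ?_ fun j _ _ => hnn i j
        intro j hj; rw [Finset.mem_range] at *; omega
    _ ≤ _ := by
        refine Finset.sum_le_sum_of_subset_of_nonneg ?_ fun i _ _ => Finset.sum_nonneg fun j _ => hnn i j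
        intro j hj; rw [Finset.mem_range]; rw [Finset.mem_Ico] at hj; omega

lemma d_u0_mean (n : ℕ) : dS n (fun i j => (i:ℝ) - j) dOne = 0 := by
  have : dS n (fun i j => (i:ℝ) - j) dOne = - dS n (fun i j => (i:ℝ) - j) dOne := by
    unfold dS
    conv_lhs => rw [Finset.sum_comm]
    rw [← Finset.sum_neg_distrib]
    refine Finset.sum_congr rfl fun i _ => ?_
    rw [← Finset.sum_neg_distrib]
    refine Finset.sum_congr rfl fun j _ => ?_
    rw [dM_swap]; simp [dOne]; ring
  linarith

lemma d_u0_energy {α β : ℝ} (hα : 0 < α) (hβ : 0 < β) (n : ℕ) :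
    dE α β n (fun i j => (i:ℝ) - j) (fun i j => (i:ℝ) - j) ≤ (α+β) * ((n:ℝ)+1)^2 := by
  unfold dE
  calc _ ≤ ∑ i ∈ Finset.range (n+1), ∑ j ∈ Finset.range (n+1), (α+β) := by
        refine Finset.sum_le_sum fun i _ => Finset.sum_le_sum fun j _ => ?_
        unfold dX dT
        have h1 := dA_le hα.le n i j
        have h2 := dA_le hβ.le n j i
        push_cast
        nlinarith
    _ = _ := by simp; ring

lemma d_exists' {α β : ℝ} (hα : 0 < α) (hβ : 0 < β) (k : ℕ) (hk : 1 ≤ k) :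
    ∃ (u : ℕ → ℕ → ℝ) (l : ℝ), 0 ≤ l ∧ dCone (4*k) u ∧
      (∀ i j, dN α β (4*k) u i j = - l * dM (4*k) i j * u i j) ∧
      l * (4*k:ℝ)^2 ≤ 3200 * (α+β) ∧ (∀ i j, i + j ≤ 4*k → |u i j| ≤ 1) ∧
      1 ≤ u (4*k) 0 - u 0 (4*k) := by
  have hk' : (1:ℝ) ≤ k := by exact_mod_cast hk
  have h0 := d_u0_norm k
  obtain ⟨u, l, hl, hc, huu, hu1, hN, hlam⟩ := d_exists hα hβ (4*k) (fun i j => (i:ℝ) - j)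
    (fun i j _ => by push_cast; constructor <;> linarith) (d_u0_mean _) (lt_of_lt_of_le (by positivity) h0)
  have hb : ∀ i j, i + j ≤ 4*k → u 0 (4*k) ≤ u i j ∧ u i j ≤ u (4*k) 0 := fun i j h =>
    ⟨dCone_mono hc (by omega) (by omega) (by omega) h, dCone_mono hc (by omega) (by omega) h (by omega)⟩
  set Mx := u (4*k) 0
  set mn := u 0 (4*k)
  have hmass : 0 < dS (4*k) dOne dOne := by
    refine lt_of_lt_of_le ?_ (dS_term_le (4*k) dOne 0 0 (by omega))
    simpa [dOne] using @dM_pos (4*k) 0 0 (by omega)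
  have hcmp : ∀ c : ℝ, (∀ i j, i + j ≤ 4*k → u i j ≤ c) → 0 ≤ c := by
    intro c hcc
    have : dS (4*k) u dOne ≤ c * dS (4*k) dOne dOne := by
      unfold dS
      simp only [Finset.mul_sum]
      refine Finset.sum_le_sum fun i _ => Finset.sum_le_sum fun j _ => ?_
      simp only [dOne, mul_one]
      rcases le_or_gt (i+j) (4*k) with h | h
      · nlinarith [dM_nonneg (4*k) i j, hcc i j h]
      · rw [dM_zero h]; simp
    rw [hu1] at this
    by_contra hneg; push Not at hneg
    nlinarith
  have hcmp2 : ∀ c : ℝ, (∀ i j, i + j ≤ 4*k → c ≤ u i j) → c ≤ 0 := by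
    intro c hcc
    have : c * dS (4*k) dOne dOne ≤ dS (4*k) u dOne := by
      unfold dS
      simp only [Finset.mul_sum]
      refine Finset.sum_le_sum fun i _ => Finset.sum_le_sum fun j _ => ?_
      simp only [dOne, mul_one]
      rcases le_or_gt (i+j) (4*k) with h | h
      · nlinarith [dM_nonneg (4*k) i j, hcc i j h]
      · rw [dM_zero h]; simp
    rw [hu1] at this
    by_contra hneg; push Not at hneg
    nlinarith
  have hMx : 0 ≤ Mx := hcmp Mx fun i j h => (hb i j h).2
  have hmn : mn ≤ 0 := hcmp2 mn fun i j h => (hb i j h).1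
  set S := max Mx (-mn) with hS
  have hS1 : Mx ≤ S := le_max_left _ _
  have hS2 : -mn ≤ S := le_max_right _ _
  have hSle : S ≤ Mx - mn := max_le (by linarith) (by linarith)
  have hSpos : 0 < S := by
    by_contra hcon; push Not at hcon
    have hz : ∀ i j, i + j ≤ 4*k → u i j = 0 := fun i j h => by
      have := hb i j h; linarith [this.1, this.2]
    have : dS (4*k) u u = 0 := by
      unfold dS
      refine Finset.sum_eq_zero fun i _ => Finset.sum_eq_zero fun j _ => ?_
      rcases le_or_gt (i+j) (4*k) with h | h
      · rw [hz i j h]; simp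
      · rw [dM_zero h]; simp
    linarith
  refine ⟨fun i j => S⁻¹ * u i j, l, hl, ?_, ?_, ?_, ?_, ?_⟩
  · intro i j h
    have := hc i j h
    have hi := (inv_pos.mpr hSpos).le
    exact ⟨mul_le_mul_of_nonneg_left this.1 hi, mul_le_mul_of_nonneg_left this.2 hi⟩
  · intro i j; rw [dN_smul, hN]; ring
  · have h3 := hlam.trans (d_u0_energy hα hβ (4*k))
    push_cast at h3
    have h4 : l * ((k:ℝ)^4/8) ≤ (α+β) * (4*k+1)^2 := (mul_le_mul_of_nonneg_left h0 hl).trans h3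
    have h5 : (4*(k:ℝ)+1)^2 ≤ 25 * k^2 := by nlinarith
    have h6 : (α+β) * (4*k+1)^2 ≤ (α+β) * (25 * k^2) := mul_le_mul_of_nonneg_left h5 (by positivity)
    have h7 : k^2 * (l * k^2) ≤ k^2 * (200 * (α+β)) := by nlinarith
    have h8 := le_of_mul_le_mul_left h7 (by positivity)
    nlinarith
  · intro i j h
    have := hb i j h
    rw [abs_mul, abs_of_pos (inv_pos.mpr hSpos), inv_mul_le_iff₀ hSpos, mul_one, abs_le]
    constructor <;> linarith [this.1, this.2]
  · simp only
    rw [← mul_sub, ← inv_mul_cancel₀ hSpos.ne']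
    exact mul_le_mul_of_nonneg_left hSle (inv_pos.mpr hSpos).le

end

section
open Set

/-- Discrete eigenvector hypotheses. -/
structure dEig (α β : ℝ) (n : ℕ) (l : ℝ) (u : ℕ → ℕ → ℝ) : Prop where
  ha : 0 < α
  hb : 0 < β
  hl : 0 ≤ l
  cone : dCone n u
  eqn : ∀ i j, dN α β n u i j = - l * dM n i j * u i j
  bd : ∀ i j, i + j ≤ n → |u i j| ≤ 1

lemma dEig.swap {α β : ℝ} {n : ℕ} {l : ℝ} {u : ℕ → ℕ → ℝ} (h : dEig α β n l u) :
    dEig β α n l (fun i j => - u j i) where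
  ha := h.hb
  hb := h.ha
  hl := h.hl
  cone := fun i j hij => by
    have := h.cone j i (by omega); constructor <;> linarith [this.1, this.2]
  eqn := fun i j => by rw [dN_swap, h.eqn, dM_swap]; ring
  bd := fun i j hij => by rw [abs_neg]; exact h.bd j i (by omega)

lemma dEig.wf {α β : ℝ} {n : ℕ} {l : ℝ} {u : ℕ → ℕ → ℝ} (h : dEig α β n l u) (v : ℕ → ℕ → ℝ) :
    dE α β n u v = l * dS n u v := by
  rw [dWF]; unfold dS
  simp only [h.eqn, Finset.mul_sum, ← Finset.sum_neg_distrib]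
  refine Finset.sum_congr rfl fun i _ => Finset.sum_congr rfl fun j _ => by ring

lemma dS_bound {n : ℕ} {u v : ℕ → ℕ → ℝ} (hu : ∀ i j, i + j ≤ n → |u i j| ≤ 1) {d s : ℕ} (hds : d + s = n)
    {c : ℝ} (hc : 0 ≤ c) (hv : ∀ i j, i + j ≤ n → |v i j| ≤ c) (hv0 : ∀ i j, i < d → v i j = 0) :
    dS n u v ≤ c * ((s:ℝ)+1)^2 := by
  unfold dS
  calc _ ≤ ∑ i ∈ Finset.range (n+1), ∑ j ∈ Finset.range (n+1),
        (if d ≤ i then (1:ℝ) else 0) * (if j ≤ s then c else 0) := by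
        refine Finset.sum_le_sum fun i _ => Finset.sum_le_sum fun j _ => ?_
        rcases lt_or_ge i d with h1 | h1
        · rw [hv0 i j h1]; simp [not_le.mpr h1]
        · rcases le_or_gt (i+j) n with h | h
          · rw [if_pos h1, if_pos (by omega), one_mul, mul_assoc]
            have h3 : |u i j * v i j| ≤ c := by
              rw [abs_mul]; nlinarith [hu i j h, hv i j h, abs_nonneg (u i j), abs_nonneg (v i j)]
            have h4 := le_abs_self (u i j * v i j)
            nlinarith [dM_le n i j, dM_nonneg n i j]
          · rw [dM_zero h]; simp; split_ifs <;> linarith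
    _ = c * ((s:ℝ)+1)^2 := by
        simp only [← Finset.mul_sum, ← Finset.sum_mul]
        have e1 : ∑ i ∈ Finset.range (n+1), (if d ≤ i then (1:ℝ) else 0) = s + 1 := by
          rw [Finset.sum_ite, Finset.sum_const_zero, add_zero, Finset.sum_const]
          have : (Finset.range (n+1)).filter (fun i => d ≤ i) = Finset.Ico d (n+1) := by
            ext i; simp; omega
          rw [this]; simp
          rw [show n + 1 - d = s + 1 by omega]; push_cast; ring
        have e2 : ∑ j ∈ Finset.range (n+1), (if j ≤ s then c else 0) = (s + 1) * c := by
          rw [Finset.sum_ite, Finset.sum_const_zero, add_zero, Finset.sum_const]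
          have : (Finset.range (n+1)).filter (fun j => j ≤ s) = Finset.range (s+1) := by
            ext i; simp; omega
          rw [this]; simp
        rw [e1, e2]; ring

lemma dEig.energy {α β : ℝ} {n : ℕ} {l : ℝ} {u : ℕ → ℕ → ℝ} (h : dEig α β n l u) {d s : ℕ} (hds : d + s = n) :
    ∑ i ∈ Finset.Ico d (n+1), ∑ j ∈ Finset.range (n+1),
      (dA α n i j * (u (i+1) j - u i j)^2 + dA β n j i * (u i (j+1) - u i j)^2) ≤ 2 * l * ((s:ℝ)+1)^2 := by
  set v : ℕ → ℕ → ℝ := fun i j => if d ≤ i then u i j - u d s else 0 with hv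
  have h1 := h.wf v
  have h2 : dS n u v ≤ 2 * ((s:ℝ)+1)^2 := by
    refine dS_bound h.bd hds (by norm_num) ?_ ?_
    · intro i j hij
      simp only [hv]
      split_ifs
      · have a := abs_le.mp (h.bd i j hij)
        have b := abs_le.mp (h.bd d s (by omega))
        rw [abs_le]; constructor <;> linarith [a.1, a.2, b.1, b.2]
      · simp
    · intro i j hij; simp only [hv]; rw [if_neg (by omega)]
  have h3 : dE α β n u v ≤ 2 * l * ((s:ℝ)+1)^2 := by
    rw [h1]; nlinarith [mul_le_mul_of_nonneg_left h2 h.hl]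
  refine le_trans ?_ h3
  unfold dE
  have hsub : Finset.Ico d (n+1) = (Finset.range (n+1)).filter (fun i => d ≤ i) := by
    ext i; simp; omega
  rw [hsub, Finset.sum_filter]
  refine Finset.sum_le_sum fun i _ => ?_
  by_cases hi : d ≤ i
  · rw [if_pos hi]
    refine Finset.sum_le_sum fun j _ => ?_
    simp only [hv, dX, dT]
    rw [if_pos hi, if_pos hi, if_pos (by omega)]
    apply le_of_eq; ring
  · rw [if_neg hi]
    refine Finset.sum_nonneg fun j _ => ?_
    simp only [hv, dX, dT]
    rw [if_neg hi, if_neg hi]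
    by_cases hi2 : d ≤ i + 1
    · rw [if_pos hi2]
      simp only [sub_self, mul_zero, add_zero, sub_zero]
      rcases lt_or_ge (i+j) n with h4 | h4
      · have e : i + 1 = d := by omega
        rw [e]
        have a1 := (h.cone i j h4).1
        rw [e] at a1
        exact mul_nonneg (mul_nonneg (dA_nonneg h.ha.le _ _ _) (by linarith))
          (sub_nonneg.mpr (dCone_down h.cone (by omega) (by omega)))
      · unfold dA; rw [if_neg (by omega)]; simp
    · rw [if_neg hi2]; simp

lemma dEig.flux {α β : ℝ} {n : ℕ} {l : ℝ} {u : ℕ → ℕ → ℝ} (h : dEig α β n l u) {d s t : ℕ} (hds : d + s = n)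
    (hts : t ≤ s) : α * (((t:ℝ)+1)/2 * (u (n-t) t - u d 0)) ≤ l * s * ((s:ℝ)+1)^2 := by
  set v : ℕ → ℕ → ℝ := fun i j => ((i - d : ℕ) : ℝ) with hv
  have h1 := h.wf v
  have h2 : dS n u v ≤ s * ((s:ℝ)+1)^2 := by
    refine dS_bound h.bd hds (by positivity) ?_ ?_
    · intro i j hij
      simp only [hv]
      rw [Nat.abs_cast]; exact_mod_cast (by omega)
    · intro i j hij; simp only [hv]; rw [Nat.sub_eq_zero_of_le hij.le]; simp
  have h3 : dE α β n u v ≤ l * s * ((s:ℝ)+1)^2 := by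
    rw [h1]; nlinarith [mul_le_mul_of_nonneg_left h2 h.hl]
  refine le_trans ?_ h3
  have e1 : dE α β n u v = ∑ j ∈ Finset.range (n+1), ∑ i ∈ Finset.range (n+1),
      dX α n u i j * (if d ≤ i then 1 else 0) := by
    unfold dE
    rw [Finset.sum_comm]
    refine Finset.sum_congr rfl fun j _ => Finset.sum_congr rfl fun i _ => ?_
    simp only [hv, sub_self, mul_zero, add_zero]
    congr 1
    split_ifs with hi
    · rw [show i + 1 - d = (i - d) + 1 by omega]; push_cast; ring
    · rw [Nat.sub_eq_zero_of_le (by omega), Nat.sub_eq_zero_of_le (by omega)]; simp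
  have hXnn : ∀ i j, 0 ≤ dX α n u i j := by
    intro i j
    unfold dX
    rcases lt_or_ge (i+j) n with h4 | h4
    · exact mul_nonneg (dA_nonneg h.ha.le _ _ _) (sub_nonneg.mpr (h.cone i j h4).1)
    · unfold dA; rw [if_neg (by omega)]; simp
  have hnn : ∀ i j, 0 ≤ dX α n u i j * (if d ≤ i then (1:ℝ) else 0) := by
    intro i j
    exact mul_nonneg (hXnn i j) (by split_ifs <;> norm_num)
  rw [e1]
  calc α * (((t:ℝ)+1)/2 * (u (n-t) t - u d 0))
      = ∑ j ∈ Finset.range (t+1), α / 2 * (u (n-t) t - u d 0) := by simp; ring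
    _ ≤ ∑ j ∈ Finset.range (t+1), ∑ i ∈ Finset.Ico d (n-j), α / 2 * (u (i+1) j - u i j) := by
        refine Finset.sum_le_sum fun j hj => ?_
        rw [Finset.mem_range] at hj
        rw [← Finset.mul_sum, Finset.sum_Ico_sub (fun i => u i j) (by omega : d ≤ n - j)]
        refine mul_le_mul_of_nonneg_left ?_ (by linarith [h.ha])
        have a1 : u (n-t) t ≤ u (n-j) j := dCone_mono h.cone (by omega) (by omega) (by omega) (by omega)
        have a2 : u d j ≤ u d 0 := dCone_down h.cone (by omega) (by omega)
        linarith
    _ ≤ ∑ j ∈ Finset.range (t+1), ∑ i ∈ Finset.Ico d (n-j), dX α n u i j * (if d ≤ i then 1 else 0) := by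
        refine Finset.sum_le_sum fun j hj => Finset.sum_le_sum fun i hi => ?_
        rw [Finset.mem_Ico] at hi
        rw [if_pos hi.1, mul_one]
        unfold dX dA
        have a1 := (h.cone i j (by omega)).1
        have := h.ha
        rw [if_pos (by omega)]
        split_ifs <;> nlinarith
    _ ≤ ∑ j ∈ Finset.range (t+1), ∑ i ∈ Finset.range (n+1), dX α n u i j * (if d ≤ i then 1 else 0) := by
        refine Finset.sum_le_sum fun j hj => Finset.sum_le_sum_of_subset_of_nonneg ?_ fun i _ _ => hnn i j
        intro i hi; rw [Finset.mem_Ico] at hi; rw [Finset.mem_range]; omega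
    _ ≤ _ := by
        refine Finset.sum_le_sum_of_subset_of_nonneg ?_ fun j _ _ => Finset.sum_nonneg fun i _ => hnn i j
        intro i hi; rw [Finset.mem_range] at *; omega

lemma cs_tele (w : ℕ → ℝ) {p q : ℕ} (hpq : p ≤ q) :
    (w q - w p)^2 ≤ ((q:ℝ) - p) * ∑ i ∈ Finset.Ico p q, (w (i+1) - w i)^2 := by
  rw [← Finset.sum_Ico_sub w hpq]
  have := sq_sum_le_card_mul_sum_sq (s := Finset.Ico p q) (f := fun i => w (i+1) - w i)
  simp only [Nat.card_Ico] at this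
  rwa [Nat.cast_sub hpq] at this

lemma dEig.good {α β : ℝ} {n : ℕ} {l : ℝ} {u : ℕ → ℕ → ℝ} (h : dEig α β n l u) {s : ℕ} (hs : 1 ≤ s) (hsn : 2*s ≤ n) :
    ∃ s', s ≤ s' ∧ s' ≤ 2*s ∧ u (n-s') 0 - u (n-s') s' ≤ Real.sqrt (72 * l / β) * s := by
  by_contra hcon
  push Not at hcon
  have hs1 : (1:ℝ) ≤ s := by exact_mod_cast hs
  have hE := h.energy (d := n - 2*s) (s := 2*s) (by omega)
  have hb := h.hb
  have hl := h.hl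
  set Q := Real.sqrt (72 * l / β) * s with hQ
  have hQ0 : 0 ≤ Q := by positivity
  have hQ2 : Q^2 = 72 * l / β * s^2 := by
    rw [hQ, mul_pow, Real.sq_sqrt (by positivity)]
  have hnn : ∀ i j, 0 ≤ dA α n i j * (u (i+1) j - u i j)^2 + dA β n j i * (u i (j+1) - u i j)^2 := fun i j =>
    add_nonneg (mul_nonneg (dA_nonneg h.ha.le _ _ _) (sq_nonneg _)) (mul_nonneg (dA_nonneg h.hb.le _ _ _) (sq_nonneg _))
  have hcol : ∀ i ∈ Finset.Ico (n-2*s) (n-s+1), β/(4*s) * Q^2 <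
      ∑ j ∈ Finset.range (n+1),
      (dA α n i j * (u (i+1) j - u i j)^2 + dA β n j i * (u i (j+1) - u i j)^2) := by
    intro i hi
    rw [Finset.mem_Ico] at hi
    have h1 := hcon (n - i) (by omega) (by omega)
    rw [show n - (n - i) = i by omega] at h1
    have h2 := cs_tele (fun j => u i j) (Nat.zero_le (n-i))
    have h3 : Q^2 < (u i (n-i) - u i 0)^2 := by nlinarith
    have h4 : ∑ j ∈ Finset.Ico 0 (n-i), (u i (j+1) - u i j)^2 ≤ 2/β * ∑ j ∈ Finset.range (n+1),
      (dA α n i j * (u (i+1) j - u i j)^2 + dA β n j i * (u i (j+1) - u i j)^2) := by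
      rw [Finset.mul_sum]
      calc _ ≤ ∑ j ∈ Finset.Ico 0 (n-i), 2/β * (dA α n i j * (u (i+1) j - u i j)^2 + dA β n j i * (u i (j+1) - u i j)^2) := by
            refine Finset.sum_le_sum fun j hj => ?_
            rw [Finset.mem_Ico] at hj
            have : β/2 ≤ dA β n j i := by
              unfold dA; rw [if_pos (by omega)]; split_ifs <;> linarith
            have h5 : 0 ≤ dA α n i j * (u (i+1) j - u i j)^2 := mul_nonneg (dA_nonneg h.ha.le _ _ _) (sq_nonneg _)
            have h6 := mul_le_mul_of_nonneg_right this (sq_nonneg (u i (j+1) - u i j))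
            rw [div_mul_eq_mul_div, le_div_iff₀ hb]
            nlinarith
        _ ≤ _ := by
            refine Finset.sum_le_sum_of_subset_of_nonneg ?_ fun j _ _ => mul_nonneg (by positivity) (hnn i j)
            intro j hj; rw [Finset.mem_Ico] at hj; rw [Finset.mem_range]; omega
    set S := ∑ j ∈ Finset.range (n+1),
      (dA α n i j * (u (i+1) j - u i j)^2 + dA β n j i * (u i (j+1) - u i j)^2)
    have h7 : ((n - i : ℕ):ℝ) ≤ 2 * s := by exact_mod_cast (by omega : n - i ≤ 2 * s)
    have hS : 0 ≤ S := Finset.sum_nonneg fun j _ => hnn i j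
    have h8 : Q^2 < 2*s * (2/β * S) := by
      have h9 : (0:ℝ) ≤ ((n - i : ℕ):ℝ) := by positivity
      calc Q^2 < _ := h3
        _ ≤ _ := h2
        _ ≤ ((n - i : ℕ):ℝ) * (2/β * S) := by
          simpa using mul_le_mul_of_nonneg_left h4 h9
        _ ≤ _ := mul_le_mul_of_nonneg_right h7 (by positivity)
    have h10 : β/(4*s) * Q^2 < β/(4*s) * (2*s * (2/β * S)) := mul_lt_mul_of_pos_left h8 (by positivity)
    have h11 : β/(4*s) * (2*s * (2/β * S)) = S := by field_simp; norm_num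
    linarith
  have h12 : ∑ i ∈ Finset.Ico (n-2*s) (n-s+1), β/(4*s) * Q^2 < 2 * l * (((2*s:ℕ):ℝ)+1)^2 := by
    refine lt_of_lt_of_le (Finset.sum_lt_sum_of_nonempty ?_ hcol) (le_trans ?_ hE)
    · exact Finset.nonempty_Ico.mpr (by omega)
    · refine Finset.sum_le_sum_of_subset_of_nonneg ?_ fun i _ _ => Finset.sum_nonneg fun j _ => hnn i j
      intro j hj; rw [Finset.mem_Ico] at *; omega
  rw [Finset.sum_const, hQ2] at h12
  simp only [Nat.card_Ico] at h12
  rw [show n - s + 1 - (n - 2*s) = s + 1 by omega] at h12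
  push_cast at h12
  have h13 : ((s + 1 : ℕ):ℝ) • (β / (4*s) * (72 * l / β * s^2)) = 18 * l * (s+1) * s := by
    push_cast; rw [smul_eq_mul]; field_simp; ring
  have h14 : ((s + 1 : ℕ)) • (β / (4*s) * (72 * l / β * s^2)) = 18 * l * (s+1) * s := by
    rw [← h13, ← Nat.cast_smul_eq_nsmul ℝ]
  rw [h14] at h12
  have : (2*(s:ℝ)+1)^2 ≤ 9 * ((s+1)*s) := by nlinarith
  nlinarith [mul_le_mul_of_nonneg_left this hl]

lemma dEig.corner {α β : ℝ} {n : ℕ} {l : ℝ} {u : ℕ → ℕ → ℝ} (h : dEig α β n l u) (s : ℕ) (hsn : 2*s ≤ n) :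
    u n 0 - u (n-s) s ≤ 2 * (72 * l * n / α + Real.sqrt (72 * l / β)) * s := by
  have ha := h.ha
  have hl := h.hl
  induction s using Nat.strong_induction_on with
  | _ s ih =>
    rcases Nat.eq_zero_or_pos s with rfl | hs
    · simp
    obtain ⟨s', h1, h2, h3⟩ := h.good hs hsn
    have h4 := h.flux (d := n - s') (s := s') (t := s/2) (by omega) (by omega)
    have h5 := ih (s/2) (by omega) (by omega)
    have h6 : u (n-s') s' ≤ u (n-s) s := dCone_mono h.cone (by omega) (by omega) (by omega) (by omega)
    set C := Real.sqrt (72 * l / β) with hC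
    have hC0 : 0 ≤ C := Real.sqrt_nonneg _
    have hs1 : (1:ℝ) ≤ s := by exact_mod_cast hs
    have hn1 : 2*(s:ℝ) ≤ n := by exact_mod_cast hsn
    have t1 : (s:ℝ)/2 ≤ ((s/2:ℕ):ℝ) + 1 := by
      have : s ≤ 2 * (s/2) + 2 := by omega
      have : (s:ℝ) ≤ 2 * ((s/2:ℕ):ℝ) + 2 := by exact_mod_cast this
      linarith
    have t2 : ((s/2:ℕ):ℝ) ≤ s/2 := by
      have : 2 * (s/2) ≤ s := by omega
      have : 2 * ((s/2:ℕ):ℝ) ≤ s := by exact_mod_cast this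
      linarith
    have t3 : (s':ℝ) ≤ 2 * s := by exact_mod_cast h2
    set D := u (n - s/2) (s/2) - u (n-s') 0 with hD
    have hDb : D ≤ 72 * l * n / α * s := by
      rcases le_or_gt D 0 with hd | hd
      · exact hd.trans (by positivity)
      · have a1 : α * ((s:ℝ)/4 * D) ≤ α * ((((s/2:ℕ):ℝ) + 1)/2 * D) := by
          refine mul_le_mul_of_nonneg_left (mul_le_mul_of_nonneg_right (by linarith) hd.le) ha.le
        have a2 : l * s' * ((s':ℝ)+1)^2 ≤ l * (2*s) * (3*s)^2 := by
          gcongr; linarith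
        have a3 : s * (α * D) ≤ s * (72 * l * s^2) := by nlinarith
        have a4 : α * D ≤ 72 * l * s^2 := le_of_mul_le_mul_left a3 (by linarith)
        have a5 : 72 * l * s^2 ≤ 72 * l * n * s := by
          have : (s:ℝ)^2 ≤ n * s := by nlinarith
          nlinarith [mul_le_mul_of_nonneg_left this hl]
        rw [div_mul_eq_mul_div, le_div_iff₀ ha]
        linarith
    have h7 : 2 * (72 * l * n / α + C) * ((s/2:ℕ):ℝ) ≤ 2 * (72 * l * n / α + C) * (s/2) :=
      mul_le_mul_of_nonneg_left t2 (by positivity)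
    nlinarith

end

section
open Set

lemma CL_sum {O c : ℝ} (hc : 0 ≤ c) {X : ℕ → ℝ} (hX : ∀ s, 0 ≤ X s) {s1 : ℕ} (hs1 : 1 ≤ s1) (k : ℕ)
    (H : ∀ s, s1 < s → s ≤ 2^k * s1 → O^2 ≤ c * s * X s) :
    k * O^2 ≤ 2 * c * ∑ s ∈ Finset.Ioc s1 (2^k * s1), X s := by
  induction k with
  | zero => simp
  | succ k ih =>
    have h0 : s1 ≤ 2^k * s1 := Nat.le_mul_of_pos_left _ (by positivity)
    have h1 : 2^k * s1 ≤ 2^(k+1) * s1 := by rw [pow_succ]; nlinarith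
    have ih' := ih fun s a b => H s a (b.trans h1)
    rw [← Finset.sum_Ioc_consecutive X h0 h1]
    set m := 2^k * s1 with hm
    have hm2 : 2^(k+1) * s1 = 2 * m := by rw [hm, pow_succ]; ring
    rw [hm2]
    have hmpos : (1:ℝ) ≤ m := by exact_mod_cast (by omega : 1 ≤ m)
    have h2 : ∑ s ∈ Finset.Ioc m (2*m), O^2 ≤ ∑ s ∈ Finset.Ioc m (2*m), c * (2*m) * X s := by
      refine Finset.sum_le_sum fun s hs => ?_
      rw [Finset.mem_Ioc] at hs
      refine (H s (by omega) (by rw [hm2]; exact hs.2)).trans ?_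
      have : (s:ℝ) ≤ 2 * m := by exact_mod_cast hs.2
      have := hX s
      gcongr
    rw [Finset.sum_const, ← Finset.mul_sum] at h2
    simp only [Nat.card_Ioc] at h2
    rw [show 2 * m - m = m by omega, nsmul_eq_mul] at h2
    have h3 : (m:ℝ) * O^2 ≤ m * (2 * c * ∑ s ∈ Finset.Ioc m (2*m), X s) := by linarith
    have h4 := le_of_mul_le_mul_left h3 (by linarith)
    push_cast
    linarith

def dEn (n : ℕ) (u : ℕ → ℕ → ℝ) (i j : ℕ) : ℝ :=
  if i + j < n then (u (i+1) j - u i j)^2 + (u i (j+1) - u i j)^2 else 0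

lemma dEn_nonneg (n : ℕ) (u : ℕ → ℕ → ℝ) (i j : ℕ) : 0 ≤ dEn n u i j := by
  unfold dEn; split_ifs <;> positivity

lemma dEig.total {α β : ℝ} {n : ℕ} {l : ℝ} {u : ℕ → ℕ → ℝ} (h : dEig α β n l u) (hn : 1 ≤ n)
    {Λ : ℝ} (hΛ : l * n^2 ≤ Λ) :
    ∑ i ∈ Finset.range (n+1), ∑ j ∈ Finset.range (n+1), dEn n u i j ≤ 16 * Λ / min α β := by
  have hE := h.energy (d := 0) (s := n) (by omega)
  have hn1 : (1:ℝ) ≤ n := by exact_mod_cast hn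
  have hg : 0 < min α β := lt_min h.ha h.hb
  have h1 : 2 * l * ((n:ℝ)+1)^2 ≤ 8 * Λ := by
    have : ((n:ℝ)+1)^2 ≤ 4 * n^2 := by nlinarith
    nlinarith [mul_le_mul_of_nonneg_left this h.hl]
  rw [le_div_iff₀ hg, mul_comm, Finset.mul_sum]
  have h2 : ∑ i ∈ Finset.range (n+1), min α β * ∑ j ∈ Finset.range (n+1), dEn n u i j ≤
      2 * ∑ i ∈ Finset.Ico 0 (n+1), ∑ j ∈ Finset.range (n+1),
      (dA α n i j * (u (i+1) j - u i j)^2 + dA β n j i * (u i (j+1) - u i j)^2) := by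
    rw [Finset.mul_sum, Finset.range_eq_Ico]
    refine Finset.sum_le_sum fun i _ => ?_
    rw [Finset.mul_sum, Finset.mul_sum]
    refine Finset.sum_le_sum fun j _ => ?_
    unfold dEn dA
    have := h.ha
    have := h.hb
    have a1 := min_le_left α β
    have a2 := min_le_right α β
    by_cases hij : i + j < n
    · rw [if_pos hij, if_pos hij, if_pos (by omega : j + i < n)]
      have p1 : min α β ≤ 2 * (α * (if j = 0 then 1/2 else 1)) := by split_ifs <;> linarith
      have p2 : min α β ≤ 2 * (β * (if i = 0 then 1/2 else 1)) := by split_ifs <;> linarith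
      have q1 := mul_le_mul_of_nonneg_right p1 (sq_nonneg (u (i+1) j - u i j))
      have q2 := mul_le_mul_of_nonneg_right p2 (sq_nonneg (u i (j+1) - u i j))
      linarith
    · rw [if_neg hij, if_neg hij, if_neg (by omega : ¬ j + i < n)]; simp
  linarith

lemma sum_shift_le {X : ℕ → ℝ} (hX : ∀ s, 0 ≤ X s) {n p q : ℕ} (g : ℕ → ℕ)
    (hg : ∀ a b, a ∈ Finset.Ioc p q → b ∈ Finset.Ioc p q → g a = g b → a = b) 
    (hg2 : ∀ a ∈ Finset.Ioc p q, g a ≤ n) :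
    ∑ s ∈ Finset.Ioc p q, X (g s) ≤ ∑ i ∈ Finset.range (n+1), X i := by
  rw [← Finset.sum_image (f := X) (g := g) (s := Finset.Ioc p q) (fun a ha b hb => hg a b ha hb)]
  refine Finset.sum_le_sum_of_subset_of_nonneg ?_ fun i _ _ => hX i
  intro i hi
  rw [Finset.mem_image] at hi
  obtain ⟨a, ha, rfl⟩ := hi
  rw [Finset.mem_range]; have := hg2 a ha; omega

lemma row_cs {n : ℕ} {u : ℕ → ℕ → ℝ} {p q j s : ℕ} (hpq : p ≤ q) (hq : q + j ≤ n) (hs : q ≤ p + 2*s) :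
    (u q j - u p j)^2 ≤ 2 * s * ∑ i ∈ Finset.range (n+1), dEn n u i j := by
  have h := cs_tele (fun i => u i j) hpq
  have h0 : (q:ℝ) - p ≤ 2 * s := by
    have : (q:ℝ) ≤ p + 2 * s := by exact_mod_cast hs
    linarith
  have hle : ∑ i ∈ Finset.Ico p q, (u (i+1) j - u i j)^2 ≤ ∑ i ∈ Finset.range (n+1), dEn n u i j := by
    calc _ ≤ ∑ i ∈ Finset.Ico p q, dEn n u i j := by
          refine Finset.sum_le_sum fun i hi => ?_
          rw [Finset.mem_Ico] at hi
          unfold dEn; rw [if_pos (by omega)]; nlinarith [sq_nonneg (u i (j+1) - u i j)]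
      _ ≤ _ := by
          refine Finset.sum_le_sum_of_subset_of_nonneg ?_ fun i _ _ => dEn_nonneg n u i j
          intro i hi; rw [Finset.mem_Ico] at hi; rw [Finset.mem_range]; omega
  have hnn : 0 ≤ ∑ i ∈ Finset.Ico p q, (u (i+1) j - u i j)^2 := Finset.sum_nonneg fun _ _ => sq_nonneg _
  calc _ ≤ _ := h
    _ ≤ 2 * s * ∑ i ∈ Finset.Ico p q, (u (i+1) j - u i j)^2 := mul_le_mul_of_nonneg_right h0 hnn
    _ ≤ _ := mul_le_mul_of_nonneg_left hle (by positivity)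

lemma col_cs {n : ℕ} {u : ℕ → ℕ → ℝ} {p q i s : ℕ} (hpq : p ≤ q) (hq : i + q ≤ n) (hs : q ≤ p + 2*s) :
    (u i p - u i q)^2 ≤ 2 * s * ∑ j ∈ Finset.range (n+1), dEn n u i j := by
  have h := cs_tele (fun j => u i j) hpq
  have h0 : (q:ℝ) - p ≤ 2 * s := by
    have : (q:ℝ) ≤ p + 2 * s := by exact_mod_cast hs
    linarith
  have hle : ∑ j ∈ Finset.Ico p q, (u i (j+1) - u i j)^2 ≤ ∑ j ∈ Finset.range (n+1), dEn n u i j := by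
    calc _ ≤ ∑ j ∈ Finset.Ico p q, dEn n u i j := by
          refine Finset.sum_le_sum fun j hi => ?_
          rw [Finset.mem_Ico] at hi
          unfold dEn; rw [if_pos (by omega)]; nlinarith [sq_nonneg (u (i+1) j - u i j)]
      _ ≤ _ := by
          refine Finset.sum_le_sum_of_subset_of_nonneg ?_ fun j _ _ => dEn_nonneg n u i j
          intro i hi; rw [Finset.mem_Ico] at hi; rw [Finset.mem_range]; omega
  have hnn : 0 ≤ ∑ j ∈ Finset.Ico p q, (u i (j+1) - u i j)^2 := Finset.sum_nonneg fun _ _ => sq_nonneg _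
  have e : (u i p - u i q)^2 = (u i q - u i p)^2 := by ring
  rw [e]
  calc _ ≤ _ := h
    _ ≤ 2 * s * ∑ j ∈ Finset.Ico p q, (u i (j+1) - u i j)^2 := mul_le_mul_of_nonneg_right h0 hnn
    _ ≤ _ := mul_le_mul_of_nonneg_left hle (by positivity)

def dKc (α β Λ : ℝ) : ℝ := 72 * Λ / α + 72 * Λ / β + Real.sqrt (72 * Λ / α) + Real.sqrt (72 * Λ / β)

lemma dEig.cornerA {α β : ℝ} {n : ℕ} {l : ℝ} {u : ℕ → ℕ → ℝ} (h : dEig α β n l u) (hn : 1 ≤ n)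
    {Λ : ℝ} (hΛ : l * n^2 ≤ Λ) (s : ℕ) (hsn : 2*s ≤ n) :
    u n 0 - u (n-s) s ≤ 2 * dKc α β Λ * s / n := by
  have hc := h.corner s hsn
  have hn1 : (1:ℝ) ≤ n := by exact_mod_cast hn
  have ha := h.ha
  have hb := h.hb
  have hl := h.hl
  have hΛ0 : 0 ≤ Λ := le_trans (by positivity) hΛ
  have h1 : 72 * l * n / α ≤ 72 * Λ / α / n := by
    rw [div_div, mul_comm α, ← div_div, le_div_iff₀ (by positivity : (0:ℝ) < α), div_mul_cancel₀ _ ha.ne',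
      le_div_iff₀ (by positivity)]
    nlinarith
  have h2 : Real.sqrt (72 * l / β) ≤ Real.sqrt (72 * Λ / β) / n := by
    rw [le_div_iff₀ (by positivity)]
    apply Real.le_sqrt_of_sq_le
    rw [mul_pow, Real.sq_sqrt (by positivity), div_mul_eq_mul_div]
    exact (div_le_div_iff_of_pos_right hb).mpr (by nlinarith)
  have h3 : 72 * l * n / α + Real.sqrt (72 * l / β) ≤ dKc α β Λ / n := by
    have h4 : dKc α β Λ / n = 72 * Λ / α / n + Real.sqrt (72 * Λ / β) / n +
      (72 * Λ / β + Real.sqrt (72 * Λ / α)) / n := by unfold dKc; ring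
    have : 0 ≤ (72 * Λ / β + Real.sqrt (72 * Λ / α)) / n := by positivity
    linarith
  refine hc.trans ?_
  have : 2 * dKc α β Λ * s / n = 2 * (dKc α β Λ / n) * s := by ring
  rw [this]
  gcongr

lemma dKc_symm (α β Λ : ℝ) : dKc α β Λ = dKc β α Λ := by unfold dKc; ring

lemma dEig.cornerB {α β : ℝ} {n : ℕ} {l : ℝ} {u : ℕ → ℕ → ℝ} (h : dEig α β n l u) (hn : 1 ≤ n)
    {Λ : ℝ} (hΛ : l * n^2 ≤ Λ) (s : ℕ) (hsn : 2*s ≤ n) :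
    u s (n-s) - u 0 n ≤ 2 * dKc α β Λ * s / n := by
  have := h.swap.cornerA hn hΛ s hsn
  rw [dKc_symm β α] at this
  linarith

lemma CL_finish {n : ℕ} {u : ℕ → ℕ → ℝ} {E0 O : ℝ}
    (hE : ∑ i ∈ Finset.range (n+1), ∑ j ∈ Finset.range (n+1), dEn n u i j ≤ E0) {s1 k : ℕ} (hs1 : 1 ≤ s1)
    (g1 g2 : ℕ → ℕ)
    (hg1 : ∀ a b, a ∈ Finset.Ioc s1 (2^k*s1) → b ∈ Finset.Ioc s1 (2^k*s1) → g1 a = g1 b → a = b) 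
    (hg1' : ∀ a ∈ Finset.Ioc s1 (2^k*s1), g1 a ≤ n)
    (hg2 : ∀ a b, a ∈ Finset.Ioc s1 (2^k*s1) → b ∈ Finset.Ioc s1 (2^k*s1) → g2 a = g2 b → a = b) 
    (hg2' : ∀ a ∈ Finset.Ioc s1 (2^k*s1), g2 a ≤ n)
    (H : ∀ s, s1 < s → s ≤ 2^k * s1 → O^2 ≤ 4 * s * (∑ j ∈ Finset.range (n+1), dEn n u (g1 s) j +
      ∑ i ∈ Finset.range (n+1), dEn n u i (g2 s))) : k * O^2 ≤ 16 * E0 := by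
  have nn1 : ∀ i, 0 ≤ ∑ j ∈ Finset.range (n+1), dEn n u i j := fun i => Finset.sum_nonneg fun j _ => dEn_nonneg _ _ _ _
  have nn2 : ∀ j, 0 ≤ ∑ i ∈ Finset.range (n+1), dEn n u i j := fun i => Finset.sum_nonneg fun j _ => dEn_nonneg _ _ _ _
  have := CL_sum (O := O) (c := 4) (by norm_num)
    (X := fun s => ∑ j ∈ Finset.range (n+1), dEn n u (g1 s) j + ∑ i ∈ Finset.range (n+1), dEn n u i (g2 s))
    (fun s => add_nonneg (nn1 _) (nn2 _)) hs1 k H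
  rw [Finset.sum_add_distrib] at this
  have h1 := sum_shift_le nn1 g1 hg1 hg1'
  have h2 := sum_shift_le nn2 g2 hg2 hg2'
  have h3 : ∑ j ∈ Finset.range (n+1), ∑ i ∈ Finset.range (n+1), dEn n u i j =
    ∑ i ∈ Finset.range (n+1), ∑ j ∈ Finset.range (n+1), dEn n u i j := Finset.sum_comm
  linarith

lemma dEig.equi {α β : ℝ} {n : ℕ} {l : ℝ} {u : ℕ → ℕ → ℝ} (h : dEig α β n l u) (hn : 1 ≤ n)
    {Λ : ℝ} (hΛ : l * n^2 ≤ Λ) {s1 k i0 j0 i j : ℕ} (hs1 : 1 ≤ s1) (hk : 8 * (2^k * s1) ≤ n)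
    (h0 : i0 + j0 ≤ n) (hij : i + j ≤ n) (c1 : i ≤ i0 + s1) (c2 : i0 ≤ i + s1) (c3 : j ≤ j0 + s1) (c4 : j0 ≤ j + s1) :
    k * (u i0 j0 - u i j)^2 ≤ 16 * (16 * Λ / min α β) ∨
    |u i0 j0 - u i j| ≤ 8 * dKc α β Λ * (2^k * s1 : ℕ) / n := by
  have hE := h.total hn hΛ
  have hSs : s1 ≤ 2^k * s1 := Nat.le_mul_of_pos_left _ (by positivity)
  set S := 2^k * s1 with hS
  have sqle : ∀ x y z : ℝ, |x| ≤ y + z → x^2 ≤ 2 * y^2 + 2 * z^2 := by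
    intro x y z hx
    have : x^2 ≤ (y+z)^2 := by rw [← sq_abs x]; gcongr
    nlinarith [sq_nonneg (y-z)]
  by_cases r1 : i0 + j0 + 2 * S ≤ n
  · left
    refine CL_finish hE hs1 (fun s => i0 + s) (fun s => j0 + s) (by intros; omega) ?_ (by intros; omega) ?_ ?_
    · intro a ha; rw [Finset.mem_Ioc] at ha; omega
    · intro a ha; rw [Finset.mem_Ioc] at ha; omega
    · intro s a b
      have e1 := col_cs (u := u) (n := n) (i := i0+s) (p := j0 - s) (q := j0 + s) (s := s) (by omega) (by omega) (by omega)
      have e2 := row_cs (u := u) (n := n) (j := j0+s) (p := i0 - s) (q := i0 + s) (s := s) (by omega) (by omega) (by omega)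
      have m1 : u i0 j0 ≤ u (i0+s) (j0-s) := dCone_mono h.cone (by omega) (by omega) (by omega) (by omega)
      have m2 : u (i0-s) (j0+s) ≤ u i0 j0 := dCone_mono h.cone (by omega) (by omega) (by omega) (by omega)
      have m3 : u i j ≤ u (i0+s) (j0-s) := dCone_mono h.cone (by omega) (by omega) (by omega) (by omega)
      have m4 : u (i0-s) (j0+s) ≤ u i j := dCone_mono h.cone (by omega) (by omega) (by omega) (by omega)
      have := sqle (u i0 j0 - u i j) (u (i0+s) (j0-s) - u (i0+s) (j0+s)) (u (i0+s) (j0+s) - u (i0-s) (j0+s))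
        (by rw [abs_le]; constructor <;> linarith)
      linarith
  · by_cases r2 : S ≤ i0 ∧ S ≤ j0
    · left
      refine CL_finish hE hs1 (fun s => i0 - s) (fun s => j0 - s) ?_ (by intros; omega) ?_ (by intros; omega) ?_
      · intro a b ha hb; rw [Finset.mem_Ioc] at ha hb; omega
      · intro a b ha hb; rw [Finset.mem_Ioc] at ha hb; omega
      · intro s a b
        have e1 := col_cs (u := u) (n := n) (i := i0-s) (p := j0 - s) (q := min (j0 + s) (n - (i0 - s))) (s := s)
          (by omega) (by omega) (by omega)
        have e2 := row_cs (u := u) (n := n) (j := j0-s) (p := i0 - s) (q := min (i0 + s) (n - (j0-s))) (s := s)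
          (by omega) (by omega) (by omega)
        set P := min (i0 + s) (n - (j0-s)) with hP
        set Q := min (j0 + s) (n - (i0 - s)) with hQ
        have m1 : u i0 j0 ≤ u P (j0-s) := dCone_mono h.cone (by omega) (by omega) (by omega) (by omega)
        have m2 : u (i0-s) Q ≤ u i0 j0 := dCone_mono h.cone (by omega) (by omega) (by omega) (by omega)
        have m3 : u i j ≤ u P (j0-s) := dCone_mono h.cone (by omega) (by omega) (by omega) (by omega)
        have m4 : u (i0-s) Q ≤ u i j := dCone_mono h.cone (by omega) (by omega) (by omega) (by omega)
        have := sqle (u i0 j0 - u i j) (u (i0-s) (j0-s) - u (i0-s) Q) (u P (j0-s) - u (i0-s) (j0-s))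
          (by rw [abs_le]; constructor <;> linarith)
        linarith
    · right
      have hmul : 8 * dKc α β Λ * (S : ℕ) / n = 2 * dKc α β Λ * (4 * S : ℕ) / n := by push_cast; ring
      rw [hmul]
      rcases Nat.lt_or_ge j0 S with hj | hj
      · have hc := h.cornerA hn hΛ (4*S) (by omega)
        have m1 : u i0 j0 ≤ u n 0 := dCone_mono h.cone (by omega) (by omega) (by omega) (by omega)
        have m2 : u (n-4*S) (4*S) ≤ u i0 j0 := dCone_mono h.cone (by omega) (by omega) (by omega) (by omega)
        have m3 : u i j ≤ u n 0 := dCone_mono h.cone (by omega) (by omega) (by omega) (by omega)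
        have m4 : u (n-4*S) (4*S) ≤ u i j := dCone_mono h.cone (by omega) (by omega) (by omega) (by omega)
        rw [abs_le]; constructor <;> linarith
      · have hc := h.cornerB hn hΛ (4*S) (by omega)
        have m1 : u i0 j0 ≤ u (4*S) (n-4*S) := dCone_mono h.cone (by omega) (by omega) (by omega) (by omega)
        have m2 : u 0 n ≤ u i0 j0 := dCone_mono h.cone (by omega) (by omega) (by omega) (by omega)
        have m3 : u i j ≤ u (4*S) (n-4*S) := dCone_mono h.cone (by omega) (by omega) (by omega) (by omega)
        have m4 : u 0 n ≤ u i j := dCone_mono h.cone (by omega) (by omega) (by omega) (by omega)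
        rw [abs_le]; constructor <;> linarith

end

section
open Set Filter Topology

lemma dKc_nonneg {α β Λ : ℝ} (ha : 0 < α) (hb : 0 < β) (hΛ : 0 ≤ Λ) : 0 ≤ dKc α β Λ := by
  unfold dKc; positivity

lemma d_equicont {α β Λ : ℝ} (ha : 0 < α) (hb : 0 < β) (hΛ : 0 ≤ Λ) {ε : ℝ} (hε : 0 < ε) :
    ∃ δ > (0:ℝ), ∀ (n : ℕ) (l : ℝ) (u : ℕ → ℕ → ℝ), dEig α β n l u → l * n^2 ≤ Λ → 1 ≤ δ * n →
      ∀ i j i' j' : ℕ, i + j ≤ n → i' + j' ≤ n → |(i:ℝ) - i'| ≤ δ * n → |(j:ℝ) - j'| ≤ δ * n →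
        |u i j - u i' j'| ≤ ε := by
  obtain ⟨k, hk⟩ := exists_nat_gt (16 * (16 * Λ / min α β) / ε^2)
  have hk1 : 16 * (16 * Λ / min α β) < k * ε^2 := by rwa [div_lt_iff₀ (by positivity)] at hk
  have hK := dKc_nonneg ha hb hΛ
  set K := 8 * dKc α β Λ * 2^k with hKdef
  have hK0 : 0 ≤ K := by positivity
  refine ⟨min (1/(8*2^k)) (ε/(K+1)), lt_min (by positivity) (by positivity), ?_⟩
  set δ := min (1/(8*2^k)) (ε/(K+1)) with hδ
  have hδ0 : 0 < δ := lt_min (by positivity) (by positivity)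
  have hδ1 : δ ≤ 1/(8*2^k) := min_le_left _ _
  have hδ2 : δ ≤ ε/(K+1) := min_le_right _ _
  rw [le_div_iff₀ (by positivity)] at hδ1 hδ2
  intro n l u h hl hn i j i' j' hij hij' hi hj
  have hn0 : 0 < n := by
    rcases Nat.eq_zero_or_pos n with rfl | h
    · norm_num at hn
    · exact h
  have hnr : (0:ℝ) < n := by exact_mod_cast hn0
  set s1 := ⌊δ * n⌋₊ with hs1
  have hs1' : 1 ≤ s1 := (Nat.one_le_floor_iff _).mpr hn
  have hfl : (s1:ℝ) ≤ δ * n := Nat.floor_le (by positivity)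
  have conv : ∀ p q : ℕ, |(p:ℝ) - q| ≤ δ * n → p ≤ q + s1 ∧ q ≤ p + s1 := by
    intro p q hpq
    have : ((p - q : ℤ).natAbs : ℝ) ≤ δ * n := by
      rw [Nat.cast_natAbs]; push_cast; exact hpq
    have := Nat.le_floor this
    omega
  have c1 := conv i i' hi
  have c2 := conv j j' hj
  have h8 : 8 * (2^k * s1) ≤ n := by
    have : (8:ℝ) * (2^k * s1) ≤ n := by
      have := mul_le_mul_of_nonneg_left hfl (by positivity : (0:ℝ) ≤ 8 * 2^k)
      nlinarith
    exact_mod_cast this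
  rcases h.equi hn0 hl hs1' h8 hij hij' c1.2 c1.1 c2.2 c2.1 with h1 | h1
  · have hkpos : (0:ℝ) < k := by
      rcases Nat.eq_zero_or_pos k with h0 | h0
      · exfalso; rw [h0] at hk1; simp at hk1
        have : 0 ≤ Λ / min α β := div_nonneg hΛ (lt_min ha hb).le
        rw [mul_div_assoc] at hk1
        linarith
      · exact_mod_cast h0
    have h2 : k * (u i j - u i' j')^2 < k * ε^2 := lt_of_le_of_lt h1 hk1
    have h3 := lt_of_mul_lt_mul_left h2 hkpos.le
    exact (abs_lt_of_sq_lt_sq h3 hε.le).le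
  · refine h1.trans ?_
    push_cast
    rw [div_le_iff₀ hnr]
    have : K * s1 ≤ K * (δ * n) := mul_le_mul_of_nonneg_left hfl hK0
    have h4 : 8 * dKc α β Λ * (2^k * s1) = K * s1 := by rw [hKdef]; ring
    rw [h4]
    have h5 : K * δ ≤ ε := by nlinarith
    nlinarith

/-- unit triangle -/
def T1 : Set (ℝ × ℝ) := {p | 0 ≤ p.1 ∧ 0 ≤ p.2 ∧ p.1 + p.2 ≤ 1}

lemma floor_T1 {p : ℝ × ℝ} (hp : p ∈ T1) (n : ℕ) : ⌊n * p.1⌋₊ + ⌊n * p.2⌋₊ ≤ n := by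
  obtain ⟨h1, h2, h3⟩ := hp
  have a := Nat.floor_le (by positivity : 0 ≤ n * p.1)
  have b := Nat.floor_le (by positivity : 0 ≤ n * p.2)
  have : ((⌊n * p.1⌋₊ + ⌊n * p.2⌋₊ : ℕ) : ℝ) ≤ n := by
    push_cast
    have : (n:ℝ) * (p.1 + p.2) ≤ n * 1 := mul_le_mul_of_nonneg_left h3 (by positivity)
    nlinarith
  exact_mod_cast this

lemma T1_totallyBounded : TotallyBounded T1 := by
  have : T1 ⊆ Icc (0:ℝ) 1 ×ˢ Icc (0:ℝ) 1 := by
    rintro ⟨x, y⟩ ⟨h1, h2, h3⟩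
    simp at h1 h2 h3 ⊢
    constructor <;> constructor <;> linarith
  exact (isCompact_Icc.prod isCompact_Icc).totallyBounded.subset this

/-- The compactness package. -/
structure dLim (α β : ℝ) (F : Filter ℕ) (u : ℕ → ℕ → ℕ → ℝ) (l : ℕ → ℝ) (lam : ℝ) (V : ℝ × ℝ → ℝ) : Prop where
  nb : F.NeBot
  top : F ≤ atTop
  eig : ∀ᶠ k in F, dEig α β (4*k) (l k) (u k)
  lim : Tendsto (fun k => l k * (4*k:ℝ)^2) F (𝓝 lam)
  pos : 0 < lam
  unif : ∀ ε > 0, ∀ᶠ k in F, ∀ i j : ℕ, i + j ≤ 4*k → |u k i j - V ((i:ℝ)/(4*k), (j:ℝ)/(4*k))| ≤ ε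
  cont : ContinuousOn V T1
  monx : ∀ x x' y : ℝ, (x, y) ∈ T1 → (x', y) ∈ T1 → x ≤ x' → V (x, y) ≤ V (x', y)
  mony : ∀ x y y' : ℝ, (x, y) ∈ T1 → (x, y') ∈ T1 → y ≤ y' → V (x, y') ≤ V (x, y)
  osc : 1 ≤ V (1, 0) - V (0, 1)

lemma d_lower {α β : ℝ} {n : ℕ} {l : ℝ} {u : ℕ → ℕ → ℝ} (k : ℕ) (hk : 1 ≤ k) (hn : n = 4*k)
    (h : dEig α β n l u) (h1 : 1 ≤ u n 0 - u 0 n) :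
    1 ≤ 2 * dKc α β (l * n^2) := by
  have a := h.cornerA (by omega) le_rfl (2*k) (by omega)
  have b := h.cornerB (by omega) le_rfl (2*k) (by omega)
  rw [show n - 2*k = 2*k by omega] at a b
  have hnr : (0:ℝ) < n := by exact_mod_cast (by omega : 0 < n)
  have : 2 * dKc α β (l * n^2) * (2*k:ℕ) / n = dKc α β (l*n^2) := by
    rw [div_eq_iff hnr.ne', hn]; push_cast; ring
  rw [this] at a b
  linarith

theorem d_limit {α β : ℝ} (ha : 0 < α) (hb : 0 < β) :
    ∃ (F : Filter ℕ) (u : ℕ → ℕ → ℕ → ℝ) (l : ℕ → ℝ) (lam : ℝ) (V : ℝ × ℝ → ℝ), dLim α β F u l lam V := by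
  have hex := fun k : ℕ => d_exists' ha hb (k+1) (by omega)
  choose u0 l0 hl0 hc0 hN0 hbd0 habs0 hosc0 using hex
  set Λ := 3200 * (α + β) with hΛd
  have hΛ : 0 ≤ Λ := by positivity
  let u : ℕ → ℕ → ℕ → ℝ := fun k => u0 (k-1)
  let l : ℕ → ℝ := fun k => l0 (k-1)
  have hk1 : ∀ k, 1 ≤ k → k - 1 + 1 = k := fun k h => by omega
  have heig : ∀ k, 1 ≤ k → dEig α β (4*k) (l k) (u k) := by
    intro k hk
    have e := hk1 k hk
    refine ⟨ha, hb, hl0 _, ?_, ?_, ?_⟩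
    · have := hc0 (k-1); rwa [e] at this
    · have := hN0 (k-1); rwa [e] at this
    · have := habs0 (k-1); rwa [e] at this
  have hlb : ∀ k, 1 ≤ k → l k * ((4*k:ℕ):ℝ)^2 ≤ Λ := by
    intro k hk
    have := hbd0 (k-1)
    have e : ((k - 1 : ℕ) : ℝ) + 1 = k := by exact_mod_cast hk1 k hk
    push_cast at this ⊢
    rw [e] at this
    exact this
  have hosc : ∀ k, 1 ≤ k → 1 ≤ u k (4*k) 0 - u k 0 (4*k) := by
    intro k hk
    have := hosc0 (k-1); rwa [hk1 k hk] at this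
  let F : Ultrafilter ℕ := hyperfilter ℕ
  have hF : (F : Filter ℕ) ≤ atTop := by
    rw [← Nat.cofinite_eq_atTop]; exact hyperfilter_le_cofinite
  have hev : ∀ᶠ k in (F : Filter ℕ), 1 ≤ k := hF (eventually_ge_atTop 1)
  -- existence of limits
  have hlimex : ∀ (g : ℕ → ℝ) (A B : ℝ), (∀ᶠ k in (F : Filter ℕ), g k ∈ Icc A B) →
      ∃ L ∈ Icc A B, Tendsto g F (𝓝 L) := by
    intro g A B hg
    have := (isCompact_Icc (a := A) (b := B)).ultrafilter_le_nhds (F.map g) (by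
      rw [Filter.le_principal_iff]; exact hg)
    obtain ⟨L, hL, hL2⟩ := this
    exact ⟨L, hL, hL2⟩
  obtain ⟨lam, hlam, hlamlim⟩ := hlimex (fun k => l k * (4*k:ℝ)^2) 0 Λ (by
    filter_upwards [hev] with k hk
    have h1 := hlb k hk
    push_cast at h1
    exact ⟨mul_nonneg (heig k hk).hl (by positivity), h1⟩)
  have hVex : ∀ p : ℝ × ℝ, ∃ L, p ∈ T1 → Tendsto (fun k : ℕ => u k ⌊((4*k:ℕ):ℝ) * p.1⌋₊ ⌊((4*k:ℕ):ℝ) * p.2⌋₊) F (𝓝 L) := by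
    intro p
    by_cases hp : p ∈ T1
    · obtain ⟨L, -, hL⟩ := hlimex (fun k : ℕ => u k ⌊((4*k:ℕ):ℝ) * p.1⌋₊ ⌊((4*k:ℕ):ℝ) * p.2⌋₊) (-1) 1 (by
        filter_upwards [hev] with k hk
        exact abs_le.mp ((heig k hk).bd _ _ (floor_T1 hp _)))
      exact ⟨L, fun _ => hL⟩
    · exact ⟨0, fun h => absurd h hp⟩
  choose V hV using hVex
  have hbig : ∀ c : ℝ, 0 < c → ∀ C : ℝ, ∀ᶠ k in (F : Filter ℕ), C ≤ c * ((4*k:ℕ):ℝ) := by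
    intro c hc C
    apply hF
    obtain ⟨N, hN⟩ := exists_nat_ge (C/c)
    filter_upwards [eventually_ge_atTop N] with k hk
    have h1 : (N:ℝ) ≤ k := by exact_mod_cast hk
    rw [div_le_iff₀ hc] at hN
    push_cast
    nlinarith [mul_le_mul_of_nonneg_right h1 hc.le, mul_nonneg hc.le (Nat.cast_nonneg k : (0:ℝ) ≤ k)]
  -- floors of close points are close
  have hfloor : ∀ (n x y d : ℝ), 0 ≤ n * x → 0 ≤ n * y → |x - y| ≤ d → 0 ≤ n →
      |((⌊n*x⌋₊:ℕ):ℝ) - (⌊n*y⌋₊:ℕ)| ≤ d * n + 1 := by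
    intro n x y d hx hy hxy hn
    have a1 := Nat.floor_le hx
    have a2 := Nat.lt_floor_add_one (n*x)
    have b1 := Nat.floor_le hy
    have b2 := Nat.lt_floor_add_one (n*y)
    have hxy' := abs_le.mp hxy
    rw [abs_le]
    constructor <;> nlinarith [mul_le_mul_of_nonneg_left hxy'.1 hn, mul_le_mul_of_nonneg_left hxy'.2 hn]
  have hequi : ∀ ε > 0, ∃ δ > 0, (∀ p ∈ T1, ∀ q ∈ T1, |p.1 - q.1| ≤ δ → |p.2 - q.2| ≤ δ →
      |V p - V q| ≤ ε) ∧ ∀ᶠ k in (F : Filter ℕ), ∀ p ∈ T1, ∀ q ∈ T1, |p.1 - q.1| ≤ δ → |p.2 - q.2| ≤ δ →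
      |u k ⌊((4*k:ℕ):ℝ) * p.1⌋₊ ⌊((4*k:ℕ):ℝ) * p.2⌋₊ - u k ⌊((4*k:ℕ):ℝ) * q.1⌋₊ ⌊((4*k:ℕ):ℝ) * q.2⌋₊| ≤ ε := by
    intro ε hε
    obtain ⟨δ, hδ, H⟩ := d_equicont ha hb hΛ hε
    have hE : ∀ᶠ k in (F : Filter ℕ), ∀ p ∈ T1, ∀ q ∈ T1, |p.1 - q.1| ≤ δ/2 → |p.2 - q.2| ≤ δ/2 →
      |u k ⌊((4*k:ℕ):ℝ) * p.1⌋₊ ⌊((4*k:ℕ):ℝ) * p.2⌋₊ - u k ⌊((4*k:ℕ):ℝ) * q.1⌋₊ ⌊((4*k:ℕ):ℝ) * q.2⌋₊| ≤ ε := by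
      filter_upwards [hev, hbig (δ/2) (by positivity) 1] with k hk hk2 p hp q hq h1 h2
      refine H (4*k) (l k) (u k) (heig k hk) (hlb k hk) (by linarith) _ _ _ _ (floor_T1 hp _) (floor_T1 hq _) ?_ ?_
      · refine (hfloor _ _ _ _ ?_ ?_ h1 (by positivity)).trans (by linarith)
        · have := hp.1; positivity
        · have := hq.1; positivity
      · refine (hfloor _ _ _ _ ?_ ?_ h2 (by positivity)).trans (by linarith)
        · have := hp.2.1; positivity
        · have := hq.2.1; positivity
    refine ⟨δ/2, by positivity, ?_, hE⟩
    intro p hp q hq h1 h2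
    refine le_of_tendsto ((hV p hp).sub (hV q hq)).abs ?_
    filter_upwards [hE] with k hk
    exact hk p hp q hq h1 h2
  refine ⟨F, u, l, lam, V, ⟨inferInstance, hF, hev.mono heig, hlamlim, ?_, ?_, ?_, ?_, ?_, ?_⟩⟩
  · -- positivity of the eigenvalue
    have hcont : Continuous (fun x : ℝ => 2 * dKc α β x) := by
      unfold dKc; fun_prop
    have h1 : 1 ≤ 2 * dKc α β lam := by
      refine ge_of_tendsto ((hcont.tendsto lam).comp hlamlim) ?_
      filter_upwards [hev] with k hk
      have := d_lower k hk rfl (heig k hk) (hosc k hk)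
      push_cast at this
      exact this
    rcases hlam.1.eq_or_lt with h | h
    · rw [← h] at h1; simp [dKc] at h1; norm_num at h1
    · exact h
  · intro ε hε
    obtain ⟨δ, hδ, H1, H2⟩ := hequi (ε/3) (by positivity)
    -- restrict net to points of T1
    obtain ⟨t, htT, htf, hcov⟩ : ∃ t ⊆ T1, t.Finite ∧ T1 ⊆ ⋃ y ∈ t, Metric.ball y δ :=
      Metric.finite_approx_of_totallyBounded T1_totallyBounded δ hδ
    have hnet : ∀ᶠ k in (F : Filter ℕ), ∀ p ∈ t,
        |u k ⌊((4*k:ℕ):ℝ) * p.1⌋₊ ⌊((4*k:ℕ):ℝ) * p.2⌋₊ - V p| ≤ ε/3 := by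
      rw [eventually_all_finite htf]
      intro p hp
      have := (hV p (htT hp)).eventually (Metric.closedBall_mem_nhds _ (by positivity : 0 < ε/3))
      filter_upwards [this] with k hk
      simpa [Real.dist_eq] using hk
    filter_upwards [hev, H2, hnet] with k hk hk2 hk3 i j hij
    have hkr : (0:ℝ) < 4*k := by
      have : (1:ℝ) ≤ k := by exact_mod_cast hk
      linarith
    have hqT : ((i:ℝ)/(4*k), (j:ℝ)/(4*k)) ∈ T1 := by
      refine ⟨by positivity, by positivity, ?_⟩
      simp only
      rw [← add_div, div_le_one hkr]
      exact_mod_cast hij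
    obtain ⟨c, hpt, hpq⟩ : ∃ c ∈ t, dist ((i:ℝ)/(4*k), (j:ℝ)/(4*k)) c < δ := by
      have := hcov hqT
      simp only [mem_iUnion, Metric.mem_ball] at this
      obtain ⟨c, h1, h2⟩ := this
      exact ⟨c, h1, h2⟩
    rw [Prod.dist_eq, max_lt_iff, Real.dist_eq, Real.dist_eq] at hpq
    have e1 := hk2 _ hqT c (htT hpt) hpq.1.le hpq.2.le
    have e2 := hk3 c hpt
    have e3 := H1 _ hqT c (htT hpt) hpq.1.le hpq.2.le
    have f1 : ⌊((4*k:ℕ):ℝ) * ((i:ℝ)/(4*k))⌋₊ = i := by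
      push_cast; rw [mul_div_cancel₀ _ hkr.ne']; simp
    have f2 : ⌊((4*k:ℕ):ℝ) * ((j:ℝ)/(4*k))⌋₊ = j := by
      push_cast; rw [mul_div_cancel₀ _ hkr.ne']; simp
    simp only [f1, f2] at e1
    rw [abs_le] at *
    constructor <;> linarith [e1.1, e1.2, e2.1, e2.2, e3.1, e3.2]
  · rw [Metric.continuousOn_iff]
    intro p hp ε hε
    obtain ⟨δ, hδ, H1, H2⟩ := hequi (ε/2) (by positivity)
    refine ⟨δ, hδ, fun q hq hd => ?_⟩
    rw [Prod.dist_eq, max_lt_iff, Real.dist_eq, Real.dist_eq] at hd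
    rw [Real.dist_eq]
    linarith [H1 q hq p hp hd.1.le hd.2.le]
  · intro x x' y h1 h2 hx
    refine le_of_tendsto_of_tendsto (hV _ h1) (hV _ h2) ?_
    filter_upwards [hev] with k hk
    refine dCone_right (heig k hk).cone (Nat.floor_mono (mul_le_mul_of_nonneg_left hx (by positivity))) ?_
    exact floor_T1 h2 _
  · intro x y y' h1 h2 hx
    refine le_of_tendsto_of_tendsto (hV _ h2) (hV _ h1) ?_
    filter_upwards [hev] with k hk
    refine dCone_down (heig k hk).cone (Nat.floor_mono (mul_le_mul_of_nonneg_left hx (by positivity))) ?_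
    exact floor_T1 h2 _
  · refine ge_of_tendsto ((hV (1,0) (by simp [T1])).sub (hV (0,1) (by simp [T1]))) ?_
    filter_upwards [hev] with k hk
    have := hosc k hk
    simp only [mul_one, mul_zero, Nat.floor_natCast, Nat.floor_zero]
    exact this

end

section
open Set Filter Topology MeasureTheory

lemma taylor3 {g g1 g2 : ℝ → ℝ} {M : ℝ} (h1 : ∀ t, HasDerivAt g (g1 t) t) (h2 : ∀ t, HasDerivAt g1 (g2 t) t)
    (hM : ∀ t s, |g2 t - g2 s| ≤ M * |t - s|) (x h : ℝ) :
    |g (x+h) - g x - h * g1 x - h^2/2 * g2 x| ≤ M * |h|^3 := by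
  have hM0 : 0 ≤ M := by
    have := hM 1 0
    have h0 := abs_nonneg (g2 1 - g2 0)
    norm_num at this; linarith
  have hseg : ∀ t ∈ uIcc 0 h, |t| ≤ |h| := by
    intro t ht
    have := abs_sub_left_of_mem_uIcc ht
    simpa using this
  have hconv : Convex ℝ (uIcc 0 h) := convex_uIcc 0 h
  have d1 : ∀ t, HasDerivAt (fun t => g1 (x+t) - g1 x - t * g2 x) (g2 (x+t) - g2 x) t := by
    intro t
    have := ((h2 (x+t)).comp_const_add x t).sub_const (g1 x) |>.sub ((hasDerivAt_id t).mul_const (g2 x))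
    exact this.congr_deriv (by ring)
  have d0 : ∀ t, HasDerivAt (fun t => g (x+t) - g x - t * g1 x - t^2/2 * g2 x) (g1 (x+t) - g1 x - t * g2 x) t := by
    intro t
    have := (((h1 (x+t)).comp_const_add x t).sub_const (g x) |>.sub ((hasDerivAt_id t).mul_const (g1 x))).sub
      ((((hasDerivAt_pow 2 t).div_const 2)).mul_const (g2 x))
    exact this.congr_deriv (by simp)
  have b1 : ∀ t ∈ uIcc 0 h, |g1 (x+t) - g1 x - t * g2 x| ≤ M * |h| * |h| := by
    intro t ht
    have := hconv.norm_image_sub_le_of_norm_hasDerivWithin_le (fun s hs => (d1 s).hasDerivWithinAt (s := uIcc 0 h))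
      (C := M * |h|) (fun s hs => by
        rw [Real.norm_eq_abs]
        refine (hM _ _).trans ?_
        have := hseg s hs
        simp only [add_sub_cancel_left]
        gcongr) left_mem_uIcc ht
    simp only [Real.norm_eq_abs, add_zero, sub_self, zero_mul, sub_zero] at this
    refine this.trans ?_
    have := hseg t ht
    gcongr
  have := hconv.norm_image_sub_le_of_norm_hasDerivWithin_le (fun s hs => (d0 s).hasDerivWithinAt (s := uIcc 0 h))
      (C := M * |h| * |h|) (fun s hs => by
        rw [Real.norm_eq_abs]; exact b1 s hs) left_mem_uIcc right_mem_uIcc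
  simp only [Real.norm_eq_abs, add_zero, sub_self, zero_mul, sub_zero] at this
  norm_num at this
  refine this.trans (le_of_eq (by ring))

/-- test function data in unit coordinates -/
structure dTest (α β : ℝ) (P Px Py Pxx Pyy : ℝ → ℝ → ℝ) (M r : ℝ) : Prop where
  hr : 0 < r
  dx : ∀ x y, HasDerivAt (fun t => P t y) (Px x y) x
  dxx : ∀ x y, HasDerivAt (fun t => Px t y) (Pxx x y) x
  dy : ∀ x y, HasDerivAt (fun t => P x t) (Py x y) y
  dyy : ∀ x y, HasDerivAt (fun t => Py x t) (Pyy x y) y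
  lx : ∀ y t s, |Pxx t y - Pxx s y| ≤ M * |t - s|
  ly : ∀ x t s, |Pyy x t - Pyy x s| ≤ M * |t - s|
  nx : ∀ y, 0 ≤ y → y < 1 → Px 0 y = 0
  ny : ∀ x, 0 ≤ x → x < 1 → Py x 0 = 0
  nh : ∀ x y, 0 < x → 0 < y → x + y = 1 → α * Px x y + β * Py x y = 0
  zA : ∀ x y, |x - 1| < r → |y| < r → P x y = 0 ∧ Pxx x y = 0 ∧ Pyy x y = 0
  zB : ∀ x y, |x| < r → |y-1| < r → P x y = 0 ∧ Pxx x y = 0 ∧ Pyy x y = 0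

lemma dTest.consist {α β M r : ℝ} {P Px Py Pxx Pyy : ℝ → ℝ → ℝ} (h : dTest α β P Px Py Pxx Pyy M r)
    (ha : 0 < α) (hb : 0 < β) (n : ℕ) (hn : 0 < n) (hnr : 1 / (n:ℝ) < r) (i j : ℕ) (hij : i + j ≤ n) :
    |(n:ℝ)^2 * dL α β n (fun i j => P (i/n) (j/n)) i j - (α * Pxx (i/n) (j/n) + β * Pyy (i/n) (j/n))|
      ≤ 2 * M * (α + β) / n := by
  have hn' : (0:ℝ) < n := by exact_mod_cast hn
  have hM0 : 0 ≤ M := by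
    have := h.lx 0 1 0
    have h0 := abs_nonneg (Pxx 1 0 - Pxx 0 0)
    norm_num at this; linarith
  have ex := fun y x s => taylor3 (fun t => h.dx t y) (fun t => h.dxx t y) (h.lx y) x s
  have ey := fun x y s => taylor3 (fun t => h.dy x t) (fun t => h.dyy x t) (h.ly x) y s
  set x : ℝ := i/n with hx
  set y : ℝ := j/n with hy
  set s : ℝ := 1/n with hs
  have hs0 : 0 < s := by positivity
  have hns : (n:ℝ) * s = 1 := by rw [hs]; field_simp
  have e1 : ((i+1:ℕ):ℝ)/n = x + s := by push_cast; rw [add_div]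
  have e2 : ((j+1:ℕ):ℝ)/n = y + s := by push_cast; rw [add_div]
  have e3 : 0 < i → ((i-1:ℕ):ℝ)/n = x + -s := by
    intro hi; rw [Nat.cast_sub hi]; push_cast; rw [sub_div]; ring
  have e4 : 0 < j → ((j-1:ℕ):ℝ)/n = y + -s := by
    intro hi; rw [Nat.cast_sub hi]; push_cast; rw [sub_div]; ring
  have hs3 : |s|^3 = s^3 := by rw [abs_of_pos hs0]
  have hs3' : |-s|^3 = s^3 := by rw [abs_neg, abs_of_pos hs0]
  have fin : ∀ Z A B, |Z - α * (s^2 * A) - β * (s^2 * B)| ≤ 2 * M * (α + β) * s^3 → 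
      |(n:ℝ)^2 * Z - (α * A + β * B)| ≤ 2 * M * (α+β) / n := by
    intro Z A B hZ
    have : (n:ℝ)^2 * Z - (α * A + β * B) = n^2 * (Z - α * (s^2 * A) - β * (s^2 * B)) := by
      have : (n:ℝ)^2 * s^2 = 1 := by rw [← mul_pow, hns, one_pow]
      linear_combination (α * A + β * B) * this
    rw [this, abs_mul, abs_of_pos (by positivity : (0:ℝ) < n^2)]
    calc (n:ℝ)^2 * |_| ≤ n^2 * (2 * M * (α + β) * s^3) := by gcongr
      _ = 2 * M * (α + β) * s * (n * s)^2 := by ring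
      _ = _ := by rw [hns, hs]; ring
  have hij' : x + y ≤ 1 := by
    rw [hx, hy, ← add_div, div_le_one hn']; exact_mod_cast hij
  rcases hij.lt_or_eq with hlt | heq
  · have hlt' : x + y < 1 := by
      rw [hx, hy, ← add_div, div_lt_one hn']; exact_mod_cast hlt
    have hx0 : 0 ≤ x := by positivity
    have hy0 : 0 ≤ y := by positivity
    rw [dL_lt _ _ _ _ _ _ hlt]
    simp only [e1, e2]
    apply fin
    -- x-part
    have X : |(P (x+s) y - P x y - if i = 0 then -(P (x+s) y - P x y) else P x y - P ((i-1:ℕ)/n) y) - s^2 * Pxx x y|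
       ≤ 2 * M * s^3 := by
      have a1 := ex y x s
      have a2 := ex y x (-s)
      rw [hs3] at a1; rw [hs3'] at a2
      rw [abs_le] at a1 a2 ⊢
      split_ifs with hi
      · have : x = 0 := by rw [hx, hi]; simp
        have hz : Px x y = 0 := by rw [this]; exact h.nx y hy0 (by linarith)
        rw [hz] at a1
        constructor <;> linarith [a1.1, a1.2]
      · rw [e3 (by omega)]
        constructor <;> nlinarith [a1.1, a1.2, a2.1, a2.2]
    have Y : |(P x (y+s) - P x y - if j = 0 then -(P x (y+s) - P x y) else P x y - P x ((j-1:ℕ)/n)) - s^2 * Pyy x y|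
       ≤ 2 * M * s^3 := by
      have a1 := ey x y s
      have a2 := ey x y (-s)
      rw [hs3] at a1; rw [hs3'] at a2
      rw [abs_le] at a1 a2 ⊢
      split_ifs with hi
      · have : y = 0 := by rw [hy, hi]; simp
        have hz : Py x y = 0 := by rw [this]; exact h.ny x hx0 (by linarith)
        rw [hz] at a1
        constructor <;> linarith [a1.1, a1.2]
      · rw [e4 (by omega)]
        constructor <;> nlinarith [a1.1, a1.2, a2.1, a2.2]
    have := abs_add_le (α * ((P (x+s) y - P x y - if i = 0 then -(P (x+s) y - P x y) else P x y - P ((i-1:ℕ)/n) y) - s^2 * Pxx x y))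
      (β * ((P x (y+s) - P x y - if j = 0 then -(P x (y+s) - P x y) else P x y - P x ((j-1:ℕ)/n)) - s^2 * Pyy x y))
    rw [abs_mul, abs_mul, abs_of_pos ha, abs_of_pos hb] at this
    have t2 := mul_le_mul_of_nonneg_left X ha.le
    have t3 := mul_le_mul_of_nonneg_left Y hb.le
    calc _ = _ := by congr 1; ring
      _ ≤ _ := this
      _ ≤ 2 * M * (α + β) * s ^ 3 := by linarith
  · have heq' : x + y = 1 := by
      rw [hx, hy, ← add_div, div_eq_one_iff_eq hn'.ne']; exact_mod_cast heq
    rw [dL_eq _ _ _ hn _ _ _ heq]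
    have hsr : |-s| < r := by rw [abs_neg, abs_of_pos hs0]; exact hnr
    rcases Nat.eq_zero_or_pos i with hi | hi
    · have hx0 : x = 0 := by rw [hx, hi]; simp
      have hy0 : y = 1 := by linarith
      have hj : 0 < j := by omega
      rw [if_pos hi, if_neg hj.ne']
      simp only [e4 hj]
      rw [hx0, hy0]
      have z1 := h.zB 0 (1 + -s) (by simpa using h.hr) (by simpa using hsr)
      have z2 := h.zB 0 1 (by simpa using h.hr) (by simpa using h.hr)
      have : P x y = 0 := by rw [hx0, hy0]; exact z2.1
      have q : P (x) (1 + -s) = 0 := by rw [hx0]; exact z1.1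
      have p1 : P (↑i/↑n) (1 + -s) = 0 := q
      have p2 : P (↑i/↑n) (↑j/↑n) = 0 := by change P x y = 0; assumption
      refine (le_of_eq ?_).trans (by positivity : (0:ℝ) ≤ 2*M*(α+β)/n)
      simp only [p1, p2, z2.2.1, z2.2.2]
      simp
    rcases Nat.eq_zero_or_pos j with hj | hj
    · have hy0 : y = 0 := by rw [hy, hj]; simp
      have hx0 : x = 1 := by linarith
      rw [if_pos hj, if_neg hi.ne']
      simp only [e3 hi]
      rw [hx0, hy0]
      have z1 := h.zA (1 + -s) 0 (by simpa using hsr) (by simpa using h.hr)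
      have z2 := h.zA 1 0 (by simpa using h.hr) (by simpa using h.hr)
      have : P x y = 0 := by rw [hx0, hy0]; exact z2.1
      have q : P (1 + -s) y = 0 := by rw [hy0]; exact z1.1
      have p1 : P (1 + -s) (↑j/↑n) = 0 := q
      have p2 : P (↑i/↑n) (↑j/↑n) = 0 := by change P x y = 0; assumption
      refine (le_of_eq ?_).trans (by positivity : (0:ℝ) ≤ 2*M*(α+β)/n)
      simp only [p1, p2, z2.2.1, z2.2.2]
      simp
    rw [if_neg hi.ne', if_neg hj.ne']
    simp only [e3 hi, e4 hj]
    apply fin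
    have a1 := ex y x (-s)
    have a2 := ey x y (-s)
    rw [hs3'] at a1 a2
    have hz := h.nh x y (by positivity) (by positivity) heq'
    have := abs_add_le (2 * α * (P (x + -s) y - P x y - -s * Px x y - (-s) ^ 2 / 2 * Pxx x y))
      (2 * β * (P x (y + -s) - P x y - -s * Py x y - (-s) ^ 2 / 2 * Pyy x y))
    rw [abs_mul (2*α), abs_mul (2*β), abs_of_pos (by positivity : 0 < 2 * α), abs_of_pos (by positivity : 0 < 2 * β)] at this
    have t2 := mul_le_mul_of_nonneg_left a1 (by positivity : 0 ≤ 2 * α)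
    have t3 := mul_le_mul_of_nonneg_left a2 (by positivity : 0 ≤ 2 * β)
    calc _ = _ := by congr 1; linear_combination (-2 * s) * hz
      _ ≤ _ := this
      _ ≤ 2 * M * (α + β) * s ^ 3 := by linarith

end

section
open Set Filter Topology MeasureTheory
open scoped Pointwise

def T1v : Set (Fin 2 → ℝ) := {x | 0 ≤ x 0 ∧ 0 ≤ x 1 ∧ x 0 + x 1 ≤ 1}

lemma T1v_closed : IsClosed T1v := by
  refine (isClosed_le continuous_const (continuous_apply 0)).inter
    ((isClosed_le continuous_const (continuous_apply 1)).inter (isClosed_le ((continuous_apply 0).add (continuous_apply 1)) continuous_const))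

lemma T1v_bdd : Bornology.IsBounded T1v := by
  refine (Metric.isBounded_Icc (0 : Fin 2 → ℝ) 1).subset ?_
  rintro x ⟨h1, h2, h3⟩
  constructor <;> intro i <;> fin_cases i <;> simp <;> linarith

lemma T1v_convex : Convex ℝ T1v := by
  rintro x ⟨h1, h2, h3⟩ y ⟨k1, k2, k3⟩ s t hs ht hst
  refine ⟨?_, ?_, ?_⟩ <;> simp
  · positivity
  · positivity
  · nlinarith

lemma T1v_sum (G : (Fin 2 → ℝ) → ℝ) (n : ℕ) (hn : 0 < n) :
    (∑' x : ↑(T1v ∩ (n:ℝ)⁻¹ • (Submodule.span ℤ (Set.range (Pi.basisFun ℝ (Fin 2))) : Set (Fin 2 → ℝ))), G x)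
     = ∑ i ∈ Finset.range (n+1), ∑ j ∈ Finset.range (n+1), if i + j ≤ n then G ![(i:ℝ)/n, (j:ℝ)/n] else 0 := by
  have hn' : (0:ℝ) < n := by exact_mod_cast hn
  have : NeZero n := ⟨hn.ne'⟩
  set S : Finset (ℕ × ℕ) := (Finset.range (n+1) ×ˢ Finset.range (n+1)).filter (fun p => p.1 + p.2 ≤ n) with hS
  let f : ℕ × ℕ → (Fin 2 → ℝ) := fun p => ![(p.1:ℝ)/n, (p.2:ℝ)/n]
  have hf : Function.Injective f := by
    rintro ⟨i, j⟩ ⟨i', j'⟩ h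
    have h0 := congrFun h 0
    have h1 := congrFun h 1
    simp [f] at h0 h1
    field_simp at h0 h1
    simp at h0 h1
    rw [h0, h1]
  have hset : T1v ∩ (n:ℝ)⁻¹ • (Submodule.span ℤ (Set.range (Pi.basisFun ℝ (Fin 2))) : Set (Fin 2 → ℝ)) = (↑(S.image f) : Set (Fin 2 → ℝ)) := by
    ext x
    have key := BoxIntegral.unitPartition.mem_smul_span_iff (n := n) (v := x)
    have : x ∈ (n:ℝ)⁻¹ • (Submodule.span ℤ (Set.range (Pi.basisFun ℝ (Fin 2))) : Set (Fin 2 → ℝ)) ↔ ∀ i, n * x i ∈ Set.range (algebraMap ℤ ℝ) := key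
    rw [mem_inter_iff, this, Finset.coe_image, mem_image]
    constructor
    · rintro ⟨⟨h1, h2, h3⟩, h4⟩
      obtain ⟨p, hp⟩ := h4 0
      obtain ⟨q, hq⟩ := h4 1
      simp at hp hq
      have hp0 : 0 ≤ p := by
        have : (0:ℝ) ≤ p := by rw [hp]; positivity
        exact_mod_cast this
      have hq0 : 0 ≤ q := by
        have : (0:ℝ) ≤ q := by rw [hq]; positivity
        exact_mod_cast this
      lift p to ℕ using hp0
      lift q to ℕ using hq0
      simp at hp hq
      have hpq : p + q ≤ n := by
        have : (p:ℝ) + q ≤ n := by rw [hp, hq]; nlinarith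
        exact_mod_cast this
      refine ⟨(p, q), ?_, ?_⟩
      · simp [hS]; omega
      · funext i; fin_cases i <;> simp [f, hp, hq] <;> field_simp
    · rintro ⟨⟨p, q⟩, hp, rfl⟩
      simp [hS] at hp
      refine ⟨⟨by simp [f]; positivity, by simp [f]; positivity, ?_⟩, ?_⟩
      · simp [f]; rw [← add_div, div_le_one hn']; exact_mod_cast hp.2
      · intro i; fin_cases i
        · exact ⟨p, by simp [f]; field_simp⟩
        · exact ⟨q, by simp [f]; field_simp⟩
  rw [hset, Finset.tsum_subtype' (S.image f) G, Finset.sum_image (fun a _ b _ h => hf h), hS, Finset.sum_filter,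
    Finset.sum_product]

lemma dM_bound (n : ℕ) (G : ℕ → ℕ → ℝ) (C : ℝ) (hC : ∀ i j, i + j ≤ n → |G i j| ≤ C) :
    |(∑ i ∈ Finset.range (n+1), ∑ j ∈ Finset.range (n+1), dM n i j * G i j) -
      ∑ i ∈ Finset.range (n+1), ∑ j ∈ Finset.range (n+1), if i + j ≤ n then G i j else 0| ≤ C * (3 * (n+1)) := by
  have hC0 : 0 ≤ C := (abs_nonneg _).trans (hC 0 0 (by omega))
  have key : ∀ i j, |dM n i j * G i j - if i + j ≤ n then G i j else 0| ≤
      C * ((if i = 0 then 1 else 0) + (if j = 0 then 1 else 0) + (if i + j = n then 1 else 0)) := by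
    intro i j
    by_cases h : i + j ≤ n
    · rw [if_pos h]
      have h1 := hC i j h
      have : dM n i j * G i j - G i j = (dM n i j - 1) * G i j := by ring
      rw [this, abs_mul, mul_comm]
      have h2 : |dM n i j - 1| ≤ (if i = 0 then 1 else 0) + (if j = 0 then 1 else 0) + (if i + j = n then 1 else 0) := by
        unfold dM; rw [if_pos h]; split_ifs <;> norm_num [abs_le]
      exact mul_le_mul h1 h2 (abs_nonneg _) hC0
    · rw [if_neg h, dM_zero (by omega)]; simp; positivity
  rw [← Finset.sum_sub_distrib]
  simp only [← Finset.sum_sub_distrib]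
  refine (Finset.abs_sum_le_sum_abs _ _).trans ?_
  refine (Finset.sum_le_sum fun i _ => (Finset.abs_sum_le_sum_abs _ _).trans (Finset.sum_le_sum fun j _ => key i j)).trans ?_
  simp only [← Finset.mul_sum]
  refine mul_le_mul_of_nonneg_left ?_ hC0
  simp only [Finset.sum_add_distrib]
  have a1 : ∑ i ∈ Finset.range (n+1), ∑ j ∈ Finset.range (n+1), (if i = 0 then (1:ℝ) else 0) = n+1 := by
    rw [Finset.sum_comm]; simp
  have a2 : ∑ i ∈ Finset.range (n+1), ∑ j ∈ Finset.range (n+1), (if j = 0 then (1:ℝ) else 0) = n+1 := by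
    simp
  have a3 : ∑ i ∈ Finset.range (n+1), ∑ j ∈ Finset.range (n+1), (if i + j = n then (1:ℝ) else 0) ≤ n+1 := by
    calc _ ≤ ∑ i ∈ Finset.range (n+1), (1:ℝ) := by
          refine Finset.sum_le_sum fun i hi => ?_
          rw [Finset.mem_range] at hi
          have : ∀ j, (if i + j = n then (1:ℝ) else 0) = if j = n - i then 1 else 0 := by
            intro j; congr 1; apply propext; omega
          simp only [this, Finset.sum_ite_eq', Finset.mem_range]
          split_ifs <;> norm_num
      _ = _ := by simp
  linarith

lemma riemann (G : (Fin 2 → ℝ) → ℝ) (hG : Continuous G) :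
    Tendsto (fun n : ℕ => (∑ i ∈ Finset.range (n+1), ∑ j ∈ Finset.range (n+1), dM n i j * G ![(i:ℝ)/n, (j:ℝ)/n]) / (n:ℝ)^2)
      atTop (𝓝 (∫ x in T1v, G x)) := by
  have h1 := tendsto_tsum_div_pow_atTop_integral T1v G hG T1v_bdd T1v_closed.measurableSet (T1v_convex.addHaar_frontier _)
  obtain ⟨C, hC⟩ := (Metric.isCompact_of_isClosed_isBounded T1v_closed T1v_bdd).exists_bound_of_continuousOn hG.continuousOn
  have h2 : Tendsto (fun n : ℕ => (∑ i ∈ Finset.range (n+1), ∑ j ∈ Finset.range (n+1), dM n i j * G ![(i:ℝ)/n, (j:ℝ)/n]) / (n:ℝ)^2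
    - (∑' x : ↑(T1v ∩ (n:ℝ)⁻¹ • (Submodule.span ℤ (Set.range (Pi.basisFun ℝ (Fin 2))) : Set (Fin 2 → ℝ))), G x) / (n:ℝ)^(Fintype.card (Fin 2))) atTop (𝓝 0) := by
    have hz : Tendsto (fun n : ℕ => (6 * C) * ((1:ℝ) / n)) atTop (𝓝 0) := by
      simpa using (tendsto_const_div_atTop_nhds_zero_nat (1:ℝ)).const_mul (6*C)
    refine squeeze_zero_norm' ?_ hz
    filter_upwards [eventually_ge_atTop 1] with n hn
    have hn' : (1:ℝ) ≤ n := by exact_mod_cast hn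
    rw [T1v_sum G n hn, Fintype.card_fin, ← sub_div, Real.norm_eq_abs, abs_div, abs_of_pos (by positivity : (0:ℝ) < n^2),
      div_le_iff₀ (by positivity)]
    have hb := dM_bound n (fun i j => G ![(i:ℝ)/n, (j:ℝ)/n]) C (fun i j hij => hC _ ?_)
    · refine hb.trans ?_
      have hC0 : 0 ≤ C := (norm_nonneg _).trans (hC 0 (by simp [T1v]))
      have : 6 * C * (1 / (n:ℝ)) * n^2 = C * (6 * n) := by field_simp
      rw [this]
      exact mul_le_mul_of_nonneg_left (by linarith) hC0
    · refine ⟨by simp; positivity, by simp; positivity, ?_⟩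
      simp; rw [← add_div, div_le_one (by positivity)]; exact_mod_cast hij
  have := h2.add h1
  simpa using this

/-- retraction onto the unit triangle -/
def retT (x : Fin 2 → ℝ) : ℝ × ℝ :=
  (max 0 (x 0) / max 1 (max 0 (x 0) + max 0 (x 1)), max 0 (x 1) / max 1 (max 0 (x 0) + max 0 (x 1)))

lemma retT_mem (x : Fin 2 → ℝ) : retT x ∈ T1 := by
  have h1 : (0:ℝ) < max 1 (max 0 (x 0) + max 0 (x 1)) := lt_max_of_lt_left one_pos
  have a : 0 ≤ max 0 (x 0) := le_max_left _ _
  have b : 0 ≤ max 0 (x 1) := le_max_left _ _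
  refine ⟨by simp [retT]; positivity, by simp [retT]; positivity, ?_⟩
  simp only [retT]
  rw [← add_div, div_le_one h1]
  exact le_max_right _ _

lemma retT_cont : Continuous retT := by
  unfold retT
  have h1 : ∀ x : Fin 2 → ℝ, max 1 (max 0 (x 0) + max 0 (x 1)) ≠ 0 := fun x => (lt_max_of_lt_left one_pos).ne'
  refine Continuous.prodMk ?_ ?_
  · exact Continuous.div (by fun_prop) (by fun_prop) h1
  · exact Continuous.div (by fun_prop) (by fun_prop) h1

lemma retT_eq {x : Fin 2 → ℝ} (hx : x ∈ T1v) : retT x = (x 0, x 1) := by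
  obtain ⟨h1, h2, h3⟩ := hx
  simp [retT, max_eq_right h1, max_eq_right h2, max_eq_left h3]

theorem dLim.weak {α β : ℝ} {F : Filter ℕ} {u : ℕ → ℕ → ℕ → ℝ} {l : ℕ → ℝ} {lam : ℝ} {V : ℝ × ℝ → ℝ}
    (h : dLim α β F u l lam V) (ha : 0 < α) (hb : 0 < β) {M r : ℝ} {P Px Py Pxx Pyy : ℝ → ℝ → ℝ}
    (t : dTest α β P Px Py Pxx Pyy M r) (hP : Continuous (fun x : Fin 2 → ℝ => P (x 0) (x 1)))
    (hPxx : Continuous (fun x : Fin 2 → ℝ => Pxx (x 0) (x 1))) (hPyy : Continuous (fun x : Fin 2 → ℝ => Pyy (x 0) (x 1))) :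
    ∫ x in T1v, V (x 0, x 1) * (α * Pxx (x 0) (x 1) + β * Pyy (x 0) (x 1) + lam * P (x 0) (x 1)) = 0 := by
  have := h.nb
  have hVc : Continuous (fun x => V (retT x)) := h.cont.comp_continuous retT_cont retT_mem
  set H : (Fin 2 → ℝ) → ℝ := fun x => α * Pxx (x 0) (x 1) + β * Pyy (x 0) (x 1) + lam * P (x 0) (x 1) with hH
  have hHc : Continuous H := ((hPxx.const_mul α).add (hPyy.const_mul β)).add (hP.const_mul lam)
  set G : (Fin 2 → ℝ) → ℝ := fun x => V (retT x) * H x with hG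
  have hGc : Continuous G := hVc.mul hHc
  have hIntg : ∫ x in T1v, V (x 0, x 1) * H x = ∫ x in T1v, G x := by
    refine setIntegral_congr_fun T1v_closed.measurableSet fun x hx => ?_
    simp [hG, retT_eq hx]
  change ∫ x in T1v, V (x 0, x 1) * H x = 0
  rw [hIntg]
  have hcomp := Metric.isCompact_of_isClosed_isBounded T1v_closed T1v_bdd
  obtain ⟨CH, hCH⟩ := hcomp.exists_bound_of_continuousOn hHc.continuousOn
  obtain ⟨CP, hCP⟩ := hcomp.exists_bound_of_continuousOn hP.continuousOn
  have hk4 : Tendsto (fun k : ℕ => 4 * k) F atTop :=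
    (tendsto_atTop_mono (fun k => by omega : ∀ k : ℕ, k ≤ 4 * k) tendsto_id).mono_left h.top
  have hR := (riemann G hGc).comp hk4
  refine tendsto_nhds_unique hR ?_
  have hM0 : 0 ≤ M := by
    have := t.lx 0 1 0
    have h0 := abs_nonneg (Pxx 1 0 - Pxx 0 0)
    norm_num at this; linarith
  rw [Metric.tendsto_nhds]
  intro ε hε
  -- error bound
  have hCH0 : 0 ≤ CH := (norm_nonneg _).trans (hCH 0 (by simp [T1v]))
  have hCP0 : 0 ≤ CP := (norm_nonneg _).trans (hCP 0 (by simp [T1v]))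
  set δ := ε / (8 * (CH + CP + 2)) with hδ
  have hδ0 : 0 < δ := by positivity
  have e1 := h.unif δ hδ0
  have e2 : ∀ᶠ k in F, |l k * (4*k:ℝ)^2 - lam| ≤ δ := by
    have := h.lim.eventually (Metric.closedBall_mem_nhds _ hδ0)
    filter_upwards [this] with k hk
    simpa [Real.dist_eq] using hk
  have e3 : ∀ᶠ k in F, 1 ≤ k := h.top (eventually_ge_atTop 1)
  have e4 : ∀ᶠ k in F, 1 / ((4*k:ℕ):ℝ) < r ∧ 2 * M * (α + β) / ((4*k:ℕ):ℝ) ≤ δ := by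
    have t1 := (tendsto_const_div_atTop_nhds_zero_nat (1:ℝ)).comp hk4
    have t2 := (tendsto_const_div_atTop_nhds_zero_nat (2 * M * (α + β))).comp hk4
    filter_upwards [t1.eventually (gt_mem_nhds t.hr), t2.eventually (ge_mem_nhds hδ0)] with k h1 h2
    exact ⟨h1, h2⟩
  filter_upwards [e1, e2, e3, e4, h.eig] with k k1 k2 k3 k4 k5
  set n := 4 * k with hn
  have hn0 : 0 < n := by omega
  have hnr : (0:ℝ) < n := by exact_mod_cast hn0
  have hn1 : (1:ℝ) ≤ n := by exact_mod_cast hn0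
  have hnk : (4 * k : ℝ) = n := by rw [hn]; push_cast; ring
  simp only [hnk] at k1 k2
  have hin : ∀ i j : ℕ, i + j ≤ n → ![(i:ℝ)/n, (j:ℝ)/n] ∈ T1v := by
    intro i j hij
    refine ⟨by simp; positivity, by simp; positivity, ?_⟩
    simp; rw [← add_div, div_le_one (by positivity)]; exact_mod_cast hij
  -- discrete identity
  set Pd : ℕ → ℕ → ℝ := fun i j => P (i/n) (j/n) with hPd
  have hid : ∑ i ∈ Finset.range (n+1), ∑ j ∈ Finset.range (n+1), dM n i j * (u k i j * ((n:ℝ)^2 * dL α β n Pd i j + l k * n^2 * Pd i j)) = 0 := by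
    have w1 := k5.wf Pd
    rw [dE_symm, dWF_L] at w1
    have : ∑ i ∈ Finset.range (n+1), ∑ j ∈ Finset.range (n+1), dM n i j * (u k i j * ((n:ℝ)^2 * dL α β n Pd i j + l k * n^2 * Pd i j))
       = (n:ℝ)^2 * (dS n (dL α β n Pd) (u k) + l k * dS n (u k) Pd) := by
      unfold dS
      simp only [Finset.mul_sum, ← Finset.sum_add_distrib]
      refine Finset.sum_congr rfl fun i _ => Finset.sum_congr rfl fun j _ => by ring
    rw [this, ← w1]; ring
  rw [dist_zero_right, Real.norm_eq_abs]
  change |(∑ i ∈ Finset.range (n+1), ∑ j ∈ Finset.range (n+1), dM n i j * G ![(i:ℝ)/n, (j:ℝ)/n]) / (n:ℝ)^2| < ε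
  rw [abs_div, abs_of_pos (by positivity : (0:ℝ) < (n:ℝ)^2), div_lt_iff₀ (by positivity)]
  rw [← sub_zero (∑ i ∈ Finset.range (n+1), _), ← hid, ← Finset.sum_sub_distrib]
  simp only [← Finset.sum_sub_distrib, ← mul_sub]
  have key : ∀ i j, |dM n i j * (G ![(i:ℝ)/n, (j:ℝ)/n] - u k i j * ((n:ℝ)^2 * dL α β n Pd i j + l k * n^2 * Pd i j))| ≤ δ * (CH + CP + 1) := by
    intro i j
    rcases le_or_gt (i+j) n with hij | hij
    · rw [abs_mul, abs_of_nonneg (dM_nonneg n i j)]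
      have hm := dM_le n i j
      have hT := hin i j hij
      have c1 := k1 i j hij
      have c2 := t.consist ha hb n hn0 k4.1 i j hij
      have c3 := hCH _ hT
      have c4 := hCP _ hT
      have c5 := k5.bd i j hij
      simp only [hG, retT_eq hT]
      have hHv : H ![(i:ℝ)/n, (j:ℝ)/n] = α * Pxx (i/n) (j/n) + β * Pyy (i/n) (j/n) + lam * Pd i j := rfl
      have hPv : |Pd i j| ≤ CP := c4
      set v := V (![(i:ℝ)/n, (j:ℝ)/n] 0, ![(i:ℝ)/n, (j:ℝ)/n] 1) with hv
      have c1' : |u k i j - v| ≤ δ := c1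
      set Hv := H ![(i:ℝ)/n, (j:ℝ)/n] with hHv'
      have c3' : |Hv| ≤ CH := c3
      have : v * Hv - u k i j * ((n:ℝ)^2 * dL α β n Pd i j + l k * n^2 * Pd i j) =
        -(u k i j - v) * Hv - u k i j * (((n:ℝ)^2 * dL α β n Pd i j - (α * Pxx (i/n) (j/n) + β * Pyy (i/n) (j/n))) + (l k * n^2 - lam) * Pd i j) := by
        rw [hHv]; ring
      have hA : |-(u k i j - v) * Hv| ≤ δ * CH := by
        rw [abs_mul, abs_neg]; exact mul_le_mul c1' c3' (abs_nonneg _) hδ0.le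
      have hB : |((n:ℝ)^2 * dL α β n Pd i j - (α * Pxx (i/n) (j/n) + β * Pyy (i/n) (j/n))) + (l k * n^2 - lam) * Pd i j| ≤ δ + δ * CP := by
        refine (abs_add_le _ _).trans (add_le_add (c2.trans k4.2) ?_)
        rw [abs_mul]; exact mul_le_mul k2 hPv (abs_nonneg _) hδ0.le
      have hBB : |u k i j * (((n:ℝ)^2 * dL α β n Pd i j - (α * Pxx (i/n) (j/n) + β * Pyy (i/n) (j/n))) + (l k * n^2 - lam) * Pd i j)| ≤ 1 * (δ + δ * CP) := by
        rw [abs_mul]; exact mul_le_mul c5 hB (abs_nonneg _) zero_le_one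
      rw [this]
      refine (mul_le_of_le_one_left (abs_nonneg _) hm).trans ?_
      refine (abs_sub _ _).trans ?_
      nlinarith
    · rw [dM_zero hij]; simp; positivity
  refine lt_of_le_of_lt (Finset.abs_sum_le_sum_abs _ _) ?_
  refine lt_of_le_of_lt (Finset.sum_le_sum fun i _ => (Finset.abs_sum_le_sum_abs _ _).trans (Finset.sum_le_sum fun j _ => key i j)) ?_
  simp only [Finset.sum_const, Finset.card_range, nsmul_eq_mul]
  push_cast
  have hb1 : δ * (CH + CP + 1) ≤ ε / 8 := by
    rw [hδ, div_mul_eq_mul_div, div_le_div_iff₀ (by positivity) (by norm_num)]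
    nlinarith
  calc ((n:ℝ)+1) * (((n:ℝ)+1) * (δ * (CH + CP + 1))) ≤ (2*n) * ((2*n) * (ε/8)) := by
        gcongr <;> linarith
    _ < ε * n^2 := by nlinarith [mul_pos hε (sq_pos_of_pos hnr)]

end

section
open Set Filter Topology MeasureTheory
open scoped ContDiff

def e0 : E2 := EuclideanSpace.single 0 1
def e1 : E2 := EuclideanSpace.single 1 1

@[simp] lemma e0_0 : e0 0 = 1 := by simp [e0]
@[simp] lemma e0_1 : e0 1 = 0 := by simp [e0]
@[simp] lemma e1_0 : e1 0 = 0 := by simp [e1]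
@[simp] lemma e1_1 : e1 1 = 1 := by simp [e1]

lemma E2_ext {z w : E2} (h0 : z 0 = w 0) (h1 : z 1 = w 1) : z = w := by
  ext i; fin_cases i
  · exact h0
  · exact h1

/-- the Laplacian -/
def lap (u : E2 → ℝ) (p : E2) : ℝ := mixedDeriv u p e0 e0 + mixedDeriv u p e1 e1

lemma negLap_eq (u : E2 → ℝ) (p : E2) : negLap u p = - lap u p := rfl

/-- standard triangle -/
def Tst (a b : ℝ) : Set E2 := {z | 0 ≤ z 0 ∧ 0 ≤ z 1 ∧ z 0 / a + z 1 / b ≤ 1}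

def Sab (a b x y : ℝ) : E2 := (a * x) • e0 + (b * y) • e1

@[simp] lemma Sab_0 (a b x y : ℝ) : Sab a b x y 0 = a * x := by simp [Sab]
@[simp] lemma Sab_1 (a b x y : ℝ) : Sab a b x y 1 = b * y := by simp [Sab]

lemma Sab_dx (a b x y : ℝ) : HasDerivAt (fun t => Sab a b t y) (a • e0) x := by
  have := (((hasDerivAt_id x).const_mul a).smul_const e0).add_const ((b*y) • e1)
  simpa [Sab] using this

lemma Sab_dy (a b x y : ℝ) : HasDerivAt (fun t => Sab a b x t) (b • e1) y := by
  have := (((hasDerivAt_id y).const_mul b).smul_const e1).const_add ((a*x) • e0)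
  simpa [Sab] using this

def Sequiv (a b : ℝ) (ha : a ≠ 0) (hb : b ≠ 0) : (Fin 2 → ℝ) ≃L[ℝ] E2 :=
  LinearEquiv.toContinuousLinearEquiv
  { toFun := fun x => Sab a b (x 0) (x 1)
    invFun := fun z => ![z 0 / a, z 1 / b]
    map_add' := fun x y => by apply E2_ext <;> simp <;> ring
    map_smul' := fun c x => by apply E2_ext <;> simp <;> ring
    left_inv := fun x => by ext i; fin_cases i <;> simp <;> field_simp
    right_inv := fun z => by apply E2_ext <;> simp <;> field_simp }

lemma Sequiv_apply (a b : ℝ) (ha : a ≠ 0) (hb : b ≠ 0) (x : Fin 2 → ℝ) : Sequiv a b ha hb x = Sab a b (x 0) (x 1) := rfl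

lemma int_transfer {a b : ℝ} (ha : 0 < a) (hb : 0 < b) (G : E2 → ℝ)
    (h : ∫ x in T1v, G (Sab a b (x 0) (x 1)) = 0) : ∫ z in Tst a b, G z = 0 := by
  set S := Sequiv a b ha.ne' hb.ne' with hS
  have hmap : ∃ c : NNReal, c ≠ 0 ∧ (volume : Measure E2) = c • (volume : Measure (Fin 2 → ℝ)).map S := by
    have : ((volume : Measure (Fin 2 → ℝ)).map S).IsAddHaarMeasure := S.isAddHaarMeasure_map _
    exact ⟨_, Measure.addHaarScalarFactor_pos_of_isAddHaarMeasure _ _ |>.ne', Measure.isAddLeftInvariant_eq_smul _ _⟩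
  obtain ⟨c, hc, hvol⟩ := hmap
  have hpre : S ⁻¹' (Tst a b) = T1v := by
    ext x
    simp only [hS, mem_preimage, Sequiv_apply, Tst, T1v, mem_ofPred_eq, Sab_0, Sab_1]
    rw [mul_div_cancel_left₀ _ ha.ne', mul_div_cancel_left₀ _ hb.ne', mul_nonneg_iff_of_pos_left ha, mul_nonneg_iff_of_pos_left hb]
  rw [hvol, Measure.restrict_smul, integral_smul_nnreal_measure]
  have e := S.toHomeomorph.toMeasurableEquiv.measurableEmbedding.setIntegral_map (μ := volume) G (Tst a b)
  have e2 : ∫ z in Tst a b, G z ∂((volume : Measure (Fin 2 → ℝ)).map S) = ∫ x in S ⁻¹' (Tst a b), G (S x) := e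
  rw [e2, hpre]
  have : ∫ x in T1v, G (S x) = 0 := h
  rw [this, smul_zero]

lemma lipD {φ : E2 → ℝ} (hφ : ContDiff ℝ ∞ φ) (hc : HasCompactSupport φ) (v w : E2) :
    ∃ K : NNReal, LipschitzWith K (fun z => mixedDeriv φ z v w) ∧ Continuous (fun z => mixedDeriv φ z v w) := by
  have h1 : ContDiff ℝ ∞ (fun z => fderiv ℝ φ z v) := (hφ.fderiv_right (m := ∞) (by simp)).clm_apply contDiff_const
  have h2 : ContDiff ℝ ∞ (fun z => mixedDeriv φ z v w) := (h1.fderiv_right (m := ∞) (by simp)).clm_apply contDiff_const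
  have c1 : HasCompactSupport (fun z => fderiv ℝ φ z v) := hc.fderiv_apply ℝ v
  have c2 : HasCompactSupport (fun z => mixedDeriv φ z v w) := c1.fderiv_apply ℝ w
  obtain ⟨K, hK⟩ := ContDiff.lipschitzWith_of_hasCompactSupport c2 h2 (by simp)
  exact ⟨K, hK, h2.continuous⟩

theorem dLim.weakE {a b : ℝ} (ha : 0 < a) (hb : 0 < b) {F : Filter ℕ} {u : ℕ → ℕ → ℕ → ℝ} {l : ℕ → ℝ} {lam : ℝ} {V : ℝ × ℝ → ℝ}
    (h : dLim (1/a^2) (1/b^2) F u l lam V) {φ : E2 → ℝ} (hφ : ContDiff ℝ ∞ φ) (hc : HasCompactSupport φ)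
    (nx : ∀ z : E2, z 0 = 0 → 0 ≤ z 1 → z 1 < b → fderiv ℝ φ z e0 = 0)
    (ny : ∀ z : E2, z 1 = 0 → 0 ≤ z 0 → z 0 < a → fderiv ℝ φ z e1 = 0)
    (nh : ∀ z : E2, 0 < z 0 → 0 < z 1 → z 0 / a + z 1 / b = 1 → fderiv ℝ φ z e0 / a + fderiv ℝ φ z e1 / b = 0)
    (zA : ∀ᶠ z in 𝓝 (a • e0), φ z = 0) (zB : ∀ᶠ z in 𝓝 (b • e1), φ z = 0) :
    ∫ z in Tst a b, V (z 0 / a, z 1 / b) * (lap φ z + lam * φ z) = 0 := by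
  apply int_transfer ha hb
  obtain ⟨K0, hK0, hc0⟩ := lipD hφ hc e0 e0
  obtain ⟨K1, hK1, hc1⟩ := lipD hφ hc e1 e1
  have hSc : Continuous (fun x : Fin 2 → ℝ => Sab a b (x 0) (x 1)) := by unfold Sab; fun_prop
  have h1 : ∀ v, ContDiff ℝ ∞ (fun z => fderiv ℝ φ z v) := fun v => (hφ.fderiv_right (m := ∞) (by simp)).clm_apply contDiff_const
  have hd : ∀ z, HasFDerivAt φ (fderiv ℝ φ z) z := fun z => (hφ.differentiable (by simp) z).hasFDerivAt
  have hd1 : ∀ v z, HasFDerivAt (fun z => fderiv ℝ φ z v) (fderiv ℝ (fun z => fderiv ℝ φ z v) z) z :=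
    fun v z => ((h1 v).differentiable (by simp) z).hasFDerivAt
  have zero : ∀ p : ℝ × ℝ, (∀ᶠ z in 𝓝 (Sab a b p.1 p.2), φ z = 0) → ∃ r > (0:ℝ), ∀ x y, |x - p.1| < r → |y - p.2| < r →
      φ (Sab a b x y) = 0 ∧ a^2 * mixedDeriv φ (Sab a b x y) e0 e0 = 0 ∧ b^2 * mixedDeriv φ (Sab a b x y) e1 e1 = 0 := by
    intro p hp
    have hz : ∀ᶠ z in 𝓝 (Sab a b p.1 p.2), φ z = 0 ∧ mixedDeriv φ z e0 e0 = 0 ∧ mixedDeriv φ z e1 e1 = 0 := by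
      have h2 := hp.eventually_nhds
      have h3 := h2.eventually_nhds
      filter_upwards [h3] with z hz
      have hz0 : φ =ᶠ[𝓝 z] 0 := hz.self_of_nhds
      have hdz : ∀ v, (fun z => fderiv ℝ φ z v) =ᶠ[𝓝 z] 0 := by
        intro v
        filter_upwards [hz] with w hw
        have hw' : φ =ᶠ[𝓝 w] 0 := hw
        rw [hw'.fderiv_eq]; simp
      refine ⟨hz0.self_of_nhds, ?_, ?_⟩
      · unfold mixedDeriv; rw [(hdz e0).fderiv_eq]; simp
      · unfold mixedDeriv; rw [(hdz e1).fderiv_eq]; simp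
    have hcont : Continuous (fun q : ℝ × ℝ => Sab a b q.1 q.2) := by unfold Sab; fun_prop
    have := (hcont.tendsto p).eventually hz
    obtain ⟨r, hr, hball⟩ := Metric.eventually_nhds_iff.mp this
    refine ⟨r, hr, fun x y hx hy => ?_⟩
    have := @hball (x, y) (by rw [Prod.dist_eq, max_lt_iff, Real.dist_eq, Real.dist_eq]; exact ⟨hx, hy⟩)
    refine ⟨this.1, ?_, ?_⟩
    · rw [this.2.1, mul_zero]
    · rw [this.2.2, mul_zero]
  obtain ⟨rA, hrA, zA'⟩ := zero (1, 0) (by simpa [Sab] using zA)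
  obtain ⟨rB, hrB, zB'⟩ := zero (0, 1) (by simpa [Sab] using zB)
  have hdistx : ∀ y t s, dist (Sab a b t y) (Sab a b s y) = a * |t - s| := by
    intro y t s
    rw [dist_eq_norm]
    have : Sab a b t y - Sab a b s y = (a * (t - s)) • e0 := by unfold Sab; module
    rw [this, norm_smul, e0, PiLp.norm_single, Real.norm_eq_abs, abs_mul, abs_of_pos ha]; simp
  have hdisty : ∀ y t s, dist (Sab a b y t) (Sab a b y s) = b * |t - s| := by
    intro y t s
    rw [dist_eq_norm]
    have : Sab a b y t - Sab a b y s = (b * (t - s)) • e1 := by unfold Sab; module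
    rw [this, norm_smul, e1, PiLp.norm_single, Real.norm_eq_abs, abs_mul, abs_of_pos hb]; simp
  have test : dTest (1/a^2) (1/b^2) (fun x y => φ (Sab a b x y)) (fun x y => a * fderiv ℝ φ (Sab a b x y) e0)
      (fun x y => b * fderiv ℝ φ (Sab a b x y) e1) (fun x y => a^2 * mixedDeriv φ (Sab a b x y) e0 e0)
      (fun x y => b^2 * mixedDeriv φ (Sab a b x y) e1 e1) (a^3 * K0 + b^3 * K1) (min rA rB) := by
    refine ⟨lt_min hrA hrB, ?_, ?_, ?_, ?_, ?_, ?_, ?_, ?_, ?_, ?_, ?_⟩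
    · intro x y
      have := (hd _).comp_hasDerivAt x (Sab_dx a b x y)
      exact this.congr_deriv (by simp)
    · intro x y
      have := ((hd1 e0 _).comp_hasDerivAt x (Sab_dx a b x y)).const_mul a
      refine this.congr_deriv ?_
      simp [mixedDeriv]; ring
    · intro x y
      have := (hd _).comp_hasDerivAt y (Sab_dy a b x y)
      exact this.congr_deriv (by simp)
    · intro x y
      have := ((hd1 e1 _).comp_hasDerivAt y (Sab_dy a b x y)).const_mul b
      refine this.congr_deriv ?_
      simp [mixedDeriv]; ring
    · intro y t s
      have := hK0.dist_le_mul (Sab a b t y) (Sab a b s y)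
      rw [hdistx, Real.dist_eq] at this
      rw [← mul_sub, abs_mul, abs_of_pos (by positivity : 0 < a^2)]
      have h2 := mul_le_mul_of_nonneg_left this (by positivity : 0 ≤ a^2)
      refine h2.trans ?_
      have : 0 ≤ b^3 * K1 * |t - s| := by positivity
      nlinarith
    · intro y t s
      have := hK1.dist_le_mul (Sab a b y t) (Sab a b y s)
      rw [hdisty, Real.dist_eq] at this
      rw [← mul_sub, abs_mul, abs_of_pos (by positivity : 0 < b^2)]
      have h2 := mul_le_mul_of_nonneg_left this (by positivity : 0 ≤ b^2)
      refine h2.trans ?_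
      have : 0 ≤ a^3 * K0 * |t - s| := by positivity
      nlinarith
    · intro y h0 h1
      rw [nx _ (by simp) (by simp; positivity) (by simp; nlinarith), mul_zero]
    · intro y h0 h1
      rw [ny _ (by simp) (by simp; positivity) (by simp; nlinarith), mul_zero]
    · intro x y h0 h1 h2
      have := nh (Sab a b x y) (by simp; positivity) (by simp; positivity) (by simp; rw [mul_div_cancel_left₀ _ ha.ne', mul_div_cancel_left₀ _ hb.ne', h2])
      rw [← this]; field_simp
    · intro x y hx hy
      exact zA' x y (hx.trans_le (min_le_left _ _)) (by simpa using hy.trans_le (min_le_left _ _))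
    · intro x y hx hy
      exact zB' x y (by simpa using hx.trans_le (min_le_right _ _)) (hy.trans_le (min_le_right _ _))
  have := h.weak (by positivity) (by positivity) test (hφ.continuous.comp hSc) ((hc0.comp hSc).const_mul _) ((hc1.comp hSc).const_mul _)
  rw [← this]
  congr 1; funext x
  simp only [Sab_0, Sab_1, mul_div_cancel_left₀ _ ha.ne', mul_div_cancel_left₀ _ hb.ne', lap]
  field_simp

end

section
open Set Filter Topology MeasureTheory InnerProductSpace
open scoped ContDiff

lemma C2.diff {u : E2 → ℝ} {p : E2} (h : ContDiffAt ℝ 2 u p) : ∀ᶠ z in 𝓝 p, DifferentiableAt ℝ u z := by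
  have := h.eventually (by simp)
  filter_upwards [this] with z hz
  exact hz.differentiableAt (by simp)

lemma C2.diff2 {u : E2 → ℝ} {p : E2} (h : ContDiffAt ℝ 2 u p) : DifferentiableAt ℝ (fderiv ℝ u) p :=
  (h.fderiv_right (m := 1) (by norm_num)).differentiableAt (by simp)

lemma mixedDeriv_eq {u : E2 → ℝ} {p : E2} (h : ContDiffAt ℝ 2 u p) (v w : E2) :
    mixedDeriv u p v w = fderiv ℝ (fderiv ℝ u) p w v := by
  unfold mixedDeriv
  have := (C2.diff2 h).hasFDerivAt.clm_apply (hasFDerivAt_const v p)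
  rw [this.fderiv]; simp

lemma mixedDeriv_symm {u : E2 → ℝ} {p : E2} (h : ContDiffAt ℝ 2 u p) (v w : E2) :
    mixedDeriv u p v w = mixedDeriv u p w v := by
  rw [mixedDeriv_eq h, mixedDeriv_eq h]
  exact (h.isSymmSndFDerivAt (by simp)) w v

lemma lap_eq {u : E2 → ℝ} {p : E2} (h : ContDiffAt ℝ 2 u p) : lap u p = Laplacian.laplacian u p := by
  rw [laplacian_eq_iteratedFDeriv_orthonormalBasis u (EuclideanSpace.basisFun (Fin 2) ℝ)]
  simp only [lap, mixedDeriv_eq h, Fin.sum_univ_two, iteratedFDeriv_two_apply]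
  simp [e0, e1]

lemma lap_basis {u : E2 → ℝ} {p : E2} (h : ContDiffAt ℝ 2 u p) (b : OrthonormalBasis (Fin 2) ℝ E2) :
    lap u p = mixedDeriv u p (b 0) (b 0) + mixedDeriv u p (b 1) (b 1) := by
  rw [lap_eq h, laplacian_eq_iteratedFDeriv_orthonormalBasis u b]
  simp only [mixedDeriv_eq h, Fin.sum_univ_two, iteratedFDeriv_two_apply]
  simp

lemma mixedDeriv_congr {u w : E2 → ℝ} {p : E2} (h : u =ᶠ[𝓝 p] w) (v v' : E2) : mixedDeriv u p v v' = mixedDeriv w p v v' := by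
  unfold mixedDeriv
  have : (fun y => fderiv ℝ u y v) =ᶠ[𝓝 p] (fun y => fderiv ℝ w y v) := by
    filter_upwards [h.eventuallyEq_nhds] with z hz
    rw [hz.fderiv_eq]
  rw [this.fderiv_eq]

lemma lap_congr {u w : E2 → ℝ} {p : E2} (h : u =ᶠ[𝓝 p] w) : lap u p = lap w p := by
  unfold lap; rw [mixedDeriv_congr h, mixedDeriv_congr h]

lemma lap_add {u w : E2 → ℝ} {p : E2} (h : ContDiffAt ℝ 2 u p) (h' : ContDiffAt ℝ 2 w p) :
    lap (fun z => u z + w z) p = lap u p + lap w p := by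
  rw [lap_eq h, lap_eq h', lap_eq (h.add h')]; exact h.laplacian_add h'

lemma lap_sub {u w : E2 → ℝ} {p : E2} (h : ContDiffAt ℝ 2 u p) (h' : ContDiffAt ℝ 2 w p) :
    lap (fun z => u z - w z) p = lap u p - lap w p := by
  rw [lap_eq h, lap_eq h', lap_eq (h.sub h')]; exact h.laplacian_sub h'

lemma lap_const_mul {u : E2 → ℝ} {p : E2} (c : ℝ) (h : ContDiffAt ℝ 2 u p) :
    lap (fun z => c * u z) p = c * lap u p := by
  rw [lap_eq h, lap_eq (contDiffAt_const.mul h)]; exact laplacian_smul c h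

lemma lap_const (c : ℝ) (p : E2) : lap (fun _ => c) p = 0 := by
  simp [lap, mixedDeriv]

lemma lap_sum {ι : Type*} (s : Finset ι) {u : ι → E2 → ℝ} {p : E2} (h : ∀ i ∈ s, ContDiffAt ℝ 2 (u i) p) :
    lap (fun z => ∑ i ∈ s, u i z) p = ∑ i ∈ s, lap (u i) p := by
  classical
  induction s using Finset.induction_on with
  | empty => simp [lap_const]
  | insert a s ha ih =>
    simp only [Finset.sum_insert ha]
    rw [lap_add (h a (by simp)) (ContDiffAt.sum fun i hi => h i (by simp [hi])), ih fun i hi => h i (by simp [hi])]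

lemma fderiv_comp_aff {u : E2 → ℝ} {z : E2} (c : E2) (L : E2 →L[ℝ] E2) (h : DifferentiableAt ℝ u (c + L z)) (v : E2) :
    fderiv ℝ (fun y => u (c + L y)) z v = fderiv ℝ u (c + L z) (L v) := by
  have h1 : HasFDerivAt (fun y => c + L y) L z := L.hasFDerivAt.const_add c
  have := h.hasFDerivAt.comp z h1
  have e : HasFDerivAt (fun y => u (c + L y)) ((fderiv ℝ u (c + L z)).comp L) z := this
  rw [e.fderiv]; rfl

lemma mixedDeriv_comp_aff {u : E2 → ℝ} {p : E2} (c : E2) (L : E2 →L[ℝ] E2) (h : ContDiffAt ℝ 2 u (c + L p)) (v w : E2) :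
    mixedDeriv (fun y => u (c + L y)) p v w = mixedDeriv u (c + L p) (L v) (L w) := by
  have hc : ContinuousAt (fun y => c + L y) p := by fun_prop
  have h1 : (fun y => fderiv ℝ (fun y => u (c + L y)) y v) =ᶠ[𝓝 p] (fun y => fderiv ℝ u (c + L y) (L v)) := by
    filter_upwards [hc.eventually (C2.diff h)] with z hz
    exact fderiv_comp_aff c L hz v
  unfold mixedDeriv
  rw [h1.fderiv_eq]
  have hd : DifferentiableAt ℝ (fun z => fderiv ℝ u z (L v)) (c + L p) :=
    ((C2.diff2 h).hasFDerivAt.clm_apply (hasFDerivAt_const (L v) _)).differentiableAt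
  exact fderiv_comp_aff (u := fun z => fderiv ℝ u z (L v)) c L hd w

lemma lap_comp_iso {u : E2 → ℝ} {p : E2} (c : E2) (A : E2 ≃ₗᵢ[ℝ] E2) (h : ContDiffAt ℝ 2 u (c + A p)) :
    lap (fun y => u (c + A y)) p = lap u (c + A p) := by
  have key := fun v => mixedDeriv_comp_aff c (A.toContinuousLinearEquiv : E2 →L[ℝ] E2) (p := p) h v v
  rw [lap_basis h ((EuclideanSpace.basisFun (Fin 2) ℝ).map A)]
  have k0 := key e0
  have k1 := key e1
  simp only [OrthonormalBasis.map_apply, EuclideanSpace.basisFun_apply]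
  exact congrArg₂ (· + ·) k0 k1

/-- Second derivative test -/
lemma second_deriv_test {g : ℝ → ℝ} (hg : IsLocalMin g 0) (hc : ContinuousAt g 0) : 0 ≤ deriv (deriv g) 0 := by
  by_contra hn
  push Not at hn
  have h1 := isLocalMax_of_deriv_deriv_neg hn hg.deriv_eq_zero hc
  have h2 : g =ᶠ[𝓝 0] fun _ => g 0 := by
    filter_upwards [hg, h1] with t a b
    exact le_antisymm b a
  have h3 : deriv g =ᶠ[𝓝 0] fun _ => 0 := by
    filter_upwards [h2.eventuallyEq_nhds] with t ht
    rw [ht.deriv_eq]; simp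
  rw [h3.deriv_eq] at hn
  simp at hn

lemma lineDeriv2 {u : E2 → ℝ} {p : E2} (h : ContDiffAt ℝ 2 u p) (v : E2) :
    deriv (fun t : ℝ => u (p + t • v)) 0 = fderiv ℝ u p v ∧
    deriv (deriv (fun t : ℝ => u (p + t • v))) 0 = mixedDeriv u p v v := by
  have hl : ∀ t : ℝ, HasDerivAt (fun t : ℝ => p + t • v) v t := fun t => by
    simpa using ((hasDerivAt_id t).smul_const v).const_add p
  have hc : ContinuousAt (fun t : ℝ => p + t • v) 0 := (hl 0).continuousAt
  have hp : p + (0:ℝ) • v = p := by simp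
  have hd := C2.diff h
  rw [← hp] at hd
  have h1 : deriv (fun t : ℝ => u (p + t • v)) =ᶠ[𝓝 0] fun t => fderiv ℝ u (p + t • v) v := by
    filter_upwards [hc.eventually hd] with t ht
    exact (ht.hasFDerivAt.comp_hasDerivAt t (hl t)).deriv
  refine ⟨by rw [h1.self_of_nhds]; simp, ?_⟩
  rw [h1.deriv_eq]
  have hd2 : HasFDerivAt (fun z => fderiv ℝ u z v) (fderiv ℝ (fun z => fderiv ℝ u z v) p) (p + (0:ℝ) • v) := by
    rw [hp]
    exact ((C2.diff2 h).hasFDerivAt.clm_apply (hasFDerivAt_const v _)).differentiableAt.hasFDerivAt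
  exact (hd2.comp_hasDerivAt 0 (hl 0)).deriv

lemma lap_min {u : E2 → ℝ} {p : E2} (h : ContDiffAt ℝ 2 u p) (hm : IsLocalMin u p) : 0 ≤ lap u p := by
  have key : ∀ v, 0 ≤ mixedDeriv u p v v := by
    intro v
    rw [← (lineDeriv2 h v).2]
    have hc : ContinuousAt (fun t : ℝ => p + t • v) 0 := by fun_prop
    apply second_deriv_test
    · have hm' : ∀ᶠ z in 𝓝 (p + (0:ℝ) • v), u p ≤ u z := by rw [zero_smul, add_zero]; exact hm
      have := hc.eventually hm'
      simpa [IsLocalMin, IsMinFilter] using this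
    · have : ContinuousAt u (p + (0:ℝ) • v) := by simpa using h.continuousAt
      exact ContinuousAt.comp (f := fun t : ℝ => p + t • v) this hc
  exact add_nonneg (key _) (key _)

/-- radial functions -/
lemma mixedDeriv_radial {f f1 : ℝ → ℝ} {f2 : ℝ} {q p : E2} (h1 : ∀ᶠ s in 𝓝 (‖p - q‖^2), HasDerivAt f (f1 s) s)
    (h2 : HasDerivAt f1 f2 (‖p - q‖^2)) (v w : E2) :
    fderiv ℝ (fun z => f (‖z - q‖^2)) p v = 2 * f1 (‖p - q‖^2) * inner ℝ (p - q) v ∧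
    mixedDeriv (fun z => f (‖z - q‖^2)) p v w =
      4 * f2 * inner ℝ (p - q) v * inner ℝ (p - q) w + 2 * f1 (‖p - q‖^2) * inner ℝ v w := by
  have hn : ∀ z : E2, HasFDerivAt (fun z => ‖z - q‖^2) (2 • (innerSL ℝ (z - q))) z := by
    intro z
    have := ((hasFDerivAt_id z).sub_const q).norm_sq
    simpa using this
  have hc : ContinuousAt (fun z : E2 => ‖z - q‖^2) p := (hn p).continuousAt
  have d1 : ∀ᶠ z in 𝓝 p, fderiv ℝ (fun z => f (‖z - q‖^2)) z v = 2 * f1 (‖z - q‖^2) * inner ℝ (z - q) v := by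
    filter_upwards [hc.eventually h1] with z hz
    have : HasFDerivAt (fun z => f (‖z - q‖^2)) _ z := hz.comp_hasFDerivAt z (hn z)
    rw [this.fderiv]
    simp [inner_sub_left]; ring
  refine ⟨d1.self_of_nhds, ?_⟩
  unfold mixedDeriv
  have e : (fun y => fderiv ℝ (fun z => f (‖z - q‖^2)) y v) =ᶠ[𝓝 p] fun z => 2 * f1 (‖z - q‖^2) * inner ℝ (z - q) v := d1
  rw [e.fderiv_eq]
  have a1 : HasFDerivAt (fun z => f1 (‖z - q‖^2)) _ p := h2.comp_hasFDerivAt p (hn p)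
  have a2 : HasFDerivAt (fun z : E2 => (inner ℝ (z - q) v : ℝ)) (innerSL ℝ v) p := by
    have : HasFDerivAt (fun z : E2 => innerSL ℝ v (z - q)) ((innerSL ℝ v).comp (ContinuousLinearMap.id ℝ E2)) p :=
      (innerSL ℝ v).hasFDerivAt.comp p ((hasFDerivAt_id p).sub_const q)
    simpa [real_inner_comm] using this
  have a3 := (a1.const_mul 2).mul a2
  have a4 : HasFDerivAt (fun z => 2 * f1 (‖z - q‖^2) * inner ℝ (z - q) v) _ p := a3
  rw [a4.fderiv]
  simp [inner_sub_left]
  ring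

lemma inner_E2 (z w : E2) : (inner ℝ z w : ℝ) = z 0 * w 0 + z 1 * w 1 := by
  simp [PiLp.inner_apply, Fin.sum_univ_two]; ring

lemma normsq_E2 (z : E2) : ‖z‖^2 = z 0 ^2 + z 1 ^ 2 := by
  rw [EuclideanSpace.norm_sq_eq]; simp [Fin.sum_univ_two]

lemma lap_radial {f f1 : ℝ → ℝ} {f2 : ℝ} {q p : E2} (h1 : ∀ᶠ s in 𝓝 (‖p - q‖^2), HasDerivAt f (f1 s) s)
    (h2 : HasDerivAt f1 f2 (‖p - q‖^2)) :
    lap (fun z => f (‖z - q‖^2)) p = 4 * f2 * ‖p - q‖^2 + 4 * f1 (‖p - q‖^2) := by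
  unfold lap
  rw [(mixedDeriv_radial h1 h2 e0 e0).2, (mixedDeriv_radial h1 h2 e1 e1).2]
  generalize f1 (‖p - q‖^2) = k
  rw [normsq_E2]
  simp only [inner_E2, e0_0, e0_1, e1_0, e1_1]
  ring

lemma lap_mul {u w : E2 → ℝ} {p : E2} (h : ContDiffAt ℝ 2 u p) (h' : ContDiffAt ℝ 2 w p) :
    lap (fun z => u z * w z) p = u p * lap w p + w p * lap u p +
      2 * (fderiv ℝ u p e0 * fderiv ℝ w p e0 + fderiv ℝ u p e1 * fderiv ℝ w p e1) := by
  have key : ∀ v, mixedDeriv (fun z => u z * w z) p v v = u p * mixedDeriv w p v v + w p * mixedDeriv u p v v +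
      2 * (fderiv ℝ u p v * fderiv ℝ w p v) := by
    intro v
    have e : (fun y => fderiv ℝ (fun z => u z * w z) y v) =ᶠ[𝓝 p] fun z => u z * fderiv ℝ w z v + w z * fderiv ℝ u z v := by
      filter_upwards [C2.diff h, C2.diff h'] with z hz hz'
      have : HasFDerivAt (fun z => u z * w z) _ z := hz.hasFDerivAt.mul hz'.hasFDerivAt
      rw [this.fderiv]; simp
    have hd : ∀ {f : E2 → ℝ}, ContDiffAt ℝ 2 f p → HasFDerivAt (fun z => fderiv ℝ f z v) (fderiv ℝ (fun z => fderiv ℝ f z v) p) p := by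
      intro f hf
      exact ((C2.diff2 hf).hasFDerivAt.clm_apply (hasFDerivAt_const v _)).differentiableAt.hasFDerivAt
    have hu := (C2.diff h).self_of_nhds.hasFDerivAt
    have hw := (C2.diff h').self_of_nhds.hasFDerivAt
    have : HasFDerivAt (fun z => u z * fderiv ℝ w z v + w z * fderiv ℝ u z v) _ p :=
      (hu.mul (hd h')).add (hw.mul (hd h))
    unfold mixedDeriv
    rw [e.fderiv_eq, this.fderiv]
    simp; ring
  unfold lap
  rw [key, key]; ring

lemma lap_linear (L : E2 →L[ℝ] ℝ) (p : E2) : lap (fun z => L z) p = 0 := by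
  simp [lap, mixedDeriv]

end

section
open Set Filter Topology MeasureTheory InnerProductSpace
open scoped ContDiff

lemma contDiff_radial (q : E2) : ContDiff ℝ ∞ (fun z : E2 => ‖z - q‖^2) :=
  (contDiff_id.sub contDiff_const).norm_sq ℝ

lemma lap_quad (k c : ℝ) (q p : E2) : lap (fun z => c - k * ‖z - q‖^2) p = - 4 * k := by
  have := lap_radial (f := fun s => c - k * s) (f1 := fun _ => - k) (f2 := 0) (q := q) (p := p)
    (Eventually.of_forall fun s => by
      have := ((hasDerivAt_id s).const_mul k).const_sub c
      simpa using this) (hasDerivAt_const _ _)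
  rw [this]; ring

lemma disc_max {w : E2 → ℝ} {x0 : E2} {R lam m : ℝ} (hl : 0 < lam) (hlR : lam * R^2 ≤ 1) (hR : 0 ≤ R)
    (hc : ContinuousOn w (Metric.closedBall x0 R)) (hd : ∀ z ∈ Metric.ball x0 R, ContDiffAt ℝ 2 w z)
    (he : ∀ z ∈ Metric.ball x0 R, lap w z = - lam * w z) (hm0 : 0 ≤ m)
    (hm : ∀ z, ‖z - x0‖ = R → w z ≤ m) : ∀ z ∈ Metric.closedBall x0 R, w z ≤ 2 * m := by
  set s : E2 → ℝ := fun z => 1 - lam/2 * ‖z - x0‖^2 with hs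
  have hs1 : ∀ z, s z ≤ 1 := fun z => by simp only [hs]; nlinarith [mul_nonneg hl.le (sq_nonneg ‖z-x0‖)]
  have hs2 : ∀ z ∈ Metric.closedBall x0 R, 1/2 ≤ s z := fun z hz => by
    rw [mem_closedBall_iff_norm] at hz
    have : ‖z - x0‖^2 ≤ R^2 := by gcongr
    have := mul_le_mul_of_nonneg_left this hl.le
    simp only [hs]; linarith
  have hsd : ContDiff ℝ ∞ s := contDiff_const.sub (contDiff_const.mul (contDiff_radial x0))
  obtain ⟨z1, hz1, hmax⟩ := (isCompact_closedBall x0 R).exists_isMaxOn (Metric.nonempty_closedBall.2 hR)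
    (f := fun z => w z / s z) (hc.div hsd.continuous.continuousOn (fun z hz => by linarith [hs2 z hz]))
  set M := w z1 / s z1 with hM
  have hs1p : 0 < s z1 := by linarith [hs2 z1 hz1]
  have hMw : w z1 = M * s z1 := by rw [hM]; field_simp
  have hall : ∀ z ∈ Metric.closedBall x0 R, w z ≤ M * s z := fun z hz => by
    have h1 : w z / s z ≤ M := hmax hz
    rwa [div_le_iff₀ (by linarith [hs2 z hz])] at h1
  have key : M ≤ 2 * m := by
    by_contra hn
    push Not at hn
    rw [mem_closedBall_iff_norm] at hz1
    rcases hz1.eq_or_lt with h | h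
    · have := hm z1 h
      have h2 := hs2 z1 (by rw [mem_closedBall_iff_norm]; exact hz1)
      nlinarith
    · have hzb : z1 ∈ Metric.ball x0 R := by rw [mem_ball_iff_norm]; exact h
      have hC : ContDiffAt ℝ 2 (fun z => M * s z) z1 := (contDiff_const.mul hsd).contDiffAt.of_le (by norm_cast)
      have h3 : 0 ≤ lap (fun z => M * s z - w z) z1 := by
        apply lap_min (hC.sub (hd z1 hzb))
        filter_upwards [Metric.isOpen_ball.mem_nhds hzb] with z hz
        have := hall z (Metric.ball_subset_closedBall hz)
        linarith
      rw [lap_sub hC (hd z1 hzb), lap_const_mul _ (hsd.contDiffAt.of_le (by norm_cast)), he z1 hzb, hs, lap_quad, hMw] at h3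
      have := hs1 z1
      have hMp : 0 < M := by linarith
      have : M * s z1 ≤ M := by nlinarith
      nlinarith [mul_pos hl hMp, mul_le_mul_of_nonneg_left this hl.le]
  intro z hz
  have h1 := hall z hz
  have h2 := hs1 z
  have h3 := hs2 z hz
  nlinarith [mul_le_mul_of_nonneg_right key (by linarith : 0 ≤ s z)]

lemma disc_max_abs {w : E2 → ℝ} {x0 : E2} {R lam m : ℝ} (hl : 0 < lam) (hlR : lam * R^2 ≤ 1) (hR : 0 ≤ R)
    (hc : ContinuousOn w (Metric.closedBall x0 R)) (hd : ∀ z ∈ Metric.ball x0 R, ContDiffAt ℝ 2 w z)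
    (he : ∀ z ∈ Metric.ball x0 R, lap w z = - lam * w z) (hm0 : 0 ≤ m)
    (hm : ∀ z, ‖z - x0‖ = R → |w z| ≤ m) : ∀ z ∈ Metric.closedBall x0 R, |w z| ≤ 2 * m := by
  intro z hz
  have h1 := disc_max hl hlR hR hc hd he hm0 (fun z hz => (le_abs_self _).trans (hm z hz)) z hz
  have h2 := disc_max (w := fun z => (-1) * w z) hl hlR hR (continuousOn_const.mul hc) (fun z hz => contDiffAt_const.mul (hd z hz))
    (fun z hz => by rw [lap_const_mul _ (hd z hz), he z hz]; ring) hm0 (fun z hz => by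
      have := (abs_le.1 (hm z hz)).1
      linarith) z hz
  rw [abs_le]; constructor <;> linarith

/-- rotations -/
def rot (θ : ℝ) : E2 ≃ₗᵢ[ℝ] E2 :=
  (Complex.orthonormalBasisOneI.repr.symm.trans (rotation (Circle.exp θ))).trans Complex.orthonormalBasisOneI.repr

lemma rot_apply (θ : ℝ) (y : E2) : rot θ y = Complex.orthonormalBasisOneI.repr
    (Complex.exp (θ * Complex.I) * Complex.orthonormalBasisOneI.repr.symm y) := by
  simp [rot, rotation_apply, Circle.coe_exp]

lemma rot_add (θ φ : ℝ) (y : E2) : rot (θ + φ) y = rot θ (rot φ y) := by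
  simp only [rot_apply, LinearIsometryEquiv.symm_apply_apply]
  push_cast
  rw [add_mul, Complex.exp_add, mul_assoc]

lemma rot_zero (y : E2) : rot 0 y = y := by
  rw [rot_apply, Complex.ofReal_zero, zero_mul, Complex.exp_zero, one_mul, LinearIsometryEquiv.apply_symm_apply]

lemma rot_two_pi (y : E2) : rot (2 * Real.pi) y = y := by
  rw [rot_apply]; push_cast
  rw [Complex.exp_two_pi_mul_I, one_mul, LinearIsometryEquiv.apply_symm_apply]

lemma rot_sub_le (δ : ℝ) (y : E2) : ‖rot δ y - y‖ ≤ |δ| * ‖y‖ := by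
  have h : rot δ y - y = Complex.orthonormalBasisOneI.repr
    ((Complex.exp (δ * Complex.I) - 1) * Complex.orthonormalBasisOneI.repr.symm y) := by
    rw [sub_mul, map_sub, ← rot_apply, one_mul, LinearIsometryEquiv.apply_symm_apply]
  rw [h, LinearIsometryEquiv.norm_map, norm_mul, LinearIsometryEquiv.norm_map]
  gcongr
  have := Real.norm_exp_I_mul_ofReal_sub_one_le (x := δ)
  rwa [mul_comm, Real.norm_eq_abs] at this

lemma exists_rot {y y' : E2} (h : ‖y‖ = ‖y'‖) : ∃ θ : ℝ, 0 ≤ θ ∧ θ < 2 * Real.pi ∧ y' = rot θ y := by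
  set z := Complex.orthonormalBasisOneI.repr.symm y with hz
  set z' := Complex.orthonormalBasisOneI.repr.symm y' with hz'
  have hn : ‖z‖ = ‖z'‖ := by rw [hz, hz', LinearIsometryEquiv.norm_map, LinearIsometryEquiv.norm_map, h]
  have hy' : y' = Complex.orthonormalBasisOneI.repr z' := by rw [hz', LinearIsometryEquiv.apply_symm_apply]
  have key : ∃ θ : ℝ, y' = rot θ y := by
    refine ⟨Complex.arg z' - Complex.arg z, ?_⟩
    rw [rot_apply, hy', ← hz]
    congr 1
    calc z' = ‖z'‖ * Complex.exp (Complex.arg z' * Complex.I) := (Complex.norm_mul_exp_arg_mul_I z').symm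
      _ = Complex.exp ((Complex.arg z' - Complex.arg z : ℝ) * Complex.I) * (‖z‖ * Complex.exp (Complex.arg z * Complex.I)) := by
        rw [mul_left_comm, ← Complex.exp_add, hn]
        congr 2; push_cast; ring
      _ = _ := by rw [Complex.norm_mul_exp_arg_mul_I z]
  obtain ⟨θ, hθ⟩ := key
  have hper : ∀ φ, rot (φ + 2 * Real.pi) y = rot φ y := fun φ => by rw [rot_add, rot_two_pi]
  have hp : Function.Periodic (fun φ => rot φ y) (2 * Real.pi) := hper
  obtain ⟨φ, hφ, e⟩ := hp.exists_mem_Ico₀ (by positivity) θ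
  exact ⟨φ, hφ.1, hφ.2, by rw [hθ]; exact e⟩

/-- discrete rotational average -/
def rav (N : ℕ) (w : E2 → ℝ) (y : E2) : ℝ := (1 / (N:ℝ)) * ∑ k ∈ Finset.range N, w (rot (2 * Real.pi * k / N) y)

lemma rav_rot (N : ℕ) (hN : 0 < N) (w : E2 → ℝ) (y : E2) : rav N w (rot (2 * Real.pi / N) y) = rav N w y := by
  unfold rav
  congr 1
  have h1 : ∀ k : ℕ, w (rot (2 * Real.pi * k / N) (rot (2 * Real.pi / N) y)) = w (rot (2 * Real.pi * (k+1 : ℕ) / N) y) := by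
    intro k
    rw [← rot_add]; congr 3; push_cast; ring
  simp only [h1]
  have h2 := Finset.sum_range_succ (fun k : ℕ => w (rot (2 * Real.pi * k / N) y)) N
  have h3 := Finset.sum_range_succ' (fun k : ℕ => w (rot (2 * Real.pi * k / N) y)) N
  have hN' : (N:ℝ) ≠ 0 := by positivity
  have h4 : 2 * Real.pi * (N:ℝ) / N = 2 * Real.pi := by field_simp
  simp only [h4, rot_two_pi] at h2
  simp only [Nat.cast_zero, mul_zero, zero_div, rot_zero] at h3
  linarith

lemma rav_rot_nat (N : ℕ) (hN : 0 < N) (w : E2 → ℝ) (y : E2) (j : ℕ) : rav N w (rot (2 * Real.pi / N * j) y) = rav N w y := by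
  induction j with
  | zero => simp [rot_zero]
  | succ j ih =>
    rw [← ih, ← rav_rot N hN w (rot (2 * Real.pi / N * j) y), ← rot_add]
    congr 3; push_cast; ring

lemma rav_diff {N : ℕ} (hN : 0 < N) {w : E2 → ℝ} {ρ K : ℝ} (hK : 0 ≤ K)
    (hw : ∀ y ∈ Metric.closedBall (0:E2) ρ, ∀ y' ∈ Metric.closedBall (0:E2) ρ, |w y - w y'| ≤ K * ‖y - y'‖)
    {y y' : E2} (hy : ‖y‖ ≤ ρ) (h : ‖y‖ = ‖y'‖) : |rav N w y' - rav N w y| ≤ K * (2 * Real.pi * ρ) / N := by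
  obtain ⟨θ, h0, h1, e⟩ := exists_rot h
  have hNp : (0:ℝ) < N := by positivity
  set d := 2 * Real.pi / N with hd
  have hdp : 0 < d := by positivity
  set j := ⌊θ / d⌋₊ with hj
  set δ := θ - d * j with hδ
  have hδ0 : 0 ≤ δ := by
    have := Nat.floor_le (div_nonneg h0 hdp.le)
    rw [← hj, le_div_iff₀ hdp] at this
    rw [hδ]; linarith
  have hδ1 : δ ≤ d := by
    have := Nat.lt_floor_add_one (θ / d)
    rw [← hj, div_lt_iff₀ hdp] at this
    rw [hδ]; linarith
  have e2 : rav N w y' = rav N w (rot δ y) := by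
    rw [e, ← rav_rot_nat N hN w (rot δ y) j, ← rot_add]
    congr 3; rw [hδ]; ring
  rw [e2]
  unfold rav
  rw [← mul_sub, ← Finset.sum_sub_distrib, abs_mul, abs_of_pos (by positivity)]
  have hb : |∑ k ∈ Finset.range N, (w (rot (2 * Real.pi * k / N) (rot δ y)) - w (rot (2 * Real.pi * k / N) y))| ≤
      ∑ k ∈ Finset.range N, K * (d * ρ) := by
    refine (Finset.abs_sum_le_sum_abs _ _).trans (Finset.sum_le_sum fun k _ => ?_)
    refine (hw _ (by simpa using hy) _ (by simpa using hy)).trans ?_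
    gcongr
    rw [← map_sub, LinearIsometryEquiv.norm_map]
    refine (rot_sub_le δ y).trans ?_
    rw [abs_of_nonneg hδ0]
    gcongr
  rw [Finset.sum_const, Finset.card_range, nsmul_eq_mul] at hb
  calc (1 / (N:ℝ)) * _ ≤ (1 / (N:ℝ)) * (N * (K * (d * ρ))) := by gcongr
    _ = K * (2 * Real.pi * ρ) / N := by rw [hd]; field_simp

end

section
open Set Filter Topology MeasureTheory InnerProductSpace
open scoped ContDiff

lemma rav_zero {N : ℕ} (hN : 0 < N) (w : E2 → ℝ) : rav N w 0 = w 0 := by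
  have : (N:ℝ) ≠ 0 := by positivity
  simp [rav, this]

lemma rav_abs {N : ℕ} (hN : 0 < N) {w : E2 → ℝ} {ρ M : ℝ}
    (hw : ∀ y, ‖y‖ ≤ ρ → |w y| ≤ M) {y : E2} (hy : ‖y‖ ≤ ρ) : |rav N w y| ≤ M := by
  have hNp : (0:ℝ) < N := by positivity
  unfold rav
  rw [abs_mul, abs_of_pos (by positivity)]
  have hb : |∑ k ∈ Finset.range N, w (rot (2 * Real.pi * k / N) y)| ≤ ∑ k ∈ Finset.range N, M :=
    (Finset.abs_sum_le_sum_abs _ _).trans (Finset.sum_le_sum fun k _ => hw _ (by simpa using hy))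
  rw [Finset.sum_const, Finset.card_range, nsmul_eq_mul] at hb
  calc (1 / (N:ℝ)) * _ ≤ (1 / (N:ℝ)) * (N * M) := by gcongr
    _ = M := by field_simp

lemma rav_C2 {N : ℕ} {w : E2 → ℝ} {R : ℝ} (hw : ∀ y ∈ Metric.ball (0:E2) R, ContDiffAt ℝ 2 w y) {y : E2}
    (hy : y ∈ Metric.ball (0:E2) R) : ContDiffAt ℝ 2 (rav N w) y := by
  unfold rav
  refine contDiffAt_const.mul (ContDiffAt.sum fun k _ => ?_)
  have h1 : rot (2 * Real.pi * k / N) y ∈ Metric.ball (0:E2) R := by simpa using hy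
  exact (hw _ h1).comp y (rot (2 * Real.pi * k / N)).contDiff.contDiffAt

lemma rav_lap {N : ℕ} {w : E2 → ℝ} {R lam : ℝ} (hw : ∀ y ∈ Metric.ball (0:E2) R, ContDiffAt ℝ 2 w y)
    (he : ∀ z ∈ Metric.ball (0:E2) R, lap w z = - lam * w z) {y : E2}
    (hy : y ∈ Metric.ball (0:E2) R) : lap (rav N w) y = - lam * rav N w y := by
  have h1 : ∀ k : ℕ, rot (2 * Real.pi * k / N) y ∈ Metric.ball (0:E2) R := fun k => by simpa using hy
  have h2 : ∀ k : ℕ, ContDiffAt ℝ 2 (fun y => w (rot (2 * Real.pi * k / N) y)) y := fun k =>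
    (hw _ (h1 k)).comp y (rot (2 * Real.pi * k / N)).contDiff.contDiffAt
  unfold rav
  rw [lap_const_mul _ (ContDiffAt.sum fun k _ => h2 k), lap_sum _ (fun k _ => h2 k)]
  have hs : ∑ k ∈ Finset.range N, lap (fun y => w (rot (2 * Real.pi * k / N) y)) y =
      ∑ k ∈ Finset.range N, - lam * w (rot (2 * Real.pi * k / N) y) := by
    refine Finset.sum_congr rfl fun k _ => ?_
    have := lap_comp_iso (u := w) (p := y) 0 (rot (2 * Real.pi * k / N)) (by simpa using hw _ (h1 k))
    simp only [zero_add] at this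
    rw [this, he _ (h1 k)]
  rw [hs, ← Finset.mul_sum]; ring

lemma cos_lap (k : ℝ) (y : E2) : lap (fun y : E2 => Real.cos (k * y 0)) y = - k^2 * Real.cos (k * y 0) := by
  have h0 : ∀ z : E2, HasFDerivAt (fun y : E2 => k * y 0) (k • (EuclideanSpace.proj 0 : E2 →L[ℝ] ℝ)) z := fun z =>
    ((EuclideanSpace.proj 0 : E2 →L[ℝ] ℝ).hasFDerivAt).const_mul k
  have h1 : ∀ v z : E2, fderiv ℝ (fun y : E2 => Real.cos (k * y 0)) z v = - k * v 0 * Real.sin (k * z 0) := by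
    intro v z
    rw [(h0 z).cos.fderiv]; simp; ring
  have h2 : ∀ v, mixedDeriv (fun y : E2 => Real.cos (k * y 0)) y v v = - k^2 * (v 0)^2 * Real.cos (k * y 0) := by
    intro v
    unfold mixedDeriv
    simp only [h1]
    rw [((h0 y).sin.const_mul _).fderiv]; simp; ring
  unfold lap
  rw [h2, h2]; simp

lemma cos_lip (k : ℝ) (hk : 0 ≤ k) (y y' : E2) : |Real.cos (k * y 0) - Real.cos (k * y' 0)| ≤ k * ‖y - y'‖ := by
  have h1 : |Real.cos (k * y 0) - Real.cos (k * y' 0)| ≤ |k * y 0 - k * y' 0| := by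
    have := Real.lipschitzWith_cos.dist_le_mul (k * y 0) (k * y' 0)
    simpa [Real.dist_eq] using this
  refine h1.trans ?_
  rw [← mul_sub, abs_mul, abs_of_nonneg hk]
  gcongr
  have := PiLp.norm_apply_le (y - y') 0
  simpa using this

/-- the quantitative comparison -/
lemma rav_compare {N : ℕ} (hN : 0 < N) {w : E2 → ℝ} {R lam ρ K M : ℝ} (hl : 0 < lam) (hlR : lam * R^2 ≤ 1)
    (hρ : 0 ≤ ρ) (hρR : ρ < R) (hw : ∀ y ∈ Metric.ball (0:E2) R, ContDiffAt ℝ 2 w y)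
    (he : ∀ z ∈ Metric.ball (0:E2) R, lap w z = - lam * w z) (hK : 0 ≤ K)
    (hwK : ∀ y ∈ Metric.closedBall (0:E2) ρ, ∀ y' ∈ Metric.closedBall (0:E2) ρ, |w y - w y'| ≤ K * ‖y - y'‖)
    (hM : ∀ y, ‖y‖ ≤ ρ → |w y| ≤ M) {y : E2} (hy : ‖y‖ ≤ ρ) :
    |w 0 * rav N (fun y => Real.cos (√lam * y 0)) y - rav N w y| ≤ 2 * ((K + M * √lam) * (2 * Real.pi * ρ)) / N := by
  set w0 : E2 → ℝ := fun y => Real.cos (√lam * y 0) with hw0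
  have hw0C : ∀ y ∈ Metric.ball (0:E2) R, ContDiffAt ℝ 2 w0 y := fun y _ => by
    have : ContDiff ℝ 2 w0 := by
      rw [hw0]
      exact Real.contDiff_cos.comp (contDiff_const.mul (EuclideanSpace.proj 0 : E2 →L[ℝ] ℝ).contDiff)
    exact this.contDiffAt
  have hw0e : ∀ z ∈ Metric.ball (0:E2) R, lap w0 z = - lam * w0 z := fun z _ => by
    rw [hw0, cos_lap, Real.sq_sqrt hl.le]
  have hM0 : 0 ≤ M := (abs_nonneg _).trans (hM 0 (by simpa using hρ))
  set α := rav N w0 y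
  set β := rav N w y
  have hα : |α| ≤ 1 := rav_abs hN (ρ := ρ) (fun y _ => Real.abs_cos_le_one _) hy
  have hβ : |β| ≤ M := rav_abs hN hM hy
  set Q : E2 → ℝ := fun z => α * rav N w z - β * rav N w0 z with hQ
  have hr : ‖y‖ < R := lt_of_le_of_lt hy hρR
  have hsub : Metric.closedBall (0:E2) ‖y‖ ⊆ Metric.ball 0 R := Metric.closedBall_subset_ball hr
  have c1 : ∀ z ∈ Metric.ball (0:E2) R, ContDiffAt ℝ 2 (rav N w) z := fun z hz => rav_C2 hw hz
  have c0 : ∀ z ∈ Metric.ball (0:E2) R, ContDiffAt ℝ 2 (rav N w0) z := fun z hz => rav_C2 hw0C hz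
  have cQ : ∀ z ∈ Metric.ball (0:E2) R, ContDiffAt ℝ 2 Q z := fun z hz =>
    (contDiffAt_const.mul (c1 z hz)).sub (contDiffAt_const.mul (c0 z hz))
  have eQ : ∀ z ∈ Metric.ball (0:E2) R, lap Q z = - lam * Q z := fun z hz => by
    rw [hQ, lap_sub (contDiffAt_const.mul (c1 z hz)) (contDiffAt_const.mul (c0 z hz)), lap_const_mul _ (c1 z hz),
      lap_const_mul _ (c0 z hz), rav_lap hw he hz, rav_lap hw0C hw0e hz]
    ring
  have hNp : (0:ℝ) < N := by positivity
  have hb : ∀ z, ‖z - 0‖ = ‖y‖ → |Q z| ≤ (K + M * √lam) * (2 * Real.pi * ρ) / N := by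
    intro z hz
    rw [sub_zero] at hz
    have d1 := rav_diff hN hK hwK hy hz.symm
    have d0 := rav_diff hN (w := w0) (Real.sqrt_nonneg lam) (fun a _ b _ => cos_lip _ (Real.sqrt_nonneg lam) a b) hy hz.symm
    have e : Q z = α * (rav N w z - β) - β * (rav N w0 z - α) := by rw [hQ]; ring
    rw [e]
    calc |α * (rav N w z - β) - β * (rav N w0 z - α)| ≤ |α * (rav N w z - β)| + |β * (rav N w0 z - α)| := abs_sub _ _
      _ = |α| * |rav N w z - β| + |β| * |rav N w0 z - α| := by rw [abs_mul, abs_mul]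
      _ ≤ 1 * (K * (2 * Real.pi * ρ) / N) + M * (√lam * (2 * Real.pi * ρ) / N) := by gcongr
      _ = _ := by ring
  have hlR' : lam * ‖y‖^2 ≤ 1 := le_trans (by gcongr) hlR
  have := disc_max_abs hl hlR' (norm_nonneg y) (fun z hz => (cQ z (hsub hz)).continuousAt.continuousWithinAt)
    (fun z hz => cQ z (hsub (Metric.ball_subset_closedBall hz))) (fun z hz => eQ z (hsub (Metric.ball_subset_closedBall hz)))
    (by positivity) hb 0 (by simp)
  have e0 : Q 0 = w 0 * α - β := by
    simp only [hQ, rav_zero hN, hw0]; simp; ring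
  rw [e0] at this
  refine this.trans (le_of_eq ?_)
  ring

lemma rav_int {N : ℕ} (hN : 0 < N) {w η : E2 → ℝ} {ρ : ℝ} (hw : ContinuousOn w (Metric.closedBall (0:E2) ρ))
    (hη : Continuous η) (hrad : ∀ y y', ‖y‖ = ‖y'‖ → η y = η y') :
    IntegrableOn (fun y => rav N w y * η y) (Metric.closedBall (0:E2) ρ) ∧
    ∫ y in Metric.closedBall (0:E2) ρ, rav N w y * η y = ∫ y in Metric.closedBall (0:E2) ρ, w y * η y := by
  have hNp : (0:ℝ) < N := by positivity
  have hc : ∀ θ : ℝ, ContinuousOn (fun y => w (rot θ y) * η y) (Metric.closedBall (0:E2) ρ) := fun θ =>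
    (hw.comp (rot θ).continuous.continuousOn (fun y hy => by simpa using hy)).mul hη.continuousOn
  have hi : ∀ θ : ℝ, IntegrableOn (fun y => w (rot θ y) * η y) (Metric.closedBall (0:E2) ρ) := fun θ =>
    (hc θ).integrableOn_compact (isCompact_closedBall _ _)
  have he : (fun y => rav N w y * η y) = fun y => (1/(N:ℝ)) * ∑ k ∈ Finset.range N, w (rot (2 * Real.pi * k / N) y) * η y := by
    ext y; rw [rav, mul_assoc, Finset.sum_mul]
  have hr : ∀ θ : ℝ, ∫ y in Metric.closedBall (0:E2) ρ, w (rot θ y) * η y = ∫ y in Metric.closedBall (0:E2) ρ, w y * η y := by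
    intro θ
    have hp : (rot θ) ⁻¹' (Metric.closedBall (0:E2) ρ) = Metric.closedBall (0:E2) ρ := by
      ext y; simp
    have := (rot θ).measurePreserving.setIntegral_preimage_emb (rot θ).toHomeomorph.measurableEmbedding (fun y => w y * η y) (Metric.closedBall (0:E2) ρ)
    rw [hp] at this
    rw [← this]
    congr 1
    ext y
    rw [hrad y (rot θ y) (by simp)]
  rw [he]
  refine ⟨(integrable_finsetSum _ fun k _ => hi _).const_mul _, ?_⟩
  rw [integral_const_mul, integral_finsetSum _ fun k _ => hi _]
  simp only [hr]
  simp
  field_simp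

/-- mean value property, centered at 0 -/
lemma mvp0 {w η : E2 → ℝ} {R lam ρ : ℝ} (hl : 0 < lam) (hlR : lam * R^2 ≤ 1)
    (hρ : 0 ≤ ρ) (hρR : ρ < R) (hw : ∀ y ∈ Metric.ball (0:E2) R, ContDiffAt ℝ 2 w y)
    (he : ∀ z ∈ Metric.ball (0:E2) R, lap w z = - lam * w z)
    (hη : Continuous η) (hrad : ∀ y y', ‖y‖ = ‖y'‖ → η y = η y') :
    ∫ y in Metric.closedBall (0:E2) ρ, w y * η y =
      w 0 * ∫ y in Metric.closedBall (0:E2) ρ, Real.cos (√lam * y 0) * η y := by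
  have hsub : Metric.closedBall (0:E2) ρ ⊆ Metric.ball 0 R := Metric.closedBall_subset_ball hρR
  have hcw : ContinuousOn w (Metric.closedBall (0:E2) ρ) := fun z hz => (hw z (hsub hz)).continuousAt.continuousWithinAt
  have hC1 : ContDiffOn ℝ 1 w (Metric.closedBall (0:E2) ρ) := fun z hz => ((hw z (hsub hz)).of_le (by norm_num)).contDiffWithinAt
  obtain ⟨K, hK⟩ := hC1.exists_lipschitzOnWith (by simp) (convex_closedBall _ _) (isCompact_closedBall _ _)
  obtain ⟨M, hM⟩ := (isCompact_closedBall (0:E2) ρ).exists_bound_of_continuousOn hcw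
  set w0 : E2 → ℝ := fun y => Real.cos (√lam * y 0) with hw0
  have hw0c : Continuous w0 := Real.continuous_cos.comp (continuous_const.mul (EuclideanSpace.proj 0 : E2 →L[ℝ] ℝ).continuous)
  set C := 2 * ((K + M * √lam) * (2 * Real.pi * ρ)) with hC
  set J := ∫ y in Metric.closedBall (0:E2) ρ, |η y| with hJ
  have key : ∀ N : ℕ, 0 < N → |w 0 * (∫ y in Metric.closedBall (0:E2) ρ, w0 y * η y) - ∫ y in Metric.closedBall (0:E2) ρ, w y * η y| ≤ C * J / N := by
    intro N hN
    obtain ⟨i1, e1⟩ := rav_int hN hcw hη hrad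
    obtain ⟨i0, e0⟩ := rav_int hN hw0c.continuousOn hη hrad (ρ := ρ)
    rw [← e1, ← e0, ← integral_const_mul, ← integral_sub (i0.const_mul _) i1]
    have hb : ∀ y ∈ Metric.closedBall (0:E2) ρ, ‖w 0 * (rav N w0 y * η y) - rav N w y * η y‖ ≤ C / N * |η y| := by
      intro y hy
      rw [mem_closedBall_zero_iff] at hy
      have := rav_compare hN hl hlR hρ hρR hw he K.2 (fun y hy y' hy' => by
        have := hK.dist_le_mul y hy y' hy'
        simpa [Real.dist_eq, dist_eq_norm] using this) (fun y hy => hM y (by simpa using hy)) hy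
      rw [← mul_assoc, ← sub_mul, norm_mul, Real.norm_eq_abs, Real.norm_eq_abs]
      exact mul_le_mul_of_nonneg_right this (abs_nonneg _)
    have := norm_integral_le_of_norm_le (μ := volume.restrict (Metric.closedBall (0:E2) ρ))
      ((hη.abs.continuousOn.integrableOn_compact (isCompact_closedBall (0:E2) ρ)).const_mul (C/N))
      (ae_restrict_of_forall_mem measurableSet_closedBall hb)
    rw [integral_const_mul] at this
    rw [Real.norm_eq_abs] at this
    refine this.trans (le_of_eq ?_)
    ring
  have hlim : Tendsto (fun N : ℕ => C * J / (N:ℝ)) atTop (𝓝 0) := tendsto_const_div_atTop_nhds_zero_nat _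
  have h0 := ge_of_tendsto hlim (eventually_atTop.2 ⟨1, fun N hN => key N hN⟩)
  have := abs_nonpos_iff.1 h0
  linarith

end

section
open Set Filter Topology MeasureTheory InnerProductSpace
open scoped ContDiff

/-- convolution -/
def cv (f η : E2 → ℝ) (x : E2) : ℝ := ∫ y, f y * η (x - y)

lemma cv_eq (f η : E2 → ℝ) : cv f η = convolution f η (ContinuousLinearMap.mul ℝ ℝ) volume := by
  ext x; rw [convolution_def]; rfl

lemma cv_smooth {f η : E2 → ℝ} (hf : LocallyIntegrable f) (hη : ContDiff ℝ ∞ η) (hc : HasCompactSupport η) :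
    ContDiff ℝ ∞ (cv f η) := by
  rw [cv_eq]; exact hc.contDiff_convolution_right _ hf hη

lemma fderiv_smooth {η : E2 → ℝ} (hη : ContDiff ℝ ∞ η) (v : E2) : ContDiff ℝ ∞ (fun y => fderiv ℝ η y v) :=
  (hη.fderiv_right (m := ∞) (by simp)).clm_apply contDiff_const

lemma fderiv_cs {η : E2 → ℝ} (hc : HasCompactSupport η) (v : E2) : HasCompactSupport (fun y => fderiv ℝ η y v) :=
  hc.fderiv_apply ℝ v

lemma cv_fderiv {f η : E2 → ℝ} (hf : LocallyIntegrable f) (hη : ContDiff ℝ ∞ η) (hc : HasCompactSupport η) (x v : E2) :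
    fderiv ℝ (cv f η) x v = cv f (fun y => fderiv ℝ η y v) x := by
  have h := hc.hasFDerivAt_convolution_right (ContinuousLinearMap.mul ℝ ℝ) hf (hη.of_le (by norm_cast)) x
  rw [cv_eq, h.fderiv, convolution_precompR_apply _ hf (hc.fderiv ℝ) (hη.continuous_fderiv (by simp)), cv_eq]

lemma lap_smooth {η : E2 → ℝ} (hη : ContDiff ℝ ∞ η) : ContDiff ℝ ∞ (lap η) :=
  (fderiv_smooth (fderiv_smooth hη e0) e0).add (fderiv_smooth (fderiv_smooth hη e1) e1)

lemma cv_lap {f η : E2 → ℝ} (hf : LocallyIntegrable f) (hη : ContDiff ℝ ∞ η) (hc : HasCompactSupport η) (x : E2) :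
    lap (cv f η) x = cv f (lap η) x := by
  have h1 : ∀ v, mixedDeriv (cv f η) x v v = cv f (fun y => mixedDeriv η y v v) x := by
    intro v
    unfold mixedDeriv
    simp only [cv_fderiv hf hη hc]
    rw [cv_fderiv hf (fderiv_smooth hη v) (fderiv_cs hc v)]
  have hi : ∀ v, Integrable (fun y => f y * mixedDeriv η (x - y) v v) := by
    intro v
    have hcs : HasCompactSupport (fun y => mixedDeriv η y v v) := fderiv_cs (fderiv_cs hc v) v
    have hct : Continuous (fun y => mixedDeriv η y v v) := (fderiv_smooth (fderiv_smooth hη v) v).continuous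
    exact (hcs.convolutionExists_right (ContinuousLinearMap.mul ℝ ℝ) hf hct x)
  unfold lap
  rw [h1, h1]
  unfold cv
  rw [← integral_add (hi e0) (hi e1)]
  congr 1; ext y; ring

/-- bump -/
def eta (ρ : ℝ) (y : E2) : ℝ := expNegInvGlue (1 - ‖y‖^2 / ρ^2)

lemma eta_smooth (ρ : ℝ) : ContDiff ℝ ∞ (eta ρ) := by
  unfold eta
  exact expNegInvGlue.contDiff.comp (contDiff_const.sub ((contDiff_norm_sq ℝ).div_const _))

lemma eta_nonneg (ρ : ℝ) (y : E2) : 0 ≤ eta ρ y := expNegInvGlue.nonneg _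

lemma eta_rad (ρ : ℝ) (y y' : E2) (h : ‖y‖ = ‖y'‖) : eta ρ y = eta ρ y' := by unfold eta; rw [h]

lemma eta_zero {ρ : ℝ} (hρ : 0 < ρ) {y : E2} (h : y ∉ Metric.closedBall (0:E2) ρ) : eta ρ y = 0 := by
  apply expNegInvGlue.zero_of_nonpos
  rw [mem_closedBall_zero_iff, not_le] at h
  rw [sub_nonpos, le_div_iff₀ (by positivity)]
  nlinarith

lemma eta_cs {ρ : ℝ} (hρ : 0 < ρ) : HasCompactSupport (eta ρ) :=
  HasCompactSupport.intro (isCompact_closedBall (0:E2) ρ) (fun _ hx => eta_zero hρ hx)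

lemma eta_scale (ρ : ℝ) (y : E2) : eta ρ y = eta 1 (ρ⁻¹ • y) := by
  unfold eta
  rw [norm_smul, mul_pow]
  congr 2
  simp; ring

lemma eta_int_pos {ρ : ℝ} (hρ : 0 < ρ) : 0 < ∫ y, eta ρ y := by
  apply (eta_smooth ρ).continuous.integral_pos_of_hasCompactSupport_nonneg_nonzero (eta_cs hρ) (eta_nonneg ρ) (x := 0)
  simp only [eta]
  exact (expNegInvGlue.pos_of_pos (by simp)).ne'

lemma eta_int_scale {ρ : ℝ} (hρ : 0 < ρ) : ∫ y, eta ρ y = ρ^2 * ∫ y, eta 1 y := by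
  simp only [eta_scale ρ]
  rw [Measure.integral_comp_smul volume (eta 1) ρ⁻¹]
  simp

def Ceta (lam ρ : ℝ) : ℝ := ∫ y in Metric.closedBall (0:E2) ρ, Real.cos (√lam * y 0) * eta ρ y

lemma Ceta_ge {lam ρ : ℝ} (hl : 0 < lam) (hρ : 0 < ρ) (h : lam * ρ^2 ≤ 1) : ρ^2 / 2 * ∫ y, eta 1 y ≤ Ceta lam ρ := by
  have h1 : ∫ y in Metric.closedBall (0:E2) ρ, (1/2) * eta ρ y = ρ^2 / 2 * ∫ y, eta 1 y := by
    rw [integral_const_mul, setIntegral_eq_integral_of_forall_compl_eq_zero (fun y hy => eta_zero hρ hy), eta_int_scale hρ]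
    ring
  rw [← h1]
  have hc : Continuous fun y : E2 => Real.cos (√lam * y 0) :=
    Real.continuous_cos.comp (continuous_const.mul (EuclideanSpace.proj 0 : E2 →L[ℝ] ℝ).continuous)
  apply setIntegral_mono_on
  · exact (continuous_const.mul (eta_smooth ρ).continuous).continuousOn.integrableOn_compact (isCompact_closedBall _ _)
  · exact (hc.mul (eta_smooth ρ).continuous).continuousOn.integrableOn_compact (isCompact_closedBall _ _)
  · exact measurableSet_closedBall
  · intro y hy
    rw [mem_closedBall_zero_iff] at hy
    apply mul_le_mul_of_nonneg_right _ (eta_nonneg ρ y)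
    have := Real.one_sub_sq_div_two_le_cos (x := √lam * y 0)
    have h2 : (√lam * y 0)^2 ≤ 1 := by
      rw [mul_pow, Real.sq_sqrt hl.le]
      have : (y 0)^2 ≤ ρ^2 := by
        have := normsq_E2 y
        have : ‖y‖^2 ≤ ρ^2 := by gcongr
        nlinarith [sq_nonneg (y 1)]
      nlinarith
    linarith

lemma Ceta_pos {lam ρ : ℝ} (hl : 0 < lam) (hρ : 0 < ρ) (h : lam * ρ^2 ≤ 1) : 0 < Ceta lam ρ :=
  lt_of_lt_of_le (by have := eta_int_pos one_pos; positivity) (Ceta_ge hl hρ h)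

lemma rep {f w : E2 → ℝ} {x : E2} {R lam ρ : ℝ} (hl : 0 < lam) (hlR : lam * R^2 ≤ 1)
    (hρ : 0 < ρ) (hρR : ρ < R) (hw : ∀ y ∈ Metric.ball x R, ContDiffAt ℝ 2 w y)
    (he : ∀ z ∈ Metric.ball x R, lap w z = - lam * w z)
    (hf : ∀ y ∈ Metric.closedBall x ρ, f y = w y) : cv f (eta ρ) x = Ceta lam ρ * w x := by
  have hb : ∀ y, y ∈ Metric.ball (0:E2) R → x + y ∈ Metric.ball x R := fun y hy => by simpa using hy
  have hL := mvp0 (w := fun y => w (x + y)) hl hlR hρ.le hρR (fun y hy => (hw _ (hb y hy)).comp y (by fun_prop))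
    (fun y hy => by
      have := lap_comp_iso (u := w) (p := y) x (LinearIsometryEquiv.refl ℝ E2) (by simpa using hw _ (hb y hy))
      simp only [LinearIsometryEquiv.coe_refl, id] at this
      rw [this, he _ (hb y hy)]) (eta_smooth ρ).continuous (eta_rad ρ)
  have h1 : cv f (eta ρ) x = ∫ y, f (x + y) * eta ρ y := by
    unfold cv
    rw [← integral_add_left_eq_self _ x]
    congr 1; ext y
    rw [eta_rad ρ (x - (x + y)) y (by simp)]
  rw [h1, ← setIntegral_eq_integral_of_forall_compl_eq_zero (s := Metric.closedBall (0:E2) ρ) (fun y hy => by rw [eta_zero hρ hy, mul_zero])]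
  rw [setIntegral_congr_fun (g := fun y => w (x+y) * eta ρ y) measurableSet_closedBall (fun y hy => by
    have : x + y ∈ Metric.closedBall x ρ := by simpa using hy
    show f (x+y) * _ = _
    rw [hf _ this]), hL]
  simp only [add_zero]
  rw [mul_comm]; rfl

lemma cv_close {f h g : E2 → ℝ} {x : E2} {δ ρ : ℝ} (hf : LocallyIntegrable f) (hh : LocallyIntegrable h) (hg : Continuous g)
    (hg0 : ∀ y, y ∉ Metric.closedBall (0:E2) ρ → g y = 0) (hb : ∀ y ∈ Metric.closedBall x ρ, |f y - h y| ≤ δ) :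
    |cv f g x - cv h g x| ≤ δ * ∫ y, |g y| := by
  have hcs : HasCompactSupport g := HasCompactSupport.intro (isCompact_closedBall (0:E2) ρ) hg0
  have i1 : Integrable (fun y => f y * g (x - y)) := hcs.convolutionExists_right (ContinuousLinearMap.mul ℝ ℝ) hf hg x
  have i2 : Integrable (fun y => h y * g (x - y)) := hcs.convolutionExists_right (ContinuousLinearMap.mul ℝ ℝ) hh hg x
  have i3 : Integrable (fun y => δ * |g (x - y)|) := by
    have : Integrable g := hg.integrable_of_hasCompactSupport hcs
    exact ((this.comp_sub_left x).abs).const_mul δ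
  unfold cv
  rw [← integral_sub i1 i2]
  have := norm_integral_le_of_norm_le i3 (f := fun y => f y * g (x - y) - h y * g (x - y)) (Eventually.of_forall fun y => by
    rw [← sub_mul, norm_mul, Real.norm_eq_abs, Real.norm_eq_abs]
    by_cases hy : y ∈ Metric.closedBall x ρ
    · exact mul_le_mul_of_nonneg_right (hb y hy) (abs_nonneg _)
    · rw [hg0 (x - y) (by rw [mem_closedBall_zero_iff, norm_sub_rev]; rwa [mem_closedBall_iff_norm] at hy)]; simp)
  rw [Real.norm_eq_abs, integral_const_mul, integral_sub_left_eq_self (fun y => |g y|)] at this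
  exact this

lemma eq_of_close {A B K : ℝ} (h : ∀ δ > (0:ℝ), |A - B| ≤ δ * K) : A = B := by
  have : Tendsto (fun δ : ℝ => δ * K) (𝓝[>] 0) (𝓝 0) := by
    have : Tendsto (fun δ : ℝ => δ * K) (𝓝 0) (𝓝 (0 * K)) := (continuous_id.mul continuous_const).tendsto 0
    rw [zero_mul] at this
    exact this.mono_left nhdsWithin_le_nhds
  have h0 := ge_of_tendsto this (eventually_nhdsWithin_of_forall fun δ hδ => h δ hδ)
  exact sub_eq_zero.1 (abs_nonpos_iff.1 h0)

end

section
open Set Filter Topology MeasureTheory InnerProductSpace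
open scoped ContDiff

lemma lap_reflect {χ : E2 → ℝ} (hχ : ContDiff ℝ ∞ χ) (x y : E2) : lap (fun y => χ (x - y)) y = lap χ (x - y) := by
  have := lap_comp_iso (u := χ) (p := y) x (LinearIsometryEquiv.neg ℝ) (hχ.contDiffAt.of_le (by norm_cast))
  simpa [sub_eq_add_neg] using this

/-- Mollification -/
def moll (v : E2 → ℝ) (ε : ℝ) (x : E2) : ℝ := (∫ y, eta ε y)⁻¹ * cv v (eta ε) x

lemma moll_smooth {v : E2 → ℝ} (hv : Continuous v) {ε : ℝ} (hε : 0 < ε) : ContDiff ℝ ∞ (moll v ε) :=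
  contDiff_const.mul (cv_smooth hv.locallyIntegrable (eta_smooth ε) (eta_cs hε))

lemma moll_close {v : E2 → ℝ} (hv : Continuous v) {ε δ : ℝ} (hε : 0 < ε) {x : E2}
    (h : ∀ y ∈ Metric.closedBall x ε, |v y - v x| ≤ δ) : |moll v ε x - v x| ≤ δ := by
  have hp := eta_int_pos hε
  have h1 := cv_close (f := v) (h := fun _ => v x) (g := eta ε) hv.locallyIntegrable continuous_const.locallyIntegrable
    (eta_smooth ε).continuous (fun y hy => eta_zero hε hy) h
  have h2 : cv (fun _ => v x) (eta ε) x = v x * ∫ y, eta ε y := by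
    unfold cv
    rw [integral_const_mul, integral_sub_left_eq_self (eta ε)]
  have h3 : ∫ y, |eta ε y| = ∫ y, eta ε y := by
    congr 1; ext y; exact abs_of_nonneg (eta_nonneg _ _)
  rw [h2, h3] at h1
  have e : moll v ε x - v x = (∫ y, eta ε y)⁻¹ * (cv v (eta ε) x - v x * ∫ y, eta ε y) := by
    unfold moll; field_simp
  rw [e, abs_mul, abs_of_pos (by positivity)]
  calc _ ≤ (∫ y, eta ε y)⁻¹ * (δ * ∫ y, eta ε y) := by gcongr
    _ = δ := by field_simp

lemma moll_lap {v : E2 → ℝ} (hv : Continuous v) {p : E2} {R lam : ℝ}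
    (hw : ∀ ψ : E2 → ℝ, ContDiff ℝ ∞ ψ → (∃ r < R, ∀ y, y ∉ Metric.closedBall p r → ψ y = 0) → ∫ y, v y * (lap ψ y + lam * ψ y) = 0)
    {ε : ℝ} (hε : 0 < ε) {x : E2} (hx : ‖x - p‖ + ε < R) : lap (moll v ε) x = - lam * moll v ε x := by
  have hcs := cv_smooth hv.locallyIntegrable (eta_smooth ε) (eta_cs hε)
  unfold moll
  rw [lap_const_mul _ (hcs.contDiffAt.of_le (by norm_cast)), cv_lap hv.locallyIntegrable (eta_smooth ε) (eta_cs hε)]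
  have h1 := hw (fun y => eta ε (x - y)) ((eta_smooth ε).comp (contDiff_const.sub contDiff_id)) ⟨‖x-p‖ + ε, hx, fun y hy => by
    apply eta_zero hε
    rw [mem_closedBall_iff_norm] at hy
    rw [mem_closedBall_zero_iff]
    intro h
    apply hy
    calc ‖y - p‖ = ‖(x - p) - (x - y)‖ := by congr 1; abel
      _ ≤ _ := (norm_sub_le _ _).trans (by gcongr)⟩
  have i1 : Integrable (fun y => v y * lap (eta ε) (x - y)) := by
    have : HasCompactSupport (lap (eta ε)) :=
      (fderiv_cs (fderiv_cs (eta_cs hε) e0) e0).add (fderiv_cs (fderiv_cs (eta_cs hε) e1) e1)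
    exact this.convolutionExists_right (ContinuousLinearMap.mul ℝ ℝ) hv.locallyIntegrable (lap_smooth (eta_smooth ε)).continuous x
  have i2 : Integrable (fun y => v y * eta ε (x - y)) :=
    (eta_cs hε).convolutionExists_right (ContinuousLinearMap.mul ℝ ℝ) hv.locallyIntegrable (eta_smooth ε).continuous x
  have h2 : cv v (lap (eta ε)) x + lam * cv v (eta ε) x = 0 := by
    rw [← h1]
    unfold cv
    rw [← integral_const_mul, ← integral_add i1 (i2.const_mul _)]
    congr 1; ext y
    rw [lap_reflect (eta_smooth ε)]; ring
  have : cv v (lap (eta ε)) x = - lam * cv v (eta ε) x := by linarith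
  rw [this]; ring

lemma lap_eta_zero {ρ : ℝ} (hρ : 0 < ρ) {y : E2} (h : y ∉ Metric.closedBall (0:E2) ρ) : lap (eta ρ) y = 0 := by
  rw [lap_congr (w := fun _ => 0), lap_const]
  filter_upwards [Metric.isClosed_closedBall.isOpen_compl.mem_nhds h] with z hz
  exact eta_zero hρ hz

/-- weak solutions are smooth -/
theorem weak_smooth {v : E2 → ℝ} (hv : Continuous v) {p : E2} {R lam : ℝ} (hR : 0 < R) (hl : 0 < lam)
    (hw : ∀ ψ : E2 → ℝ, ContDiff ℝ ∞ ψ → (∃ r < R, ∀ y, y ∉ Metric.closedBall p r → ψ y = 0) → ∫ y, v y * (lap ψ y + lam * ψ y) = 0) :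
    ∃ r > (0:ℝ), ∀ z ∈ Metric.ball p r, ContDiffAt ℝ ∞ v z ∧ lap v z = - lam * v z := by
  obtain ⟨R1, hR1, hR1R, hlR⟩ : ∃ R1 > (0:ℝ), R1 ≤ R ∧ lam * R1^2 ≤ 1 := by
    have hs := Real.sqrt_pos.2 hl
    refine ⟨min R (1/√lam), lt_min hR (by positivity), min_le_left _ _, ?_⟩
    have : (min R (1/√lam))^2 ≤ (1/√lam)^2 := by gcongr; exact min_le_right _ _
    calc _ ≤ lam * (1/√lam)^2 := by gcongr
      _ = 1 := by rw [div_pow, Real.sq_sqrt hl.le]; field_simp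
  -- uniform approximation
  have hap : ∀ δ > (0:ℝ), ∃ ε > (0:ℝ), ε < R1/4 ∧ ∀ y ∈ Metric.closedBall p R1, |moll v ε y - v y| ≤ δ := by
    intro δ hδ
    have huc := (isCompact_closedBall p (2*R1)).uniformContinuousOn_of_continuous hv.continuousOn
    rw [Metric.uniformContinuousOn_iff] at huc
    obtain ⟨ε0, hε0, h0⟩ := huc δ hδ
    refine ⟨min (ε0/2) (R1/8), by positivity, lt_of_le_of_lt (min_le_right _ _) (by linarith), fun y hy => ?_⟩
    refine moll_close hv (by positivity) (fun y' hy' => ?_)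
    have a1 := min_le_left (ε0/2) (R1/8)
    have a2 := min_le_right (ε0/2) (R1/8)
    have hy'2 : dist y' y ≤ min (ε0/2) (R1/8) := hy'
    have hy2 : dist y p ≤ R1 := hy
    have := h0 y' (by rw [Metric.mem_closedBall]; linarith [dist_triangle y' y p]) y (by rw [Metric.mem_closedBall]; linarith) (by linarith)
    rw [Real.dist_eq] at this
    exact this.le
  set ρ := R1/4 with hρ
  have hρ0 : 0 < ρ := by positivity
  have hCp : 0 < Ceta lam ρ := Ceta_pos hl hρ0 (le_trans (by gcongr; rw [hρ]; linarith) hlR)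
  -- representation for mollified
  have hrep : ∀ ε > (0:ℝ), ε < R1/4 → ∀ x ∈ Metric.ball p ρ, cv (moll v ε) (eta ρ) x = Ceta lam ρ * moll v ε x := by
    intro ε hε hε1 x hx
    rw [mem_ball_iff_norm] at hx
    refine rep (R := R1/2) hl (le_trans (by gcongr; linarith) hlR) hρ0 (by rw [hρ]; linarith) (fun y _ => (moll_smooth hv hε).contDiffAt.of_le (by norm_cast))
      (fun y hy => moll_lap hv hw hε ?_) (fun _ _ => rfl)
    rw [mem_ball_iff_norm] at hy
    have := norm_sub_le_norm_sub_add_norm_sub y x p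
    linarith
  have hballs : ∀ x ∈ Metric.ball p ρ, ∀ y ∈ Metric.closedBall x ρ, y ∈ Metric.closedBall p R1 := by
    intro x hx y hy
    rw [Metric.mem_ball] at hx
    rw [Metric.mem_closedBall] at *
    linarith [dist_triangle y x p]
  have hconv : ∀ (g : E2 → ℝ), Continuous g → (∀ y, y ∉ Metric.closedBall (0:E2) ρ → g y = 0) → ∀ x ∈ Metric.ball p ρ, ∀ k : ℝ,
      (∀ ε > (0:ℝ), ε < R1/4 → cv (moll v ε) g x = k * moll v ε x) → cv v g x = k * v x := by
    intro g hg hg0 x hx k hk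
    apply eq_of_close (K := (∫ y, |g y|) + |k|)
    intro δ hδ
    obtain ⟨ε, hε, hε1, h⟩ := hap δ hδ
    have h1 := cv_close (x := x) hv.locallyIntegrable (moll_smooth hv hε).continuous.locallyIntegrable hg hg0
      (δ := δ) (fun y hy => by rw [abs_sub_comm]; exact h y (hballs x hx y hy))
    have h2 := h x (hballs x hx x (Metric.mem_closedBall_self hρ0.le))
    rw [hk ε hε hε1] at h1
    calc |cv v g x - k * v x| = |(cv v g x - k * moll v ε x) + k * (moll v ε x - v x)| := by ring_nf
      _ ≤ |cv v g x - k * moll v ε x| + |k| * |moll v ε x - v x| := (abs_add_le _ _).trans (by rw [abs_mul])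
      _ ≤ δ * (∫ y, |g y|) + |k| * δ := by gcongr
      _ = _ := by ring
  have hV : ∀ x ∈ Metric.ball p ρ, cv v (eta ρ) x = Ceta lam ρ * v x := fun x hx =>
    hconv (eta ρ) (eta_smooth ρ).continuous (fun y hy => eta_zero hρ0 hy) x hx _ (fun ε hε hε1 => hrep ε hε hε1 x hx)
  have hcs : ∀ f : E2 → ℝ, Continuous f → ContDiff ℝ ∞ (cv f (eta ρ)) := fun f hf =>
    cv_smooth hf.locallyIntegrable (eta_smooth ρ) (eta_cs hρ0)
  have hloc : ∀ (f : E2 → ℝ), (∀ x ∈ Metric.ball p ρ, cv f (eta ρ) x = Ceta lam ρ * f x) → ∀ x ∈ Metric.ball p ρ,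
      f =ᶠ[𝓝 x] fun x => (Ceta lam ρ)⁻¹ * cv f (eta ρ) x := by
    intro f hf x hx
    filter_upwards [Metric.isOpen_ball.mem_nhds hx] with y hy
    rw [hf y hy]; field_simp
  have hloclap : ∀ (f : E2 → ℝ), Continuous f → (∀ x ∈ Metric.ball p ρ, cv f (eta ρ) x = Ceta lam ρ * f x) → ∀ x ∈ Metric.ball p ρ,
      cv f (lap (eta ρ)) x = Ceta lam ρ * lap f x := by
    intro f hfc hf x hx
    rw [lap_congr (hloc f hf x hx), lap_const_mul _ ((hcs f hfc).contDiffAt.of_le (by norm_cast)),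
      cv_lap hfc.locallyIntegrable (eta_smooth ρ) (eta_cs hρ0)]
    field_simp
  refine ⟨ρ, hρ0, fun x hx => ⟨?_, ?_⟩⟩
  · exact (contDiff_const.mul (hcs v hv)).contDiffAt.congr_of_eventuallyEq (hloc v hV x hx)
  · have := hconv (lap (eta ρ)) (lap_smooth (eta_smooth ρ)).continuous (fun y hy => lap_eta_zero hρ0 hy) x hx (- lam * Ceta lam ρ)
      (fun ε hε hε1 => by
        rw [hloclap _ (moll_smooth hv hε).continuous (hrep ε hε hε1) x hx, moll_lap hv hw hε]
        · ring
        · rw [mem_ball_iff_norm] at hx; linarith)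
    rw [hloclap v hv hV x hx] at this
    have h2 : Ceta lam ρ * lap v x = Ceta lam ρ * (- lam * v x) := by rw [this]; ring
    exact mul_left_cancel₀ hCp.ne' h2

/-- commuting lap and derivative -/
lemma lap_fderiv {w : E2 → ℝ} {p : E2} (h : ContDiffAt ℝ ∞ w p) (v : E2) :
    lap (fun z => fderiv ℝ w z v) p = fderiv ℝ (lap w) p v := by
  have hs : ∀ {f : E2 → ℝ} {z : E2} (v : E2), ContDiffAt ℝ ∞ f z → ContDiffAt ℝ ∞ (fun y => fderiv ℝ f y v) z := fun v hf =>
    (hf.fderiv_right (m := ∞) (by simp)).clm_apply contDiffAt_const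
  have h2 : ∀ {f : E2 → ℝ} {z : E2}, ContDiffAt ℝ ∞ f z → ContDiffAt ℝ 2 f z := fun hf => hf.of_le (by norm_cast)
  have hev : ∀ᶠ z in 𝓝 p, ContDiffAt ℝ 2 w z := (h2 h).eventually (by simp)
  have key : ∀ e : E2, mixedDeriv (fun z => fderiv ℝ w z v) p e e = fderiv ℝ (fun z => mixedDeriv w z e e) p v := by
    intro e
    have e1 : (fun y => fderiv ℝ (fun z => fderiv ℝ w z v) y e) =ᶠ[𝓝 p] (fun y => fderiv ℝ (fun z => fderiv ℝ w z e) y v) := by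
      filter_upwards [hev] with y hy
      exact mixedDeriv_symm hy v e
    have e2 : mixedDeriv (fun z => fderiv ℝ w z v) p e e = mixedDeriv (fun z => fderiv ℝ w z e) p v e := by
      unfold mixedDeriv
      rw [e1.fderiv_eq]
    rw [e2, mixedDeriv_symm (h2 (hs e h))]
    rfl
  have hd : ∀ e : E2, DifferentiableAt ℝ (fun z => mixedDeriv w z e e) p := fun e =>
    (hs e (hs e h)).differentiableAt (by simp)
  unfold lap
  rw [key, key]
  have : fderiv ℝ (fun z => mixedDeriv w z e0 e0 + mixedDeriv w z e1 e1) p = _ := fderiv_fun_add (hd e0) (hd e1)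
  rw [this]; rfl

end

section
open Set Filter Topology MeasureTheory InnerProductSpace
open scoped ContDiff

lemma smooth_of_C2 {w : E2 → ℝ} {x : E2} {lam : ℝ} (hl : 0 < lam) (hw : ∀ᶠ y in 𝓝 x, ContDiffAt ℝ 2 w y)
    (he : ∀ᶠ y in 𝓝 x, lap w y = - lam * w y) : ContDiffAt ℝ ∞ w x := by
  obtain ⟨R0, hR0, h0⟩ := Metric.eventually_nhds_iff_ball.1 (hw.and he)
  obtain ⟨R, hR, hRR, hlR⟩ : ∃ R1 > (0:ℝ), R1 ≤ R0 ∧ lam * R1^2 ≤ 1 := by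
    have hs := Real.sqrt_pos.2 hl
    refine ⟨min R0 (1/√lam), lt_min hR0 (by positivity), min_le_left _ _, ?_⟩
    have : (min R0 (1/√lam))^2 ≤ (1/√lam)^2 := by gcongr; exact min_le_right _ _
    calc _ ≤ lam * (1/√lam)^2 := by gcongr
      _ = 1 := by rw [div_pow, Real.sq_sqrt hl.le]; field_simp
  set cb := Metric.closedBall x (R * (3/4))
  set f := cb.indicator w with hf
  have hcb : cb ⊆ Metric.ball x R0 := (Metric.closedBall_subset_ball (by linarith)).trans (Metric.ball_subset_ball hRR)
  have hfi : LocallyIntegrable f := by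
    have : IntegrableOn w cb := by
      apply ContinuousOn.integrableOn_compact (isCompact_closedBall _ _)
      exact fun z hz => (h0 z (hcb hz)).1.continuousAt.continuousWithinAt
    exact ((integrable_indicator_iff measurableSet_closedBall).2 this).locallyIntegrable
  have hρ : 0 < R/4 := by positivity
  have hC := Ceta_pos hl hρ (le_trans (by gcongr; linarith) hlR)
  have key : ∀ y ∈ Metric.ball x (R/4), cv f (eta (R/4)) y = Ceta lam (R/4) * w y := by
    intro y hy
    rw [Metric.mem_ball] at hy
    have hsub : ∀ z ∈ Metric.ball y (R/2), z ∈ cb := fun z hz => by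
      rw [Metric.mem_ball] at hz
      rw [Metric.mem_closedBall]; linarith [dist_triangle z y x]
    apply rep (R := R/2) hl (le_trans (by gcongr; linarith) hlR) hρ (by linarith) (fun z hz => (h0 z (hcb (hsub z hz))).1)
      (fun z hz => (h0 z (hcb (hsub z hz))).2)
    intro z hz
    rw [hf, indicator_of_mem (hsub z (Metric.closedBall_subset_ball (by linarith) hz))]
  have e : w =ᶠ[𝓝 x] fun y => (Ceta lam (R/4))⁻¹ * cv f (eta (R/4)) y := by
    filter_upwards [Metric.ball_mem_nhds x hρ] with y hy
    rw [key y hy]; field_simp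
  exact (contDiff_const.mul (cv_smooth hfi (eta_smooth _) (eta_cs hρ))).contDiffAt.congr_of_eventuallyEq e

theorem grad_est : ∃ C > (0:ℝ), ∀ (lam R : ℝ) (z : E2) (w : E2 → ℝ) (c0 om : ℝ), 0 < lam → 0 < R → lam * R^2 ≤ 1 →
    (∀ y ∈ Metric.ball z R, ContDiffAt ℝ 2 w y) → (∀ y ∈ Metric.ball z R, lap w y = - lam * w y) →
    (∀ y ∈ Metric.ball z R, |w y - c0| ≤ om) → ‖fderiv ℝ w z‖ ≤ C * om / R := by
  obtain ⟨L1, hL1⟩ := ((eta_smooth 1).of_le (by norm_cast : (1 : WithTop ℕ∞) ≤ ∞)).lipschitzWith_of_hasCompactSupport (eta_cs one_pos) (by simp)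
  set I := ∫ y, eta 1 y with hI
  have hIp : 0 < I := eta_int_pos one_pos
  set V := volume.real (Metric.ball (0:E2) 1) with hV
  refine ⟨9 * L1 * V / I + 1, by positivity, ?_⟩
  intro lam R z w c0 om hl hR hlR hw he hb
  set ρ := R/2 with hρ
  have hρp : 0 < ρ := by positivity
  have hom : 0 ≤ om := (abs_nonneg _).trans (hb z (Metric.mem_ball_self hR))
  set cb := Metric.closedBall z (R * (3/4))
  set d := cb.indicator (fun y => w y - c0) with hd
  have hcb : cb ⊆ Metric.ball z R := (Metric.closedBall_subset_ball (by linarith))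
  have hdi : LocallyIntegrable d := by
    have : IntegrableOn (fun y => w y - c0) cb := by
      apply ContinuousOn.integrableOn_compact (isCompact_closedBall _ _)
      exact fun z hz => ((hw z (hcb hz)).continuousAt.sub continuousAt_const).continuousWithinAt
    exact ((integrable_indicator_iff measurableSet_closedBall).2 this).locallyIntegrable
  have hci : ∀ x, Integrable (fun y => d y * eta ρ (x - y)) := fun x =>
    (eta_cs hρp).convolutionExists_right (ContinuousLinearMap.mul ℝ ℝ) hdi (eta_smooth ρ).continuous x
  have hcc : ∀ x, Integrable (fun y => c0 * eta ρ (x - y)) := fun x =>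
    (((eta_smooth ρ).continuous.integrable_of_hasCompactSupport (eta_cs hρp)).comp_sub_left x).const_mul c0
  have hrep : ∀ x ∈ Metric.ball z (R/4), Ceta lam ρ * w x = c0 * (∫ y, eta ρ y) + cv d (eta ρ) x := by
    intro x hx
    rw [Metric.mem_ball] at hx
    rw [← rep (f := fun y => c0 + d y) (R := R * (3/4)) hl (le_trans (by gcongr; linarith) hlR) hρp (by rw [hρ]; linarith)
      (fun y hy => hw y ?_) (fun y hy => he y ?_)]
    · unfold cv
      rw [← integral_sub_left_eq_self (eta ρ) volume x, ← integral_const_mul, ← integral_add (hcc x) (hci x)]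
      congr 1; ext y; ring
    · intro y hy
      have : y ∈ cb := by
        rw [Metric.mem_closedBall] at *; linarith [dist_triangle y x z]
      rw [hd, indicator_of_mem this]; ring
    · rw [Metric.mem_ball] at *; linarith [dist_triangle y x z]
    · rw [Metric.mem_ball] at *; linarith [dist_triangle y x z]
  have hlip : ∀ x x' : E2, |eta ρ x - eta ρ x'| ≤ L1 * (ρ⁻¹ * ‖x - x'‖) := by
    intro x x'
    rw [eta_scale ρ x, eta_scale ρ x']
    have := hL1.dist_le_mul (ρ⁻¹ • x) (ρ⁻¹ • x')
    rw [Real.dist_eq, dist_eq_norm, ← smul_sub, norm_smul, Real.norm_eq_abs, abs_of_pos (show 0 < ρ⁻¹ by positivity)] at this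
    exact this
  have hvol : volume.real cb = (R * (3/4))^2 * V := by
    have := Measure.addHaar_real_closedBall (volume : Measure E2) z (r := R * (3/4)) (by positivity)
    simpa using this
  have hC := Ceta_ge hl hρp (le_trans (by gcongr; linarith) hlR)
  have hCp := Ceta_pos hl hρp (le_trans (by gcongr; linarith) hlR)
  have hzz : z ∈ Metric.ball z (R/4) := Metric.mem_ball_self (by positivity)
  have key : ∀ x ∈ Metric.ball z (R/4), ‖w x - w z‖ ≤ ((9 * L1 * V / I + 1) * om / R) * ‖x - z‖ := by
    intro x hx
    have h1 : Ceta lam ρ * (w x - w z) = ∫ y in cb, (w y - c0) * (eta ρ (x - y) - eta ρ (z - y)) := by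
      rw [mul_sub, hrep x hx, hrep z hzz]
      rw [← integral_indicator measurableSet_closedBall]
      have : cv d (eta ρ) x - cv d (eta ρ) z = ∫ y, d y * (eta ρ (x - y) - eta ρ (z - y)) := by
        unfold cv; rw [← integral_sub (hci x) (hci z)]; congr 1; ext y; ring
      have h3 : ∀ y, d y * (eta ρ (x - y) - eta ρ (z - y)) = cb.indicator (fun y => (w y - c0) * (eta ρ (x - y) - eta ρ (z - y))) y := by
        intro y
        by_cases hy : y ∈ cb
        · simp [hd, hy]
        · simp [hd, hy]
      rw [← integral_congr_ae (Eventually.of_forall h3), ← this]; ring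
    have h2 : ‖∫ y in cb, (w y - c0) * (eta ρ (x - y) - eta ρ (z - y))‖ ≤ (om * (L1 * (ρ⁻¹ * ‖x - z‖))) * volume.real cb := by
      apply norm_setIntegral_le_of_norm_le_const
      · exact (isCompact_closedBall _ _).measure_lt_top
      · intro y hy
        rw [norm_mul, Real.norm_eq_abs, Real.norm_eq_abs]
        have := hlip (x - y) (z - y)
        rw [sub_sub_sub_cancel_right] at this
        exact mul_le_mul (hb y (hcb hy)) this (abs_nonneg _) hom
    rw [← h1, norm_mul, Real.norm_eq_abs, abs_of_pos hCp, hvol] at h2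
    have h4 : ρ^2/2 * I * ‖w x - w z‖ ≤ Ceta lam ρ * ‖w x - w z‖ := by gcongr
    have h5 := h4.trans h2
    have hL0 : (0:ℝ) ≤ L1 := L1.2
    have h6 : ‖w x - w z‖ ≤ (9 * L1 * V / I) * om / R * ‖x - z‖ := by
      rw [← mul_le_mul_iff_of_pos_left (show 0 < ρ^2/2*I by positivity)]
      refine h5.trans (le_of_eq ?_)
      rw [hρ]; field_simp; ring
    refine h6.trans ?_
    gcongr
    linarith
  refine HasFDerivAt.le_of_lip' ((hw z (Metric.mem_ball_self hR)).differentiableAt (by simp)).hasFDerivAt (by positivity) ?_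
  filter_upwards [Metric.ball_mem_nhds z (show 0 < R/4 by positivity)] with x hx
  exact key x hx

theorem grad_est2 : ∃ C > (0:ℝ), ∀ (lam R : ℝ) (z : E2) (w : E2 → ℝ) (c0 om : ℝ), 0 < lam → 0 < R → lam * R^2 ≤ 1 →
    (∀ y ∈ Metric.ball z R, ContDiffAt ℝ ∞ w y) → (∀ y ∈ Metric.ball z R, lap w y = - lam * w y) →
    (∀ y ∈ Metric.ball z R, |w y - c0| ≤ om) → ‖fderiv ℝ w z‖ ≤ C * om / R ∧
      ∀ v : E2, ‖fderiv ℝ (fun y => fderiv ℝ w y v) z‖ ≤ C * om / R^2 * ‖v‖ := by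
  obtain ⟨C, hC, h⟩ := grad_est
  refine ⟨C + 4 * C^2, by positivity, ?_⟩
  intro lam R z w c0 om hl hR hlR hw he hb
  have hom : 0 ≤ om := (abs_nonneg _).trans (hb z (Metric.mem_ball_self hR))
  have hw2 : ∀ y ∈ Metric.ball z R, ContDiffAt ℝ 2 w y := fun y hy => (hw y hy).of_le (by norm_cast)
  have h1 := h lam R z w c0 om hl hR hlR hw2 he hb
  refine ⟨h1.trans ?_, fun v => ?_⟩
  · gcongr; nlinarith [sq_nonneg C]
  have hR2 : lam * (R/2)^2 ≤ 1 := le_trans (by gcongr; linarith) hlR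
  have hsub : ∀ y ∈ Metric.ball z (R/2), ∀ x ∈ Metric.ball y (R/2), x ∈ Metric.ball z R := by
    intro y hy x hx
    rw [Metric.mem_ball] at *; linarith [dist_triangle x y z]
  have hsub' : Metric.ball z (R/2) ⊆ Metric.ball z R := Metric.ball_subset_ball (by linarith)
  have h2 : ∀ y ∈ Metric.ball z (R/2), ‖fderiv ℝ w y‖ ≤ C * om / (R/2) := fun y hy =>
    h lam (R/2) y w c0 om hl (by positivity) hR2 (fun x hx => hw2 x (hsub y hy x hx)) (fun x hx => he x (hsub y hy x hx))
      (fun x hx => hb x (hsub y hy x hx))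
  have h3 := h lam (R/2) z (fun y => fderiv ℝ w y v) 0 (C * om / (R/2) * ‖v‖) hl (by positivity) hR2
    (fun y hy => ((((hw y (hsub' hy)).fderiv_right (m := ∞) (by simp)).clm_apply contDiffAt_const).of_le (by norm_cast)))
    (fun y hy => by
      rw [lap_fderiv (hw y (hsub' hy))]
      have e : lap w =ᶠ[𝓝 y] fun x => - lam * w x := by
        filter_upwards [Metric.isOpen_ball.mem_nhds (hsub' hy)] with x hx using he x hx
      rw [e.fderiv_eq, fderiv_const_mul ((hw2 y (hsub' hy)).differentiableAt (by simp))]; rfl)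
    (fun y hy => by
      rw [sub_zero]
      exact ((fderiv ℝ w y).le_opNorm v).trans (by gcongr; exact h2 y hy))
  refine h3.trans ?_
  have : C * (C * om / (R/2) * ‖v‖) / (R/2) = (4 * C^2) * om / R^2 * ‖v‖ := by field_simp; ring
  rw [this]
  gcongr
  linarith

end

section
open Set Filter Topology MeasureTheory InnerProductSpace
open scoped ContDiff

/-- reflection y ↦ (y0, -y1) -/
def R1 : E2 ≃ₗᵢ[ℝ] E2 := Submodule.reflection (ℝ ∙ e0)

lemma inner_e0 (y : E2) : (inner ℝ e0 y : ℝ) = y 0 := by rw [inner_E2]; simp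
lemma inner_e1 (y : E2) : (inner ℝ e1 y : ℝ) = y 1 := by rw [inner_E2]; simp
lemma norm_e0 : ‖e0‖ = 1 := by simp [e0]
lemma norm_e1 : ‖e1‖ = 1 := by simp [e1]

lemma R1_apply (y : E2) : R1 y = (y 0) • e0 - (y 1) • e1 := by
  have := Submodule.reflection_singleton_apply (𝕜 := ℝ) e0 y
  rw [R1, this, norm_e0, inner_e0]
  apply E2_ext <;> simp [two_mul]

@[simp] lemma R1_0 (y : E2) : R1 y 0 = y 0 := by rw [R1_apply]; simp
@[simp] lemma R1_1 (y : E2) : R1 y 1 = - y 1 := by rw [R1_apply]; simp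
lemma R1_R1 (y : E2) : R1 (R1 y) = y := by apply E2_ext <;> simp
lemma R1_fix {y : E2} (h : y 1 = 0) : R1 y = y := by apply E2_ext <;> simp [h]

def glue (σ : ℝ) (f : E2 → ℝ) (y : E2) : ℝ := if 0 ≤ y 1 then f y else σ * f (R1 y)

def HB (r : ℝ) : Set E2 := {y | ‖y‖ < r ∧ 0 ≤ y 1}

def P0 : E2 →L[ℝ] ℝ := EuclideanSpace.proj 0
def P1 : E2 →L[ℝ] ℝ := EuclideanSpace.proj 1
@[simp] lemma P0_apply (y : E2) : P0 y = y 0 := rfl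
@[simp] lemma P1_apply (y : E2) : P1 y = y 1 := rfl

lemma R1_HB {r : ℝ} {y : E2} (h : ‖y‖ < r) (h1 : y 1 ≤ 0) : R1 y ∈ HB r := ⟨by simpa using h, by simpa using h1⟩

lemma glue_neg {σ : ℝ} {f : E2 → ℝ} {y : E2} (hc : y 1 = 0 → f y = σ * f y) (h : y 1 ≤ 0) : glue σ f y = σ * f (R1 y) := by
  unfold glue
  split_ifs with h1
  · have := le_antisymm h h1
    rw [R1_fix this]; exact hc this
  · rfl

lemma glue_pos {σ : ℝ} {f : E2 → ℝ} {y : E2} (h : 0 ≤ y 1) : glue σ f y = f y := by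
  unfold glue; rw [if_pos h]

lemma cont_c1 : Continuous fun y : E2 => y 1 := P1.continuous

lemma glue_diff {σ r : ℝ} {f : E2 → ℝ} {a b : E2 → ℝ} (hf : ∀ z ∈ HB r, HasFDerivWithinAt f (a z • P0 + b z • P1) (HB r) z)
    (hc : ∀ z ∈ HB r, z 1 = 0 → f z = σ * f z ∧ a z = σ * a z ∧ b z = - σ * b z) {y : E2} (hy : ‖y‖ < r) :
    HasFDerivAt (glue σ f) (glue σ a y • P0 + glue (-σ) b y • P1) y := by
  have hB : Metric.ball (0:E2) r ∈ 𝓝 y := Metric.isOpen_ball.mem_nhds (by simpa using hy)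
  have hp : HasFDerivWithinAt (glue σ f) (glue σ a y • P0 + glue (-σ) b y • P1) {z | ‖z‖ < r ∧ 0 ≤ z 1} y := by
    by_cases h : 0 ≤ y 1
    · rw [glue_pos h, glue_pos h]
      exact (hf y ⟨hy, h⟩).congr (fun z hz => glue_pos hz.2) (glue_pos h)
    · apply HasFDerivWithinAt.of_notMem_closure
      intro hcl
      have : y ∈ {z : E2 | 0 ≤ z 1} := closure_minimal (fun z hz => hz.2) (isClosed_le continuous_const cont_c1) hcl
      exact h this
  have hn : HasFDerivWithinAt (glue σ f) (glue σ a y • P0 + glue (-σ) b y • P1) {z | ‖z‖ < r ∧ z 1 ≤ 0} y := by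
    by_cases h : y 1 ≤ 0
    · have hR := R1_HB hy h
      have hR1 : HasFDerivWithinAt R1 (R1.toContinuousLinearEquiv : E2 →L[ℝ] E2) {z | ‖z‖ < r ∧ z 1 ≤ 0} y :=
        (R1.toContinuousLinearEquiv : E2 →L[ℝ] E2).hasFDerivAt.hasFDerivWithinAt
      have h1 := (hf _ hR).comp y hR1 (fun z hz => R1_HB hz.1 hz.2)
      have h2 := h1.const_mul σ
      have e : glue σ a y • P0 + glue (-σ) b y • P1 = σ • ((a (R1 y) • P0 + b (R1 y) • P1).comp (R1.toContinuousLinearEquiv : E2 →L[ℝ] E2)) := by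
        rw [glue_neg (fun h0 => (hc y ⟨hy, h0.ge⟩ h0).2.1) h, glue_neg (fun h0 => (hc y ⟨hy, h0.ge⟩ h0).2.2) h]
        ext v
        simp
        ring
      rw [e]
      exact h2.congr (fun z hz => glue_neg (fun h0 => (hc z ⟨hz.1, h0.ge⟩ h0).1) hz.2) (glue_neg (fun h0 => (hc y ⟨hy, h0.ge⟩ h0).1) h)
    · apply HasFDerivWithinAt.of_notMem_closure
      intro hcl
      have : y ∈ {z : E2 | z 1 ≤ 0} := closure_minimal (fun z hz => hz.2) (isClosed_le cont_c1 continuous_const) hcl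
      exact h this
  refine (hp.union hn).hasFDerivAt ?_
  filter_upwards [hB] with z hz
  have hz' : ‖z‖ < r := by simpa using hz
  rcases le_total 0 (z 1) with h | h
  · exact Or.inl ⟨hz', h⟩
  · exact Or.inr ⟨hz', h⟩

lemma glue_cont {σ r : ℝ} {f : E2 → ℝ} (hf : ContinuousOn f (HB r)) (hc : ∀ z ∈ HB r, z 1 = 0 → f z = σ * f z) :
    ContinuousOn (glue σ f) (Metric.ball (0:E2) r) := by
  have hp : ContinuousOn (glue σ f) (Metric.ball (0:E2) r ∩ {z | 0 ≤ z 1}) := by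
    refine (hf.mono ?_).congr (fun z hz => glue_pos hz.2)
    exact fun z hz => ⟨by simpa using hz.1, hz.2⟩
  have hn : ContinuousOn (glue σ f) (Metric.ball (0:E2) r ∩ {z | z 1 ≤ 0}) := by
    have : ContinuousOn (fun z => σ * f (R1 z)) (Metric.ball (0:E2) r ∩ {z | z 1 ≤ 0}) :=
      continuousOn_const.mul (hf.comp R1.continuous.continuousOn (fun z hz => R1_HB (by simpa using hz.1) hz.2))
    exact this.congr (fun z hz => glue_neg (fun h0 => hc z ⟨by simpa using hz.1, h0.ge⟩ h0) hz.2)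
  have hu : Metric.ball (0:E2) r = (Metric.ball (0:E2) r ∩ {z | 0 ≤ z 1}) ∪ (Metric.ball (0:E2) r ∩ {z | z 1 ≤ 0}) := by
    rw [← inter_union_distrib_left, eq_comm, inter_eq_left]
    intro z _
    exact le_total 0 (z 1)
  intro z hz
  rw [hu]
  apply ContinuousWithinAt.union
  · by_cases h : 0 ≤ z 1
    · exact hp z ⟨hz, h⟩
    · apply continuousWithinAt_of_notMem_closure
      intro hcl
      exact h (closure_minimal (fun z hz => hz.2) (isClosed_le continuous_const cont_c1) hcl : z ∈ {z : E2 | 0 ≤ z 1})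
  · by_cases h : z 1 ≤ 0
    · exact hn z ⟨hz, h⟩
    · apply continuousWithinAt_of_notMem_closure
      intro hcl
      exact h (closure_minimal (fun z hz => hz.2) (isClosed_le cont_c1 continuous_const) hcl : z ∈ {z : E2 | z 1 ≤ 0})

lemma clm_coord (L : E2 →L[ℝ] ℝ) : L = L e0 • P0 + L e1 • P1 := by
  ext v
  have : v = v 0 • e0 + v 1 • e1 := by apply E2_ext <;> simp
  conv_lhs => rw [this]
  simp; ring

lemma HB_convex (r : ℝ) : Convex ℝ (HB r) := by
  have : HB r = Metric.ball (0:E2) r ∩ {z | 0 ≤ P1 z} := by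
    ext z; simp [HB]
  rw [this]
  exact (convex_ball _ _).inter (convex_halfSpace_ge P1.toLinearMap.isLinear 0)

lemma HB_interior {r : ℝ} {z : E2} (h : ‖z‖ < r) (h1 : 0 < z 1) : HB r ∈ 𝓝 z := by
  filter_upwards [Metric.isOpen_ball.mem_nhds (show z ∈ Metric.ball (0:E2) r by simpa using h), (isOpen_lt continuous_const cont_c1).mem_nhds h1] with y hy hy1
  exact ⟨by simpa using hy, le_of_lt hy1⟩

lemma HB_ud {r : ℝ} (hr : 0 < r) : UniqueDiffOn ℝ (HB r) := by
  apply uniqueDiffOn_convex (HB_convex r)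
  refine ⟨(r/2) • e1, mem_interior_iff_mem_nhds.2 (HB_interior ?_ ?_)⟩
  · rw [norm_smul, norm_e1, Real.norm_eq_abs, abs_of_pos (by positivity)]; linarith
  · simp; exact hr

lemma HB_cl {r : ℝ} {z : E2} (h : z ∈ HB r) : z ∈ closure (interior (HB r)) := by
  have hc : ContinuousWithinAt (fun t : ℝ => z + t • e1) (Ioi 0) 0 := by fun_prop
  have h0 : (0:ℝ) ∈ closure (Ioi (0:ℝ)) := by simp
  have := ContinuousWithinAt.mem_closure_image (f := fun t : ℝ => z + t • e1) (s := Ioi 0) hc h0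
  have hb : ∀ᶠ t : ℝ in 𝓝[>] 0, z + t • e1 ∈ interior (HB r) := by
    have hcc : ContinuousAt (fun t : ℝ => ‖z + t • e1‖) 0 := by fun_prop
    have h2 := hcc.eventually (gt_mem_nhds (show ‖z + (0:ℝ) • e1‖ < r by simpa using h.1))
    filter_upwards [nhdsWithin_le_nhds h2, self_mem_nhdsWithin] with t ht ht0
    refine mem_interior_iff_mem_nhds.2 (HB_interior ht ?_)
    have := h.2
    have ht0' : 0 < t := ht0
    simp; linarith
  have hl : Tendsto (fun t : ℝ => z + t • e1) (𝓝[>] 0) (𝓝 z) := by simpa [ContinuousWithinAt] using hc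
  exact mem_closure_of_tendsto hl hb

lemma C1_of {n : ℕ∞} {U : Set E2} (hU : IsOpen U) {F a b : E2 → ℝ} (h : ∀ y ∈ U, HasFDerivAt F (a y • P0 + b y • P1) y)
    (ha : ContDiffOn ℝ n a U) (hb : ContDiffOn ℝ n b U) : ContDiffOn ℝ (n+1) F U := by
  rw [contDiffOn_succ_iff_fderiv_of_isOpen hU]
  refine ⟨fun y hy => (h y hy).differentiableAt.differentiableWithinAt, by simp, ?_⟩
  have : ContDiffOn ℝ n (fun y => a y • P0 + b y • P1) U := (ha.smul contDiffOn_const).add (hb.smul contDiffOn_const)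
  exact this.congr fun y hy => (h y hy).fderiv

/-- gluing by even reflection -/
theorem glue0 {u : E2 → ℝ} {r mu : ℝ} (hr : 0 < r) (hmu : 0 < mu) (hu : ContDiffOn ℝ ∞ u (HB r))
    (he : ∀ y, ‖y‖ < r → 0 < y 1 → lap u y = - mu * u y)
    (hn : ∀ y, ‖y‖ < r → y 1 = 0 → fderivWithin ℝ u (HB r) y e1 = 0) :
    ∀ y ∈ Metric.ball (0:E2) r, ContDiffAt ℝ ∞ (glue 1 u) y ∧ lap (glue 1 u) y = - mu * glue 1 u y := by
  have ud := HB_ud hr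
  set D : (E2 → ℝ) → E2 → E2 → ℝ := fun f v z => fderivWithin ℝ f (HB r) z v with hD
  have hDs : ∀ {f : E2 → ℝ} (v : E2), ContDiffOn ℝ ∞ f (HB r) → ContDiffOn ℝ ∞ (D f v) (HB r) := fun v hf =>
    (hf.fderivWithin ud (m := ∞) (by simp)).clm_apply contDiffOn_const
  have hDd : ∀ {f : E2 → ℝ}, ContDiffOn ℝ ∞ f (HB r) → ∀ z ∈ HB r, HasFDerivWithinAt f (D f e0 z • P0 + D f e1 z • P1) (HB r) z := by
    intro f hf z hz
    have := ((hf.differentiableOn (by simp)) z hz).hasFDerivWithinAt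
    rwa [clm_coord (fderivWithin ℝ f (HB r) z)] at this
  have s0 := hDs e0 hu
  have s1 := hDs e1 hu
  -- tangential derivative of functions vanishing on the line
  have htan : ∀ {f : E2 → ℝ}, ContDiffOn ℝ ∞ f (HB r) → (∀ z ∈ HB r, z 1 = 0 → f z = 0) → ∀ z ∈ HB r, z 1 = 0 → D f e0 z = 0 := by
    intro f hf h0 z hz hz1
    have h1 := hDd hf z hz
    have hl : HasDerivAt (fun t : ℝ => z + t • e0) e0 0 := by
      simpa using ((hasDerivAt_id (0:ℝ)).smul_const e0).const_add z
    have hcc : ContinuousAt (fun t : ℝ => ‖z + t • e0‖) 0 := by fun_prop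
    have h2 := hcc.eventually (gt_mem_nhds (show ‖z + (0:ℝ) • e0‖ < r by simpa using hz.1))
    set S : Set ℝ := {t | ‖z + t • e0‖ < r} with hS
    have hSn : S ∈ 𝓝 (0:ℝ) := h2
    have hmem : ∀ t ∈ S, z + t • e0 ∈ HB r := fun t ht => ⟨ht, by simp [hz1]⟩
    have h1' : HasFDerivWithinAt f (D f e0 z • P0 + D f e1 z • P1) (HB r) (z + (0:ℝ) • e0) := by simpa using h1
    have h3 := h1'.comp_hasDerivWithinAt (0:ℝ) (hl.hasDerivWithinAt (s := S)) hmem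
    have h4 : HasDerivAt (fun t : ℝ => f (z + t • e0)) (D f e0 z) 0 := by
      have h : HasDerivAt (fun t : ℝ => f (z + t • e0)) _ 0 := h3.hasDerivAt hSn
      exact h.congr_deriv (by simp)
    have h5 : (fun t : ℝ => f (z + t • e0)) =ᶠ[𝓝 0] fun _ => 0 := by
      filter_upwards [hSn] with t ht
      exact h0 _ (hmem t ht) (by simp [hz1])
    rw [← h4.deriv, h5.deriv_eq]; simp
  have n1 : ∀ z ∈ HB r, z 1 = 0 → D u e1 z = 0 := fun z hz h1 => hn z hz.1 h1
  have n10 := htan s1 n1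
  have hsym : ∀ z ∈ HB r, D (D u e0) e1 z = D (D u e1) e0 z := by
    intro z hz
    have hs := (hu z hz).isSymmSndFDerivWithinAt (by rw [minSmoothness_of_isRCLikeNormedField]; norm_cast) ud (HB_cl hz) hz
    have hdd : DifferentiableWithinAt ℝ (fderivWithin ℝ u (HB r)) (HB r) z :=
      ((hu.fderivWithin ud (m := ∞) (by simp)).differentiableOn (by simp)) z hz
    have hk : ∀ v w, D (D u v) w z = fderivWithin ℝ (fderivWithin ℝ u (HB r)) (HB r) z w v := by
      intro v w
      have := hdd.hasFDerivWithinAt.clm_apply (hasFDerivWithinAt_const v z (HB r))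
      have h2 := this.fderivWithin (ud z hz)
      show fderivWithin ℝ (fun y => fderivWithin ℝ u (HB r) y v) (HB r) z w = _
      rw [h2]; simp
    rw [hk, hk]; exact hs e1 e0
  have n01 : ∀ z ∈ HB r, z 1 = 0 → D (D u e0) e1 z = 0 := fun z hz h1 => by rw [hsym z hz, n10 z hz h1]
  -- derivatives of the glued function
  have hB : ∀ y ∈ Metric.ball (0:E2) r, ‖y‖ < r := fun y hy => by simpa using hy
  have d1 : ∀ y ∈ Metric.ball (0:E2) r, HasFDerivAt (glue 1 u) (glue 1 (D u e0) y • P0 + glue (-1) (D u e1) y • P1) y :=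
    fun y hy => glue_diff (hDd hu) (fun z hz h1 => ⟨by simp, by simp, by rw [n1 z hz h1]; simp⟩) (hB y hy)
  have d2 : ∀ y ∈ Metric.ball (0:E2) r, HasFDerivAt (glue 1 (D u e0)) (glue 1 (D (D u e0) e0) y • P0 + glue (-1) (D (D u e0) e1) y • P1) y :=
    fun y hy => glue_diff (hDd s0) (fun z hz h1 => ⟨by simp, by simp, by rw [n01 z hz h1]; simp⟩) (hB y hy)
  have d3 : ∀ y ∈ Metric.ball (0:E2) r, HasFDerivAt (glue (-1) (D u e1)) (glue (-1) (D (D u e1) e0) y • P0 + glue (- -1) (D (D u e1) e1) y • P1) y :=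
    fun y hy => glue_diff (hDd s1) (fun z hz h1 => ⟨by rw [n1 z hz h1]; simp, by rw [n10 z hz h1]; simp, by simp⟩) (hB y hy)
  have c1 : ContDiffOn ℝ 1 (glue 1 (D u e0)) (Metric.ball (0:E2) r) := by
    have := C1_of (n := 0) Metric.isOpen_ball d2 (contDiffOn_zero.2 (glue_cont (hDs e0 s0).continuousOn (fun z _ _ => by simp)))
      (contDiffOn_zero.2 (glue_cont (hDs e1 s0).continuousOn (fun z hz h1 => by rw [n01 z hz h1]; simp)))
    simpa using this
  have c2 : ContDiffOn ℝ 1 (glue (-1) (D u e1)) (Metric.ball (0:E2) r) := by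
    have := C1_of (n := 0) Metric.isOpen_ball d3 (contDiffOn_zero.2 (glue_cont (hDs e0 s1).continuousOn (fun z hz h1 => by rw [n10 z hz h1]; simp)))
      (contDiffOn_zero.2 (glue_cont (hDs e1 s1).continuousOn (fun z hz h1 => by simp)))
    simpa using this
  have c3 : ContDiffOn ℝ 2 (glue 1 u) (Metric.ball (0:E2) r) := by
    have := C1_of (n := 1) Metric.isOpen_ball d1 c1 c2
    have e : ((1:ℕ∞) : WithTop ℕ∞) + 1 = 2 := by norm_num
    rwa [e] at this
  have c4 : ∀ y ∈ Metric.ball (0:E2) r, ContDiffAt ℝ 2 (glue 1 u) y := fun y hy => c3.contDiffAt (Metric.isOpen_ball.mem_nhds hy)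
  -- the equation
  have hpos : ∀ y ∈ Metric.ball (0:E2) r, 0 < y 1 → ContDiffAt ℝ 2 u y := fun y hy h1 =>
    ((hu.contDiffAt (HB_interior (hB y hy) h1))).of_le (by norm_cast)
  have eqp : ∀ y ∈ Metric.ball (0:E2) r, 0 < y 1 → lap (glue 1 u) y = - mu * glue 1 u y := by
    intro y hy h1
    have : glue 1 u =ᶠ[𝓝 y] u := by
      filter_upwards [(isOpen_lt continuous_const cont_c1).mem_nhds h1] with z hz
      exact glue_pos (le_of_lt hz)
    rw [lap_congr this, he y (hB y hy) h1, glue_pos h1.le]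
  have hev : ∀ y, glue 1 u (R1 y) = glue 1 u y := by
    intro y
    rcases le_total 0 (y 1) with h | h
    · rw [glue_neg (fun _ => by simp) (by simpa using h), R1_R1, one_mul, glue_pos h]
    · rw [glue_pos (by simpa using h), glue_neg (fun _ => by simp) h, one_mul]
  have eqn : ∀ y ∈ Metric.ball (0:E2) r, y 1 < 0 → lap (glue 1 u) y = - mu * glue 1 u y := by
    intro y hy h1
    have hRy : R1 y ∈ Metric.ball (0:E2) r := by simpa using hy
    have h2 := lap_comp_iso (u := glue 1 u) (p := y) 0 R1 (by simpa using c4 _ hRy)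
    simp only [zero_add, hev] at h2
    have e : (fun y => glue 1 u y) = glue 1 u := rfl
    rw [e] at h2
    rw [h2, eqp _ hRy (by simpa using h1), hev]
  have eq0 : ∀ y ∈ Metric.ball (0:E2) r, lap (glue 1 u) y = - mu * glue 1 u y := by
    intro y hy
    rcases lt_trichotomy (y 1) 0 with h | h | h
    · exact eqn y hy h
    · have hcl : ContinuousAt (fun z => lap (glue 1 u) z + mu * glue 1 u z) y := by
        have hcd : ∀ v : E2, ContinuousAt (fun z => mixedDeriv (glue 1 u) z v v) y := by
          intro v
          have : ContDiffAt ℝ 1 (fun z => fderiv ℝ (glue 1 u) z v) y :=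
            ((c4 y hy).fderiv_right (m := 1) (by norm_num)).clm_apply contDiffAt_const
          exact (this.fderiv_right (m := 0) (by norm_num)).continuousAt.clm_apply continuousAt_const
        exact ((hcd e0).add (hcd e1)).add (continuousAt_const.mul (c4 y hy).continuousAt)
      have hc : ContinuousAt (fun t : ℝ => y + t • e1) 0 := by fun_prop
      have ht : Tendsto (fun t : ℝ => y + t • e1) (𝓝[>] 0) (𝓝 y) := by
        have : Tendsto (fun t : ℝ => y + t • e1) (𝓝 0) (𝓝 y) := by simpa [ContinuousAt] using hc
        exact this.mono_left nhdsWithin_le_nhds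
      have h1 := hcl.tendsto.comp ht
      have h2 : Tendsto (fun _ : ℝ => (0:ℝ)) (𝓝[>] (0:ℝ)) (𝓝 0) := tendsto_const_nhds
      have h3 : (fun _ : ℝ => (0:ℝ)) =ᶠ[𝓝[>] (0:ℝ)] ((fun z => lap (glue 1 u) z + mu * glue 1 u z) ∘ fun t : ℝ => y + t • e1) := by
        filter_upwards [ht.eventually (Metric.isOpen_ball.mem_nhds hy), self_mem_nhdsWithin] with t htb ht0
        have := eqp _ htb (by simp [h]; exact ht0)
        simp only [Function.comp]
        rw [this]; ring
      have := tendsto_nhds_unique h1 (h2.congr' h3)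
      linarith
    · exact eqp y hy h
  intro y hy
  refine ⟨smooth_of_C2 hmu ?_ ?_, eq0 y hy⟩
  · filter_upwards [Metric.isOpen_ball.mem_nhds hy] with z hz using c4 z hz
  · filter_upwards [Metric.isOpen_ball.mem_nhds hy] with z hz using eq0 z hz

end

section
open Set Filter Topology MeasureTheory InnerProductSpace
open scoped ContDiff

def kap (a b : ℝ) : ℝ := 1 / √(1/a^2 + 1/b^2)

/-- inner unit normals of the sides of the standard triangle -/
def nu (a b : ℝ) (i : Fin 3) : E2 := ![e0, e1, -((kap a b / a) • e0 + (kap a b / b) • e1)] i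

def ell (a b : ℝ) (i : Fin 3) (z : E2) : ℝ := ![0, 0, kap a b] i + inner ℝ (nu a b i) z

lemma kap_pos {a b : ℝ} (ha : 0 < a) (_hb : 0 < b) : 0 < kap a b := by
  unfold kap; positivity

lemma kap_sq {a b : ℝ} (ha : 0 < a) (_hb : 0 < b) : kap a b ^2 * (1/a^2 + 1/b^2) = 1 := by
  unfold kap
  rw [div_pow, Real.sq_sqrt (by positivity)]
  field_simp

lemma ell0 (a b : ℝ) (z : E2) : ell a b 0 z = z 0 := by simp [ell, nu, inner_e0]
lemma ell1 (a b : ℝ) (z : E2) : ell a b 1 z = z 1 := by simp [ell, nu, inner_e1]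
lemma ell2 (a b : ℝ) (z : E2) : ell a b 2 z = kap a b * (1 - z 0 / a - z 1 / b) := by
  simp [ell, nu, inner_E2]; ring

lemma nu_norm {a b : ℝ} (ha : 0 < a) (hb : 0 < b) (i : Fin 3) : ‖nu a b i‖ = 1 := by
  fin_cases i
  · simp [nu, norm_e0]
  · simp [nu, norm_e1]
  · have : ‖nu a b 2‖^2 = 1 := by
      rw [normsq_E2]
      simp [nu]
      have := kap_sq ha hb
      field_simp at this ⊢
      linarith
    have h0 := norm_nonneg (nu a b 2)
    show ‖nu a b 2‖ = 1
    nlinarith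

lemma ell_add (a b : ℝ) (i : Fin 3) (p v : E2) : ell a b i (p + v) = ell a b i p + inner ℝ (nu a b i) v := by
  simp [ell, inner_add_right]; ring

lemma ell_sub (a b : ℝ) (i : Fin 3) (p z : E2) : ell a b i z = ell a b i p + inner ℝ (nu a b i) (z - p) := by
  rw [← ell_add]; congr 1; abel

lemma ell_lip {a b : ℝ} (ha : 0 < a) (hb : 0 < b) (i : Fin 3) (p z : E2) : |ell a b i z - ell a b i p| ≤ ‖z - p‖ := by
  rw [ell_sub a b i p z, add_sub_cancel_left]
  have := abs_real_inner_le_norm (nu a b i) (z - p)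
  rwa [nu_norm ha hb, one_mul] at this

lemma ell_cont (a b : ℝ) (i : Fin 3) : Continuous (ell a b i) := by
  unfold ell; fun_prop

def TD (a b : ℝ) : Set E2 := {z | (∀ i, 0 ≤ ell a b i z) ∧ ∀ i j, i ≠ j → 0 < ell a b i z + ell a b j z}
def TI (a b : ℝ) : Set E2 := {z | ∀ i, 0 < ell a b i z}

lemma ell_comb (a b : ℝ) (i : Fin 3) (x y : E2) (s t : ℝ) (h : s + t = 1) :
    ell a b i (s • x + t • y) = s * ell a b i x + t * ell a b i y := by
  simp only [ell, inner_add_right, inner_smul_right]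
  have : (![0, 0, kap a b] i : ℝ) = s * ![0, 0, kap a b] i + t * ![0, 0, kap a b] i := by rw [← add_mul, h, one_mul]
  linarith

lemma D_convex (a b : ℝ) : Convex ℝ (TD a b) := by
  intro x hx y hy s t hs ht hst
  refine ⟨fun i => ?_, fun i j hij => ?_⟩
  · rw [ell_comb _ _ _ _ _ _ _ hst]
    have := hx.1 i; have := hy.1 i; positivity
  · rw [ell_comb _ _ _ _ _ _ _ hst, ell_comb _ _ _ _ _ _ _ hst]
    have h1 := hx.2 i j hij; have h2 := hy.2 i j hij
    rcases hs.eq_or_lt with h | h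
    · have : t = 1 := by linarith
      subst this; rw [← h]; linarith
    · nlinarith [mul_pos h h1, mul_nonneg ht h2.le]

lemma Int_open (a b : ℝ) : IsOpen (TI a b) := by
  have : TI a b = ⋂ i, {z | 0 < ell a b i z} := by ext z; simp [TI]
  rw [this]
  exact isOpen_iInter_of_finite fun i => isOpen_lt continuous_const (ell_cont a b i)

lemma Int_sub (a b : ℝ) : TI a b ⊆ TD a b := fun z hz => ⟨fun i => (hz i).le, fun i j _ => add_pos (hz i) (hz j)⟩

def cen (a b : ℝ) : E2 := (a/3) • e0 + (b/3) • e1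

lemma cen_mem {a b : ℝ} (ha : 0 < a) (hb : 0 < b) : cen a b ∈ TI a b := by
  have hk := kap_pos ha hb
  intro i
  fin_cases i
  · show 0 < ell a b 0 _
    rw [ell0]; simp [cen]; positivity
  · show 0 < ell a b 1 _
    rw [ell1]; simp [cen]; positivity
  · show 0 < ell a b 2 _
    rw [ell2]; simp [cen]; apply mul_pos hk
    have h1 : a / 3 / a = 1/3 := by field_simp
    have h2 : b / 3 / b = 1/3 := by field_simp
    rw [h1, h2]; norm_num

lemma to_cen {a b : ℝ} (ha : 0 < a) (hb : 0 < b) {z : E2} (hz : ∀ i, 0 ≤ ell a b i z) {t : ℝ} (h0 : 0 < t) (h1 : t ≤ 1) :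
    (1 - t) • z + t • cen a b ∈ TI a b := by
  intro i
  rw [ell_comb _ _ _ _ _ _ _ (by ring)]
  have := mul_pos h0 (cen_mem ha hb i)
  have := mul_nonneg (sub_nonneg.2 h1) (hz i)
  linarith

lemma T_cl {a b : ℝ} (ha : 0 < a) (hb : 0 < b) {z : E2} (hz : ∀ i, 0 ≤ ell a b i z) : z ∈ closure (TI a b) := by
  have h : Tendsto (fun t : ℝ => (1 - t) • z + t • cen a b) (𝓝[>] 0) (𝓝 z) := by
    have : Continuous (fun t : ℝ => (1 - t) • z + t • cen a b) := by fun_prop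
    have := this.tendsto 0
    simp at this
    exact this.mono_left nhdsWithin_le_nhds
  refine mem_closure_of_tendsto h ?_
  filter_upwards [Ioc_mem_nhdsGT (show (0:ℝ) < 1 by norm_num)] with t ht
  exact to_cen ha hb hz ht.1 ht.2

lemma D_int {a b : ℝ} : TI a b ⊆ interior (TD a b) := interior_maximal (Int_sub a b) (Int_open a b)

lemma D_ud {a b : ℝ} (ha : 0 < a) (hb : 0 < b) : UniqueDiffOn ℝ (TD a b) :=
  uniqueDiffOn_convex (D_convex a b) ⟨_, D_int (cen_mem ha hb)⟩

lemma D_cl {a b : ℝ} (ha : 0 < a) (hb : 0 < b) {z : E2} (hz : z ∈ TD a b) : z ∈ closure (interior (TD a b)) :=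
  closure_mono D_int (T_cl ha hb hz.1)

lemma D_nhds {a b : ℝ} {z : E2} (hz : z ∈ TI a b) : TD a b ∈ 𝓝 z := mem_of_superset ((Int_open a b).mem_nhds hz) (Int_sub a b)

lemma ball_Int {a b r : ℝ} (ha : 0 < a) (hb : 0 < b) {p : E2} (h : ∀ i, r ≤ ell a b i p) : Metric.ball p r ⊆ TI a b := by
  intro z hz i
  rw [Metric.mem_ball, dist_eq_norm] at hz
  have h1 := abs_le.1 (ell_lip ha hb i p z)
  linarith [h i]

lemma side_loc {a b r : ℝ} (ha : 0 < a) (hb : 0 < b) {p : E2} {i : Fin 3} (h : ∀ j, j ≠ i → r ≤ ell a b j p) {z : E2}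
    (hz : ‖z - p‖ < r) : z ∈ TD a b ↔ 0 ≤ ell a b i z := by
  have hj : ∀ j, j ≠ i → 0 < ell a b j z := by
    intro j hj
    have h1 := abs_le.1 (ell_lip ha hb j p z)
    linarith [h j hj]
  constructor
  · exact fun hz => hz.1 i
  · intro h0
    have h0' : ∀ k, 0 ≤ ell a b k z := by
      intro k
      by_cases hk : k = i
      · rwa [hk]
      · exact (hj k hk).le
    refine ⟨h0', fun k l hkl => ?_⟩
    by_cases hk : k = i
    · have := hj l (by rintro rfl; exact hkl hk)
      linarith [h0' k]
    · have := hj k hk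
      linarith [h0' l]

lemma side_Int {a b r : ℝ} (ha : 0 < a) (hb : 0 < b) {p : E2} {i : Fin 3} (h : ∀ j, j ≠ i → r ≤ ell a b j p) {z : E2}
    (hz : ‖z - p‖ < r) (h0 : 0 < ell a b i z) : z ∈ TI a b := by
  intro j
  by_cases hk : j = i
  · rwa [hk]
  · have h1 := abs_le.1 (ell_lip ha hb j p z)
    linarith [h j hk]

lemma side_rad {a b : ℝ} {p : E2} (hp : p ∈ TD a b) {i : Fin 3} (hi : ell a b i p = 0) : ∃ r > (0:ℝ), ∀ j, j ≠ i → r ≤ ell a b j p := by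
  have hpos : ∀ j, j ≠ i → 0 < ell a b j p := fun j hj => by have := hp.2 i j hj.symm; linarith
  have : ∃ r > (0:ℝ), ∀ j ∈ (Finset.univ.filter (fun j => j ≠ i)), r ≤ ell a b j p := by
    have hne : (Finset.univ.filter (fun j : Fin 3 => j ≠ i)).Nonempty := by
      fin_cases i
      · exact ⟨1, by simp⟩
      · exact ⟨0, by simp⟩
      · exact ⟨0, by simp⟩
    obtain ⟨m, hm, h⟩ := Finset.exists_min_image _ (fun j => ell a b j p) hne
    exact ⟨_, hpos m (by simpa using hm), fun j hj => h j hj⟩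
  obtain ⟨r, h0, h⟩ := this
  exact ⟨r, h0, fun j hj => h j (by simpa using hj)⟩

lemma D_cases {a b : ℝ} {p : E2} (hp : p ∈ TD a b) : p ∈ TI a b ∨ ∃ i, ell a b i p = 0 := by
  by_cases h : ∃ i, ell a b i p = 0
  · exact Or.inr h
  · push Not at h
    exact Or.inl fun i => lt_of_le_of_ne (hp.1 i) (Ne.symm (h i))

lemma Tst_iff {a b : ℝ} (ha : 0 < a) (hb : 0 < b) (z : E2) : z ∈ Tst a b ↔ ∀ i, 0 ≤ ell a b i z := by
  rw [Fin.forall_fin_succ, Fin.forall_fin_succ, Fin.forall_fin_one]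
  show z ∈ Tst a b ↔ 0 ≤ ell a b 0 z ∧ 0 ≤ ell a b 1 z ∧ 0 ≤ ell a b 2 z
  rw [ell0, ell1, ell2]
  have hk := kap_pos ha hb
  simp only [Tst, mem_ofPred_eq]
  have : 0 ≤ kap a b * (1 - z 0 / a - z 1 / b) ↔ z 0 / a + z 1 / b ≤ 1 := by
    rw [mul_nonneg_iff_of_pos_left hk]; constructor <;> intro h <;> linarith
  rw [this]

lemma Tst_closed {a b : ℝ} (ha : 0 < a) (hb : 0 < b) : IsClosed (Tst a b) := by
  have : Tst a b = ⋂ i, {z | 0 ≤ ell a b i z} := by ext z; rw [Tst_iff ha hb]; simp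
  rw [this]
  exact isClosed_iInter fun i => isClosed_le continuous_const (ell_cont a b i)

lemma D_sub_T {a b : ℝ} (ha : 0 < a) (hb : 0 < b) : TD a b ⊆ Tst a b := fun z hz => (Tst_iff ha hb z).2 hz.1

lemma Tst_interior {a b : ℝ} (ha : 0 < a) (hb : 0 < b) : interior (Tst a b) = TI a b := by
  apply Subset.antisymm
  · intro z hz i
    by_contra hn
    have hz0 := (Tst_iff ha hb z).1 (interior_subset hz) i
    have h0 : ell a b i z = 0 := le_antisymm (not_lt.1 hn) hz0
    obtain ⟨r, hr, hb'⟩ := Metric.isOpen_iff.1 isOpen_interior z hz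
    have h2 : z + (-(r/2)) • nu a b i ∈ Tst a b := by
      apply interior_subset; apply hb'
      rw [Metric.mem_ball, dist_eq_norm, add_sub_cancel_left, norm_smul, nu_norm ha hb, Real.norm_eq_abs, abs_neg, abs_of_pos (by positivity)]
      linarith
    have h3 := (Tst_iff ha hb _).1 h2 i
    rw [ell_add, h0, inner_smul_right, real_inner_self_eq_norm_sq, nu_norm ha hb] at h3
    linarith
  · exact interior_maximal (fun z hz => (Tst_iff ha hb z).2 fun i => (hz i).le) (Int_open a b)

lemma Tst_bdd {a b : ℝ} (ha : 0 < a) (hb : 0 < b) {z : E2} (hz : z ∈ Tst a b) : ‖z‖ ≤ a + b := by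
  obtain ⟨h0, h1, h2⟩ := hz
  have hx : z 0 ≤ a := by
    have : z 0 / a ≤ 1 := by have : 0 ≤ z 1 / b := by positivity
                             linarith
    rwa [div_le_one ha] at this
  have hy : z 1 ≤ b := by
    have : z 1 / b ≤ 1 := by have : 0 ≤ z 0 / a := by positivity
                             linarith
    rwa [div_le_one hb] at this
  apply abs_le_of_sq_le_sq' _ (by positivity) |>.2
  rw [normsq_E2]; nlinarith

lemma Tst_compact {a b : ℝ} (ha : 0 < a) (hb : 0 < b) : IsCompact (Tst a b) :=
  (isCompact_closedBall (0:E2) (a+b)).of_isClosed_subset (Tst_closed ha hb) fun z hz => by simpa using Tst_bdd ha hb hz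

/-- vertices of the standard triangle -/
def Vx (a b : ℝ) : Set E2 := {0, a • e0, b • e1}

lemma D_eq {a b : ℝ} (ha : 0 < a) (hb : 0 < b) : TD a b = Tst a b \ Vx a b := by
  have hk := kap_pos ha hb
  ext z
  constructor
  · intro hz
    refine ⟨D_sub_T ha hb hz, ?_⟩
    rintro (rfl | rfl | rfl)
    · have := hz.2 0 1 (by simp); rw [ell0, ell1] at this; simp at this
    · have := hz.2 1 2 (by simp); rw [ell1, ell2] at this; simp [ha.ne'] at this
    · have := hz.2 0 2 (by simp); rw [ell0, ell2] at this; simp [hb.ne'] at this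
  · rintro ⟨hz, hv⟩
    have hz' := (Tst_iff ha hb z).1 hz
    refine ⟨hz', ?_⟩
    have h01 : 0 < ell a b 0 z + ell a b 1 z := by
      by_contra hn
      apply hv; left
      have h0 := hz' 0; have h1 := hz' 1
      rw [ell0] at h0; rw [ell1] at h1; rw [ell0, ell1] at hn
      apply E2_ext <;> simp <;> linarith
    have h12 : 0 < ell a b 1 z + ell a b 2 z := by
      by_contra hn
      apply hv; right; left
      have h0 := hz' 1; have h1 := hz' 2
      have e1' : z 1 = 0 := by rw [← ell1 a b]; linarith
      have e2' : ell a b 2 z = 0 := by linarith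
      rw [ell2, e1'] at e2'
      simp only [zero_div, sub_zero] at e2'
      have : z 0 = a := by
        have := (mul_eq_zero.1 e2').resolve_left hk.ne'
        field_simp at this; linarith
      apply E2_ext <;> simp [this, e1']
    have h02 : 0 < ell a b 0 z + ell a b 2 z := by
      by_contra hn
      apply hv; right; right
      have h0 := hz' 0; have h1 := hz' 2
      have e1' : z 0 = 0 := by rw [← ell0 a b]; linarith
      have e2' : ell a b 2 z = 0 := by linarith
      rw [ell2, e1'] at e2'
      simp only [zero_div, sub_zero] at e2'
      have : z 1 = b := by
        have := (mul_eq_zero.1 e2').resolve_left hk.ne'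
        field_simp at this; linarith
      apply E2_ext <;> simp [this, e1']
    intro i j hij
    fin_cases i <;> fin_cases j <;> first | exact absurd rfl hij | assumption | (rw [add_comm]; assumption)

end

section
open Set Filter Topology MeasureTheory InnerProductSpace
open scoped ContDiff

structure Eig (a b mu : ℝ) (u : E2 → ℝ) : Prop where
  pos : 0 < mu
  nonconst : ¬ ∃ c : ℝ, ∀ z ∈ Tst a b, u z = c
  cont : ContinuousOn u (Tst a b)
  smooth : ContDiffOn ℝ ∞ u (TD a b)
  eqn : ∀ p ∈ TI a b, lap u p = - mu * u p
  neu : ∀ p ∈ TD a b, ∀ i, ell a b i p = 0 → fderivWithin ℝ u (TD a b) p (nu a b i) = 0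

structure Adm (a b : ℝ) (w1 w2 : E2 → ℝ) : Prop where
  s1 : ContDiffOn ℝ ∞ w1 (TD a b)
  s2 : ContDiffOn ℝ ∞ w2 (TD a b)
  x1 : ∀ p ∈ TD a b, ell a b 0 p = 0 → w1 p = 0
  x2 : ∀ p ∈ TD a b, ell a b 0 p = 0 → fderivWithin ℝ w2 (TD a b) p (nu a b 0) = 0
  y1 : ∀ p ∈ TD a b, ell a b 1 p = 0 → w2 p = 0
  y2 : ∀ p ∈ TD a b, ell a b 1 p = 0 → fderivWithin ℝ w1 (TD a b) p (nu a b 1) = 0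
  h1 : ∀ p ∈ TD a b, ell a b 2 p = 0 → b * w1 p = a * w2 p
  h2 : ∀ p ∈ TD a b, ell a b 2 p = 0 → a * fderivWithin ℝ w1 (TD a b) p (nu a b 2) + b * fderivWithin ℝ w2 (TD a b) p (nu a b 2) = 0

lemma smooth_diff {a b : ℝ} {w : E2 → ℝ} (h : ContDiffOn ℝ ∞ w (TD a b)) {p : E2} (hp : p ∈ TD a b) :
    DifferentiableWithinAt ℝ w (TD a b) p := h.differentiableOn (by simp) p hp

lemma fdw_comb {a b : ℝ} (ha : 0 < a) (hb : 0 < b) {w v : E2 → ℝ} (hw : ContDiffOn ℝ ∞ w (TD a b)) (hv : ContDiffOn ℝ ∞ v (TD a b))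
    {p : E2} (hp : p ∈ TD a b) (c d : ℝ) (n : E2) : fderivWithin ℝ (fun z => c * w z + d * v z) (TD a b) p n =
      c * fderivWithin ℝ w (TD a b) p n + d * fderivWithin ℝ v (TD a b) p n := by
  have h := (((smooth_diff hw hp).hasFDerivWithinAt.const_mul c).add ((smooth_diff hv hp).hasFDerivWithinAt.const_mul d))
  have h2 := h.fderivWithin (D_ud ha hb p hp)
  have h3 : fderivWithin ℝ (fun z => c * w z + d * v z) (TD a b) p = _ := h2
  rw [h3]; simp

lemma Adm.comb {a b : ℝ} (ha : 0 < a) (hb : 0 < b) {w1 w2 v1 v2 : E2 → ℝ} (hw : Adm a b w1 w2) (hv : Adm a b v1 v2) (c d : ℝ) :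
    Adm a b (fun z => c * w1 z + d * v1 z) (fun z => c * w2 z + d * v2 z) where
  s1 := (contDiffOn_const.mul hw.s1).add (contDiffOn_const.mul hv.s1)
  s2 := (contDiffOn_const.mul hw.s2).add (contDiffOn_const.mul hv.s2)
  x1 p hp h := by simp [hw.x1 p hp h, hv.x1 p hp h]
  x2 p hp h := by rw [fdw_comb ha hb hw.s2 hv.s2 hp, hw.x2 p hp h, hv.x2 p hp h]; simp
  y1 p hp h := by simp [hw.y1 p hp h, hv.y1 p hp h]
  y2 p hp h := by rw [fdw_comb ha hb hw.s1 hv.s1 hp, hw.y2 p hp h, hv.y2 p hp h]; simp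
  h1 p hp h := by linear_combination c * hw.h1 p hp h + d * hv.h1 p hp h
  h2 p hp h := by
    rw [fdw_comb ha hb hw.s1 hv.s1 hp, fdw_comb ha hb hw.s2 hv.s2 hp]
    linear_combination c * hw.h2 p hp h + d * hv.h2 p hp h

lemma dir_deriv {a b : ℝ} {w : E2 → ℝ} {p n : E2} (hw : DifferentiableWithinAt ℝ w (TD a b) p) {S : Set ℝ}
    (hm : ∀ t ∈ S, p + t • n ∈ TD a b) : HasDerivWithinAt (fun t : ℝ => w (p + t • n)) (fderivWithin ℝ w (TD a b) p n) S 0 := by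
  have hl : HasDerivAt (fun t : ℝ => p + t • n) n 0 := by
    have := ((hasDerivAt_id (0:ℝ)).smul_const n).const_add p
    exact this.congr_deriv (by simp)
  have h1 : HasFDerivWithinAt w (fderivWithin ℝ w (TD a b) p) (TD a b) (p + (0:ℝ) • n) := by simpa using hw.hasFDerivWithinAt
  exact h1.comp_hasDerivWithinAt (0:ℝ) (hl.hasDerivWithinAt (s := S)) hm

lemma dir_ge {a b k : ℝ} {w : E2 → ℝ} {p n : E2} (hw : DifferentiableWithinAt ℝ w (TD a b) p)
    (h : ∀ᶠ t in 𝓝[>] (0:ℝ), p + t • n ∈ TD a b ∧ w p + k * t ≤ w (p + t • n)) : k ≤ fderivWithin ℝ w (TD a b) p n := by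
  obtain ⟨δ, hδ, hm⟩ := mem_nhdsGT_iff_exists_Ioo_subset.1 h
  have hd := dir_deriv hw (S := Ioo 0 δ) (n := n) fun t ht => (hm ht).1
  rw [hasDerivWithinAt_iff_tendsto_slope' (by simp)] at hd
  have : (𝓝[Ioo 0 δ] (0:ℝ)).NeBot := by
    rw [nhdsWithin_Ioo_eq_nhdsGT hδ]; infer_instance
  refine ge_of_tendsto hd ?_
  filter_upwards [self_mem_nhdsWithin] with t ht
  have h2 := (hm ht).2
  rw [slope_def_field, le_div_iff₀ (by linarith [ht.1])]
  simp; linarith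

lemma in_ev {a b : ℝ} (ha : 0 < a) (hb : 0 < b) {p : E2} (hp : p ∈ TD a b) {i : Fin 3} (hi : ell a b i p = 0) :
    ∀ᶠ t in 𝓝[>] (0:ℝ), p + t • nu a b i ∈ TI a b := by
  obtain ⟨r, hr, h⟩ := side_rad hp hi
  filter_upwards [Ioo_mem_nhdsGT hr] with t ht
  apply side_Int ha hb h
  · rw [add_sub_cancel_left, norm_smul, nu_norm ha hb, Real.norm_eq_abs, abs_of_pos ht.1]; linarith [ht.2]
  · rw [ell_add, hi, inner_smul_right, real_inner_self_eq_norm_sq, nu_norm ha hb]; simpa using ht.1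

lemma hess {a b : ℝ} (ha : 0 < a) (hb : 0 < b) {u : E2 → ℝ} (hu : ContDiffOn ℝ ∞ u (TD a b)) {p : E2} (hp : p ∈ TD a b) (v w : E2) :
    fderivWithin ℝ (fun z => fderivWithin ℝ u (TD a b) z v) (TD a b) p w =
      fderivWithin ℝ (fderivWithin ℝ u (TD a b)) (TD a b) p w v := by
  have ud := D_ud ha hb
  have hdd : DifferentiableWithinAt ℝ (fderivWithin ℝ u (TD a b)) (TD a b) p :=
      ((hu.fderivWithin ud (m := ∞) (by simp)).differentiableOn (by simp)) p hp
  have := hdd.hasFDerivWithinAt.clm_apply (hasFDerivWithinAt_const v p (TD a b))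
  rw [this.fderivWithin (ud p hp)]
  simp

lemma hess_symm {a b : ℝ} (ha : 0 < a) (hb : 0 < b) {u : E2 → ℝ} (hu : ContDiffOn ℝ ∞ u (TD a b)) {p : E2} (hp : p ∈ TD a b) (v w : E2) :
    fderivWithin ℝ (fderivWithin ℝ u (TD a b)) (TD a b) p w v = fderivWithin ℝ (fderivWithin ℝ u (TD a b)) (TD a b) p v w :=
  (hu p hp).isSymmSndFDerivWithinAt (by rw [minSmoothness_of_isRCLikeNormedField]; norm_cast) (D_ud ha hb) (D_cl ha hb hp) hp w v

lemma grad_smooth {a b : ℝ} (ha : 0 < a) (hb : 0 < b) {u : E2 → ℝ} (hu : ContDiffOn ℝ ∞ u (TD a b)) (v : E2) :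
    ContDiffOn ℝ ∞ (fun z => fderivWithin ℝ u (TD a b) z v) (TD a b) :=
  (hu.fderivWithin (D_ud ha hb) (m := ∞) (by simp)).clm_apply contDiffOn_const

lemma Eig.mixed {a b mu : ℝ} (ha : 0 < a) (hb : 0 < b) {u : E2 → ℝ} (hu : Eig a b mu u) {p : E2} (hp : p ∈ TD a b) {i : Fin 3}
    (hi : ell a b i p = 0) {t : E2} (ht : inner ℝ (nu a b i) t = 0) :
    fderivWithin ℝ (fderivWithin ℝ u (TD a b)) (TD a b) p (nu a b i) t = 0 := by
  rw [hess_symm ha hb hu.smooth hp, ← hess ha hb hu.smooth hp]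
  obtain ⟨r, hr, h⟩ := side_rad hp hi
  have hcc : ContinuousAt (fun s : ℝ => ‖s • t‖) 0 := by fun_prop
  have h2 := hcc.eventually (gt_mem_nhds (show ‖(0:ℝ) • t‖ < r by simpa using hr))
  set S : Set ℝ := {s | ‖s • t‖ < r} with hS
  have hSn : S ∈ 𝓝 (0:ℝ) := h2
  have hl : ∀ s : ℝ, ell a b i (p + s • t) = 0 := fun s => by rw [ell_add, hi, inner_smul_right, ht]; simp
  have hmem : ∀ s ∈ S, p + s • t ∈ TD a b := fun s hs =>
    (side_loc ha hb h (by rw [add_sub_cancel_left]; exact hs)).2 (by rw [hl])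
  have h3 := (dir_deriv (smooth_diff (grad_smooth ha hb hu.smooth (nu a b i)) hp) hmem).hasDerivAt hSn
  have h5 : (fun s : ℝ => fderivWithin ℝ u (TD a b) (p + s • t) (nu a b i)) =ᶠ[𝓝 0] fun _ => 0 := by
    filter_upwards [hSn] with s hs
    exact hu.neu _ (hmem s hs) i (hl s)
  rw [← h3.deriv, h5.deriv_eq]; simp

lemma nu2_eq (a b : ℝ) : nu a b 2 = -((kap a b / a) • e0 + (kap a b / b) • e1) := rfl

lemma Eig.adm {a b mu : ℝ} (ha : 0 < a) (hb : 0 < b) {u : E2 → ℝ} (hu : Eig a b mu u) :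
    Adm a b (fun z => fderivWithin ℝ u (TD a b) z e0) (fun z => fderivWithin ℝ u (TD a b) z (-e1)) where
  s1 := grad_smooth ha hb hu.smooth e0
  s2 := grad_smooth ha hb hu.smooth (-e1)
  x1 p hp h := hu.neu p hp 0 h
  x2 p hp h := by
    rw [hess ha hb hu.smooth hp]
    exact hu.mixed ha hb hp h (by show (inner ℝ e0 (-e1) : ℝ) = 0; rw [inner_e0]; simp)
  y1 p hp h := by
    have := hu.neu p hp 1 h
    rw [map_neg, neg_eq_zero]; exact this
  y2 p hp h := by
    rw [hess ha hb hu.smooth hp]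
    exact hu.mixed ha hb hp h (by show (inner ℝ e1 e0 : ℝ) = 0; rw [inner_e1]; simp)
  h1 p hp h := by
    have hk := kap_pos ha hb
    have := hu.neu p hp 2 h
    rw [nu2_eq, map_neg, map_add, map_smul, map_smul, neg_eq_zero] at this
    rw [map_neg]
    simp only [smul_eq_mul] at this
    field_simp at this
    rw [mul_zero] at this
    have := (mul_eq_zero.1 this).resolve_left hk.ne'
    linarith
  h2 p hp h := by
    rw [hess ha hb hu.smooth hp, hess ha hb hu.smooth hp]
    have := hu.mixed ha hb hp h (t := a • e0 + b • (-e1)) (by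
      rw [nu2_eq, inner_E2]; simp; field_simp; ring)
    rw [map_add, map_smul, map_smul] at this
    exact this

lemma fdw_int {a b : ℝ} {u : E2 → ℝ} {p : E2} (hp : p ∈ TI a b) : fderivWithin ℝ u (TD a b) p = fderiv ℝ u p :=
  fderivWithin_of_mem_nhds (D_nhds hp)

lemma Eig.lap_grad {a b mu : ℝ} {u : E2 → ℝ} (hu : Eig a b mu u) (v : E2) {p : E2} (hp : p ∈ TI a b) :
    lap (fun z => fderivWithin ℝ u (TD a b) z v) p = - mu * fderivWithin ℝ u (TD a b) p v := by
  have hn := (Int_open a b).mem_nhds hp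
  have h1 : (fun z => fderivWithin ℝ u (TD a b) z v) =ᶠ[𝓝 p] fun z => fderiv ℝ u z v := by
    filter_upwards [hn] with z hz
    rw [fdw_int hz]
  rw [lap_congr h1, lap_fderiv ((hu.smooth p (Int_sub a b hp)).contDiffAt (D_nhds hp)), fdw_int hp]
  have h2 : lap u =ᶠ[𝓝 p] fun z => - mu * u z := by
    filter_upwards [hn] with z hz
    exact hu.eqn z hz
  have hd : DifferentiableAt ℝ u p := ((hu.smooth p (Int_sub a b hp)).contDiffAt (D_nhds hp)).differentiableAt (by simp)
  rw [h2.fderiv_eq, fderiv_const_mul hd]; simp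

end

section
open Set Filter Topology MeasureTheory InnerProductSpace
open scoped ContDiff

lemma inv_radial {q p : E2} (hp : p ≠ q) : ContDiffAt ℝ 2 (fun z : E2 => (‖z - q‖^2)⁻¹) p ∧
    lap (fun z : E2 => (‖z - q‖^2)⁻¹) p = 4 * ((‖p - q‖^2)⁻¹)^2 := by
  have h0 : ‖p - q‖^2 ≠ 0 := by simpa [sub_eq_zero] using hp
  constructor
  · exact ((contDiff_radial q).contDiffAt.of_le (by norm_cast)).inv h0
  · have hd : ∀ s : ℝ, s ≠ 0 → HasDerivAt (fun s : ℝ => s⁻¹) (-(s^2)⁻¹) s := fun s hs => hasDerivAt_inv hs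
    have h2 : HasDerivAt (fun s : ℝ => -(s^2)⁻¹) (2 * ((‖p - q‖^2)⁻¹)^3) (‖p - q‖^2) := by
      have := ((hasDerivAt_pow 2 (‖p - q‖^2)).inv (pow_ne_zero 2 h0)).neg
      refine this.congr_deriv ?_
      generalize ‖p - q‖^2 = s at h0
      field_simp; norm_num; ring
    have := lap_radial (f := fun s => s⁻¹) (f1 := fun s => -(s^2)⁻¹) (q := q) (p := p)
      (by filter_upwards [isOpen_ne.mem_nhds h0] with s hs using hd s hs) h2
    rw [this]; field_simp; ring

lemma barrier {h : E2 → ℝ} {q : E2} {R : ℝ} (hR : 0 < R) (hc : ContinuousOn h (Metric.closedBall q R))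
    (hs : ∀ z ∈ Metric.ball q R, ContDiffAt ℝ 2 h z ∧ lap h z ≤ 0) (h0 : ∀ z ∈ Metric.closedBall q R, 0 ≤ h z) (hq : 0 < h q) :
    ∃ ε > (0:ℝ), ∀ z ∈ Metric.closedBall q R, ε * (R^2 - ‖z - q‖^2) ≤ h z := by
  set m := h q / 2 with hm
  have hm0 : 0 < m := by positivity
  have hcq : ContinuousAt h q := hc.continuousAt (Metric.closedBall_mem_nhds q hR)
  obtain ⟨δ', hδ', hd⟩ := Metric.eventually_nhds_iff.1 (hcq.eventually (lt_mem_nhds (show m < h q by rw [hm]; linarith)))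
  set δ := min (δ'/2) (R/2) with hδ
  have hδ0 : 0 < δ := by positivity
  have hδR : δ < R := lt_of_le_of_lt (min_le_right _ _) (by linarith)
  have hin : ∀ z, ‖z - q‖ ≤ δ → m ≤ h z := fun z hz => (hd (by
    rw [dist_eq_norm]; have := min_le_left (δ'/2) (R/2); linarith)).le
  set ψ : E2 → ℝ := fun z => (‖z - q‖^2)⁻¹ - (R^2)⁻¹ with hψ
  set e := m * δ^2 with he
  have he0 : 0 < e := by positivity
  have claim : ∀ z, δ ≤ ‖z - q‖ → ‖z - q‖ ≤ R → e * ψ z ≤ h z := by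
    set K : Set E2 := {z | δ ≤ ‖z - q‖ ∧ ‖z - q‖ ≤ R} with hK
    have hKc : IsCompact K := by
      refine (isCompact_closedBall q R).of_isClosed_subset ?_ fun z hz => by rw [Metric.mem_closedBall, dist_eq_norm]; exact hz.2
      have i1 : IsClosed {z : E2 | δ ≤ ‖z - q‖} := isClosed_le continuous_const (by fun_prop)
      have i2 : IsClosed {z : E2 | ‖z - q‖ ≤ R} := isClosed_le (by fun_prop) continuous_const
      exact i1.inter i2
    have hne : ∀ z ∈ K, ‖z - q‖^2 ≠ 0 := fun z hz => pow_ne_zero 2 (lt_of_lt_of_le hδ0 hz.1).ne'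
    have hψc : ContinuousOn ψ K := by
      apply ContinuousOn.sub _ continuousOn_const
      exact ContinuousOn.inv₀ (by fun_prop) hne
    intro z hz1 hz2
    obtain ⟨x, hx, hmin⟩ := hKc.exists_isMinOn ⟨z, hz1, hz2⟩ ((hc.mono fun z hz => by
      rw [Metric.mem_closedBall, dist_eq_norm]; exact hz.2).sub (hψc.const_smul e))
    have hzx := hmin (show z ∈ K from ⟨hz1, hz2⟩)
    simp only [mem_ofPred_eq, smul_eq_mul, Pi.sub_apply, Pi.smul_apply] at hzx
    suffices 0 ≤ h x - e * ψ x by linarith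
    rcases hx.1.eq_or_lt with h1 | h1
    · have := hin x h1.symm.le
      have h2 : e * ψ x ≤ m := by
        rw [hψ]; simp only; rw [← h1, he]
        have : m * δ^2 * ((δ^2)⁻¹ - (R^2)⁻¹) = m - m * δ^2 * (R^2)⁻¹ := by field_simp
        rw [this]
        have : 0 ≤ m * δ^2 * (R^2)⁻¹ := by positivity
        linarith
      linarith
    rcases hx.2.eq_or_lt with h2 | h2
    · have := h0 x (by rw [Metric.mem_closedBall, dist_eq_norm]; exact hx.2)
      have h3 : ψ x = 0 := by rw [hψ]; simp [h2]
      rw [h3]; linarith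
    · exfalso
      have hxq : x ≠ q := by rintro rfl; simp at h1; linarith
      have hxb : x ∈ Metric.ball q R := by rw [Metric.mem_ball, dist_eq_norm]; exact h2
      obtain ⟨c1, l1⟩ := hs x hxb
      obtain ⟨c2, l2⟩ := inv_radial hxq
      have c3 : ContDiffAt ℝ 2 ψ x := c2.sub contDiffAt_const
      have l3 : lap ψ x = 4 * ((‖x - q‖^2)⁻¹)^2 := by rw [hψ, lap_sub c2 contDiffAt_const, lap_const, l2, sub_zero]
      have hKn : K ∈ 𝓝 x := by
        have o1 : IsOpen {z : E2 | δ < ‖z - q‖} := isOpen_lt continuous_const (by fun_prop)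
        have o2 : IsOpen {z : E2 | ‖z - q‖ < R} := isOpen_lt (by fun_prop) continuous_const
        filter_upwards [o1.mem_nhds h1, o2.mem_nhds h2] with z ha hb
        exact ⟨le_of_lt ha, le_of_lt hb⟩
      have hlm : IsLocalMin (fun z => h z - e * ψ z) x := by
        filter_upwards [hKn] with z hz
        have := hmin hz
        simpa using this
      have c4 : ContDiffAt ℝ 2 (fun z => e * ψ z) x := contDiffAt_const.mul c3
      have := lap_min (c1.sub c4) hlm
      have e1 : lap (fun z => h z - e * ψ z) x = lap h x - e * lap ψ x := by rw [lap_sub c1 c4, lap_const_mul _ c3]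
      rw [e1, l3] at this
      have hp : 0 < (‖x - q‖^2)⁻¹ := by have : 0 < ‖x - q‖ := by linarith
                                        positivity
      have : 0 < e * (4 * ((‖x - q‖^2)⁻¹)^2) := by positivity
      linarith
  refine ⟨min (e / R^4) (m / R^2), by positivity, fun z hz => ?_⟩
  rw [Metric.mem_closedBall, dist_eq_norm] at hz
  have hRs : 0 ≤ R^2 - ‖z - q‖^2 := by nlinarith [norm_nonneg (z - q)]
  by_cases hzd : ‖z - q‖ ≤ δ
  · calc _ ≤ (m / R^2) * (R^2 - ‖z - q‖^2) := mul_le_mul_of_nonneg_right (min_le_right _ _) hRs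
      _ ≤ (m / R^2) * R^2 := mul_le_mul_of_nonneg_left (by nlinarith [norm_nonneg (z - q)]) (by positivity)
      _ = m := by field_simp
      _ ≤ _ := hin z hzd
  · push Not at hzd
    refine le_trans ?_ (claim z hzd.le hz)
    have hzp : 0 < ‖z - q‖^2 := by have : 0 < ‖z - q‖ := by linarith
                                   positivity
    have hle : ‖z - q‖^2 ≤ R^2 := by linarith
    calc _ ≤ (e / R^4) * (R^2 - ‖z - q‖^2) := mul_le_mul_of_nonneg_right (min_le_left _ _) hRs
      _ ≤ e * ψ z := by
        have : ψ z = (R^2 - ‖z - q‖^2) / (‖z - q‖^2 * R^2) := by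
          have hz' : ‖z - q‖ ≠ 0 := by
            intro h'
            rw [h'] at hzp; simp at hzp
          rw [hψ]; field_simp
        rw [this, div_mul_eq_mul_div, mul_div_assoc]
        apply mul_le_mul_of_nonneg_left _ he0.le
        apply div_le_div_of_nonneg_left hRs (by positivity)
        nlinarith [sq_nonneg R]

lemma TI_C2 {a b : ℝ} {w : E2 → ℝ} (hw : ContDiffOn ℝ ∞ w (TD a b)) {p : E2} (hp : p ∈ TI a b) : ContDiffAt ℝ 2 w p :=
  ((hw p (Int_sub a b hp)).contDiffAt (D_nhds hp)).of_le (by norm_cast)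

lemma TI_convex (a b : ℝ) : Convex ℝ (TI a b) := by
  intro x hx y hy s t hs ht hst i
  rw [ell_comb _ _ _ _ _ _ _ hst]
  have h1 := hx i; have h2 := hy i
  rcases hs.eq_or_lt with h | h
  · have : t = 1 := by linarith
    subst this; rw [← h]; linarith
  · nlinarith [mul_pos h h1, mul_nonneg ht h2.le]

lemma strong_max {a b : ℝ} {w : E2 → ℝ} (hw : ContDiffOn ℝ ∞ w (TD a b)) (h0 : ∀ z ∈ TD a b, 0 ≤ w z)
    (hl : ∀ z ∈ TI a b, lap w z ≤ 0) {q : E2} (hq : q ∈ TI a b) (hq0 : 0 < w q) : ∀ z ∈ TI a b, 0 < w z := by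
  set U : Set E2 := {z | z ∈ TI a b ∧ 0 < w z} with hU
  have hUo : IsOpen U := by
    rw [isOpen_iff_mem_nhds]
    rintro z ⟨hz, hz0⟩
    filter_upwards [(Int_open a b).mem_nhds hz, (TI_C2 hw hz).continuousAt.eventually (lt_mem_nhds hz0)] with y h1 h2
    exact ⟨h1, h2⟩
  have := (TI_convex a b).isPreconnected.subset_of_closure_inter_subset hUo ⟨q, hq, hq, hq0⟩ ?_
  · exact fun z hz => (this hz).2
  rintro z ⟨hzc, hz⟩
  refine ⟨hz, ?_⟩
  obtain ⟨r, hr, hrb⟩ := Metric.isOpen_iff.1 (Int_open a b) z hz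
  obtain ⟨y, hy, hyz⟩ := Metric.mem_closure_iff.1 hzc (r/3) (by positivity)
  have hsub : Metric.closedBall y (r/3) ⊆ TI a b := by
    intro x hx
    apply hrb
    rw [Metric.mem_closedBall] at hx
    rw [Metric.mem_ball]
    have := dist_triangle x y z
    rw [dist_comm] at hyz
    linarith
  obtain ⟨ε, hε, hb⟩ := barrier (h := w) (q := y) (R := r/3) (by positivity)
    (fun x hx => (TI_C2 hw (hsub hx)).continuousAt.continuousWithinAt)
    (fun x hx => ⟨TI_C2 hw (hsub (Metric.ball_subset_closedBall hx)), hl x (hsub (Metric.ball_subset_closedBall hx))⟩)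
    (fun x hx => h0 x (Int_sub a b (hsub hx))) hy.2
  have h1 := hb z (by rw [Metric.mem_closedBall]; exact hyz.le)
  rw [dist_eq_norm] at hyz
  have : 0 < ε * ((r/3)^2 - ‖z - y‖^2) := by
    apply mul_pos hε
    nlinarith [norm_nonneg (z - y)]
  linarith

lemma hopf {a b : ℝ} (ha : 0 < a) (hb : 0 < b) {w : E2 → ℝ} (hw : ContDiffOn ℝ ∞ w (TD a b)) (h0 : ∀ z ∈ TD a b, 0 ≤ w z)
    (hl : ∀ z ∈ TI a b, lap w z ≤ 0) (hpos : ∀ z ∈ TI a b, 0 < w z) {p : E2} (hp : p ∈ TD a b) {i : Fin 3} (hi : ell a b i p = 0)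
    (hwp : w p = 0) : 0 < fderivWithin ℝ w (TD a b) p (nu a b i) := by
  obtain ⟨r, hr, hrad⟩ := side_rad hp hi
  set R := r/3 with hR
  have hR0 : 0 < R := by positivity
  set q := p + R • nu a b i with hq
  have hqp : ‖q - p‖ = R := by rw [hq, add_sub_cancel_left, norm_smul, nu_norm ha hb, Real.norm_eq_abs, abs_of_pos hR0, mul_one]
  have hlq : ell a b i q = R := by
    rw [hq, ell_add, hi, inner_smul_right, real_inner_self_eq_norm_sq, nu_norm ha hb]; simp
  have hdist : ∀ z, ‖z - q‖ ≤ R → ‖z - p‖ < r := by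
    intro z hz
    have := norm_sub_le_norm_sub_add_norm_sub z q p
    rw [hR] at *; linarith
  have hcb : ∀ z ∈ Metric.closedBall q R, z ∈ TD a b := by
    intro z hz
    rw [Metric.mem_closedBall, dist_eq_norm] at hz
    apply (side_loc ha hb hrad (hdist z hz)).2
    have := (abs_le.1 (ell_lip ha hb i q z)).1
    linarith
  have hob : ∀ z ∈ Metric.ball q R, z ∈ TI a b := by
    intro z hz
    rw [Metric.mem_ball, dist_eq_norm] at hz
    apply side_Int ha hb hrad (hdist z hz.le)
    have := (abs_le.1 (ell_lip ha hb i q z)).1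
    linarith
  obtain ⟨ε, hε, hbar⟩ := barrier (h := w) hR0 (hw.continuousOn.mono hcb) (fun z hz => ⟨TI_C2 hw (hob z hz), hl z (hob z hz)⟩)
    (fun z hz => h0 z (hcb z hz)) (hpos q (hob q (Metric.mem_ball_self hR0)))
  have : ε * R ≤ fderivWithin ℝ w (TD a b) p (nu a b i) := by
    apply dir_ge (smooth_diff hw hp)
    filter_upwards [in_ev ha hb hp hi, Ioo_mem_nhdsGT hR0] with t ht1 ht2
    refine ⟨Int_sub a b ht1, ?_⟩
    have hn : ‖p + t • nu a b i - q‖ = R - t := by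
      rw [hq, add_sub_add_left_eq_sub, ← sub_smul, norm_smul, nu_norm ha hb, Real.norm_eq_abs, abs_sub_comm, abs_of_pos (by linarith [ht2.2]), mul_one]
    have h1 := hbar (p + t • nu a b i) (by rw [Metric.mem_closedBall, dist_eq_norm, hn]; linarith [ht2.1])
    rw [hn] at h1
    rw [hwp, zero_add]
    refine le_trans ?_ h1
    rw [mul_assoc]
    apply mul_le_mul_of_nonneg_left _ hε.le
    nlinarith [ht2.1, ht2.2]
  have : 0 < ε * R := by positivity
  linarith

structure SPos (a b : ℝ) (w1 w2 : E2 → ℝ) : Prop where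
  p1 : ∀ p ∈ TD a b, 0 < ell a b 0 p → 0 < w1 p
  d1 : ∀ p ∈ TD a b, ell a b 0 p = 0 → 0 < fderivWithin ℝ w1 (TD a b) p (nu a b 0)
  p2 : ∀ p ∈ TD a b, 0 < ell a b 1 p → 0 < w2 p
  d2 : ∀ p ∈ TD a b, ell a b 1 p = 0 → 0 < fderivWithin ℝ w2 (TD a b) p (nu a b 1)

lemma zero_of_TI {a b : ℝ} (ha : 0 < a) (hb : 0 < b) {w : E2 → ℝ} (hw : ContDiffOn ℝ ∞ w (TD a b)) (h : ∀ z ∈ TI a b, w z = 0) :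
    ∀ z ∈ TD a b, w z = 0 := by
  intro z hz
  have h1 : Tendsto w (𝓝[TI a b] z) (𝓝 (w z)) := (hw.continuousOn z hz).mono_left (nhdsWithin_mono _ (Int_sub a b))
  have : (𝓝[TI a b] z).NeBot := mem_closure_iff_nhdsWithin_neBot.1 (T_cl ha hb hz.1)
  refine tendsto_nhds_unique h1 ?_
  apply tendsto_const_nhds.congr'
  filter_upwards [self_mem_nhdsWithin] with y hy
  exact (h y hy).symm

lemma strong_pair {a b : ℝ} (ha : 0 < a) (hb : 0 < b) {w1 w2 : E2 → ℝ} (hw : Adm a b w1 w2) (h1 : ∀ z ∈ TD a b, 0 ≤ w1 z)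
    (h2 : ∀ z ∈ TD a b, 0 ≤ w2 z) (l1 : ∀ z ∈ TI a b, lap w1 z ≤ 0) (l2 : ∀ z ∈ TI a b, lap w2 z ≤ 0) :
    (∀ z ∈ TD a b, w1 z = 0 ∧ w2 z = 0) ∨ SPos a b w1 w2 := by
  by_cases hz : ∀ z ∈ TI a b, w1 z = 0 ∧ w2 z = 0
  · left
    exact fun z hz' => ⟨zero_of_TI ha hb hw.s1 (fun z h => (hz z h).1) z hz', zero_of_TI ha hb hw.s2 (fun z h => (hz z h).2) z hz'⟩
  right
  -- the combination is positive inside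
  set W : E2 → ℝ := fun z => a * w1 z + b * w2 z with hW
  have hWs : ContDiffOn ℝ ∞ W (TD a b) := (contDiffOn_const.mul hw.s1).add (contDiffOn_const.mul hw.s2)
  have hW0 : ∀ z ∈ TD a b, 0 ≤ W z := fun z hz => by have := h1 z hz; have := h2 z hz; simp only [hW]; positivity
  have hWl : ∀ z ∈ TI a b, lap W z ≤ 0 := by
    intro z hz
    have c1 := TI_C2 hw.s1 hz; have c2 := TI_C2 hw.s2 hz
    rw [hW, lap_add (contDiffAt_const.mul c1) (contDiffAt_const.mul c2), lap_const_mul _ c1, lap_const_mul _ c2]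
    nlinarith [l1 z hz, l2 z hz]
  have hWp : ∀ z ∈ TI a b, 0 < W z := by
    push Not at hz
    obtain ⟨q, hq, hne⟩ := hz
    apply strong_max hWs hW0 hWl hq
    have i1 := h1 q (Int_sub a b hq); have i2 := h2 q (Int_sub a b hq)
    simp only [hW]
    rcases i1.eq_or_lt with h | h
    · have := lt_of_le_of_ne i2 (hne h.symm).symm
      have := mul_pos hb this
      rw [← h]; linarith
    · have := mul_pos ha h
      have := mul_nonneg hb.le i2
      linarith
  have hWh : ∀ p ∈ TD a b, ell a b 2 p = 0 → 0 < W p := by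
    intro p hp hi
    rcases (hW0 p hp).eq_or_lt with h | h
    · have := hopf ha hb hWs hW0 hWl hWp hp hi h.symm
      rw [hW, fdw_comb ha hb hw.s1 hw.s2 hp, hw.h2 p hp hi] at this
      exact absurd this (lt_irrefl _)
    · exact h
  have hh1 : ∀ p ∈ TD a b, ell a b 2 p = 0 → 0 < w1 p ∧ 0 < w2 p := by
    intro p hp hi
    have e := hw.h1 p hp hi
    have hp0 := hWh p hp hi
    simp only [hW] at hp0
    have i1 := h1 p hp
    have i2 := h2 p hp
    constructor
    · rcases i1.eq_or_lt with h | h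
      · rw [← h] at e hp0
        have : w2 p = 0 := by
          have : a * w2 p = 0 := by linarith
          exact (mul_eq_zero.1 this).resolve_left ha.ne'
        rw [this] at hp0; simp at hp0
      · exact h
    · rcases i2.eq_or_lt with h | h
      · rw [← h] at e hp0
        have : w1 p = 0 := by
          have : b * w1 p = 0 := by linarith
          exact (mul_eq_zero.1 this).resolve_left hb.ne'
        rw [this] at hp0; simp at hp0
      · exact h
  -- a point of the hypotenuse
  have hk := kap_pos ha hb
  set m : E2 := (a/2) • e0 + (b/2) • e1 with hm
  have m0 : ell a b 0 m = a/2 := by rw [ell0]; simp [hm]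
  have m1 : ell a b 1 m = b/2 := by rw [ell1]; simp [hm]
  have m2 : ell a b 2 m = 0 := by rw [ell2]; simp [hm]; right; field_simp; norm_num
  have hmD : m ∈ TD a b := by
    have hr : ∀ j : Fin 3, j ≠ 2 → min (a/2) (b/2) ≤ ell a b j m := by
      intro j hj
      fin_cases j
      · show _ ≤ ell a b 0 m
        rw [m0]; exact min_le_left _ _
      · show _ ≤ ell a b 1 m
        rw [m1]; exact min_le_right _ _
      · exact absurd rfl hj
    exact (side_loc ha hb hr (by simp; constructor <;> positivity)).2 m2.ge
  have hpos : ∀ {w : E2 → ℝ}, ContDiffOn ℝ ∞ w (TD a b) → (∀ z ∈ TD a b, 0 ≤ w z) → (∀ z ∈ TI a b, lap w z ≤ 0) → 0 < w m →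
      ∀ z ∈ TI a b, 0 < w z := by
    intro w hs h0 hl hwm
    by_cases hex : ∃ q ∈ TI a b, 0 < w q
    · obtain ⟨q, hq, hq0⟩ := hex
      exact strong_max hs h0 hl hq hq0
    · push Not at hex
      have := zero_of_TI ha hb hs (fun z hz => le_antisymm (hex z hz) (h0 z (Int_sub a b hz))) m hmD
      linarith
  have P1 := hpos hw.s1 h1 l1 (hh1 m hmD m2).1
  have P2 := hpos hw.s2 h2 l2 (hh1 m hmD m2).2
  have gen : ∀ {w : E2 → ℝ} {i : Fin 3} {p : E2}, ContDiffOn ℝ ∞ w (TD a b) → (∀ z ∈ TD a b, 0 ≤ w z) → (∀ z ∈ TI a b, lap w z ≤ 0) →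
      (∀ z ∈ TI a b, 0 < w z) → p ∈ TD a b → ell a b i p = 0 → fderivWithin ℝ w (TD a b) p (nu a b i) = 0 → 0 < w p := by
    intro w i p hs h0 hl hp hpD hi hd
    rcases (h0 p hpD).eq_or_lt with h | h
    · have := hopf ha hb hs h0 hl hp hpD hi h.symm
      rw [hd] at this; exact absurd this (lt_irrefl _)
    · exact h
  refine ⟨?_, fun p hp hi => hopf ha hb hw.s1 h1 l1 P1 hp hi (hw.x1 p hp hi), ?_,
    fun p hp hi => hopf ha hb hw.s2 h2 l2 P2 hp hi (hw.y1 p hp hi)⟩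
  · intro p hp h0
    rcases D_cases hp with h | ⟨i, hi⟩
    · exact P1 p h
    · fin_cases i
      · exact absurd hi h0.ne'
      · exact gen hw.s1 h1 l1 P1 hp hi (hw.y2 p hp hi)
      · exact (hh1 p hp hi).1
  · intro p hp h0
    rcases D_cases hp with h | ⟨i, hi⟩
    · exact P2 p h
    · fin_cases i
      · exact gen hw.s2 h2 l2 P2 hp hi (hw.x2 p hp hi)
      · exact absurd hi h0.ne'
      · exact (hh1 p hp hi).2

end

section
open Set Filter Topology MeasureTheory InnerProductSpace
open scoped ContDiff

def Good (a b mu : ℝ) (u : E2 → ℝ) (p : E2) (R : ℝ) (v : E2 → ℝ) : Prop :=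
  (∀ z ∈ Metric.ball p R, ContDiffAt ℝ ∞ v z ∧ lap v z = - mu * v z) ∧
  (∀ z ∈ Metric.ball p R, z ∈ TD a b → v z = u z) ∧
  (∀ z ∈ Metric.ball p R, ∃ y ∈ Metric.ball p R, y ∈ TD a b ∧ v z = u y)

lemma Eig.good_int {a b mu : ℝ} (ha : 0 < a) (hb : 0 < b) {u : E2 → ℝ} (hu : Eig a b mu u) {p : E2} {R : ℝ}
    (h : ∀ j, R ≤ ell a b j p) : Good a b mu u p R u := by
  have hs := ball_Int ha hb h
  refine ⟨fun z hz => ⟨(hu.smooth z (Int_sub a b (hs hz))).contDiffAt (D_nhds (hs hz)), hu.eqn z (hs hz)⟩, fun _ _ _ => rfl,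
    fun z hz => ⟨z, hz, Int_sub a b (hs hz), rfl⟩⟩

lemma Eig.good_side {a b mu : ℝ} (ha : 0 < a) (hb : 0 < b) {u : E2 → ℝ} (hu : Eig a b mu u) {p : E2} {i : Fin 3} {R : ℝ} (hR : 0 < R)
    (hi : ell a b i p = 0) (h : ∀ j, j ≠ i → R ≤ ell a b j p) : ∃ v, Good a b mu u p R v := by
  obtain ⟨A, hA⟩ : ∃ A : E2 ≃ₗᵢ[ℝ] E2, A e1 = nu a b i := ⟨_, Submodule.reflection_sub (by rw [norm_e1, nu_norm ha hb])⟩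
  have hin : ∀ y, inner ℝ (nu a b i) (A y) = y 1 := fun y => by rw [← hA, A.inner_map_map, inner_e1]
  have hl : ∀ y, ell a b i (p + A y) = y 1 := fun y => by rw [ell_add, hi, hin, zero_add]
  set U : E2 → ℝ := fun y => u (p + A y) with hU
  have hm : ∀ y ∈ HB R, p + A y ∈ TD a b := by
    intro y hy
    apply (side_loc ha hb h (by rw [add_sub_cancel_left, A.norm_map]; exact hy.1)).2
    rw [hl]; exact hy.2
  have hm' : MapsTo (fun y => p + A y) (HB R) (TD a b) := hm
  have hAs : ContDiff ℝ ∞ (fun y => p + A y) := contDiff_const.add A.contDiff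
  have hUs : ContDiffOn ℝ ∞ U (HB R) := hu.smooth.comp hAs.contDiffOn hm'
  have key := glue0 (u := U) hR hu.pos hUs (fun y hy h1 => by
    have hyI : p + A y ∈ TI a b := by
      apply side_Int ha hb h (by rw [add_sub_cancel_left, A.norm_map]; exact hy)
      rw [hl]; exact h1
    rw [hU, lap_comp_iso _ _ (TI_C2 hu.smooth hyI)]
    exact hu.eqn _ hyI) (fun y hy h1 => by
    have hyH : y ∈ HB R := ⟨hy, h1.ge⟩
    have hd := (smooth_diff hu.smooth (hm y hyH)).hasFDerivWithinAt
    have hAd : HasFDerivWithinAt (fun y => p + A y) (A : E2 →L[ℝ] E2) (HB R) y := (A.hasFDerivAt.const_add p).hasFDerivWithinAt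
    have := (hd.comp y hAd hm').fderivWithin ((HB_ud hR) y hyH)
    have h2 : fderivWithin ℝ U (HB R) y = _ := this
    rw [h2]
    have h3 := hu.neu _ (hm y hyH) i (by rw [hl, h1])
    rw [← hA] at h3
    exact h3)
  refine ⟨fun z => glue 1 U (A.symm (-p) + A.symm z), fun z hz => ?_, fun z hz hzD => ?_, fun z hz => ?_⟩
  all_goals
    have hz' : ‖A.symm (-p) + A.symm z‖ < R := by
      rw [← map_add, A.symm.norm_map, neg_add_eq_sub]; rwa [Metric.mem_ball, dist_eq_norm] at hz
    have hzA : p + A (A.symm (-p) + A.symm z) = z := by rw [← map_add, A.apply_symm_apply]; abel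
  · obtain ⟨k1, k2⟩ := key (A.symm (-p) + A.symm z) (by simpa using hz')
    refine ⟨?_, ?_⟩
    · have : ContDiff ℝ ∞ (fun z => A.symm (-p) + A.symm z) := contDiff_const.add A.symm.contDiff
      exact k1.comp z this.contDiffAt
    · rw [lap_comp_iso _ _ (k1.of_le (by norm_cast)), k2]
  · simp only
    rw [glue_pos, hU]
    · simp only; rw [hzA]
    · rw [← hl, hzA]; exact hzD.1 i
  · by_cases h1 : 0 ≤ (A.symm (-p) + A.symm z) 1
    · refine ⟨z, hz, ?_, ?_⟩
      · have := hm (A.symm (-p) + A.symm z) ⟨hz', h1⟩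
        rwa [hzA] at this
      · simp only
        rw [glue_pos h1, hU]; simp only; rw [hzA]
    · push Not at h1
      have hR1 := R1_HB hz' h1.le
      refine ⟨p + A (R1 (A.symm (-p) + A.symm z)), ?_, hm _ hR1, ?_⟩
      · rw [Metric.mem_ball, dist_eq_norm, add_sub_cancel_left, A.norm_map]; exact hR1.1
      · simp only [glue, if_neg (not_le.2 h1), hU, one_mul]

lemma good_deriv {a b mu : ℝ} (ha : 0 < a) (hb : 0 < b) {u v : E2 → ℝ} {p : E2} {R : ℝ} (h : Good a b mu u p R v) {z : E2}
    (hz : z ∈ Metric.ball p R) (hzD : z ∈ TD a b) : fderivWithin ℝ u (TD a b) z = fderiv ℝ v z := by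
  have h1 : u =ᶠ[𝓝[TD a b] z] v := by
    filter_upwards [self_mem_nhdsWithin, mem_nhdsWithin_of_mem_nhds (Metric.isOpen_ball.mem_nhds hz)] with y h1 h2
    exact (h.2.1 y h2 h1).symm
  rw [h1.fderivWithin_eq (h.2.1 z hz hzD).symm]
  exact fderivWithin_eq_fderiv (D_ud ha hb z hzD) ((h.1 z hz).1.differentiableAt (by simp))

lemma good_deriv2 {a b mu : ℝ} (ha : 0 < a) (hb : 0 < b) {u v : E2 → ℝ} {p : E2} {R : ℝ} (h : Good a b mu u p R v) {z : E2}
    (hz : z ∈ Metric.ball p R) (hzD : z ∈ TD a b) (e : E2) : fderivWithin ℝ (fun y => fderivWithin ℝ u (TD a b) y e) (TD a b) z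
      = fderiv ℝ (fun y => fderiv ℝ v y e) z := by
  have h1 : (fun y => fderivWithin ℝ u (TD a b) y e) =ᶠ[𝓝[TD a b] z] (fun y => fderiv ℝ v y e) := by
    filter_upwards [self_mem_nhdsWithin, mem_nhdsWithin_of_mem_nhds (Metric.isOpen_ball.mem_nhds hz)] with y h1 h2
    rw [good_deriv ha hb h h2 h1]
  rw [h1.fderivWithin_eq (by rw [good_deriv ha hb h hz hzD])]
  refine fderivWithin_eq_fderiv (D_ud ha hb z hzD) ?_
  have := ((h.1 z hz).1.fderiv_right (m := ∞) (by simp)).clm_apply (contDiffAt_const (c := e))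
  exact this.differentiableAt (by simp)

structure Cor (a b : ℝ) (P : E2) (i j k : Fin 3) (C : ℝ) : Prop where
  hi : ell a b i P = 0
  hj : ell a b j P = 0
  hk : 0 < ell a b k P
  all : ∀ m, m = i ∨ m = j ∨ m = k
  hC : 1 ≤ C
  est : ∀ z ∈ Tst a b, ‖z - P‖ ≤ C * (ell a b i z + ell a b j z)

lemma Cor.P_mem {a b : ℝ} (ha : 0 < a) (hb : 0 < b) {P : E2} {i j k : Fin 3} {C : ℝ} (h : Cor a b P i j k C) : P ∈ Tst a b := by
  rw [Tst_iff ha hb]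
  intro m
  rcases h.all m with rfl | rfl | rfl
  · exact h.hi.ge
  · exact h.hj.ge
  · exact h.hk.le

lemma Cor.symm {a b : ℝ} {P : E2} {i j k : Fin 3} {C : ℝ} (h : Cor a b P i j k C) : Cor a b P j i k C :=
  ⟨h.hj, h.hi, h.hk, fun m => by rcases h.all m with h | h | h <;> simp [h], h.hC, fun z hz => by rw [add_comm]; exact h.est z hz⟩

/-- near a corner there is a good extension on a ball of comparable radius -/
lemma Eig.good_tip {a b mu : ℝ} (ha : 0 < a) (hb : 0 < b) {u : E2 → ℝ} (hu : Eig a b mu u) {P : E2} {i j k : Fin 3} {C : ℝ}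
    (h : Cor a b P i j k C) {z : E2} (hz : z ∈ TD a b) (hr0 : 0 < ‖z - P‖) (hr : ‖z - P‖ ≤ ell a b k P / 4) :
    ∃ p R v, Good a b mu u p R v ∧ Metric.ball z (‖z - P‖ / (8 * C)) ⊆ Metric.ball p R ∧ Metric.ball p R ⊆ Metric.ball P (4 * ‖z - P‖) := by
  have hC := h.hC
  set r := ‖z - P‖ with hrd
  set s := r / (8 * C) with hs
  have hs0 : 0 < s := by positivity
  have hsr : s ≤ r / 8 := div_le_div_of_nonneg_left hr0.le (by norm_num) (by linarith)
  have hsum : 8 * s ≤ ell a b i z + ell a b j z := by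
    have := h.est z (D_sub_T ha hb hz)
    have e : 8 * s = r / C := by rw [hs]; field_simp
    rw [e, div_le_iff₀ (by linarith)]; linarith
  have hkz : 3 * r ≤ ell a b k z := by
    have := (abs_le.1 (ell_lip ha hb k P z)).1
    linarith
  have side : ∀ {i j : Fin 3}, Cor a b P i j k C → 8 * s ≤ ell a b i z + ell a b j z → ell a b i z < s → ∃ p R v, Good a b mu u p R v ∧ Metric.ball z s ⊆ Metric.ball p R ∧ Metric.ball p R ⊆ Metric.ball P (4 * r) := by
    intro i j h hsum hlt
    set p := z - ell a b i z • nu a b i with hp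
    have hzp : z - p = ell a b i z • nu a b i := by rw [hp]; abel
    have hzi := hz.1 i
    have hn : ‖z - p‖ = ell a b i z := by rw [hzp, norm_smul, nu_norm ha hb, Real.norm_eq_abs, abs_of_nonneg hzi, mul_one]
    have hpi : ell a b i p = 0 := by
      have := ell_sub a b i p z
      rw [hzp, inner_smul_right, real_inner_self_eq_norm_sq, nu_norm ha hb] at this
      linarith
    obtain ⟨v, hv⟩ := hu.good_side ha hb (R := 2 * s) (by positivity) hpi (fun m hm => by
      have hl := (abs_le.1 (ell_lip ha hb m p z)).2
      rcases h.all m with rfl | rfl | rfl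
      · exact absurd rfl hm
      · linarith
      · linarith)
    refine ⟨p, 2 * s, v, hv, fun y hy => ?_, fun y hy => ?_⟩
    · rw [Metric.mem_ball, dist_eq_norm] at hy ⊢
      have := norm_sub_le_norm_sub_add_norm_sub y z p
      linarith
    · rw [Metric.mem_ball, dist_eq_norm] at hy ⊢
      have h1 := norm_sub_le_norm_sub_add_norm_sub y p P
      have h2 := norm_sub_le_norm_sub_add_norm_sub p z P
      rw [norm_sub_rev p z, hn] at h2
      linarith
  by_cases h1 : ell a b i z < s
  · exact side h hsum h1
  by_cases h2 : ell a b j z < s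
  · exact side h.symm (by linarith) h2
  push Not at h1 h2
  refine ⟨z, s, u, hu.good_int ha hb fun m => ?_, Subset.rfl, fun y hy => ?_⟩
  · rcases h.all m with rfl | rfl | rfl
    · exact h1
    · exact h2
    · linarith
  · rw [Metric.mem_ball, dist_eq_norm] at hy ⊢
    have h1 := norm_sub_le_norm_sub_add_norm_sub y z P
    linarith

lemma Eig.tip {a b mu : ℝ} (ha : 0 < a) (hb : 0 < b) {u : E2 → ℝ} (hu : Eig a b mu u) {P : E2} {i j k : Fin 3} {C : ℝ}
    (h : Cor a b P i j k C) {η : ℝ} (hη : 0 < η) : ∃ ρ > (0:ℝ), ∀ z ∈ TD a b, 0 < ‖z - P‖ → ‖z - P‖ < ρ →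
      ∀ v : E2, |fderivWithin ℝ u (TD a b) z v| ≤ η / ‖z - P‖ * ‖v‖ ∧
      ‖fderivWithin ℝ (fun y => fderivWithin ℝ u (TD a b) y v) (TD a b) z‖ ≤ η / ‖z - P‖^2 * ‖v‖ := by
  obtain ⟨C1, hC1, hg⟩ := grad_est2
  have hC := h.hC
  set om := min (η / (8 * C) / C1) (η / (8 * C)^2 / C1) with hom
  have hom0 : 0 < om := by positivity
  have hc := hu.cont P (h.P_mem ha hb)
  obtain ⟨δ, hδ, hd⟩ := Metric.continuousWithinAt_iff.1 hc om hom0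
  have hk := h.hk
  have hmu := hu.pos
  refine ⟨min (δ/4) (min (ell a b k P / 4) (min 1 (1/mu))), by positivity, fun z hz hz0 hzr v => ?_⟩
  simp only [lt_min_iff] at hzr
  obtain ⟨h1, h2, h3, h4⟩ := hzr
  obtain ⟨p, R, w, hw, hb1, hb2⟩ := hu.good_tip ha hb h hz hz0 h2.le
  set r := ‖z - P‖ with hrd
  set s := r / (8 * C) with hs
  have hs0 : 0 < s := by positivity
  have hsr : s ≤ r := by
    rw [hs, div_le_iff₀ (by positivity)]; nlinarith
  have hms : mu * s^2 ≤ 1 := by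
    rw [lt_div_iff₀ hmu] at h4
    have : s^2 ≤ r := by nlinarith
    nlinarith
  have hosc : ∀ y ∈ Metric.ball z s, |w y - u P| ≤ om := by
    intro y hy
    obtain ⟨x, hx, hxD, hxe⟩ := hw.2.2 y (hb1 hy)
    rw [hxe]
    have := hb2 hx
    rw [Metric.mem_ball] at this
    have := hd (D_sub_T ha hb hxD) (by linarith)
    rw [Real.dist_eq] at this; exact this.le
  have hzs : z ∈ Metric.ball z s := Metric.mem_ball_self hs0
  obtain ⟨g1, g2⟩ := hg mu s z w (u P) om hmu hs0 hms (fun y hy => (hw.1 y (hb1 hy)).1) (fun y hy => (hw.1 y (hb1 hy)).2) hosc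
  have o1 : C1 * om / s ≤ η / r := by
    have : om ≤ η / (8 * C) / C1 := min_le_left _ _
    rw [le_div_iff₀ hC1, le_div_iff₀ (by positivity)] at this
    rw [hs, div_div_eq_mul_div, div_le_div_iff_of_pos_right hz0]; linarith
  have o2 : C1 * om / s^2 ≤ η / r^2 := by
    have : om ≤ η / (8 * C)^2 / C1 := min_le_right _ _
    rw [le_div_iff₀ hC1, le_div_iff₀ (by positivity)] at this
    rw [hs, div_pow, div_div_eq_mul_div, div_le_div_iff_of_pos_right (by positivity)]; linarith
  constructor
  · rw [good_deriv ha hb hw (hb1 hzs) hz, ← Real.norm_eq_abs]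
    refine (ContinuousLinearMap.le_opNorm _ _).trans ?_
    exact mul_le_mul_of_nonneg_right (g1.trans o1) (norm_nonneg _)
  · rw [good_deriv2 ha hb hw (hb1 hzs) hz]
    exact (g2 v).trans (mul_le_mul_of_nonneg_right o2 (norm_nonneg _))

end

section
open Set Filter Topology MeasureTheory InnerProductSpace
open scoped ContDiff

lemma Cor.mem_TD {a b : ℝ} (ha : 0 < a) (hb : 0 < b) {P : E2} {i j k : Fin 3} {C : ℝ} (h : Cor a b P i j k C) {z : E2}
    (hz : z ∈ Tst a b) (h0 : 0 < ‖z - P‖) (h1 : ‖z - P‖ < ell a b k P) : z ∈ TD a b := by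
  have hz' := (Tst_iff ha hb z).1 hz
  refine ⟨hz', ?_⟩
  have hk : 0 < ell a b k z := by
    have := (abs_le.1 (ell_lip ha hb k P z)).1
    linarith
  have hij : 0 < ell a b i z + ell a b j z := by
    have := h.est z hz
    have hC := h.hC
    by_contra hn
    push Not at hn
    nlinarith
  intro m n hmn
  rcases h.all m with rfl | rfl | rfl <;> rcases h.all n with rfl | rfl | rfl <;>
    first | exact absurd rfl hmn | assumption | (rw [add_comm]; assumption) | linarith [hz' m, hz' n]

lemma proj_T {a b : ℝ} (ha : 0 < a) (hb : 0 < b) {m : Fin 3} (hm : m = 0 ∨ m = 1) {z : E2} (hz : z ∈ Tst a b) :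
    z - ell a b m z • nu a b m ∈ Tst a b := by
  obtain ⟨h0, h1, h2⟩ := hz
  rcases hm with rfl | rfl
  · rw [ell0]
    refine ⟨?_, ?_, ?_⟩ <;> simp [nu]
    · exact h1
    · have : 0 ≤ z 0 / a := by positivity
      linarith
  · rw [ell1]
    refine ⟨?_, ?_, ?_⟩ <;> simp [nu]
    · exact h0
    · have : 0 ≤ z 1 / b := by positivity
      linarith

lemma Eig.tip_comp {a b mu : ℝ} (ha : 0 < a) (hb : 0 < b) {u : E2 → ℝ} (hu : Eig a b mu u) {P : E2} {m j k : Fin 3} {C : ℝ}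
    (h : Cor a b P m j k C) (hm : m = 0 ∨ m = 1) {η : ℝ} (hη : 0 < η) : ∃ ρ > (0:ℝ), ∀ z ∈ TD a b, 0 < ‖z - P‖ → ‖z - P‖ < ρ →
      |fderivWithin ℝ u (TD a b) z (nu a b m)| ≤ η * ell a b m z / ‖z - P‖^2 := by
  obtain ⟨ρ, hρ, ht⟩ := hu.tip ha hb h (η := η/4) (by positivity)
  have hk := h.hk
  refine ⟨min (ρ/2) (ell a b k P / 2), by positivity, fun z hz hz0 hzr => ?_⟩
  rw [lt_min_iff] at hzr
  set r := ‖z - P‖ with hr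
  have hl0 := hz.1 m
  by_cases hc : r / 2 ≤ ell a b m z
  · have := (ht z hz hz0 (by linarith [hzr.1]) (nu a b m)).1
    rw [nu_norm ha hb, mul_one] at this
    refine this.trans ?_
    rw [div_le_div_iff₀ hz0 (by positivity)]
    have : η / 4 * r ≤ η * ell a b m z := by nlinarith
    nlinarith
  push Not at hc
  set q := z - ell a b m z • nu a b m with hq
  have hqz : q - z = -(ell a b m z • nu a b m) := by rw [hq]; abel
  have hqn : ‖q - z‖ = ell a b m z := by
    rw [hqz, norm_neg, norm_smul, nu_norm ha hb, Real.norm_eq_abs, abs_of_nonneg hl0, mul_one]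
  have hball : ∀ y, ‖y - z‖ ≤ ell a b m z → r / 2 < ‖y - P‖ ∧ ‖y - P‖ < 2 * r := by
    intro y hy
    have h1 := norm_sub_le_norm_sub_add_norm_sub y z P
    have h2 := norm_sub_le_norm_sub_add_norm_sub z y P
    rw [norm_sub_rev z y] at h2
    constructor <;> linarith
  have hqD : q ∈ TD a b := h.mem_TD ha hb (proj_T ha hb hm (D_sub_T ha hb hz)) (by linarith [(hball q hqn.le).1]) (by linarith [(hball q hqn.le).2, hzr.2])
  have hq0 : ell a b m q = 0 := by
    rw [ell_sub a b m z q, hqz, inner_neg_right, inner_smul_right, real_inner_self_eq_norm_sq, nu_norm ha hb]; ring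
  have hsub : segment ℝ q z ⊆ TD a b := (D_convex a b).segment_subset hqD hz
  have key := Convex.norm_image_sub_le_of_norm_hasFDerivWithin_le (s := segment ℝ q z) (C := η / r^2)
    (f := fun y => fderivWithin ℝ u (TD a b) y (nu a b m)) (x := q) (y := z)
    (fun y hy => ((smooth_diff (grad_smooth ha hb hu.smooth (nu a b m)) (hsub hy)).hasFDerivWithinAt).mono hsub) (fun y hy => by
      have hyz : ‖y - z‖ ≤ ell a b m z := by
        have : y ∈ Metric.closedBall z (ell a b m z) := (convex_closedBall z _).segment_subset
          (by rw [Metric.mem_closedBall, dist_eq_norm]; exact hqn.le) (Metric.mem_closedBall_self hl0) hy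
        rwa [Metric.mem_closedBall, dist_eq_norm] at this
      obtain ⟨b1, b2⟩ := hball y hyz
      have := (ht y (hsub hy) (by linarith) (by linarith [hzr.1]) (nu a b m)).2
      rw [nu_norm ha hb, mul_one] at this
      refine this.trans ?_
      rw [div_le_div_iff₀ (by nlinarith) (by positivity)]
      have hsq : (r / 2) ^ 2 ≤ ‖y - P‖ ^ 2 := pow_le_pow_left₀ (by linarith) b1.le 2
      nlinarith [mul_le_mul_of_nonneg_left hsq hη.le]) (convex_segment q z) (left_mem_segment ℝ q z) (right_mem_segment ℝ q z)
  rw [hu.neu q hqD m hq0, sub_zero, norm_sub_rev, hqn, Real.norm_eq_abs] at key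
  rw [mul_div_right_comm]; exact key

/-- full data of a vertex -/
structure Vert (a b : ℝ) (P : E2) (σ τ : ℝ) (i j k : Fin 3) (C : ℝ) : Prop extends Cor a b P i j k C where
  ang : -1 < inner ℝ (nu a b i) (nu a b j)
  X0 : ∀ z ∈ Tst a b, 0 ≤ σ * (z 0 - P 0)
  Y0 : ∀ z ∈ Tst a b, 0 ≤ τ * (z 1 - P 1)
  hyp : k = 2 ∨ σ + τ = 0
  cX : (i = 0 ∧ σ = 1) ∨ ∀ z ∈ Tst a b, ‖z - P‖ ≤ C * (σ * (z 0 - P 0))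
  cY : (j = 1 ∧ τ = 1) ∨ ∀ z ∈ Tst a b, ‖z - P‖ ≤ C * (τ * (z 1 - P 1))

lemma vert_O {a b : ℝ} (ha : 0 < a) (hb : 0 < b) : Vert a b 0 1 1 0 1 2 1 where
  hi := by simp [ell0]
  hj := by simp [ell1]
  hk := by rw [ell2]; simpa using kap_pos ha hb
  all := by decide
  hC := le_rfl
  est z hz := by
    rw [ell0, ell1, sub_zero, one_mul]
    have := hz.1; have := hz.2.1
    apply abs_le_of_sq_le_sq' _ (by positivity) |>.2
    rw [normsq_E2]; nlinarith
  ang := by show -1 < inner ℝ e0 e1; rw [inner_e0]; simp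
  X0 z hz := by simpa using hz.1
  Y0 z hz := by simpa using hz.2.1
  hyp := Or.inl rfl
  cX := Or.inl ⟨rfl, rfl⟩
  cY := Or.inl ⟨rfl, rfl⟩

lemma norm_le_abs (v : E2) : ‖v‖ ≤ |v 0| + |v 1| := by
  apply abs_le_of_sq_le_sq' _ (by positivity) |>.2
  rw [normsq_E2, ← sq_abs (v 0), ← sq_abs (v 1)]
  nlinarith [abs_nonneg (v 0), abs_nonneg (v 1)]

lemma kap_lt {a b : ℝ} (ha : 0 < a) (hb : 0 < b) : kap a b < a ∧ kap a b < b := by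
  have hk := kap_pos ha hb
  have h := kap_sq ha hb
  constructor
  · by_contra hn
    push Not at hn
    have : 1 ≤ kap a b^2 * (1/a^2) := by
      rw [mul_one_div, le_div_iff₀ (by positivity)]; nlinarith
    have : 0 < kap a b^2 * (1/b^2) := by positivity
    linarith
  · by_contra hn
    push Not at hn
    have : 1 ≤ kap a b^2 * (1/b^2) := by
      rw [mul_one_div, le_div_iff₀ (by positivity)]; nlinarith
    have : 0 < kap a b^2 * (1/a^2) := by positivity
    linarith

lemma vert_A {a b : ℝ} (ha : 0 < a) (hb : 0 < b) : ∃ C, Vert a b (a • e0) (-1) 1 2 1 0 C := by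
  have hk := kap_pos ha hb
  refine ⟨1 + a / b + a / kap a b + b / a, ?_⟩
  have hbasic : ∀ z ∈ Tst a b, z 1 / b ≤ (a - z 0) / a := by
    intro z hz
    have := hz.2.2
    rw [sub_div, div_self ha.ne']; linarith
  have hX : ∀ z ∈ Tst a b, 0 ≤ a - z 0 := by
    intro z hz
    have h1 := hbasic z hz
    have : 0 ≤ z 1 / b := by have := hz.2.1; positivity
    have h2 : 0 ≤ (a - z 0) / a := by linarith
    by_contra hn
    push Not at hn
    have := div_neg_of_neg_of_pos hn ha
    linarith
  have hnorm : ∀ z ∈ Tst a b, ‖z - a • e0‖ ≤ (a - z 0) + z 1 := by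
    intro z hz
    have := norm_le_abs (z - a • e0)
    have e : |(z - a • e0) 0| = a - z 0 := by
      have := hX z hz
      simp; rw [abs_sub_comm, abs_of_nonneg this]
    have e' : |(z - a • e0) 1| = z 1 := by simp; exact hz.2.1
    rwa [e, e'] at this
  refine ⟨⟨?_, ?_, ?_, by decide, ?_, fun z hz => ?_⟩, ?_, fun z hz => ?_, fun z hz => ?_, Or.inr (by norm_num), Or.inr fun z hz => ?_, Or.inl ⟨rfl, rfl⟩⟩
  · rw [ell2]; simp [ha.ne']
  · rw [ell1]; simp
  · rw [ell0]; simpa using ha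
  · have : 0 ≤ a / b + a / kap a b + b / a := by positivity
    linarith
  · refine (hnorm z hz).trans ?_
    have h2 : a - z 0 = a / kap a b * ell a b 2 z + a / b * ell a b 1 z := by
      rw [ell2, ell1]; field_simp; ring
    have e2 := (Tst_iff ha hb z).1 hz 2
    have e1 := (Tst_iff ha hb z).1 hz 1
    rw [h2]
    have hz1 : z 1 = ell a b 1 z := (ell1 a b z).symm
    rw [hz1]
    have A1 : 0 < a / b := by positivity
    have A2 : 0 < a / kap a b := by positivity
    have A3 : 0 < b / a := by positivity
    nlinarith [mul_nonneg A1.le e1, mul_nonneg A1.le e2, mul_nonneg A2.le e1, mul_nonneg A2.le e2, mul_nonneg A3.le e1, mul_nonneg A3.le e2]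
  · have : inner ℝ (nu a b 2) (nu a b 1) = - (kap a b / b) := by
      rw [real_inner_comm]; show inner ℝ e1 _ = _
      rw [inner_e1]; simp [nu]
    rw [this, neg_lt_neg_iff, div_lt_one hb]
    exact (kap_lt ha hb).2
  · have := hX z hz
    simp; linarith
  · simpa using hz.2.1
  · refine (hnorm z hz).trans ?_
    have h1 := hbasic z hz
    have h2 := hX z hz
    have h3 : z 1 ≤ b / a * (a - z 0) := by
      rw [div_le_iff₀ hb] at h1
      calc z 1 ≤ (a - z 0) / a * b := h1
        _ = _ := by ring
    have e : (-1:ℝ) * (z 0 - (a • e0 : E2) 0) = a - z 0 := by simp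
    rw [e]
    have A1 : 0 < a / b := by positivity
    have A2 : 0 < a / kap a b := by positivity
    nlinarith [mul_nonneg A1.le h2, mul_nonneg A2.le h2]

lemma vert_B {a b : ℝ} (ha : 0 < a) (hb : 0 < b) : ∃ C, Vert a b (b • e1) 1 (-1) 0 2 1 C := by
  have hk := kap_pos ha hb
  refine ⟨1 + b / a + b / kap a b + a / b, ?_⟩
  have hbasic : ∀ z ∈ Tst a b, z 0 / a ≤ (b - z 1) / b := by
    intro z hz
    have := hz.2.2
    rw [sub_div, div_self hb.ne']; linarith
  have hX : ∀ z ∈ Tst a b, 0 ≤ b - z 1 := by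
    intro z hz
    have h1 := hbasic z hz
    have : 0 ≤ z 0 / a := by have := hz.1; positivity
    have h2 : 0 ≤ (b - z 1) / b := by linarith
    by_contra hn
    push Not at hn
    have := div_neg_of_neg_of_pos hn hb
    linarith
  have hnorm : ∀ z ∈ Tst a b, ‖z - b • e1‖ ≤ (b - z 1) + z 0 := by
    intro z hz
    have := norm_le_abs (z - b • e1)
    have e : |(z - b • e1) 1| = b - z 1 := by
      have := hX z hz
      simp; rw [abs_sub_comm, abs_of_nonneg this]
    have e' : |(z - b • e1) 0| = z 0 := by simp; exact hz.1
    rw [e, e'] at this; linarith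
  refine ⟨⟨?_, ?_, ?_, by decide, ?_, fun z hz => ?_⟩, ?_, fun z hz => ?_, fun z hz => ?_, Or.inr (by norm_num), Or.inl ⟨rfl, rfl⟩, Or.inr fun z hz => ?_⟩
  · rw [ell0]; simp
  · rw [ell2]; simp [hb.ne']
  · rw [ell1]; simpa using hb
  · have : 0 ≤ b / a + b / kap a b + a / b := by positivity
    linarith
  · refine (hnorm z hz).trans ?_
    have h2 : b - z 1 = b / kap a b * ell a b 2 z + b / a * ell a b 0 z := by
      rw [ell2, ell0]; field_simp; ring
    have e2 := (Tst_iff ha hb z).1 hz 2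
    have e1 := (Tst_iff ha hb z).1 hz 0
    rw [h2]
    have hz1 : z 0 = ell a b 0 z := (ell0 a b z).symm
    rw [hz1]
    have A1 : 0 < b / a := by positivity
    have A2 : 0 < b / kap a b := by positivity
    have A3 : 0 < a / b := by positivity
    nlinarith [mul_nonneg A1.le e1, mul_nonneg A1.le e2, mul_nonneg A2.le e1, mul_nonneg A2.le e2, mul_nonneg A3.le e1, mul_nonneg A3.le e2]
  · have : inner ℝ (nu a b 0) (nu a b 2) = - (kap a b / a) := by
      show inner ℝ e0 _ = _
      rw [inner_e0]; simp [nu]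
    rw [this, neg_lt_neg_iff, div_lt_one ha]
    exact (kap_lt ha hb).1
  · simpa using hz.1
  · have := hX z hz
    simp; linarith
  · refine (hnorm z hz).trans ?_
    have h1 := hbasic z hz
    have h2 := hX z hz
    have h3 : z 0 ≤ a / b * (b - z 1) := by
      rw [div_le_iff₀ ha] at h1
      calc z 0 ≤ (b - z 1) / b * a := h1
        _ = _ := by ring
    have e : (-1:ℝ) * (z 1 - (b • e1 : E2) 1) = b - z 1 := by simp
    rw [e]
    have A1 : 0 < b / a := by positivity
    have A2 : 0 < b / kap a b := by positivity
    nlinarith [mul_nonneg A1.le h2, mul_nonneg A2.le h2]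

/-- smallness of the gradient field near a vertex -/
def Tip (a b : ℝ) (P : E2) (σ τ : ℝ) (w1 w2 : E2 → ℝ) : Prop := ∀ η > (0:ℝ), ∃ ρ > (0:ℝ), ∀ z ∈ TD a b, 0 < ‖z - P‖ → ‖z - P‖ < ρ →
  |w1 z| ≤ η * (σ * (z 0 - P 0)) / ‖z - P‖^2 ∧ |w2 z| ≤ η * (τ * (z 1 - P 1)) / ‖z - P‖^2

lemma Eig.tipV {a b mu : ℝ} (ha : 0 < a) (hb : 0 < b) {u : E2 → ℝ} (hu : Eig a b mu u) {P : E2} {σ τ : ℝ} {i j k : Fin 3} {C : ℝ}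
    (h : Vert a b P σ τ i j k C) : Tip a b P σ τ (fun z => fderivWithin ℝ u (TD a b) z e0) (fun z => fderivWithin ℝ u (TD a b) z (-e1)) := by
  intro η hη
  have hC := h.hC
  have far : ∀ (v : E2) (X : E2 → ℝ), ‖v‖ = 1 → (∀ z ∈ Tst a b, ‖z - P‖ ≤ C * X z) → ∃ ρ > (0:ℝ), ∀ z ∈ TD a b, 0 < ‖z - P‖ → ‖z - P‖ < ρ →
      |fderivWithin ℝ u (TD a b) z v| ≤ η * X z / ‖z - P‖^2 := by
    intro v X hv hX
    obtain ⟨ρ, hρ, ht⟩ := hu.tip ha hb h.toCor (η := η / C) (by positivity)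
    refine ⟨ρ, hρ, fun z hz h0 h1 => (ht z hz h0 h1 v).1.trans ?_⟩
    have hx := hX z (D_sub_T ha hb hz)
    rw [hv, mul_one, div_div, div_le_div_iff₀ (by positivity) (by positivity)]
    have : ‖z - P‖^2 ≤ X z * (C * ‖z - P‖) := by nlinarith
    nlinarith
  have r1 : ∃ ρ > (0:ℝ), ∀ z ∈ TD a b, 0 < ‖z - P‖ → ‖z - P‖ < ρ → |fderivWithin ℝ u (TD a b) z e0| ≤ η * (σ * (z 0 - P 0)) / ‖z - P‖^2 := by
    rcases h.cX with ⟨rfl, rfl⟩ | hx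
    · obtain ⟨ρ, hρ, ht⟩ := hu.tip_comp ha hb h.toCor (Or.inl rfl) hη
      refine ⟨ρ, hρ, fun z hz h0 h1 => ?_⟩
      have := ht z hz h0 h1
      have hP := h.hi
      rw [ell0] at this hP
      rw [hP, sub_zero, one_mul]; exact this
    · exact far e0 _ norm_e0 hx
  have r2 : ∃ ρ > (0:ℝ), ∀ z ∈ TD a b, 0 < ‖z - P‖ → ‖z - P‖ < ρ → |fderivWithin ℝ u (TD a b) z (-e1)| ≤ η * (τ * (z 1 - P 1)) / ‖z - P‖^2 := by
    rcases h.cY with ⟨rfl, rfl⟩ | hx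
    · obtain ⟨ρ, hρ, ht⟩ := hu.tip_comp ha hb h.toCor.symm (Or.inr rfl) hη
      refine ⟨ρ, hρ, fun z hz h0 h1 => ?_⟩
      have := ht z hz h0 h1
      have hP := h.hj
      rw [ell1] at this hP
      rw [hP, sub_zero, one_mul, map_neg, abs_neg]; exact this
    · exact far (-e1) _ (by rw [norm_neg, norm_e1]) hx
  obtain ⟨ρ1, h1, t1⟩ := r1
  obtain ⟨ρ2, h2, t2⟩ := r2
  exact ⟨min ρ1 ρ2, by positivity, fun z hz h0 hr => ⟨t1 z hz h0 (hr.trans_le (min_le_left _ _)), t2 z hz h0 (hr.trans_le (min_le_right _ _))⟩⟩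

lemma Tip.comb {a b : ℝ} {P : E2} {σ τ : ℝ} {w1 w2 v1 v2 : E2 → ℝ} (hw : Tip a b P σ τ w1 w2) (hv : Tip a b P σ τ v1 v2) (c d : ℝ) :
    Tip a b P σ τ (fun z => c * w1 z + d * v1 z) (fun z => c * w2 z + d * v2 z) := by
  intro η hη
  obtain ⟨ρ1, h1, t1⟩ := hw (η / (|c| + |d| + 1)) (by positivity)
  obtain ⟨ρ2, h2, t2⟩ := hv (η / (|c| + |d| + 1)) (by positivity)
  refine ⟨min ρ1 ρ2, by positivity, fun z hz h0 hr => ?_⟩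
  have a1 := t1 z hz h0 (hr.trans_le (min_le_left _ _))
  have a2 := t2 z hz h0 (hr.trans_le (min_le_right _ _))
  have gen : ∀ x y X : ℝ, |x| ≤ η / (|c| + |d| + 1) * X / ‖z - P‖^2 → |y| ≤ η / (|c| + |d| + 1) * X / ‖z - P‖^2 →
      |c * x + d * y| ≤ η * X / ‖z - P‖^2 := by
    intro x y X hx hy
    set t := η / (|c| + |d| + 1) * X / ‖z - P‖^2 with ht
    have e : η * X / ‖z - P‖^2 = (|c| + |d| + 1) * t := by rw [ht]; field_simp
    have t0 : 0 ≤ t := (abs_nonneg x).trans hx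
    rw [e]
    calc |c * x + d * y| ≤ |c| * |x| + |d| * |y| := by rw [← abs_mul, ← abs_mul]; exact abs_add_le _ _
      _ ≤ |c| * t + |d| * t := by gcongr
      _ ≤ _ := by nlinarith
  exact ⟨gen _ _ _ a1.1 a2.1, gen _ _ _ a1.2 a2.2⟩

end

section
open Set Filter Topology MeasureTheory InnerProductSpace
open scoped ContDiff

structure AdmK (a b : ℝ) (k : Fin 3) (w1 w2 : E2 → ℝ) : Prop where
  s1 : ContDiffOn ℝ ∞ w1 (TD a b)
  s2 : ContDiffOn ℝ ∞ w2 (TD a b)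
  x1 : (0 : Fin 3) ≠ k → ∀ p ∈ TD a b, ell a b 0 p = 0 → w1 p = 0
  x2 : (0 : Fin 3) ≠ k → ∀ p ∈ TD a b, ell a b 0 p = 0 → fderivWithin ℝ w2 (TD a b) p (nu a b 0) = 0
  y1 : (1 : Fin 3) ≠ k → ∀ p ∈ TD a b, ell a b 1 p = 0 → w2 p = 0
  y2 : (1 : Fin 3) ≠ k → ∀ p ∈ TD a b, ell a b 1 p = 0 → fderivWithin ℝ w1 (TD a b) p (nu a b 1) = 0
  h1 : (2 : Fin 3) ≠ k → ∀ p ∈ TD a b, ell a b 2 p = 0 → b * w1 p = a * w2 p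
  h2 : (2 : Fin 3) ≠ k → ∀ p ∈ TD a b, ell a b 2 p = 0 → a * fderivWithin ℝ w1 (TD a b) p (nu a b 2) + b * fderivWithin ℝ w2 (TD a b) p (nu a b 2) = 0

lemma AdmK.comb {a b : ℝ} {k : Fin 3} (ha : 0 < a) (hb : 0 < b) {w1 w2 v1 v2 : E2 → ℝ} (hw : Adm a b w1 w2) (hv : AdmK a b k v1 v2) (c d : ℝ) :
    AdmK a b k (fun z => c * w1 z + d * v1 z) (fun z => c * w2 z + d * v2 z) where
  s1 := (contDiffOn_const.mul hw.s1).add (contDiffOn_const.mul hv.s1)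
  s2 := (contDiffOn_const.mul hw.s2).add (contDiffOn_const.mul hv.s2)
  x1 hk p hp h := by simp [hw.x1 p hp h, hv.x1 hk p hp h]
  x2 hk p hp h := by rw [fdw_comb ha hb hw.s2 hv.s2 hp, hw.x2 p hp h, hv.x2 hk p hp h]; ring
  y1 hk p hp h := by simp [hw.y1 p hp h, hv.y1 hk p hp h]
  y2 hk p hp h := by rw [fdw_comb ha hb hw.s1 hv.s1 hp, hw.y2 p hp h, hv.y2 hk p hp h]; ring
  h1 hk p hp h := by linear_combination c * hw.h1 p hp h + d * hv.h1 hk p hp h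
  h2 hk p hp h := by
    rw [fdw_comb ha hb hw.s1 hv.s1 hp, fdw_comb ha hb hw.s2 hv.s2 hp]
    linear_combination c * hw.h2 p hp h + d * hv.h2 hk p hp h

def SB (mu : ℝ) (n P z : E2) : ℝ := (1 + inner ℝ n P - mu * ‖z - P‖^2) - innerSL ℝ n z

lemma SB_smooth (mu : ℝ) (n P : E2) : ContDiff ℝ ∞ (SB mu n P) :=
  (contDiff_const.sub (contDiff_const.mul (contDiff_radial P))).sub (innerSL ℝ n).contDiff

lemma SB_lap (mu : ℝ) (n P z : E2) : lap (SB mu n P) z = - 4 * mu := by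
  have h1 : ContDiffAt ℝ 2 (fun z : E2 => (1 + inner ℝ n P - mu * ‖z - P‖^2)) z :=
    ((contDiff_const.sub (contDiff_const.mul (contDiff_radial P))).contDiffAt).of_le (by norm_cast)
  have := lap_sub h1 ((innerSL ℝ n).contDiff.contDiffAt (x := z))
  rw [lap_quad, lap_linear, sub_zero] at this
  exact this

lemma radial_hasFDerivAt (P z : E2) : HasFDerivAt (fun z : E2 => ‖z - P‖^2) ((2:ℝ) • innerSL ℝ (z - P)) z := by
  have := ((hasFDerivAt_id (𝕜 := ℝ) z).sub_const P).norm_sq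
  exact this.congr_fderiv (by ext v; simp)

lemma SB_fd (mu : ℝ) (n P z v : E2) : fderiv ℝ (SB mu n P) z v = - (2 * mu * inner ℝ (z - P) v) - inner ℝ n v := by
  have h : HasFDerivAt (SB mu n P) _ z := (((radial_hasFDerivAt P z).const_mul mu).const_sub (1 + inner ℝ n P)).sub (innerSL ℝ n).hasFDerivAt
  rw [h.fderiv]
  simp only [sub_apply, neg_apply, smul_apply, innerSL_apply_apply, smul_eq_mul]; ring

lemma SB_bd {a b : ℝ} (ha : 0 < a) (hb : 0 < b) {mu ρ : ℝ} (hmu : 0 < mu) (h1 : ρ ≤ 1/8) (h2 : mu * ρ^2 ≤ 1/4) {i j : Fin 3} {P z : E2} (hz : ‖z - P‖ ≤ ρ) :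
    1/2 ≤ SB mu (nu a b i + nu a b j) P z ∧ SB mu (nu a b i + nu a b j) P z ≤ 5/4 := by
  have e : SB mu (nu a b i + nu a b j) P z = 1 - mu * ‖z - P‖^2 - (inner ℝ (nu a b i) (z - P) + inner ℝ (nu a b j) (z - P)) := by
    simp only [SB, innerSL_apply_apply, inner_add_left, inner_sub_right]; ring
  rw [e]
  have a1 := abs_real_inner_le_norm (nu a b i) (z - P)
  have a2 := abs_real_inner_le_norm (nu a b j) (z - P)
  rw [nu_norm ha hb, one_mul] at a1 a2
  have b1 := abs_le.1 a1
  have b2 := abs_le.1 a2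
  have : mu * ‖z - P‖^2 ≤ mu * ρ^2 := by gcongr
  have : 0 ≤ mu * ‖z - P‖^2 := by positivity
  constructor <;> linarith [b1.1, b1.2, b2.1, b2.2]

lemma corner_min {a b mu ρ δ : ℝ} (ha : 0 < a) (hb : 0 < b) (hmu : 0 < mu) {P : E2} {σ τ : ℝ} {i j k : Fin 3} {C : ℝ}
    (h : Vert a b P σ τ i j k C) {w1 w2 : E2 → ℝ} (hw : AdmK a b k w1 w2) (r1 : ρ ≤ 1/8) (r2 : mu * ρ^2 ≤ 1/4) (r3 : ρ < ell a b k P)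
    (l1 : ∀ z ∈ TI a b, ‖z - P‖ < ρ → lap w1 z ≤ - mu * w1 z) (l2 : ∀ z ∈ TI a b, ‖z - P‖ < ρ → lap w2 z ≤ - mu * w2 z)
    (hδ : 0 < δ) (near : ∀ z ∈ TD a b, ‖z - P‖ < δ → 0 ≤ w1 z ∧ 0 ≤ w2 z)
    (bd : ∀ z ∈ TD a b, ‖z - P‖ = ρ → 0 ≤ w1 z ∧ 0 ≤ w2 z) :
    ∀ z ∈ TD a b, ‖z - P‖ ≤ ρ → 0 ≤ w1 z ∧ 0 ≤ w2 z := by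
  set n := nu a b i + nu a b j with hn
  set S := SB mu n P with hS
  have Sb : ∀ z, ‖z - P‖ ≤ ρ → 1/2 ≤ S z ∧ S z ≤ 5/4 := fun z hz => SB_bd ha hb hmu r1 r2 hz
  set K : Set E2 := Tst a b ∩ {z | δ/2 ≤ ‖z - P‖ ∧ ‖z - P‖ ≤ ρ} with hK
  have Kc : IsCompact K := by
    apply (Tst_compact ha hb).inter_right
    have q1 : IsClosed {z : E2 | δ/2 ≤ ‖z - P‖} := isClosed_le continuous_const (by fun_prop)
    have q2 : IsClosed {z : E2 | ‖z - P‖ ≤ ρ} := isClosed_le (by fun_prop) continuous_const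
    exact q1.inter q2
  have KD : K ⊆ TD a b := fun z hz => h.toCor.mem_TD ha hb hz.1 (by linarith [hz.2.1]) (by linarith [hz.2.2])
  set g : E2 → ℝ := fun z => min (w1 z / (a * S z)) (w2 z / (b * S z)) with hg
  have Spos : ∀ z ∈ K, 0 < S z := fun z hz => by linarith [(Sb z hz.2.2).1]
  have gc : ContinuousOn g K := by
    have Sc : ContinuousOn S K := (SB_smooth mu n P).continuous.continuousOn
    refine continuous_min.comp_continuousOn (ContinuousOn.prodMk ((hw.s1.continuousOn.mono KD).div (continuousOn_const.mul Sc) fun z hz => ?_) ((hw.s2.continuousOn.mono KD).div (continuousOn_const.mul Sc) fun z hz => ?_))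
    · have := Spos z hz; exact (mul_pos ha this).ne'
    · have := Spos z hz; exact (mul_pos hb this).ne'
  suffices main : ∀ z ∈ K, 0 ≤ g z by
    intro z hz hzr
    by_cases hd : ‖z - P‖ < δ
    · exact near z hz hd
    · push Not at hd
      have hzK : z ∈ K := ⟨D_sub_T ha hb hz, by linarith, hzr⟩
      have hgz := main z hzK
      have := Spos z hzK
      rw [hg, le_min_iff] at hgz
      constructor
      · by_contra hc
        push Not at hc
        have := div_neg_of_neg_of_pos hc (by positivity : 0 < a * S z)
        linarith [hgz.1]
      · by_contra hc
        push Not at hc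
        have := div_neg_of_neg_of_pos hc (by positivity : 0 < b * S z)
        linarith [hgz.2]
  by_contra hcon
  push Not at hcon
  obtain ⟨z0, hz0, hg0⟩ := hcon
  obtain ⟨p, hpK, hmin⟩ := Kc.exists_isMinOn ⟨z0, hz0⟩ gc
  set m := g p with hm
  have hm0 : m < 0 := lt_of_le_of_lt (hmin hz0) hg0
  have hpD := KD hpK
  have hSp := Spos p hpK
  have notnn : ¬ (0 ≤ w1 p ∧ 0 ≤ w2 p) := by
    rintro ⟨q1, q2⟩
    have : 0 ≤ g p := le_min (by positivity) (by positivity)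
    linarith
  have hpδ : δ ≤ ‖p - P‖ := by
    by_contra hc; push Not at hc
    exact notnn (near p hpD hc)
  have hpρ : ‖p - P‖ < ρ := lt_of_le_of_ne hpK.2.2 fun hc => notnn (bd p hpD hc)
  -- shifted functions
  have f1 : ∀ z ∈ K, 0 ≤ w1 z - m * a * S z := by
    intro z hz
    have hs := Spos z hz
    have : m ≤ w1 z / (a * S z) := (hmin hz).trans (min_le_left _ _)
    rw [le_div_iff₀ (by positivity)] at this
    linarith
  have f2 : ∀ z ∈ K, 0 ≤ w2 z - m * b * S z := by
    intro z hz
    have hs := Spos z hz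
    have : m ≤ w2 z / (b * S z) := (hmin hz).trans (min_le_right _ _)
    rw [le_div_iff₀ (by positivity)] at this
    linarith
  have hor : w1 p - m * a * S p = 0 ∨ w2 p - m * b * S p = 0 := by
    rcases min_choice (w1 p / (a * S p)) (w2 p / (b * S p)) with hc | hc
    · left
      have : m = w1 p / (a * S p) := hc
      rw [eq_div_iff (by positivity)] at this; linarith
    · right
      have : m = w2 p / (b * S p) := hc
      rw [eq_div_iff (by positivity)] at this; linarith
  have Knh : ∀ᶠ z in 𝓝 p, z ∈ TD a b → z ∈ K := by
    have c1 : ∀ᶠ z in 𝓝 p, δ/2 < ‖z - P‖ := (isOpen_lt continuous_const (by fun_prop)).mem_nhds (show δ/2 < ‖p - P‖ by linarith)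
    have c2 : ∀ᶠ z in 𝓝 p, ‖z - P‖ < ρ := (isOpen_lt (by fun_prop) continuous_const).mem_nhds hpρ
    filter_upwards [c1, c2] with z d1 d2 hz
    exact ⟨D_sub_T ha hb hz, d1.le, d2.le⟩
  have SC2 : ContDiffAt ℝ 2 S p := ((SB_smooth mu n P).contDiffAt).of_le (by norm_cast)
  have SDw : ContDiffOn ℝ ∞ S (TD a b) := (SB_smooth mu n P).contDiffOn
  rcases D_cases hpD with hI | ⟨l, hl⟩
  · -- interior
    have Kn : ∀ᶠ z in 𝓝 p, z ∈ K := by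
      filter_upwards [Knh, D_nhds hI] with z q1 q2 using q1 q2
    have gen : ∀ (w : E2 → ℝ) (c : ℝ), 0 < c → ContDiffOn ℝ ∞ w (TD a b) → lap w p ≤ - mu * w p → (∀ z ∈ K, 0 ≤ w z - m * c * S z) → w p - m * c * S p ≠ 0 := by
      intro w c hc hws hwl hnn h0
      have hC2 := TI_C2 hws hI
      have hd : ContDiffAt ℝ 2 (fun z => (m * c) * S z) p := contDiffAt_const.mul SC2
      have := lap_min (hC2.sub hd) (by
        filter_upwards [Kn] with z hz
        simp only [h0]; exact hnn z hz)
      have e := lap_sub hC2 hd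
      rw [lap_const_mul _ SC2, SB_lap] at e
      rw [e] at this
      have hw0 : w p = m * c * S p := by linarith
      rw [hw0] at hwl
      have hb2 := (Sb p hpρ.le).2
      have : 0 < mu * c * (-m) * (4 - S p) := by
        have : 0 < -m := by linarith
        have : 0 < 4 - S p := by linarith
        positivity
      nlinarith
    rcases hor with h0 | h0
    · exact gen w1 a ha hw.s1 (l1 p hI hpρ) f1 h0
    · exact gen w2 b hb hw.s2 (l2 p hI hpρ) f2 h0
  · -- side
    have hlk : l ≠ k := by
      rintro rfl
      have := ell_lip ha hb l P p
      rw [hl] at this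
      have := abs_le.1 this
      linarith [this.1]
    have hlP : ell a b l P = 0 := by
      rcases h.all l with rfl | rfl | rfl
      · exact h.hi
      · exact h.hj
      · exact absurd rfl hlk
    have hin : inner ℝ (p - P) (nu a b l) = 0 := by
      have := ell_sub a b l P p
      rw [hl, hlP] at this
      rw [real_inner_comm]; linarith
    have hSl : fderivWithin ℝ S (TD a b) p (nu a b l) < 0 := by
      rw [((SB_smooth mu n P).differentiable (by simp) p).fderivWithin (D_ud ha hb p hpD)]
      rw [SB_fd, hin, hn, inner_add_left]
      have nn : ∀ l, inner ℝ (nu a b l) (nu a b l) = 1 := fun l => by rw [real_inner_self_eq_norm_sq, nu_norm ha hb]; norm_num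
      have := h.ang
      rcases h.all l with rfl | rfl | rfl
      · rw [nn, real_inner_comm]; linarith
      · rw [nn]; linarith
      · exact absurd rfl hlk
    -- general boundary contradiction
    have gen : ∀ (W : E2 → ℝ) (c : ℝ), 0 < c → ContDiffOn ℝ ∞ W (TD a b) → fderivWithin ℝ W (TD a b) p (nu a b l) = 0 →
        (∀ z ∈ K, 0 ≤ W z - m * c * S z) → W p - m * c * S p ≠ 0 := by
      intro W c hc hws hd hnn h0
      have hsm : ContDiffOn ℝ ∞ (fun z => 1 * W z + (-(m * c)) * S z) (TD a b) := (contDiffOn_const.mul hws).add (contDiffOn_const.mul SDw)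
      have := dir_ge (k := 0) (n := nu a b l) (smooth_diff hsm hpD) (by
        have hcont : ContinuousAt (fun t : ℝ => p + t • nu a b l) 0 := by fun_prop
        have hcont' : Tendsto (fun t : ℝ => p + t • nu a b l) (𝓝[>] 0) (𝓝 p) := by
          have := hcont.tendsto; simp only [zero_smul, add_zero] at this
          exact this.mono_left nhdsWithin_le_nhds
        filter_upwards [in_ev ha hb hpD hl, hcont'.eventually Knh] with t t1 t2
        have t3 := Int_sub a b t1
        refine ⟨t3, ?_⟩
        have := hnn _ (t2 t3)
        linarith)
      rw [fdw_comb ha hb hws SDw hpD, hd] at this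
      have : 0 < (-m) * c * (- fderivWithin ℝ S (TD a b) p (nu a b l)) := by
        have : 0 < -m := by linarith
        have : 0 < - fderivWithin ℝ S (TD a b) p (nu a b l) := by linarith
        positivity
      nlinarith
    fin_cases l
    · simp only [Fin.zero_eta] at *
      have hw0 := hw.x1 hlk p hpD hl
      refine gen w2 b hb hw.s2 (hw.x2 hlk p hpD hl) f2 (hor.resolve_left ?_)
      rw [hw0]
      have : 0 < (-m) * a * S p := by
        have : 0 < -m := by linarith
        positivity
      intro hc; linarith
    · simp only [Fin.mk_one] at *
      have hw0 := hw.y1 hlk p hpD hl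
      refine gen w1 a ha hw.s1 (hw.y2 hlk p hpD hl) f1 (hor.resolve_right ?_)
      rw [hw0]
      have : 0 < (-m) * b * S p := by
        have : 0 < -m := by linarith
        positivity
      intro hc; linarith
    · simp only [Fin.reduceFinMk] at *
      have e1 := hw.h1 hlk p hpD hl
      refine gen (fun z => a * w1 z + b * w2 z) (a^2+b^2) (by positivity) ((contDiffOn_const.mul hw.s1).add (contDiffOn_const.mul hw.s2)) ?_ ?_ ?_
      · rw [fdw_comb ha hb hw.s1 hw.s2 hpD]; exact hw.h2 hlk p hpD hl
      · intro z hz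
        nlinarith [mul_nonneg ha.le (f1 z hz), mul_nonneg hb.le (f2 z hz)]
      · have e2 : b * (w1 p - m * a * S p) = a * (w2 p - m * b * S p) := by linear_combination e1
        have z1 : w1 p - m * a * S p = 0 := by
          rcases hor with h0 | h0
          · exact h0
          · rw [h0, mul_zero] at e2; exact (mul_eq_zero.1 e2).resolve_left hb.ne'
        have z2 : w2 p - m * b * S p = 0 := by
          rw [z1, mul_zero] at e2; exact (mul_eq_zero.1 e2.symm).resolve_left ha.ne'
        linear_combination a * z1 + b * z2

end

section
open Set Filter Topology MeasureTheory InnerProductSpace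
open scoped ContDiff

def bf (M s : ℝ) : ℝ := s⁻¹ - M * Real.log s
def bf1 (M s : ℝ) : ℝ := - (s^2)⁻¹ - M * s⁻¹

lemma bf_d {M s : ℝ} (hs : s ≠ 0) : HasDerivAt (bf M) (bf1 M s) s := by
  have : HasDerivAt (bf M) _ s := (hasDerivAt_inv hs).sub ((Real.hasDerivAt_log hs).const_mul M)
  exact this

lemma bf1_d {M s : ℝ} (hs : s ≠ 0) : HasDerivAt (bf1 M) (2 * (s^3)⁻¹ + M * (s^2)⁻¹) s := by
  have h1 : HasDerivAt (fun s : ℝ => (s^2)⁻¹) _ s := (hasDerivAt_pow 2 s).inv (pow_ne_zero 2 hs)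
  have : HasDerivAt (bf1 M) _ s := h1.neg.sub ((hasDerivAt_inv hs).const_mul M)
  refine this.congr_deriv ?_
  field_simp; ring

/-- affine form times radial -/
def bG (M : ℝ) (n P z : E2) : ℝ := inner ℝ n (z - P) * bf M (‖z - P‖^2)

lemma bf_cd {M : ℝ} {P z : E2} (hz : 0 < ‖z - P‖) : ContDiffAt ℝ ∞ (fun z => bf M (‖z - P‖^2)) z := by
  have h0 : ‖z - P‖^2 ≠ 0 := by positivity
  have hr := (contDiff_radial P).contDiffAt (x := z)
  exact (hr.inv h0).sub (contDiffAt_const.mul (hr.log h0))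

lemma bG_cd {M : ℝ} {n P z : E2} (hz : 0 < ‖z - P‖) : ContDiffAt ℝ ∞ (bG M n P) z := by
  have : ContDiff ℝ ∞ (fun z : E2 => inner ℝ n (z - P)) := contDiff_const.inner ℝ (contDiff_id.sub contDiff_const)
  exact this.contDiffAt.mul (bf_cd hz)

lemma bf_fd {M : ℝ} {P z : E2} (hz : 0 < ‖z - P‖) : HasFDerivAt (fun z => bf M (‖z - P‖^2)) (bf1 M (‖z - P‖^2) • ((2:ℝ) • innerSL ℝ (z - P))) z := by
  have := HasDerivAt.comp_hasFDerivAt (h₂ := bf M) (f := fun z : E2 => ‖z - P‖^2) z (bf_d (M := M) (by positivity : ‖z - P‖^2 ≠ 0)) (radial_hasFDerivAt P z)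
  exact this

lemma aff_fd (n P z : E2) : HasFDerivAt (fun z : E2 => inner ℝ n (z - P)) (innerSL ℝ n) z := by
  have : HasFDerivAt (fun z : E2 => innerSL ℝ n (z - P)) _ z := (innerSL ℝ n).hasFDerivAt.comp z ((hasFDerivAt_id (𝕜 := ℝ) z).sub_const P)
  exact this.congr_fderiv (by ext v; simp)

lemma bG_fd {M : ℝ} {n P z : E2} (hz : 0 < ‖z - P‖) (v : E2) : fderiv ℝ (bG M n P) z v =
    inner ℝ n v * bf M (‖z - P‖^2) + inner ℝ n (z - P) * (bf1 M (‖z - P‖^2) * (2 * inner ℝ (z - P) v)) := by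
  have : HasFDerivAt (bG M n P) _ z := (aff_fd n P z).mul (bf_fd (M := M) hz)
  rw [this.fderiv]
  simp only [add_apply, smul_apply, innerSL_apply_apply, smul_eq_mul]; ring

lemma bG_lap {M : ℝ} {n P z : E2} (hz : 0 < ‖z - P‖) : lap (bG M n P) z = - 4 * M * inner ℝ n (z - P) / ‖z - P‖^2 := by
  have hs : ‖z - P‖^2 ≠ 0 := by positivity
  have A : ContDiff ℝ ∞ (fun z : E2 => inner ℝ n (z - P)) := contDiff_const.inner ℝ (contDiff_id.sub contDiff_const)
  have h1 := lap_mul (u := fun z : E2 => inner ℝ n (z - P)) (w := fun z => bf M (‖z - P‖^2)) (p := z) (A.contDiffAt.of_le (by norm_cast)) ((bf_cd hz).of_le (by norm_cast))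
  have l1 : lap (fun z : E2 => inner ℝ n (z - P)) z = 0 := by
    have := lap_sub (p := z) ((innerSL ℝ n).contDiff.contDiffAt) (contDiffAt_const (c := inner ℝ n P))
    rw [lap_linear, lap_const, sub_zero] at this
    rw [← this]; congr 1; funext y; simp [inner_sub_right]
  have l2 := lap_radial (f := bf M) (f1 := bf1 M) (q := P) (p := z) ((isOpen_ne.eventually_mem hs).mono fun s hs => bf_d hs) (bf1_d hs)
  rw [l1, l2, (bf_fd hz).fderiv, (aff_fd n P z).fderiv] at h1
  have : lap (bG M n P) z = _ := h1
  rw [this]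
  simp only [smul_apply, innerSL_apply_apply, smul_eq_mul]
  have e : inner ℝ n e0 * inner ℝ (z - P) e0 + inner ℝ n e1 * inner ℝ (z - P) e1 = inner ℝ n (z - P) := by
    simp only [inner_E2]; simp
  have : ∀ c : ℝ, inner ℝ n e0 * (c * (2 * inner ℝ (z - P) e0)) + inner ℝ n e1 * (c * (2 * inner ℝ (z - P) e1)) = 2 * c * inner ℝ n (z - P) := by
    intro c; rw [← e]; ring
  rw [this, bf1]
  field_simp; ring

lemma bf_lower {M s : ℝ} (hM : 0 < M) (h0 : 0 < s) (h1 : s ≤ 1) : 1 / s ≤ bf M s := by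
  have := Real.log_nonpos h0.le h1
  unfold bf
  rw [one_div]; nlinarith

/-- `mu * f ≤ 4 M / s` for small radius -/
lemma bf_upper {M r : ℝ} (hM : 0 < M) (h0 : 0 < r) (h1 : M * r ≤ 1) : M * bf M (r^2) ≤ 4 * M / r^2 := by
  have hl : - Real.log r ≤ r⁻¹ := by
    have := Real.one_sub_inv_le_log_of_pos h0; linarith
  have e : Real.log (r^2) = 2 * Real.log r := by rw [Real.log_pow]; norm_num
  rw [bf, e]
  have h2 : (r^2)⁻¹ - M * (2 * Real.log r) ≤ (r^2)⁻¹ + 2 * (M * r⁻¹) := by nlinarith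
  have h3 : M * r⁻¹ ≤ (r^2)⁻¹ := by
    rw [← div_eq_mul_inv, inv_eq_one_div, div_le_div_iff₀ h0 (by positivity)]; nlinarith
  have h4 : 4 * M / r^2 = M * (4 * (r^2)⁻¹) := by rw [div_eq_mul_inv]; ring
  rw [h4]
  have : 0 < (r^2)⁻¹ := by positivity
  gcongr; linarith

lemma TD_ne {a b : ℝ} {P : E2} {i j k : Fin 3} {C : ℝ} (h : Cor a b P i j k C) {z : E2} (hz : z ∈ TD a b) (hij : i ≠ j) : 0 < ‖z - P‖ := by
  rw [norm_pos_iff, sub_ne_zero]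
  rintro rfl
  have := hz.2 i j hij
  rw [h.hi, h.hj] at this; simp at this

lemma Vert.ij {a b : ℝ} {P : E2} {σ τ : ℝ} {i j k : Fin 3} {C : ℝ} (h : Vert a b P σ τ i j k C) : i ≠ j := by
  rintro rfl
  have := h.all
  revert this
  clear h
  revert i k; decide

lemma Vert.zero {a b : ℝ} {P : E2} {σ τ : ℝ} {i j k : Fin 3} {C : ℝ} (h : Vert a b P σ τ i j k C) {l : Fin 3} (hl : l ≠ k) : ell a b l P = 0 := by
  rcases h.all l with rfl | rfl | rfl
  · exact h.hi
  · exact h.hj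
  · exact absurd rfl hl

lemma G_admK {a b M : ℝ} (ha : 0 < a) (hb : 0 < b) {P : E2} {σ τ : ℝ} {i j k : Fin 3} {C : ℝ}
    (h : Vert a b P σ τ i j k C) : AdmK a b k (bG M (σ • e0) P) (bG M (τ • e1) P) := by
  have pos : ∀ z ∈ TD a b, 0 < ‖z - P‖ := fun z hz => TD_ne h.toCor hz h.ij
  have fdw : ∀ n z, z ∈ TD a b → fderivWithin ℝ (bG M n P) (TD a b) z = fderiv ℝ (bG M n P) z := fun n z hz =>
    ((bG_cd (M := M) (n := n) (pos z hz)).differentiableAt (by simp)).fderivWithin (D_ud ha hb z hz)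
  have perp : ∀ l, l ≠ k → ∀ p, ell a b l p = 0 → inner ℝ (p - P) (nu a b l) = 0 := by
    intro l hl p hp
    have := ell_sub a b l P p
    rw [hp, h.zero hl] at this
    rw [real_inner_comm]; linarith
  constructor
  · exact fun z hz => (bG_cd (pos z hz)).contDiffWithinAt
  · exact fun z hz => (bG_cd (pos z hz)).contDiffWithinAt
  · intro hk p hp h0
    have := perp 0 hk p h0
    simp only [nu] at this
    rw [bG, inner_smul_left, real_inner_comm]
    simp at this ⊢
    simp [this]
  · intro hk p hp h0
    rw [fdw _ p hp, bG_fd (pos p hp), perp 0 hk p h0]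
    simp [nu, inner_E2]
  · intro hk p hp h0
    have := perp 1 hk p h0
    simp only [nu] at this
    rw [bG, inner_smul_left, real_inner_comm]
    simp at this ⊢
    simp [this]
  · intro hk p hp h0
    rw [fdw _ p hp, bG_fd (pos p hp), perp 1 hk p h0]
    simp [nu, inner_E2]
  · intro hk p hp h0
    have h2 := perp 2 hk p h0
    have hst := h.hyp.resolve_left (Ne.symm hk)
    rw [nu2_eq, inner_E2] at h2
    simp at h2
    have hk2 := kap_pos ha hb
    have e : b * (p 0 - P 0) = - (a * (p 1 - P 1)) := by
      field_simp at h2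
      have : kap a b * (b * (p 0 - P 0) + a * (p 1 - P 1)) = 0 := by linarith
      rcases mul_eq_zero.1 this with hc | hc
      · exact absurd hc hk2.ne'
      · linarith
    have hτ : τ = - σ := by linarith
    simp only [bG, inner_E2, hτ]
    simp
    linear_combination (σ * bf M (‖p - P‖^2)) * e
  · intro hk p hp h0
    have h2 := perp 2 hk p h0
    have hst := h.hyp.resolve_left (Ne.symm hk)
    rw [fdw _ p hp, fdw _ p hp, bG_fd (pos p hp), bG_fd (pos p hp), h2]
    have hτ : τ = - σ := by linarith
    rw [nu2_eq, hτ]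
    simp only [inner_E2]
    simp
    field_simp
    ring

lemma corner {a b mu : ℝ} (ha : 0 < a) (hb : 0 < b) (hmu : 0 < mu) {P : E2} {σ τ : ℝ} {i j k : Fin 3} {C : ℝ}
    (h : Vert a b P σ τ i j k C) : ∃ ρ0 > (0:ℝ), ∀ ρ, ρ ≤ ρ0 → ∀ w1 w2 : E2 → ℝ, Adm a b w1 w2 →
      (∀ z ∈ TI a b, lap w1 z ≤ - mu * w1 z) → (∀ z ∈ TI a b, lap w2 z ≤ - mu * w2 z) → Tip a b P σ τ w1 w2 →
      (∀ z ∈ TD a b, ‖z - P‖ = ρ → 0 ≤ w1 z ∧ 0 ≤ w2 z) → ∀ z ∈ TD a b, ‖z - P‖ ≤ ρ → 0 ≤ w1 z ∧ 0 ≤ w2 z := by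
  have hk := h.hk
  refine ⟨min (min (1/8) (1/mu)) (min (1/(4*mu)) (ell a b k P / 2)), by positivity, ?_⟩
  intro ρ hρ w1 w2 hw l1 l2 ht bd z hz hzr
  simp only [le_min_iff] at hρ
  obtain ⟨⟨r1, r2⟩, r3, r4⟩ := hρ
  rw [le_div_iff₀ (by positivity)] at r2 r3
  have pos : ∀ z ∈ TD a b, 0 < ‖z - P‖ := fun z hz => TD_ne h.toCor hz h.ij
  have hρ0 : 0 < ρ := lt_of_lt_of_le (pos z hz) hzr
  have X0 : ∀ z ∈ TD a b, 0 ≤ inner ℝ (σ • e0) (z - P) := fun z hz => by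
    have := h.X0 z (D_sub_T ha hb hz); rw [inner_E2]; simpa using this
  have Y0 : ∀ z ∈ TD a b, 0 ≤ inner ℝ (τ • e1) (z - P) := fun z hz => by
    have := h.Y0 z (D_sub_T ha hb hz); rw [inner_E2]; simpa using this
  have Xe : ∀ z, inner ℝ (σ • e0) (z - P) = σ * (z 0 - P 0) := fun z => by rw [inner_E2]; simp
  have Ye : ∀ z, inner ℝ (τ • e1) (z - P) = τ * (z 1 - P 1) := fun z => by rw [inner_E2]; simp
  have Glow : ∀ n : E2, ∀ z, 0 < ‖z - P‖ → ‖z - P‖ ≤ 1 → 0 ≤ inner ℝ n (z - P) → inner ℝ n (z - P) / ‖z - P‖^2 ≤ bG mu n P z := by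
    intro n z h0 h1 hn
    have := mul_le_mul_of_nonneg_left (bf_lower hmu (by positivity : 0 < ‖z - P‖^2) (by nlinarith)) hn
    rw [mul_one_div] at this; exact this
  have Glap : ∀ n : E2, ∀ z, 0 < ‖z - P‖ → ‖z - P‖ < ρ → 0 ≤ inner ℝ n (z - P) → lap (bG mu n P) z ≤ - mu * bG mu n P z := by
    intro n z h0 h1 hn
    rw [bG_lap h0, bG]
    have := mul_le_mul_of_nonneg_left (bf_upper (r := ‖z - P‖) hmu h0 (by nlinarith)) hn
    have e : - 4 * mu * inner ℝ n (z - P) / ‖z - P‖^2 = - (inner ℝ n (z - P) * (4 * mu / ‖z - P‖^2)) := by ring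
    rw [e]; linarith
  have GK := G_admK (M := mu) ha hb h
  have main : ∀ ε > (0:ℝ), 0 ≤ 1 * w1 z + ε * bG mu (σ • e0) P z ∧ 0 ≤ 1 * w2 z + ε * bG mu (τ • e1) P z := by
    intro ε hε
    obtain ⟨δ, hδ, hd⟩ := ht ε hε
    refine corner_min ha hb hmu h (AdmK.comb ha hb hw GK 1 ε) (by linarith) (by nlinarith) (by linarith) ?_ ?_ (lt_min hδ one_pos) ?_ ?_ z hz hzr
    · intro y hy hyr
      have hy' := Int_sub a b hy
      rw [lap_add (contDiffAt_const.mul (TI_C2 hw.s1 hy)) (contDiffAt_const.mul (TI_C2 GK.s1 hy)), lap_const_mul _ (TI_C2 hw.s1 hy), lap_const_mul _ (TI_C2 GK.s1 hy)]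
      have := mul_le_mul_of_nonneg_left (Glap (σ • e0) y (pos y hy') hyr (X0 y hy')) hε.le
      have := l1 y hy
      linarith
    · intro y hy hyr
      have hy' := Int_sub a b hy
      rw [lap_add (contDiffAt_const.mul (TI_C2 hw.s2 hy)) (contDiffAt_const.mul (TI_C2 GK.s2 hy)), lap_const_mul _ (TI_C2 hw.s2 hy), lap_const_mul _ (TI_C2 GK.s2 hy)]
      have := mul_le_mul_of_nonneg_left (Glap (τ • e1) y (pos y hy') hyr (Y0 y hy')) hε.le
      have := l2 y hy
      linarith
    · intro y hy hyr
      rw [lt_min_iff] at hyr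
      obtain ⟨q1, q2⟩ := hd y hy (pos y hy) hyr.1
      have g1 := mul_le_mul_of_nonneg_left (Glow (σ • e0) y (pos y hy) hyr.2.le (X0 y hy)) hε.le
      have g2 := mul_le_mul_of_nonneg_left (Glow (τ • e1) y (pos y hy) hyr.2.le (Y0 y hy)) hε.le
      rw [Xe, ← mul_div_assoc] at g1
      rw [Ye, ← mul_div_assoc] at g2
      have q1 := (abs_le.1 q1).1
      have q2 := (abs_le.1 q2).1
      constructor <;> linarith
    · intro y hy hyr
      obtain ⟨q1, q2⟩ := bd y hy hyr
      have g1 := (div_nonneg (X0 y hy) (sq_nonneg _)).trans (Glow (σ • e0) y (pos y hy) (by linarith) (X0 y hy))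
      have g2 := (div_nonneg (Y0 y hy) (sq_nonneg _)).trans (Glow (τ • e1) y (pos y hy) (by linarith) (Y0 y hy))
      constructor <;> positivity
  have lim : ∀ x g : ℝ, (∀ ε > (0:ℝ), 0 ≤ 1 * x + ε * g) → 0 ≤ x := by
    intro x g hh
    by_contra hc
    push Not at hc
    have := hh (-x / (2 * (|g| + 1))) (div_pos (by linarith) (by positivity))
    have h2 : -x / (2 * (|g| + 1)) * g ≤ -x / 2 := by
      rw [div_mul_eq_mul_div, div_le_div_iff₀ (by positivity) (by norm_num)]
      have := le_abs_self g
      nlinarith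
    linarith
  exact ⟨lim _ _ fun ε hε => (main ε hε).1, lim _ _ fun ε hε => (main ε hε).2⟩

end

section
open Set Filter Topology MeasureTheory InnerProductSpace
open scoped ContDiff

lemma side_mono {a b : ℝ} (ha : 0 < a) (hb : 0 < b) {g : E2 → ℝ} {m : Fin 3} (hg : ContDiffOn ℝ ∞ g (TD a b))
    (g0 : ∀ z ∈ TD a b, ell a b m z = 0 → g z = 0) {p : E2} (hp : p ∈ TD a b) (hm : ell a b m p = 0)
    (hd : 0 < fderivWithin ℝ g (TD a b) p (nu a b m)) : ∀ᶠ z in 𝓝[TD a b] p, 0 ≤ g z := by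
  obtain ⟨r, hr, hrad⟩ := side_rad hp hm
  have hc := (grad_smooth ha hb hg (nu a b m)).continuousOn p hp
  have hev : ∀ᶠ z in 𝓝[TD a b] p, 0 < fderivWithin ℝ g (TD a b) z (nu a b m) := hc.eventually (lt_mem_nhds hd)
  rw [eventually_nhdsWithin_iff, Metric.eventually_nhds_iff] at hev
  obtain ⟨ε, hε, hev⟩ := hev
  rw [eventually_nhdsWithin_iff, Metric.eventually_nhds_iff]
  refine ⟨min r ε / 2, by positivity, fun z hz hzD => ?_⟩
  rw [dist_eq_norm] at hz
  set t0 := ell a b m z with ht0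
  have ht0n : 0 ≤ t0 := hzD.1 m
  have ht1 : t0 ≤ ‖z - p‖ := by
    have := ell_lip ha hb m p z
    rw [hm, sub_zero] at this
    exact (le_abs_self _).trans this
  have hnear : ∀ s ∈ Icc 0 t0, ‖z + (s - t0) • nu a b m - p‖ < min r ε := by
    intro s hs
    have e : z + (s - t0) • nu a b m - p = (z - p) + (s - t0) • nu a b m := by abel
    rw [e]
    have h1 := norm_add_le (z - p) ((s - t0) • nu a b m)
    rw [norm_smul, nu_norm ha hb, mul_one, Real.norm_eq_abs, abs_of_nonpos (by linarith [hs.2])] at h1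
    linarith [hs.1]
  have hell : ∀ s, ell a b m (z + (s - t0) • nu a b m) = s := by
    intro s
    rw [ell_sub a b m z, add_sub_cancel_left, inner_smul_right, real_inner_self_eq_norm_sq, nu_norm ha hb, ← ht0]; ring
  have hmem : ∀ s ∈ Icc 0 t0, z + (s - t0) • nu a b m ∈ TD a b := fun s hs =>
    (side_loc ha hb hrad ((hnear s hs).trans_le (min_le_left _ _))).2 (by rw [hell]; exact hs.1)
  have hmono : MonotoneOn (fun s : ℝ => g (z + (s - t0) • nu a b m)) (Icc 0 t0) := by
    apply monotoneOn_of_hasDerivWithinAt_nonneg (convex_Icc 0 t0) (f' := fun s => fderivWithin ℝ g (TD a b) (z + (s - t0) • nu a b m) (nu a b m))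
    · exact hg.continuousOn.comp (by fun_prop) hmem
    · intro s hs
      rw [interior_Icc] at hs
      have hs' := Ioo_subset_Icc_self hs
      have hI : z + (s - t0) • nu a b m ∈ TI a b := side_Int ha hb hrad ((hnear s hs').trans_le (min_le_left _ _)) (by rw [hell]; exact hs.1)
      have h1 : HasFDerivAt g (fderivWithin ℝ g (TD a b) (z + (s - t0) • nu a b m)) (z + (s - t0) • nu a b m) :=
        (smooth_diff hg (Int_sub a b hI)).hasFDerivWithinAt.hasFDerivAt (D_nhds hI)
      have h2 : HasDerivAt (fun s : ℝ => z + (s - t0) • nu a b m) (nu a b m) s := by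
        have := (((hasDerivAt_id s).sub_const t0).smul_const (nu a b m)).const_add z
        exact this.congr_deriv (by simp)
      exact (h1.comp_hasDerivAt s h2).hasDerivWithinAt
    · intro s hs
      rw [interior_Icc] at hs
      have hs' := Ioo_subset_Icc_self hs
      exact (hev (by rw [dist_eq_norm]; exact (hnear s hs').trans_le (min_le_right _ _)) (hmem s hs')).le
  have := hmono (left_mem_Icc.2 ht0n) (right_mem_Icc.2 ht0n) ht0n
  simp only [sub_self, zero_smul, add_zero] at this
  rw [g0 _ (hmem 0 (left_mem_Icc.2 ht0n)) (hell 0)] at this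
  exact this

lemma loc_comp {a b : ℝ} (ha : 0 < a) (hb : 0 < b) {f v : E2 → ℝ} {m : Fin 3} (hf : ContDiffOn ℝ ∞ f (TD a b)) (hv : ContDiffOn ℝ ∞ v (TD a b))
    (f0 : ∀ z ∈ TD a b, ell a b m z = 0 → f z = 0) (v0 : ∀ z ∈ TD a b, ell a b m z = 0 → v z = 0)
    (vp : ∀ z ∈ TD a b, 0 < ell a b m z → 0 < v z) (vd : ∀ z ∈ TD a b, ell a b m z = 0 → 0 < fderivWithin ℝ v (TD a b) z (nu a b m))
    {K : Set E2} (hK : IsCompact K) (hKD : K ⊆ TD a b) : ∃ C : ℝ, 0 ≤ C ∧ ∀ z ∈ K, |f z| ≤ C * v z := by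
  have vn : ∀ z ∈ TD a b, 0 ≤ v z := by
    intro z hz
    rcases (hz.1 m).lt_or_eq with h | h
    · exact (vp z hz h).le
    · exact (v0 z hz h.symm).ge
  suffices ∃ C : ℝ, 0 ≤ C ∧ ∀ z ∈ K, z ∈ TD a b → |f z| ≤ C * v z by
    obtain ⟨C, hC, h⟩ := this
    exact ⟨C, hC, fun z hz => h z hz (hKD hz)⟩
  refine hK.induction_on (p := fun s => ∃ C : ℝ, 0 ≤ C ∧ ∀ z ∈ s, z ∈ TD a b → |f z| ≤ C * v z) ⟨0, le_rfl, by simp⟩ ?_ ?_ ?_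
  · rintro s t hst ⟨C, hC, h⟩
    exact ⟨C, hC, fun z hz => h z (hst hz)⟩
  · rintro s t ⟨C, hC, h⟩ ⟨C', hC', h'⟩
    refine ⟨C + C', by positivity, fun z hz hD => ?_⟩
    have := vn z hD
    rcases hz with hz | hz
    · nlinarith [h z hz hD, mul_nonneg hC' this]
    · nlinarith [h' z hz hD, mul_nonneg hC this]
  · intro p hp
    have hpD := hKD hp
    suffices ∃ C : ℝ, 0 ≤ C ∧ ∀ᶠ z in 𝓝[TD a b] p, |f z| ≤ C * v z by
      obtain ⟨C, hC, h⟩ := this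
      rw [eventually_nhdsWithin_iff] at h
      exact ⟨_, mem_nhdsWithin_of_mem_nhds h, C, hC, fun z hz hD => hz hD⟩
    rcases (hpD.1 m).lt_or_eq with h | h
    · have hvp := vp p hpD h
      refine ⟨(|f p| + 1) / v p, by positivity, ?_⟩
      have c1 : ContinuousWithinAt (fun z => (|f p| + 1) / v p * v z - |f z|) (TD a b) p :=
        (continuousWithinAt_const.mul (hv.continuousOn p hpD)).sub (hf.continuousOn p hpD).abs
      have : ∀ᶠ z in 𝓝[TD a b] p, 0 < (|f p| + 1) / v p * v z - |f z| := c1.eventually (lt_mem_nhds (by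
        show 0 < (|f p| + 1) / v p * v p - |f p|
        rw [div_mul_cancel₀ _ hvp.ne']; linarith))
      filter_upwards [this] with z hz; linarith
    · have hvd := vd p hpD h.symm
      set C := (|fderivWithin ℝ f (TD a b) p (nu a b m)| + 1) / fderivWithin ℝ v (TD a b) p (nu a b m) with hC
      have hC0 : 0 ≤ C := by positivity
      have e : C * fderivWithin ℝ v (TD a b) p (nu a b m) = |fderivWithin ℝ f (TD a b) p (nu a b m)| + 1 := div_mul_cancel₀ _ hvd.ne'
      have gen : ∀ d : ℝ, |d| ≤ 1 → ∀ᶠ z in 𝓝[TD a b] p, 0 ≤ C * v z + d * f z := by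
        intro d hd
        apply side_mono ha hb (m := m) ((contDiffOn_const.mul hv).add (contDiffOn_const.mul hf)) _ hpD h.symm
        · rw [fdw_comb ha hb hv hf hpD, e]
          have h1 := neg_abs_le (d * fderivWithin ℝ f (TD a b) p (nu a b m))
          rw [abs_mul] at h1
          have := mul_le_mul_of_nonneg_right hd (abs_nonneg (fderivWithin ℝ f (TD a b) p (nu a b m)))
          linarith
        · intro z hz hz0
          rw [v0 z hz hz0, f0 z hz hz0]; ring
      refine ⟨C, hC0, ?_⟩
      filter_upwards [gen 1 (by simp), gen (-1) (by simp)] with z h1 h2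
      rw [abs_le]; constructor <;> linarith

structure Fld (a b mu : ℝ) (w1 w2 : E2 → ℝ) : Prop where
  adm : Adm a b w1 w2
  l1 : ∀ z ∈ TI a b, lap w1 z = - mu * w1 z
  l2 : ∀ z ∈ TI a b, lap w2 z = - mu * w2 z
  tO : Tip a b 0 1 1 w1 w2
  tA : Tip a b (a • e0) (-1) 1 w1 w2
  tB : Tip a b (b • e1) 1 (-1) w1 w2

lemma Eig.fld {a b mu : ℝ} (ha : 0 < a) (hb : 0 < b) {u : E2 → ℝ} (hu : Eig a b mu u) :
    Fld a b mu (fun z => fderivWithin ℝ u (TD a b) z e0) (fun z => fderivWithin ℝ u (TD a b) z (-e1)) where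
  adm := hu.adm ha hb
  l1 _ hz := hu.lap_grad e0 hz
  l2 _ hz := hu.lap_grad (-e1) hz
  tO := hu.tipV ha hb (vert_O ha hb)
  tA := hu.tipV ha hb (vert_A ha hb).choose_spec
  tB := hu.tipV ha hb (vert_B ha hb).choose_spec

lemma K_exists {a b mu : ℝ} (ha : 0 < a) (hb : 0 < b) (hmu : 0 < mu) : ∃ K : Set E2, IsCompact K ∧ K ⊆ TD a b ∧
    ∀ w1 w2 : E2 → ℝ, Adm a b w1 w2 → (∀ z ∈ TI a b, lap w1 z ≤ - mu * w1 z) → (∀ z ∈ TI a b, lap w2 z ≤ - mu * w2 z) →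
      Tip a b 0 1 1 w1 w2 → Tip a b (a • e0) (-1) 1 w1 w2 → Tip a b (b • e1) 1 (-1) w1 w2 →
      (∀ z ∈ K, 0 ≤ w1 z ∧ 0 ≤ w2 z) → ∀ z ∈ TD a b, 0 ≤ w1 z ∧ 0 ≤ w2 z := by
  obtain ⟨ρ1, p1, c1⟩ := corner ha hb hmu (vert_O ha hb)
  obtain ⟨ρ2, p2, c2⟩ := corner ha hb hmu (vert_A ha hb).choose_spec
  obtain ⟨ρ3, p3, c3⟩ := corner ha hb hmu (vert_B ha hb).choose_spec
  obtain ⟨ρ, hρ, q1, q2, q3, q4, q5⟩ : ∃ ρ > (0:ℝ), ρ ≤ ρ1 ∧ ρ ≤ ρ2 ∧ ρ ≤ ρ3 ∧ 2 * ρ ≤ a ∧ 2 * ρ ≤ b := by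
    refine ⟨min (min ρ1 ρ2) (min ρ3 (min (a/2) (b/2))), by positivity, ?_, ?_, ?_, ?_, ?_⟩
    · exact (min_le_left _ _).trans (min_le_left _ _)
    · exact (min_le_left _ _).trans (min_le_right _ _)
    · exact (min_le_right _ _).trans (min_le_left _ _)
    · have : min (min ρ1 ρ2) (min ρ3 (min (a/2) (b/2))) ≤ a / 2 := (min_le_right _ _).trans ((min_le_right _ _).trans (min_le_left _ _))
      linarith
    · have : min (min ρ1 ρ2) (min ρ3 (min (a/2) (b/2))) ≤ b / 2 := (min_le_right _ _).trans ((min_le_right _ _).trans (min_le_right _ _))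
      linarith
  have dOA : a ≤ ‖(0 : E2) - a • e0‖ := by
    rw [zero_sub, norm_neg, norm_smul, norm_e0, mul_one, Real.norm_eq_abs]; exact le_abs_self a
  have dOB : b ≤ ‖(0 : E2) - b • e1‖ := by
    rw [zero_sub, norm_neg, norm_smul, norm_e1, mul_one, Real.norm_eq_abs]; exact le_abs_self b
  have dAB : a ≤ ‖a • e0 - b • e1‖ := by
    apply le_of_sq_le_sq _ (norm_nonneg _)
    rw [normsq_E2]; simp; positivity
  set K : Set E2 := Tst a b ∩ {z | ∀ P ∈ Vx a b, ρ ≤ ‖z - P‖} with hK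
  have sep : ∀ z P Q : E2, 2 * ρ ≤ ‖P - Q‖ → ‖z - P‖ = ρ → ρ ≤ ‖z - Q‖ := by
    intro z P Q h1 h2
    have := norm_sub_le_norm_sub_add_norm_sub P z Q
    rw [norm_sub_rev P z] at this
    linarith
  refine ⟨K, ?_, ?_, ?_⟩
  · apply (Tst_compact ha hb).inter_right
    have : {z : E2 | ∀ P ∈ Vx a b, ρ ≤ ‖z - P‖} = ⋂ P ∈ Vx a b, {z : E2 | ρ ≤ ‖z - P‖} := by ext; simp
    rw [this]
    refine isClosed_biInter fun P _ => ?_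
    exact isClosed_le continuous_const (by fun_prop)
  · intro z hz
    rw [D_eq ha hb]
    refine ⟨hz.1, fun hv => ?_⟩
    have := hz.2 z hv
    simp at this; linarith
  · intro w1 w2 hw l1 l2 t1 t2 t3 hnn z hz
    by_cases hzK : z ∈ K
    · exact hnn z hzK
    have : ∃ P ∈ Vx a b, ‖z - P‖ < ρ := by
      by_contra hc; push Not at hc
      exact hzK ⟨D_sub_T ha hb hz, hc⟩
    obtain ⟨P, hP, hzP⟩ := this
    simp only [Vx, mem_insert_iff, mem_singleton_iff] at hP
    have mk : ∀ y ∈ TD a b, ρ ≤ ‖y - (0:E2)‖ → ρ ≤ ‖y - a • e0‖ → ρ ≤ ‖y - b • e1‖ → y ∈ K := by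
      intro y hy h1 h2 h3
      refine ⟨D_sub_T ha hb hy, ?_⟩
      intro P hP
      simp only [Vx, mem_insert_iff, mem_singleton_iff] at hP
      rcases hP with rfl | rfl | rfl <;> assumption
    rcases hP with rfl | rfl | rfl
    · exact c1 ρ q1 w1 w2 hw l1 l2 t1 (fun y hy h => hnn y (mk y hy h.ge (sep y _ _ (by linarith) h) (sep y _ _ (by linarith) h))) z hz hzP.le
    · exact c2 ρ q2 w1 w2 hw l1 l2 t2 (fun y hy h => hnn y (mk y hy (sep y _ _ (by rw [norm_sub_rev]; linarith) h) h.ge (sep y _ _ (by linarith) h))) z hz hzP.le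
    · exact c3 ρ q3 w1 w2 hw l1 l2 t3 (fun y hy h => hnn y (mk y hy (sep y _ _ (by rw [norm_sub_rev]; linarith) h) (sep y _ _ (by rw [norm_sub_rev]; linarith) h) h.ge)) z hz hzP.le

lemma SPos.nn {a b : ℝ} {v1 v2 : E2 → ℝ} (hv : Adm a b v1 v2) (h : SPos a b v1 v2) : ∀ z ∈ TD a b, 0 ≤ v1 z ∧ 0 ≤ v2 z := by
  intro z hz
  constructor
  · rcases (hz.1 0).lt_or_eq with h0 | h0
    · exact (h.p1 z hz h0).le
    · exact (hv.x1 z hz h0.symm).ge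
  · rcases (hz.1 1).lt_or_eq with h0 | h0
    · exact (h.p2 z hz h0).le
    · exact (hv.y1 z hz h0.symm).ge

lemma pair_comp {a b : ℝ} (ha : 0 < a) (hb : 0 < b) {f1 f2 v1 v2 : E2 → ℝ} (hf : Adm a b f1 f2) (hv : Adm a b v1 v2) (h : SPos a b v1 v2)
    {K : Set E2} (hK : IsCompact K) (hKD : K ⊆ TD a b) : ∃ C : ℝ, 0 < C ∧ ∀ z ∈ K, |f1 z| ≤ C * v1 z ∧ |f2 z| ≤ C * v2 z := by
  obtain ⟨C, hC, h1⟩ := loc_comp ha hb (m := 0) hf.s1 hv.s1 hf.x1 hv.x1 h.p1 h.d1 hK hKD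
  obtain ⟨C', hC', h2⟩ := loc_comp ha hb (m := 1) hf.s2 hv.s2 hf.y1 hv.y1 h.p2 h.d2 hK hKD
  refine ⟨C + C' + 1, by positivity, fun z hz => ?_⟩
  obtain ⟨n1, n2⟩ := h.nn hv z (hKD hz)
  constructor
  · nlinarith [h1 z hz]
  · nlinarith [h2 z hz]

lemma slide {a b mu lam : ℝ} (ha : 0 < a) (hb : 0 < b) (hmu : 0 < mu) (hml : mu ≤ lam) {w1 w2 v1 v2 : E2 → ℝ}
    (hw : Fld a b mu w1 w2) (hv : Fld a b lam v1 v2) (hs : SPos a b v1 v2) :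
    (∃ c, ∀ z ∈ TD a b, w1 z = c * v1 z ∧ w2 z = c * v2 z) ∨ ∀ z ∈ TD a b, w1 z ≤ 0 ∧ w2 z ≤ 0 := by
  obtain ⟨K, hK, hKD, hcor⟩ := K_exists ha hb hmu
  have vn := hs.nn hv.adm
  set A : Set ℝ := {c | 0 ≤ c ∧ ∀ z ∈ K, 0 ≤ c * v1 z + (-1) * w1 z ∧ 0 ≤ c * v2 z + (-1) * w2 z} with hA
  have Ane : A.Nonempty := by
    obtain ⟨C, hC, h⟩ := pair_comp ha hb hw.adm hv.adm hs hK hKD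
    refine ⟨C, hC.le, fun z hz => ?_⟩
    have h1 := le_abs_self (w1 z)
    have h2 := le_abs_self (w2 z)
    have := h z hz
    constructor <;> linarith
  have Acl : IsClosed A := by
    have : A = {c : ℝ | 0 ≤ c} ∩ ⋂ z ∈ K, ({c : ℝ | 0 ≤ c * v1 z + (-1) * w1 z} ∩ {c : ℝ | 0 ≤ c * v2 z + (-1) * w2 z}) := by
      ext c; simp [hA]
    rw [this]
    refine (isClosed_le continuous_const continuous_id).inter (isClosed_biInter fun z _ => ?_)
    exact (isClosed_le continuous_const (by fun_prop)).inter (isClosed_le continuous_const (by fun_prop))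
  have Abd : BddBelow A := ⟨0, fun c hc => hc.1⟩
  set c := sInf A with hc
  have hcA : c ∈ A := Acl.csInf_mem Ane Abd
  have hwAdm := hv.adm.comb ha hb hw.adm c (-1)
  have L : ∀ (v w : E2 → ℝ), ContDiffOn ℝ ∞ v (TD a b) → ContDiffOn ℝ ∞ w (TD a b) → (∀ z ∈ TD a b, 0 ≤ v z) → (∀ z ∈ TI a b, lap v z = - lam * v z) →
      (∀ z ∈ TI a b, lap w z = - mu * w z) → ∀ z ∈ TI a b, lap (fun z => c * v z + (-1) * w z) z ≤ - mu * (c * v z + (-1) * w z) := by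
    intro v w sv sw vnn lv lw z hz
    rw [lap_add (contDiffAt_const.mul (TI_C2 sv hz)) (contDiffAt_const.mul (TI_C2 sw hz)), lap_const_mul _ (TI_C2 sv hz), lap_const_mul _ (TI_C2 sw hz), lv z hz, lw z hz]
    have := mul_nonneg (mul_nonneg hcA.1 (vnn z (Int_sub a b hz))) (sub_nonneg.2 hml)
    nlinarith
  have L1 := L v1 w1 hv.adm.s1 hw.adm.s1 (fun z hz => (vn z hz).1) hv.l1 hw.l1
  have L2 := L v2 w2 hv.adm.s2 hw.adm.s2 (fun z hz => (vn z hz).2) hv.l2 hw.l2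
  have nn := hcor _ _ hwAdm L1 L2 (hv.tO.comb hw.tO c (-1)) (hv.tA.comb hw.tA c (-1)) (hv.tB.comb hw.tB c (-1)) hcA.2
  rcases strong_pair ha hb hwAdm (fun z hz => (nn z hz).1) (fun z hz => (nn z hz).2)
    (fun z hz => (L1 z hz).trans (by nlinarith [(nn z (Int_sub a b hz)).1])) (fun z hz => (L2 z hz).trans (by nlinarith [(nn z (Int_sub a b hz)).2])) with h | h
  · left
    exact ⟨c, fun z hz => ⟨by linarith [(h z hz).1], by linarith [(h z hz).2]⟩⟩
  · right
    have c0 : c = 0 := by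
      by_contra hne
      have cpos : 0 < c := lt_of_le_of_ne hcA.1 (Ne.symm hne)
      obtain ⟨C, hC, hcomp⟩ := pair_comp ha hb hv.adm hwAdm h hK hKD
      set t := min c (1 / C) with ht
      have tpos : 0 < t := by positivity
      have tC : C * t ≤ 1 := by
        have : t ≤ 1 / C := min_le_right _ _
        rw [le_div_iff₀ hC] at this; linarith
      have : c - t ∈ A := by
        refine ⟨sub_nonneg.2 (min_le_left _ _), fun z hz => ?_⟩
        obtain ⟨k1, k2⟩ := hcomp z hz
        obtain ⟨m1, m2⟩ := nn z (hKD hz)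
        have gen : ∀ x y : ℝ, |x| ≤ C * y → 0 ≤ y → t * x ≤ y := by
          intro x y h1 h2
          have := mul_le_mul_of_nonneg_left ((le_abs_self x).trans h1) tpos.le
          have := mul_le_mul_of_nonneg_right tC h2
          linarith
        have g1 := gen _ _ k1 m1
        have g2 := gen _ _ k2 m2
        constructor <;> linarith
      have := csInf_le Abd this
      linarith
    intro z hz
    have := nn z hz
    rw [c0] at this
    constructor <;> linarith [this.1, this.2]

lemma Fld.neg {a b mu : ℝ} (ha : 0 < a) (hb : 0 < b) {w1 w2 : E2 → ℝ} (hw : Fld a b mu w1 w2) :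
    Fld a b mu (fun z => (-1) * w1 z + 0 * w1 z) (fun z => (-1) * w2 z + 0 * w2 z) where
  adm := hw.adm.comb ha hb hw.adm (-1) 0
  l1 z hz := by
    have := TI_C2 hw.adm.s1 hz
    rw [lap_add (contDiffAt_const.mul this) (contDiffAt_const.mul this), lap_const_mul _ this, lap_const_mul _ this, hw.l1 z hz]; ring
  l2 z hz := by
    have := TI_C2 hw.adm.s2 hz
    rw [lap_add (contDiffAt_const.mul this) (contDiffAt_const.mul this), lap_const_mul _ this, lap_const_mul _ this, hw.l2 z hz]; ring
  tO := hw.tO.comb hw.tO _ _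
  tA := hw.tA.comb hw.tA _ _
  tB := hw.tB.comb hw.tB _ _

lemma unique_dir {a b mu lam : ℝ} (ha : 0 < a) (hb : 0 < b) (hmu : 0 < mu) (hml : mu ≤ lam) {w1 w2 v1 v2 : E2 → ℝ}
    (hw : Fld a b mu w1 w2) (hv : Fld a b lam v1 v2) (hs : SPos a b v1 v2) :
    ∃ c, ∀ z ∈ TD a b, w1 z = c * v1 z ∧ w2 z = c * v2 z := by
  rcases slide ha hb hmu hml hw hv hs with h | h
  · exact h
  rcases slide ha hb hmu hml (hw.neg ha hb) hv hs with ⟨c, h'⟩ | h'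
  · exact ⟨-c, fun z hz => ⟨by linarith [(h' z hz).1], by linarith [(h' z hz).2]⟩⟩
  · exact ⟨0, fun z hz => ⟨by linarith [(h' z hz).1, (h z hz).1], by linarith [(h' z hz).2, (h z hz).2]⟩⟩

/-- gradient zero everywhere contradicts nonconstancy -/
lemma Eig.grad_ne {a b mu : ℝ} (ha : 0 < a) (hb : 0 < b) {u : E2 → ℝ} (hu : Eig a b mu u)
    (h : ∀ z ∈ TD a b, fderivWithin ℝ u (TD a b) z e0 = 0 ∧ fderivWithin ℝ u (TD a b) z (-e1) = 0) : False := by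
  have h0 : ∀ z ∈ TD a b, fderivWithin ℝ u (TD a b) z = 0 := by
    intro z hz
    obtain ⟨h1, h2⟩ := h z hz
    rw [map_neg, neg_eq_zero] at h2
    ext v
    have : v = v 0 • e0 + v 1 • e1 := by apply E2_ext <;> simp
    rw [this, map_add, map_smul, map_smul, h1, h2]; simp
  apply hu.nonconst
  have hcst : ∀ z ∈ TD a b, u z = u (cen a b) := fun z hz =>
    (D_convex a b).is_const_of_fderivWithin_eq_zero (hu.smooth.differentiableOn (by simp)) h0 hz (Int_sub a b (cen_mem ha hb))
  refine ⟨u (cen a b), fun z hz => ?_⟩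
  have h1 : Tendsto u (𝓝[TI a b] z) (𝓝 (u z)) := (hu.cont z hz).mono_left (nhdsWithin_mono _ ((Int_sub a b).trans (D_sub_T ha hb)))
  have : (𝓝[TI a b] z).NeBot := mem_closure_iff_nhdsWithin_neBot.1 (T_cl ha hb ((Tst_iff ha hb z).1 hz))
  refine tendsto_nhds_unique h1 ?_
  refine tendsto_const_nhds.congr' ?_
  filter_upwards [self_mem_nhdsWithin] with y hy
  exact (hcst y (Int_sub a b hy)).symm

lemma no_crit {a b mu lam : ℝ} (ha : 0 < a) (hb : 0 < b) (hml : mu ≤ lam) {u U : E2 → ℝ} (hu : Eig a b mu u) (hU : Eig a b lam U)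
    (U1 : ∀ z ∈ TD a b, 0 ≤ fderivWithin ℝ U (TD a b) z e0) (U2 : ∀ z ∈ TD a b, 0 ≤ fderivWithin ℝ U (TD a b) z (-e1))
    {p : E2} (hp : p ∈ TD a b) (hcrit : fderivWithin ℝ u (TD a b) p = 0) : False := by
  have hF := hu.fld ha hb
  have hF1 := hU.fld ha hb
  have hs : SPos a b (fun z => fderivWithin ℝ U (TD a b) z e0) (fun z => fderivWithin ℝ U (TD a b) z (-e1)) := by
    refine (strong_pair ha hb hF1.adm U1 U2 ?_ ?_).resolve_left fun hc => hU.grad_ne ha hb hc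
    · intro z hz
      have := hF1.l1 z hz
      have := mul_nonneg hU.pos.le (U1 z (Int_sub a b hz))
      linarith
    · intro z hz
      have := hF1.l2 z hz
      have := mul_nonneg hU.pos.le (U2 z (Int_sub a b hz))
      linarith
  obtain ⟨c, hc⟩ := unique_dir ha hb hu.pos hml hF hF1 hs
  have c0 : c = 0 := by
    obtain ⟨h1, h2⟩ := hc p hp
    simp only [hcrit] at h1 h2
    have := hp.2 0 1 (by decide)
    rcases (hp.1 0).lt_or_eq with h0 | h0
    · have := hs.p1 p hp h0
      exact (mul_eq_zero.1 h1.symm).resolve_right this.ne'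
    · have := hs.p2 p hp (by linarith)
      exact (mul_eq_zero.1 h2.symm).resolve_right this.ne'
  exact hu.grad_ne ha hb fun z hz => by
    have := hc z hz
    rw [c0] at this; simpa using this

end

section
open Set Filter Topology MeasureTheory InnerProductSpace
open scoped ContDiff

lemma zero_near {φ : E2 → ℝ} {p z : E2} {r : ℝ} (h : ∀ y, y ∉ Metric.closedBall p r → φ y = 0) (hz : r < ‖z - p‖) :
    φ =ᶠ[𝓝 z] fun _ => 0 := by
  have : (Metric.closedBall p r)ᶜ ∈ 𝓝 z := Metric.isClosed_closedBall.isOpen_compl.mem_nhds (by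
    simp [dist_eq_norm]; exact hz)
  filter_upwards [this] with y hy using h y hy

lemma weakT {a b : ℝ} (ha : 0 < a) (hb : 0 < b) {F : Filter ℕ} {u : ℕ → ℕ → ℕ → ℝ} {l : ℕ → ℝ} {lam : ℝ} {V : ℝ × ℝ → ℝ}
    (h : dLim (1/a^2) (1/b^2) F u l lam V) {φ : E2 → ℝ} (hφ : ContDiff ℝ ∞ φ) {p : E2} {r R : ℝ} (hr : r < R)
    (hs : ∀ y, y ∉ Metric.closedBall p r → φ y = 0) {i : Fin 3} (hR : ∀ j, j ≠ i → R ≤ ell a b j p)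
    (hn : ∀ z, ell a b i z = 0 → fderiv ℝ φ z (nu a b i) = 0) :
    ∫ z in Tst a b, V (z 0/a, z 1/b) * (lap φ z + lam * φ z) = 0 := by
  have far : ∀ j, j ≠ i → ∀ z, ell a b j z = 0 → φ =ᶠ[𝓝 z] fun _ => 0 := by
    intro j hj z hz
    refine zero_near hs ?_
    have h1 := abs_le.1 (ell_lip ha hb j p z)
    have h2 := hR j hj
    linarith
  have nor : ∀ j z, ell a b j z = 0 → fderiv ℝ φ z (nu a b j) = 0 := by
    intro j z hz
    by_cases hj : j = i
    · subst hj; exact hn z hz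
    · rw [(far j hj z hz).fderiv_eq]; simp
  have vert : ∀ j k, j ≠ k → ∀ z, ell a b j z = 0 → ell a b k z = 0 → φ =ᶠ[𝓝 z] fun _ => 0 := by
    intro j k hjk z h1 h2
    by_cases hj : j = i
    · exact far k (fun hk => hjk (hj.trans hk.symm)) z h2
    · exact far j hj z h1
  refine h.weakE ha hb hφ (HasCompactSupport.intro (isCompact_closedBall p r) hs) ?_ ?_ ?_ ?_ ?_
  · intro z h0 _ _
    exact nor 0 z (by rw [ell0, h0])
  · intro z h0 _ _
    exact nor 1 z (by rw [ell1, h0])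
  · intro z _ _ h0
    have := nor 2 z (by rw [ell2]; rw [show 1 - z 0/a - z 1/b = 0 by linarith, mul_zero])
    rw [nu2_eq] at this
    simp only [map_neg, map_add, map_smul, smul_eq_mul] at this
    have hk := kap_pos ha hb
    have h2 : kap a b * (fderiv ℝ φ z e0/a + fderiv ℝ φ z e1/b) = 0 := by
      linear_combination -this
    exact (mul_eq_zero.1 h2).resolve_left hk.ne'
  · exact vert 1 2 (by decide) _ (by rw [ell1]; simp) (by rw [ell2]; simp [ha.ne'])
  · exact vert 0 2 (by decide) _ (by rw [ell0]; simp) (by rw [ell2]; simp [hb.ne'])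

/-- continuous extension of the limit function -/
def Uex (a b : ℝ) (V : ℝ × ℝ → ℝ) (z : E2) : ℝ := V (retT ![z 0/a, z 1/b])

lemma Uex_cont {a b : ℝ} {V : ℝ × ℝ → ℝ} (hV : ContinuousOn V T1) : Continuous (Uex a b V) := by
  refine hV.comp_continuous (retT_cont.comp ?_) fun z => retT_mem _
  refine continuous_pi fun i => ?_
  fin_cases i
  · show Continuous fun z : E2 => z 0 / a
    fun_prop
  · show Continuous fun z : E2 => z 1 / b
    fun_prop

lemma Uex_eq {a b : ℝ} (ha : 0 < a) (hb : 0 < b) {V : ℝ × ℝ → ℝ} {z : E2} (hz : z ∈ Tst a b) : Uex a b V z = V (z 0/a, z 1/b) := by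
  unfold Uex
  obtain ⟨h0, h1, h2⟩ := hz
  rw [retT_eq (by refine ⟨?_, ?_, ?_⟩ <;> simp <;> first | positivity | exact h2)]
  simp

/-- distributional test against general continuous extension -/
lemma weakT' {a b : ℝ} (ha : 0 < a) (hb : 0 < b) {F : Filter ℕ} {u : ℕ → ℕ → ℕ → ℝ} {l : ℕ → ℝ} {lam : ℝ} {V : ℝ × ℝ → ℝ}
    (h : dLim (1/a^2) (1/b^2) F u l lam V) {φ v : E2 → ℝ} (hφ : ContDiff ℝ ∞ φ) {p : E2} {r R : ℝ} (hr : r < R)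
    (hs : ∀ y, y ∉ Metric.closedBall p r → φ y = 0) {i : Fin 3} (hR : ∀ j, j ≠ i → R ≤ ell a b j p)
    (hn : ∀ z, ell a b i z = 0 → fderiv ℝ φ z (nu a b i) = 0) (hv : ∀ z ∈ Tst a b, v z = Uex a b V z) :
    ∫ z in {z | 0 ≤ ell a b i z}, v z * (lap φ z + lam * φ z) = 0 := by
  have hcl : IsClosed {z : E2 | 0 ≤ ell a b i z} := isClosed_le continuous_const (ell_cont a b i)
  refine Eq.trans ?_ (weakT ha hb h hφ hr hs hR hn)
  rw [← integral_indicator hcl.measurableSet, ← integral_indicator (Tst_closed ha hb).measurableSet]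
  congr 1
  ext z
  by_cases hz : r < ‖z - p‖
  · have h1 := zero_near hs hz
    have h2 : lap φ z + lam * φ z = 0 := by rw [lap_congr h1, h1.eq_of_nhds, lap_const]; simp
    simp [indicator, h2]
  · have hm : z ∈ Tst a b ↔ 0 ≤ ell a b i z := by
      rw [← side_loc ha hb hR (lt_of_le_of_lt (not_lt.1 hz) hr)]
      refine ⟨fun ht => ?_, fun ht => D_sub_T ha hb ht⟩
      rw [Tst_iff ha hb] at ht
      exact (side_loc ha hb hR (lt_of_le_of_lt (not_lt.1 hz) hr)).2 (ht i)
    by_cases ht : z ∈ Tst a b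
    · rw [indicator_of_mem (show z ∈ {z | 0 ≤ ell a b i z} from hm.1 ht), indicator_of_mem ht, hv z ht, Uex_eq ha hb ht]
    · rw [indicator_of_notMem (show z ∉ {z | 0 ≤ ell a b i z} from fun hh => ht (hm.2 hh)), indicator_of_notMem ht]

/-- reflection in the side i -/
def rfl_lin (a b : ℝ) (i : Fin 3) : E2 ≃ₗᵢ[ℝ] E2 := (ℝ ∙ nu a b i)ᗮ.reflection

def rfl_c (a b : ℝ) (i : Fin 3) : E2 := -(2 * ell a b i 0) • nu a b i

lemma rfl_eq {a b : ℝ} (ha : 0 < a) (hb : 0 < b) (i : Fin 3) (z : E2) :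
    rfl_c a b i + rfl_lin a b i z = z - (2 * ell a b i z) • nu a b i := by
  have h1 : rfl_lin a b i z = z - (2 * inner ℝ (nu a b i) z) • nu a b i := by
    unfold rfl_lin
    rw [Submodule.reflection_orthogonal_apply, Submodule.reflection_singleton_apply, nu_norm ha hb]
    simp [two_smul, two_mul, add_smul]
  rw [h1, rfl_c, ell_sub a b i 0 z]
  simp only [sub_zero, mul_add, add_smul, neg_smul]
  abel

lemma rfl_ell {a b : ℝ} (ha : 0 < a) (hb : 0 < b) (i : Fin 3) (z : E2) :
    ell a b i (rfl_c a b i + rfl_lin a b i z) = - ell a b i z := by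
  rw [rfl_eq ha hb, ell_sub a b i z]
  simp [inner_smul_right, nu_norm ha hb i]
  ring

lemma rfl_rfl {a b : ℝ} (ha : 0 < a) (hb : 0 < b) (i : Fin 3) (z : E2) :
    rfl_c a b i + rfl_lin a b i (rfl_c a b i + rfl_lin a b i z) = z := by
  rw [rfl_eq ha hb i (rfl_c a b i + rfl_lin a b i z), rfl_ell ha hb, rfl_eq ha hb]
  simp

lemma rfl_dist (a b : ℝ) (i : Fin 3) (z w : E2) :
    ‖(rfl_c a b i + rfl_lin a b i z) - (rfl_c a b i + rfl_lin a b i w)‖ = ‖z - w‖ := by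
  rw [add_sub_add_left_eq_sub, ← map_sub, LinearIsometryEquiv.norm_map]

lemma rfl_nu {a b : ℝ} (i : Fin 3) : rfl_lin a b i (nu a b i) = - nu a b i := by
  unfold rfl_lin
  exact Submodule.reflection_orthogonalComplement_singleton_eq_neg _

lemma rfl_mp (a b : ℝ) (i : Fin 3) : MeasurePreserving (fun z => rfl_c a b i + rfl_lin a b i z) volume volume :=
  (measurePreserving_add_left volume (rfl_c a b i)).comp (rfl_lin a b i).measurePreserving

lemma rfl_int (a b : ℝ) (i : Fin 3) (g : E2 → ℝ) : ∫ z, g (rfl_c a b i + rfl_lin a b i z) = ∫ z, g z :=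
  (rfl_mp a b i).integral_comp
    ((MeasurableEquiv.addLeft (rfl_c a b i)).measurableEmbedding.comp (rfl_lin a b i).toHomeomorph.measurableEmbedding) g

lemma ell_null {a b : ℝ} (ha : 0 < a) (hb : 0 < b) (i : Fin 3) : volume {z : E2 | ell a b i z = 0} = 0 := by
  have hne : nu a b i ≠ 0 := by intro h; have := nu_norm ha hb i; rw [h] at this; simp at this
  let q : E2 := -(ell a b i 0) • nu a b i
  have hq : {z : E2 | ell a b i z = 0} = (fun z => z - q) ⁻¹' (((ℝ ∙ nu a b i)ᗮ : Submodule ℝ E2) : Set E2) := by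
    ext z
    simp only [mem_ofPred_eq, mem_preimage, SetLike.mem_coe, Submodule.mem_orthogonal_singleton_iff_inner_right]
    rw [ell_sub a b i 0 z]
    simp [q, inner_add_right, inner_smul_right, nu_norm ha hb i]
    ring_nf
  rw [hq]
  simp only [sub_eq_add_neg]
  rw [measure_preimage_add_right]
  refine Measure.addHaar_submodule _ _ ?_
  intro ht
  have : nu a b i ∈ ((ℝ ∙ nu a b i)ᗮ : Submodule ℝ E2) := by rw [ht]; trivial
  rw [Submodule.mem_orthogonal_singleton_iff_inner_right] at this
  simp at this
  exact hne this

end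

section
open Set Filter Topology MeasureTheory InnerProductSpace
open scoped ContDiff

/-- even extension across side i -/
def evn (a b : ℝ) (V : ℝ × ℝ → ℝ) (i : Fin 3) (z : E2) : ℝ := Uex a b V (z + (|ell a b i z| - ell a b i z) • nu a b i)

lemma evn_cont {a b : ℝ} {V : ℝ × ℝ → ℝ} (hV : ContinuousOn V T1) (i : Fin 3) : Continuous (evn a b V i) := by
  refine (Uex_cont hV).comp ?_
  have := ell_cont a b i
  fun_prop

lemma evn_eq {a b : ℝ} {V : ℝ × ℝ → ℝ} {i : Fin 3} {z : E2} (hz : 0 ≤ ell a b i z) : evn a b V i z = Uex a b V z := by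
  simp [evn, abs_of_nonneg hz]

lemma evn_rfl {a b : ℝ} (ha : 0 < a) (hb : 0 < b) (V : ℝ × ℝ → ℝ) (i : Fin 3) (z : E2) :
    evn a b V i (rfl_c a b i + rfl_lin a b i z) = evn a b V i z := by
  unfold evn
  rw [rfl_ell ha hb, rfl_eq ha hb, abs_neg]
  congr 1
  simp only [sub_smul, neg_smul, two_mul, add_smul]
  abel

lemma test_cont {v ψ : E2 → ℝ} (hv : Continuous v) (hψ : ContDiff ℝ ∞ ψ) (lam : ℝ) :
    Continuous fun y => v y * (lap ψ y + lam * ψ y) :=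
  hv.mul ((lap_smooth hψ).continuous.add (continuous_const.mul hψ.continuous))

lemma test_int {v ψ : E2 → ℝ} (hv : Continuous v) (hψ : ContDiff ℝ ∞ ψ) (lam : ℝ) {p : E2} {r : ℝ}
    (hs : ∀ y, y ∉ Metric.closedBall p r → ψ y = 0) : Integrable fun y => v y * (lap ψ y + lam * ψ y) := by
  refine (test_cont hv hψ lam).integrable_of_hasCompactSupport (HasCompactSupport.intro (isCompact_closedBall p r) ?_)
  intro y hy
  have h1 := zero_near hs (z := y) (by simpa [dist_eq_norm] using hy)
  rw [lap_congr h1, h1.eq_of_nhds, lap_const]; simp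

lemma evn_weak {a b : ℝ} (ha : 0 < a) (hb : 0 < b) {F : Filter ℕ} {u : ℕ → ℕ → ℕ → ℝ} {l : ℕ → ℝ} {lam : ℝ} {V : ℝ × ℝ → ℝ}
    (h : dLim (1/a^2) (1/b^2) F u l lam V) {ψ : E2 → ℝ} (hψ : ContDiff ℝ ∞ ψ) {p : E2} {r R : ℝ} (hr : r < R)
    (hs : ∀ y, y ∉ Metric.closedBall p r → ψ y = 0) {i : Fin 3} (hp : ell a b i p = 0) (hR : ∀ j, j ≠ i → R ≤ ell a b j p) :
    ∫ y, evn a b V i y * (lap ψ y + lam * ψ y) = 0 := by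
  set v := evn a b V i with hvd
  have hv : Continuous v := evn_cont h.cont i
  set ρ : E2 → E2 := fun z => rfl_c a b i + rfl_lin a b i z with hρ
  have hρs : ContDiff ℝ ∞ ρ := contDiff_const.add (rfl_lin a b i).toContinuousLinearEquiv.contDiff
  have hρp : ρ p = p := by rw [hρ]; simp only; rw [rfl_eq ha hb, hp]; simp
  have hψρ : ContDiff ℝ ∞ (fun z => ψ (ρ z)) := hψ.comp hρs
  have hsρ : ∀ y, y ∉ Metric.closedBall p r → ψ (ρ y) = 0 := by
    intro y hy
    apply hs
    rw [Metric.mem_closedBall, dist_eq_norm] at hy ⊢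
    have := rfl_dist a b i y p
    change ‖ρ y - ρ p‖ = _ at this
    rw [hρp] at this
    rwa [this]
  have hlap : ∀ z, lap (fun z => ψ (ρ z)) z = lap ψ (ρ z) := fun z =>
    lap_comp_iso (rfl_c a b i) (rfl_lin a b i) (hψ.contDiffAt.of_le (by norm_cast))
  set φ : E2 → ℝ := fun z => ψ z + ψ (ρ z) with hφd
  have hφ : ContDiff ℝ ∞ φ := hψ.add hψρ
  have hφs : ∀ y, y ∉ Metric.closedBall p r → φ y = 0 := fun y hy => by simp [hφd, hs y hy, hsρ y hy]
  have hφρ : ∀ z, φ (ρ z) = φ z := fun z => by simp only [hφd, hρ]; rw [rfl_rfl ha hb]; ring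
  have hlφ : ∀ z, lap φ z = lap ψ z + lap ψ (ρ z) := fun z => by
    rw [← hlap]
    exact lap_add (hψ.contDiffAt.of_le (by norm_cast)) (hψρ.contDiffAt.of_le (by norm_cast))
  have hn : ∀ z, ell a b i z = 0 → fderiv ℝ φ z (nu a b i) = 0 := by
    intro z hz
    have hρz : rfl_c a b i + rfl_lin a b i z = z := by rw [rfl_eq ha hb, hz]; simp
    have hd : DifferentiableAt ℝ ψ z := hψ.differentiable (by simp) z
    have h1 : fderiv ℝ φ z = fderiv ℝ ψ z + fderiv ℝ (fun z => ψ (ρ z)) z :=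
      fderiv_add hd (hψρ.differentiable (by simp) z)
    have h2 := fderiv_comp_aff (u := ψ) (rfl_c a b i) ((rfl_lin a b i).toContinuousLinearEquiv : E2 →L[ℝ] E2) (z := z)
      (by show DifferentiableAt ℝ ψ (rfl_c a b i + rfl_lin a b i z); rw [hρz]; exact hd) (nu a b i)
    change fderiv ℝ (fun z => ψ (ρ z)) z (nu a b i) = fderiv ℝ ψ (rfl_c a b i + rfl_lin a b i z) (rfl_lin a b i (nu a b i)) at h2
    rw [hρz, rfl_nu, map_neg] at h2
    rw [h1, add_apply, h2]; ring
  have hpos := weakT' ha hb h hφ hr hφs hR hn (v := v) fun z hz => evn_eq (((Tst_iff ha hb z).1 hz) i)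
  set g : E2 → ℝ := fun y => v y * (lap ψ y + lam * ψ y) with hg
  set G : E2 → ℝ := fun y => v y * (lap φ y + lam * φ y) with hG
  have hgi : Integrable g := test_int hv hψ lam hs
  have hGi : Integrable G := test_int hv hφ lam hφs
  have hGg : ∀ y, G y = g y + g (ρ y) := by
    intro y
    show v y * (lap φ y + lam * (ψ y + ψ (ρ y))) = v y * (lap ψ y + lam * ψ y) + v (ρ y) * (lap ψ (ρ y) + lam * ψ (ρ y))
    rw [hlφ, show v (ρ y) = v y from evn_rfl ha hb V i y]; ring
  have hGρ : ∀ y, G (ρ y) = G y := by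
    intro y
    rw [hGg, hGg]
    simp only [hρ]; rw [rfl_rfl ha hb]; ring
  have hclm : MeasurableSet {z : E2 | 0 ≤ ell a b i z} := (isClosed_le continuous_const (ell_cont a b i)).measurableSet
  have hclm' : MeasurableSet {z : E2 | 0 < ell a b i z} := (isOpen_lt continuous_const (ell_cont a b i)).measurableSet
  have hGtot : ∫ y, G y = 0 := by
    rw [← integral_add_compl hclm hGi, hpos, zero_add, ← integral_indicator hclm.compl, ← rfl_int a b i]
    have e1 : ∀ y, indicator {z : E2 | 0 ≤ ell a b i z}ᶜ G (rfl_c a b i + rfl_lin a b i y) = indicator {z : E2 | 0 < ell a b i z} G y := by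
      intro y
      have hy := rfl_ell ha hb i y
      by_cases hh : 0 < ell a b i y
      · rw [indicator_of_mem (show y ∈ {z : E2 | 0 < ell a b i z} from hh), indicator_of_mem, ]
        · exact hGρ y
        · show ¬ (0 ≤ ell a b i _); rw [hy]; linarith
      · rw [indicator_of_notMem (show y ∉ {z : E2 | 0 < ell a b i z} from hh), indicator_of_notMem]
        show ¬ ¬ (0 ≤ ell a b i _); rw [hy]; push Not; linarith
    simp_rw [e1]
    rw [integral_indicator hclm']
    refine (setIntegral_congr_set ?_).trans hpos
    have hnull := ell_null ha hb i
    have : ∀ᵐ z : E2, ell a b i z ≠ 0 := by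
      rw [ae_iff]; simpa using hnull
    filter_upwards [this] with z hz
    have : (0 < ell a b i z) = (0 ≤ ell a b i z) := propext ⟨le_of_lt, fun h => lt_of_le_of_ne h hz.symm⟩
    exact this
  have h3 : ∫ y, G y = (∫ y, g y) + ∫ y, g (ρ y) := by
    have hgi2 : Integrable fun y => g (ρ y) := (rfl_mp a b i).integrable_comp_of_integrable hgi
    rw [← integral_add hgi hgi2]
    exact integral_congr_ae (Eventually.of_forall hGg)
  have h4 : ∫ y, g (ρ y) = ∫ y, g y := rfl_int a b i g
  rw [h4, hGtot] at h3
  linarith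

end

section
open Set Filter Topology MeasureTheory InnerProductSpace
open scoped ContDiff

lemma Tst_T1 {a b : ℝ} (ha : 0 < a) (hb : 0 < b) {z : E2} (hz : z ∈ Tst a b) : (z 0/a, z 1/b) ∈ T1 := by
  obtain ⟨h0, h1, h2⟩ := hz
  exact ⟨div_nonneg h0 ha.le, div_nonneg h1 hb.le, h2⟩

/-- the extension by reflection is smooth near a boundary point, and the limit function near an interior point -/
lemma loc_side {a b : ℝ} (ha : 0 < a) (hb : 0 < b) {F : Filter ℕ} {u : ℕ → ℕ → ℕ → ℝ} {l : ℕ → ℝ} {lam : ℝ} {V : ℝ × ℝ → ℝ}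
    (h : dLim (1/a^2) (1/b^2) F u l lam V) {p : E2} (hpD : p ∈ TD a b) {i : Fin 3} (hp : ell a b i p = 0) :
    ContDiffAt ℝ ∞ (evn a b V i) p := by
  obtain ⟨R, hR0, hR⟩ := side_rad hpD hp
  obtain ⟨r, hr, hs⟩ := weak_smooth (evn_cont h.cont i) hR0 h.pos (p := p) fun ψ hψ ⟨r, hr, hs⟩ =>
    evn_weak ha hb h hψ hr hs hp hR
  exact (hs p (Metric.mem_ball_self hr)).1

lemma loc_int {a b : ℝ} (ha : 0 < a) (hb : 0 < b) {F : Filter ℕ} {u : ℕ → ℕ → ℕ → ℝ} {l : ℕ → ℝ} {lam : ℝ} {V : ℝ × ℝ → ℝ}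
    (h : dLim (1/a^2) (1/b^2) F u l lam V) {p : E2} (hp : p ∈ TI a b) :
    ContDiffAt ℝ ∞ (Uex a b V) p ∧ lap (Uex a b V) p = - lam * Uex a b V p := by
  obtain ⟨R, hR0, hR⟩ : ∃ R > (0:ℝ), ∀ i, R ≤ ell a b i p := by
    refine ⟨min (ell a b 0 p) (min (ell a b 1 p) (ell a b 2 p)), lt_min (hp 0) (lt_min (hp 1) (hp 2)), fun i => ?_⟩
    fin_cases i
    · exact min_le_left _ _
    · exact (min_le_right _ _).trans (min_le_left _ _)
    · exact (min_le_right _ _).trans (min_le_right _ _)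
  obtain ⟨r, hr, hs⟩ := weak_smooth (Uex_cont h.cont) hR0 h.pos (p := p) (fun ψ hψ ⟨r, hr, hs⟩ => by
    have hn : ∀ z, ell a b 0 z = 0 → ψ =ᶠ[𝓝 z] fun _ => 0 := by
      intro z hz
      refine zero_near hs ?_
      have h1 := abs_le.1 (ell_lip ha hb 0 p z)
      have h2 := hR 0
      linarith
    have := weakT' ha hb h hψ hr hs (i := 0) (fun j _ => hR j) (fun z hz => by rw [(hn z hz).fderiv_eq]; simp)
      (v := Uex a b V) (fun z _ => rfl)
    rw [← this]
    refine (setIntegral_eq_integral_of_forall_compl_eq_zero ?_).symm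
    intro z hz
    have hz' : ell a b 0 z < 0 := not_le.1 hz
    have h1 := abs_le.1 (ell_lip ha hb 0 p z)
    have h2 := hR 0
    have h3 := zero_near hs (z := z) (by linarith)
    rw [lap_congr h3, h3.eq_of_nhds, lap_const]; simp)
  exact hs p (Metric.mem_ball_self hr)

lemma mono_ext {a b : ℝ} (ha : 0 < a) (hb : 0 < b) {U : E2 → ℝ} (hU : ContDiffOn ℝ ∞ U (TD a b)) {n : E2}
    (hm : ∀ p ∈ TI a b, ∀ t : ℝ, 0 < t → p + t • n ∈ TI a b → U p ≤ U (p + t • n)) :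
    ∀ z ∈ TD a b, 0 ≤ fderivWithin ℝ U (TD a b) z n := by
  have hI : ∀ p ∈ TI a b, 0 ≤ fderivWithin ℝ U (TD a b) p n := by
    intro p hp
    refine dir_ge (smooth_diff hU (Int_sub a b hp)) ?_
    have hc : Tendsto (fun t : ℝ => p + t • n) (𝓝[>] 0) (𝓝 p) := by
      have : Continuous (fun t : ℝ => p + t • n) := by fun_prop
      have := this.tendsto 0
      simp only [zero_smul, add_zero] at this
      exact this.mono_left nhdsWithin_le_nhds
    filter_upwards [hc.eventually ((Int_open a b).mem_nhds hp), self_mem_nhdsWithin] with t ht h0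
    exact ⟨Int_sub a b ht, by simpa using hm p hp t h0 ht⟩
  intro z hz
  have hc := (grad_smooth ha hb hU n).continuousOn z hz
  have h1 : (𝓝[TI a b] z).NeBot := mem_closure_iff_nhdsWithin_neBot.1 (T_cl ha hb hz.1)
  exact ge_of_tendsto (hc.mono (Int_sub a b)) (by filter_upwards [self_mem_nhdsWithin] with y hy using hI y hy)

theorem exists_mono {a b : ℝ} (ha : 0 < a) (hb : 0 < b) : ∃ lam U, Eig a b lam U ∧
    (∀ z ∈ TD a b, 0 ≤ fderivWithin ℝ U (TD a b) z e0) ∧ (∀ z ∈ TD a b, 0 ≤ fderivWithin ℝ U (TD a b) z (-e1)) := by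
  obtain ⟨F, u, l, lam, V, h⟩ := d_limit (α := 1/a^2) (β := 1/b^2) (by positivity) (by positivity)
  have side : ∀ p ∈ TD a b, ∀ i, ell a b i p = 0 → Uex a b V =ᶠ[𝓝[TD a b] p] evn a b V i := by
    intro p hp i hi
    filter_upwards [self_mem_nhdsWithin] with z hz
    exact (evn_eq (hz.1 i)).symm
  have hsm : ContDiffOn ℝ ∞ (Uex a b V) (TD a b) := by
    intro p hp
    rcases D_cases hp with hI | ⟨i, hi⟩
    · exact (loc_int ha hb h hI).1.contDiffWithinAt
    · exact (loc_side ha hb h hp hi).contDiffWithinAt.congr_of_eventuallyEq (side p hp i hi) (evn_eq hi.ge).symm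
  refine ⟨lam, Uex a b V, ⟨h.pos, ?_, (Uex_cont h.cont).continuousOn, hsm, fun p hp => (loc_int ha hb h hp).2, ?_⟩, ?_, ?_⟩
  · rintro ⟨c, hc⟩
    have hA : a • e0 ∈ Tst a b := ⟨by simp [ha.le], by simp, by simp [ha.ne']⟩
    have hB : b • e1 ∈ Tst a b := ⟨by simp, by simp [hb.le], by simp [hb.ne']⟩
    have h1 := hc _ hA
    have h2 := hc _ hB
    rw [Uex_eq ha hb hA] at h1
    rw [Uex_eq ha hb hB] at h2
    simp [ha.ne', hb.ne'] at h1 h2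
    have := h.osc
    linarith
  · intro p hp i hi
    have hd := (loc_side ha hb h hp hi).differentiableAt (by simp)
    have h1 : fderivWithin ℝ (Uex a b V) (TD a b) p = fderiv ℝ (evn a b V i) p := by
      rw [(side p hp i hi).fderivWithin_eq (evn_eq hi.ge).symm]
      exact hd.fderivWithin (D_ud ha hb p hp)
    rw [h1]
    have hρp : rfl_c a b i + rfl_lin a b i p = p := by rw [rfl_eq ha hb, hi]; simp
    have h2 := fderiv_comp_aff (u := evn a b V i) (rfl_c a b i) ((rfl_lin a b i).toContinuousLinearEquiv : E2 →L[ℝ] E2) (z := p)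
      (by show DifferentiableAt ℝ (evn a b V i) (rfl_c a b i + rfl_lin a b i p); rw [hρp]; exact hd) (nu a b i)
    change fderiv ℝ (fun z => evn a b V i (rfl_c a b i + rfl_lin a b i z)) p (nu a b i) =
      fderiv ℝ (evn a b V i) (rfl_c a b i + rfl_lin a b i p) (rfl_lin a b i (nu a b i)) at h2
    simp_rw [evn_rfl ha hb] at h2
    rw [hρp, rfl_nu, map_neg] at h2
    have h3 : fderiv ℝ (evn a b V i) p (nu a b i) = - fderiv ℝ (evn a b V i) p (nu a b i) := h2
    linarith
  · refine mono_ext ha hb hsm fun p hp t ht hq => ?_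
    have hp' := D_sub_T ha hb (Int_sub a b hp)
    have hq' := D_sub_T ha hb (Int_sub a b hq)
    rw [Uex_eq ha hb hp', Uex_eq ha hb hq']
    have k1 := Tst_T1 ha hb hp'
    have k2 := Tst_T1 ha hb hq'
    simp at k2 ⊢
    exact h.monx _ _ _ k1 k2 (by gcongr; linarith)
  · refine mono_ext ha hb hsm fun p hp t ht hq => ?_
    have hp' := D_sub_T ha hb (Int_sub a b hp)
    have hq' := D_sub_T ha hb (Int_sub a b hq)
    rw [Uex_eq ha hb hp', Uex_eq ha hb hq']
    have k1 := Tst_T1 ha hb hp'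
    have k2 := Tst_T1 ha hb hq'
    simp at k2 ⊢
    exact h.mony _ _ _ k2 k1 (by gcongr; linarith)

end

section
open Set Filter Topology MeasureTheory InnerProductSpace
open scoped ContDiff

lemma Tri_std {a b : ℝ} (ha : 0 < a) (hb : 0 < b) : Tri 0 (a • e0) (b • e1) = Tst a b := by
  apply Subset.antisymm
  · refine convexHull_min ?_ ?_
    · rintro z (rfl | rfl | rfl)
      · exact ⟨by simp, by simp, by simp⟩
      · exact ⟨by simp [ha.le], by simp, by simp [ha.ne']⟩
      · exact ⟨by simp, by simp [hb.le], by simp [hb.ne']⟩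
    · intro x hx y hy s t hs ht hst
      rw [Tst_iff ha hb] at hx hy ⊢
      intro i
      rw [ell_comb _ _ _ _ _ _ _ hst]
      have := hx i
      have := hy i
      positivity
  · rintro z ⟨h0, h1, h2⟩
    have hc := convex_convexHull ℝ ({0, a • e0, b • e1} : Set E2)
    have := hc.sum_mem (t := Finset.univ) (w := ![1 - z 0/a - z 1/b, z 0/a, z 1/b]) (z := ![0, a • e0, b • e1]) ?_ ?_ ?_
    · have hz : ∑ i, (![1 - z 0/a - z 1/b, z 0/a, z 1/b] i) • (![0, a • e0, b • e1] i : E2) = z := by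
        rw [Fin.sum_univ_three]
        apply E2_ext
        · simp [ha.ne']
        · simp [hb.ne']
      rw [hz] at this
      exact this
    · intro i _
      fin_cases i
      · simp; linarith
      · simp; positivity
      · simp; positivity
    · rw [Fin.sum_univ_three]; simp; ring
    · intro i _
      apply subset_convexHull
      fin_cases i <;> simp

lemma Dom_std {a b : ℝ} (ha : 0 < a) (hb : 0 < b) : TriDom 0 (a • e0) (b • e1) = TD a b := by
  rw [D_eq ha hb, ← Tri_std ha hb]; rfl

/-- direction vectors of the sides -/
def sA (a b : ℝ) (i : Fin 3) : E2 := ![b • e1, 0, a • e0] i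
def sB (a b : ℝ) (i : Fin 3) : E2 := ![0, a • e0, b • e1] i

lemma side_seg {a b : ℝ} (ha : 0 < a) (hb : 0 < b) {p : E2} (hp : p ∈ TD a b) {i : Fin 3} (hi : ell a b i p = 0) :
    p ∈ segment ℝ (sA a b i) (sB a b i) := by
  have hT := D_sub_T ha hb hp
  obtain ⟨h0, h1, h2⟩ := hT
  have hk := kap_pos ha hb
  have g0 : 0 ≤ p 0 / a := by positivity
  have g1 : 0 ≤ p 1 / b := by positivity
  fin_cases i
  · change ell a b 0 p = 0 at hi
    rw [ell0] at hi
    rw [hi] at h2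
    refine ⟨p 1/b, 1 - p 1/b, g1, by simp at h2; linarith, by ring, ?_⟩
    apply E2_ext
    · simp [sA, sB, hi]
    · simp [sA, sB, hb.ne']
  · change ell a b 1 p = 0 at hi
    rw [ell1] at hi
    rw [hi] at h2
    refine ⟨1 - p 0/a, p 0/a, by simp at h2; linarith, g0, by ring, ?_⟩
    apply E2_ext
    · simp [sA, sB, ha.ne']
    · simp [sA, sB, hi]
  · change ell a b 2 p = 0 at hi
    rw [ell2] at hi
    have h3 := (mul_eq_zero.1 hi).resolve_left hk.ne'
    refine ⟨p 0/a, p 1/b, g0, g1, by linarith, ?_⟩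
    apply E2_ext
    · simp [sA, sB, ha.ne']
    · simp [sA, sB, hb.ne']

lemma ell_sA {a b : ℝ} (ha : 0 < a) (hb : 0 < b) (i : Fin 3) : ell a b i (sA a b i) = 0 := by
  fin_cases i
  · show ell a b 0 _ = 0; rw [ell0]; simp [sA]
  · show ell a b 1 _ = 0; rw [ell1]; simp [sA]
  · show ell a b 2 _ = 0; rw [ell2]; simp [sA, ha.ne']

lemma ell_sB {a b : ℝ} (ha : 0 < a) (hb : 0 < b) (i : Fin 3) : ell a b i (sB a b i) = 0 := by
  fin_cases i
  · show ell a b 0 _ = 0; rw [ell0]; simp [sB]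
  · show ell a b 1 _ = 0; rw [ell1]; simp [sB]
  · show ell a b 2 _ = 0; rw [ell2]; simp [sB, hb.ne']

lemma nu_perp {a b : ℝ} (ha : 0 < a) (hb : 0 < b) (i : Fin 3) : inner ℝ (nu a b i) (sB a b i - sA a b i) = 0 := by
  have h := ell_sub a b i (sA a b i) (sB a b i)
  rw [ell_sA ha hb, ell_sB ha hb] at h
  linarith

lemma perp_nu {a b : ℝ} (ha : 0 < a) (hb : 0 < b) (i : Fin 3) {w : E2} (hw : inner ℝ w (sB a b i - sA a b i) = 0) :
    ∃ k : ℝ, w = k • nu a b i := by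
  have hk := kap_pos ha hb
  rw [inner_E2] at hw
  fin_cases i
  · simp [sA, sB, hb.ne'] at hw
    refine ⟨w 0, ?_⟩
    apply E2_ext <;> simp [nu, hw]
  · simp [sA, sB, ha.ne'] at hw
    refine ⟨w 1, ?_⟩
    apply E2_ext <;> simp [nu, hw]
  · simp [sA, sB] at hw
    refine ⟨-(a * w 0 / kap a b), ?_⟩
    apply E2_ext
    · simp [nu]; field_simp
    · simp [nu]; field_simp; linarith

lemma seg_D {a b : ℝ} (ha : 0 < a) (hb : 0 < b) {p : E2} {i : Fin 3} (hp : p ∈ segment ℝ (sA a b i) (sB a b i))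
    (h1 : p ≠ sA a b i) (h2 : p ≠ sB a b i) : p ∈ TD a b ∧ ell a b i p = 0 := by
  have hk := kap_pos ha hb
  have hl : ell a b i p = 0 := by
    obtain ⟨s, t, hs, ht, hst, rfl⟩ := hp
    rw [ell_comb _ _ _ _ _ _ _ hst, ell_sA ha hb, ell_sB ha hb]; simp
  refine ⟨?_, hl⟩
  rw [← Dom_std ha hb]
  refine ⟨?_, ?_⟩
  · refine segment_subset_convexHull ?_ ?_ hp
    · fin_cases i <;> simp [sA]
    · fin_cases i <;> simp [sB]
  · intro hv
    fin_cases i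
    · rcases hv with rfl | rfl | rfl
      · exact h2 rfl
      · change ell a b 0 _ = 0 at hl
        rw [ell0] at hl; simp [ha.ne'] at hl
      · exact h1 rfl
    · rcases hv with rfl | rfl | rfl
      · exact h1 rfl
      · exact h2 rfl
      · change ell a b 1 _ = 0 at hl
        rw [ell1] at hl; simp [hb.ne'] at hl
    · rcases hv with rfl | rfl | rfl
      · change ell a b 2 _ = 0 at hl
        rw [ell2] at hl; simp [hk.ne'] at hl
      · exact h1 rfl
      · exact h2 rfl

lemma D_ne {a b : ℝ} (ha : 0 < a) (hb : 0 < b) {p : E2} (hp : p ∈ TD a b) (i : Fin 3) : p ≠ sA a b i ∧ p ≠ sB a b i := by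
  rw [← Dom_std ha hb] at hp
  have := hp.2
  simp only [Vtx, mem_insert_iff, mem_singleton_iff, not_or] at this
  obtain ⟨g1, g2, g3⟩ := this
  fin_cases i
  · exact ⟨g3, g1⟩
  · exact ⟨g1, g2⟩
  · exact ⟨g2, g3⟩

lemma neu_iff {a b : ℝ} (ha : 0 < a) (hb : 0 < b) {u : E2 → ℝ} (i : Fin 3) : NeumannOn (TD a b) (sA a b i) (sB a b i) u ↔
    ∀ p ∈ TD a b, ell a b i p = 0 → fderivWithin ℝ u (TD a b) p (nu a b i) = 0 := by
  constructor
  · intro h p hp hi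
    exact h p (side_seg ha hb hp hi) (D_ne ha hb hp i).1 (D_ne ha hb hp i).2 _ (nu_perp ha hb i)
  · intro h p hp h1 h2 w hw
    obtain ⟨k, rfl⟩ := perp_nu ha hb i hw
    obtain ⟨k1, k2⟩ := seg_D ha hb hp h1 h2
    rw [map_smul, h p k1 k2, smul_zero]

lemma std_iff {a b mu : ℝ} (ha : 0 < a) (hb : 0 < b) {u : E2 → ℝ} :
    IsNeumannEigenfun 0 (a • e0) (b • e1) mu u ↔ Eig a b mu u := by
  constructor
  · rintro ⟨h1, h2, h3, h4, h5, h6, h7, h8⟩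
    rw [Tri_std ha hb] at h2 h3 h5
    rw [Dom_std ha hb] at h4 h6 h7 h8
    refine ⟨h1, h2, h3, h4, fun p hp => ?_, fun p hp i hi => ?_⟩
    · have := h5 p (by rw [Tst_interior ha hb]; exact hp)
      rw [negLap_eq] at this; linarith
    · fin_cases i
      · exact (neu_iff ha hb 0).1 h8 p hp hi
      · exact (neu_iff ha hb 1).1 h6 p hp hi
      · exact (neu_iff ha hb 2).1 h7 p hp hi
  · rintro ⟨h1, h2, h3, h4, h5, h6⟩
    refine ⟨h1, ?_, ?_, ?_, ?_, ?_, ?_, ?_⟩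
    · rwa [Tri_std ha hb]
    · rwa [Tri_std ha hb]
    · rwa [Dom_std ha hb]
    · rw [Tri_std ha hb, Tst_interior ha hb]
      intro p hp
      rw [negLap_eq, h5 p hp]; ring
    · rw [Dom_std ha hb]
      exact (neu_iff ha hb 1).2 fun p hp hi => h6 p hp 1 hi
    · rw [Dom_std ha hb]
      exact (neu_iff ha hb 2).2 fun p hp hi => h6 p hp 2 hi
    · rw [Dom_std ha hb]
      exact (neu_iff ha hb 0).2 fun p hp hi => h6 p hp 0 hi

end

section
open Set Filter Topology MeasureTheory InnerProductSpace
open scoped ContDiff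

def afi (c : E2) (A : E2 ≃ₗᵢ[ℝ] E2) : E2 ≃ₜ E2 := A.toHomeomorph.trans (Homeomorph.addLeft c)

lemma afi_apply (c : E2) (A : E2 ≃ₗᵢ[ℝ] E2) (z : E2) : afi c A z = c + A z := rfl

lemma afi_comb (c : E2) (A : E2 ≃ₗᵢ[ℝ] E2) (x y : E2) {s t : ℝ} (h : s + t = 1) :
    afi c A (s • x + t • y) = s • afi c A x + t • afi c A y := by
  simp only [afi_apply, map_add, map_smul, smul_add]
  have : c = s • c + t • c := by rw [← add_smul, h, one_smul]
  nth_rewrite 1 [this]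
  abel

lemma afi_Tri (c : E2) (A : E2 ≃ₗᵢ[ℝ] E2) (x y z : E2) :
    Tri (afi c A x) (afi c A y) (afi c A z) = afi c A '' Tri x y z := by
  let f : E2 →ᵃ[ℝ] E2 := (A.toLinearEquiv : E2 →ₗ[ℝ] E2).toAffineMap + AffineMap.const ℝ E2 c
  have hf : ∀ z, f z = afi c A z := fun z => by
    show A z + c = c + A z
    abel
  have hf' : (f : E2 → E2) = afi c A := funext hf
  unfold Tri
  rw [← hf', AffineMap.image_convexHull]
  simp [image_insert_eq]

lemma afi_Dom (c : E2) (A : E2 ≃ₗᵢ[ℝ] E2) (x y z : E2) :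
    TriDom (afi c A x) (afi c A y) (afi c A z) = afi c A '' TriDom x y z := by
  unfold TriDom
  rw [image_sdiff (afi c A).injective, afi_Tri]
  simp [Vtx, image_insert_eq]

lemma afi_has (c : E2) (A : E2 ≃ₗᵢ[ℝ] E2) (z : E2) : HasFDerivAt (afi c A) (A.toContinuousLinearEquiv : E2 →L[ℝ] E2) z :=
  (A.toContinuousLinearEquiv.hasFDerivAt (x := z)).const_add c

lemma afi_smooth (c : E2) (A : E2 ≃ₗᵢ[ℝ] E2) : ContDiff ℝ ∞ (afi c A) :=
  contDiff_const.add A.toContinuousLinearEquiv.contDiff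

structure Reg (x y z : E2) : Prop where
  ud : UniqueDiffOn ℝ (TriDom x y z)
  int : interior (Tri x y z) ⊆ TriDom x y z

lemma Reg.afi {x y z : E2} (h : Reg x y z) (c : E2) (A : E2 ≃ₗᵢ[ℝ] E2) : Reg (afi c A x) (afi c A y) (afi c A z) where
  ud := by
    rw [afi_Dom]
    exact h.ud.image (fun p _ => (afi_has c A p).hasFDerivWithinAt) fun p _ => A.toContinuousLinearEquiv.surjective.denseRange
  int := by
    rw [afi_Dom, afi_Tri, ← Homeomorph.image_interior]
    exact image_mono h.int

lemma Reg_std {a b : ℝ} (ha : 0 < a) (hb : 0 < b) : Reg 0 (a • e0) (b • e1) where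
  ud := by rw [Dom_std ha hb]; exact D_ud ha hb
  int := by rw [Dom_std ha hb, Tri_std ha hb, Tst_interior ha hb]; exact Int_sub a b

lemma afi_fdw {x y z : E2} (hr : Reg x y z) (c : E2) (A : E2 ≃ₗᵢ[ℝ] E2) {u : E2 → ℝ}
    (hs : ContDiffOn ℝ ∞ u (TriDom (afi c A x) (afi c A y) (afi c A z))) {p : E2} (hp : p ∈ TriDom x y z) :
    fderivWithin ℝ (fun q => u (afi c A q)) (TriDom x y z) p =
      (fderivWithin ℝ u (TriDom (afi c A x) (afi c A y) (afi c A z)) (afi c A p)).comp (A.toContinuousLinearEquiv : E2 →L[ℝ] E2) := by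
  have hm : MapsTo (afi c A) (TriDom x y z) (TriDom (afi c A x) (afi c A y) (afi c A z)) := by
    rw [afi_Dom]; exact mapsTo_image _ _
  have hd := hs.differentiableOn (by simp) _ (hm hp)
  exact (hd.hasFDerivWithinAt.comp p (afi_has c A p).hasFDerivWithinAt hm).fderivWithin (hr.ud p hp)

lemma afi_neu {x y z : E2} (hr : Reg x y z) (c : E2) (A : E2 ≃ₗᵢ[ℝ] E2) {u : E2 → ℝ}
    (hs : ContDiffOn ℝ ∞ u (TriDom (afi c A x) (afi c A y) (afi c A z))) {v w : E2}
    (hsub : ∀ p ∈ segment ℝ v w, p ≠ v → p ≠ w → p ∈ TriDom x y z)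
    (h : NeumannOn (TriDom (afi c A x) (afi c A y) (afi c A z)) (afi c A v) (afi c A w) u) :
    NeumannOn (TriDom x y z) v w (fun q => u (afi c A q)) := by
  intro p hp h1 h2 n hn
  rw [afi_fdw hr c A hs (hsub p hp h1 h2)]
  refine h (afi c A p) ?_ ?_ ?_ (A n) ?_
  · obtain ⟨s, t, hs, ht, hst, rfl⟩ := hp
    exact ⟨s, t, hs, ht, hst, (afi_comb c A v w hst).symm⟩
  · exact fun hh => h1 ((afi c A).injective hh)
  · exact fun hh => h2 ((afi c A).injective hh)
  · rw [afi_apply, afi_apply, add_sub_add_left_eq_sub, ← map_sub, LinearIsometryEquiv.inner_map_map]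
    exact hn

/-- non-endpoints of sides are non-vertices -/
structure Sid (x y z : E2) : Prop where
  s1 : ∀ p ∈ segment ℝ x y, p ≠ x → p ≠ y → p ∈ TriDom x y z
  s2 : ∀ p ∈ segment ℝ y z, p ≠ y → p ≠ z → p ∈ TriDom x y z
  s3 : ∀ p ∈ segment ℝ z x, p ≠ z → p ≠ x → p ∈ TriDom x y z

lemma Sid_std {a b : ℝ} (ha : 0 < a) (hb : 0 < b) : Sid 0 (a • e0) (b • e1) where
  s1 p hp h1 h2 := by rw [Dom_std ha hb]; exact (seg_D ha hb (i := 1) hp h1 h2).1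
  s2 p hp h1 h2 := by rw [Dom_std ha hb]; exact (seg_D ha hb (i := 2) hp h1 h2).1
  s3 p hp h1 h2 := by rw [Dom_std ha hb]; exact (seg_D ha hb (i := 0) hp h1 h2).1

lemma afi_seg (c : E2) (A : E2 ≃ₗᵢ[ℝ] E2) {v w x y z : E2} (h : ∀ p ∈ segment ℝ v w, p ≠ v → p ≠ w → p ∈ TriDom x y z) :
    ∀ p ∈ segment ℝ (afi c A v) (afi c A w), p ≠ afi c A v → p ≠ afi c A w → p ∈ TriDom (afi c A x) (afi c A y) (afi c A z) := by
  rintro p ⟨s, t, hs, ht, hst, rfl⟩ h1 h2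
  rw [← afi_comb c A v w hst] at h1 h2 ⊢
  rw [afi_Dom]
  exact mem_image_of_mem _ (h _ ⟨s, t, hs, ht, hst, rfl⟩ (fun hh => h1 (by rw [hh])) (fun hh => h2 (by rw [hh])))

lemma Sid.afi {x y z : E2} (h : Sid x y z) (c : E2) (A : E2 ≃ₗᵢ[ℝ] E2) : Sid (afi c A x) (afi c A y) (afi c A z) where
  s1 := afi_seg c A h.s1
  s2 := afi_seg c A h.s2
  s3 := afi_seg c A h.s3

lemma afi_eig {x y z : E2} (hr : Reg x y z) (hd : Sid x y z) (c : E2) (A : E2 ≃ₗᵢ[ℝ] E2) {u : E2 → ℝ} {mu : ℝ}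
    (h : IsNeumannEigenfun (afi c A x) (afi c A y) (afi c A z) mu u) : IsNeumannEigenfun x y z mu (fun q => u (afi c A q)) where
  pos := h.pos
  nonconst := by
    rintro ⟨k, hk⟩
    refine h.nonconst ⟨k, ?_⟩
    rw [afi_Tri]
    rintro _ ⟨q, hq, rfl⟩
    exact hk q hq
  cont := h.cont.comp (afi c A).continuous.continuousOn (by rw [afi_Tri]; exact mapsTo_image _ _)
  smooth := h.smooth.comp (afi_smooth c A).contDiffOn (by rw [afi_Dom]; exact mapsTo_image _ _)
  eqn := by
    intro p hp
    have hp' : afi c A p ∈ interior (Tri (afi c A x) (afi c A y) (afi c A z)) := by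
      rw [afi_Tri, ← Homeomorph.image_interior]; exact mem_image_of_mem _ hp
    have hc : ContDiffAt ℝ ∞ u (afi c A p) := by
      refine h.smooth.contDiffAt (mem_of_superset (isOpen_interior.mem_nhds hp') (hr.afi c A).int)
    have := h.eqn _ hp'
    rw [negLap_eq] at this ⊢
    rw [← this]
    congr 1
    exact lap_comp_iso c A (hc.of_le (by norm_cast))
  neumann₁₂ := afi_neu hr c A h.smooth hd.s1 h.neumann₁₂
  neumann₂₃ := afi_neu hr c A h.smooth hd.s2 h.neumann₂₃
  neumann₃₁ := afi_neu hr c A h.smooth hd.s3 h.neumann₃₁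

theorem std_no_crit {a b : ℝ} (ha : 0 < a) (hb : 0 < b) (c : E2) (A : E2 ≃ₗᵢ[ℝ] E2) {x y z : E2} (hx : x = afi c A 0)
    (hy : y = afi c A (a • e0)) (hz : z = afi c A (b • e1)) {u : E2 → ℝ} (hu : IsSecondNeumannEigenfun x y z u) :
    ¬ ∃ p, IsCritPt x y z u p := by
  subst hx hy hz
  rintro ⟨p, hp, hcrit⟩
  obtain ⟨mu, hu, hmin⟩ := hu
  have hr := Reg_std ha hb
  have hd := Sid_std ha hb
  obtain ⟨lam, U, hU, hU1, hU2⟩ := exists_mono ha hb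
  have hinv : ∀ q, afi (-(A.symm c)) A.symm (afi c A q) = q := fun q => by simp [afi_apply]
  have hml : mu ≤ lam := by
    refine hmin lam (fun q => U (afi (-(A.symm c)) A.symm q)) (afi_eig (hr.afi c A) (hd.afi c A) _ _ ?_)
    rw [hinv, hinv, hinv]
    exact (std_iff ha hb).2 hU
  have hu' := (std_iff ha hb).1 (afi_eig hr hd c A hu)
  rw [afi_Dom] at hp
  obtain ⟨q, hq, rfl⟩ := hp
  have hc := afi_fdw hr c A hu.smooth hq
  rw [hcrit] at hc
  rw [Dom_std ha hb] at hq hc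
  exact no_crit ha hb hml hu' hU hU1 hU2 hq (by rw [hc]; simp)

lemma exists_iso {f g : E2} (hf : f ≠ 0) (hg : g ≠ 0) (h : inner ℝ f g = 0) :
    ∃ A : E2 ≃ₗᵢ[ℝ] E2, A (‖f‖ • e0) = f ∧ A (‖g‖ • e1) = g := by
  have hf' : ‖f‖ ≠ 0 := norm_ne_zero_iff.2 hf
  have hg' : ‖g‖ ≠ 0 := norm_ne_zero_iff.2 hg
  have on : Orthonormal ℝ ![(‖f‖)⁻¹ • f, (‖g‖)⁻¹ • g] := by
    constructor
    · intro i
      fin_cases i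
      · simp [norm_smul, hf']
      · simp [norm_smul, hg']
    · intro i j hij
      fin_cases i <;> fin_cases j
      · exact absurd rfl hij
      · simp [inner_smul_left, inner_smul_right, h]
      · simp [inner_smul_left, inner_smul_right, real_inner_comm, h]
      · exact absurd rfl hij
  let bs := OrthonormalBasis.mk on (by
    have hli := on.linearIndependent
    have := hli.span_eq_top_of_card_eq_finrank (by simp)
    rw [this])
  have hb0 : bs 0 = (‖f‖)⁻¹ • f := by simp [bs]
  have hb1 : bs 1 = (‖g‖)⁻¹ • g := by simp [bs]
  refine ⟨(EuclideanSpace.basisFun (Fin 2) ℝ).equiv bs (Equiv.refl _), ?_, ?_⟩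
  · have : e0 = EuclideanSpace.basisFun (Fin 2) ℝ 0 := by simp [e0]
    rw [map_smul, this, OrthonormalBasis.equiv_apply_basis, Equiv.refl_apply, hb0, smul_smul, mul_inv_cancel₀ hf', one_smul]
  · have : e1 = EuclideanSpace.basisFun (Fin 2) ℝ 1 := by simp [e1]
    rw [map_smul, this, OrthonormalBasis.equiv_apply_basis, Equiv.refl_apply, hb1, smul_smul, mul_inv_cancel₀ hg', one_smul]

theorem right_no_crit {x y z : E2} (hxy : x ≠ y) (hxz : x ≠ z) (h : EuclideanGeometry.angle y x z = Real.pi / 2)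
    {u : E2 → ℝ} (hu : IsSecondNeumannEigenfun x y z u) : ¬ ∃ p, IsCritPt x y z u p := by
  have hf : y - x ≠ 0 := sub_ne_zero.2 hxy.symm
  have hg : z - x ≠ 0 := sub_ne_zero.2 hxz.symm
  have hi : inner ℝ (y - x) (z - x) = 0 := InnerProductGeometry.inner_eq_zero_iff_angle_eq_pi_div_two _ _ |>.2 h
  obtain ⟨A, h1, h2⟩ := exists_iso hf hg hi
  refine std_no_crit (norm_pos_iff.2 hf) (norm_pos_iff.2 hg) x A (by simp [afi_apply]) ?_ ?_ hu
  · rw [afi_apply, h1]; abel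
  · rw [afi_apply, h2]; abel

lemma cyc_set (x y z : E2) : ({y, z, x} : Set E2) = {x, y, z} := by
  ext p; simp only [mem_insert_iff, mem_singleton_iff]; tauto

lemma cyc_Tri (x y z : E2) : Tri y z x = Tri x y z := by unfold Tri; rw [cyc_set]
lemma cyc_Dom (x y z : E2) : TriDom y z x = TriDom x y z := by unfold TriDom Vtx; rw [cyc_set, cyc_Tri]

lemma cyc_eig {x y z : E2} {mu : ℝ} {u : E2 → ℝ} (h : IsNeumannEigenfun x y z mu u) : IsNeumannEigenfun y z x mu u := by
  obtain ⟨h1, h2, h3, h4, h5, h6, h7, h8⟩ := h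
  refine ⟨h1, ?_, ?_, ?_, ?_, ?_, ?_, ?_⟩
  · rwa [cyc_Tri]
  · rwa [cyc_Tri]
  · rwa [cyc_Dom]
  · rwa [cyc_Tri]
  · rwa [cyc_Dom]
  · rwa [cyc_Dom]
  · rwa [cyc_Dom]

lemma cyc_second {x y z : E2} {u : E2 → ℝ} (h : IsSecondNeumannEigenfun x y z u) : IsSecondNeumannEigenfun y z x u := by
  obtain ⟨mu, h1, h2⟩ := h
  exact ⟨mu, cyc_eig h1, fun m w hw => h2 m w (cyc_eig (cyc_eig hw))⟩

lemma cyc_crit {x y z p : E2} {u : E2 → ℝ} (h : IsCritPt x y z u p) : IsCritPt y z x u p := by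
  unfold IsCritPt at h ⊢
  rwa [cyc_Dom]

end

/-- A second Neumann eigenfunction of a right triangle has no critical points. -/
theorem right_triangle_no_critical_points
    (v₁ v₂ v₃ : E2) (hT : AffineIndependent ℝ ![v₁, v₂, v₃])
    (hright : EuclideanGeometry.angle v₂ v₁ v₃ = Real.pi / 2 ∨
      EuclideanGeometry.angle v₁ v₂ v₃ = Real.pi / 2 ∨
      EuclideanGeometry.angle v₁ v₃ v₂ = Real.pi / 2)
    (u : E2 → ℝ) (hu : IsSecondNeumannEigenfun v₁ v₂ v₃ u) :
    ¬ ∃ p, IsCritPt v₁ v₂ v₃ u p := by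
  have h12 : v₁ ≠ v₂ := fun h => by
    have := hT.injective (a₁ := 0) (a₂ := 1) (by simpa using h)
    simp at this
  have h13 : v₁ ≠ v₃ := fun h => by
    have := hT.injective (a₁ := 0) (a₂ := 2) (by simpa using h)
    simp at this
  have h23 : v₂ ≠ v₃ := fun h => by
    have := hT.injective (a₁ := 1) (a₂ := 2) (by simpa using h)
    simp at this
  rcases hright with h | h | h
  · exact right_no_crit h12 h13 h hu
  · rintro ⟨p, hp⟩
    rw [EuclideanGeometry.angle_comm] at h
    exact right_no_crit h23 h12.symm h (cyc_second hu) ⟨p, cyc_crit hp⟩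
  · rintro ⟨p, hp⟩
    exact right_no_crit h13.symm h23.symm h (cyc_second (cyc_second hu)) ⟨p, cyc_crit (cyc_crit hp)⟩

end
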